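/- Let n ≥ 2 and let W be a normalized double-well potential (Fuglede-type estimate). For every K > 0 there exist constants δ₀ > 0, ε₀ > 0 and C, depending only on n, W and K, with the following property: if ε < ε₀, u_ε is a radial decreasing minimizer of ψ(ε), and u ∈ H¹(ℝⁿ;[0,1]) is radial with ∫_{ℝⁿ}V(u) dx = 1, ∫_{ℝⁿ}(u−u_ε)² dx ≤ K ε and ‖u−u_ε‖_{L^∞(ℝⁿ)} ≤ δ₀, then, setting h = u − u_ε, AC_ε(u) − ψ(ε) ≥ (1/C) ∫_{ℝⁿ} ( ε|∇h|² + h²/ε ) dx. -/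

import Mathlib

noncomputable section

open MeasureTheory Real Set Filter

abbrev En (n : ℕ) : Type := EuclideanSpace ℝ (Fin n)

/-- Volume of the unit ball of `ℝⁿ`. -/
def ballVol (n : ℕ) : ℝ := (volume (Metric.ball (0 : En n) 1)).toReal

/-- A normalized double-well potential. -/
structure DoubleWell (W : ℝ → ℝ) : Prop where
  contDiffOn : ContDiffOn ℝ 2 W (Icc 0 1)
  lipschitzSecond : ∃ L : NNReal, LipschitzOnWith L (iteratedDerivWithin 2 W (Icc 0 1)) (Icc 0 1)
  zero_at_zero : W 0 = 0
  zero_at_one : W 1 = 0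
  pos_on : ∀ t ∈ Ioo (0:ℝ) 1, 0 < W t
  second_pos_zero : 0 < iteratedDerivWithin 2 W (Icc 0 1) 0
  second_pos_one : 0 < iteratedDerivWithin 2 W (Icc 0 1) 1
  normalized : ∫ t in (0:ℝ)..1, Real.sqrt (W t) = 1

/-- `Φ(t) = ∫₀ᵗ √W`. -/
def Phi (W : ℝ → ℝ) (t : ℝ) : ℝ := ∫ s in (0:ℝ)..t, Real.sqrt (W s)

/-- `V(t) = Φ(t)^{n/(n-1)}`. -/
def Vpot (n : ℕ) (W : ℝ → ℝ) (t : ℝ) : ℝ := Phi W t ^ ((n : ℝ) / ((n : ℝ) - 1))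

/-- Membership in `H¹(ℝⁿ;[0,1])`. -/
structure H1Box (n : ℕ) (u : En n → ℝ) : Prop where
  mem_Icc : ∀ x, u x ∈ Icc (0:ℝ) 1
  diff : Differentiable ℝ u
  memL2 : MemLp u 2 (volume : Measure (En n))
  grad_memL2 : MemLp (fun x => fderiv ℝ u x) 2 (volume : Measure (En n))

/-- The Allen–Cahn energy. -/
def AC (n : ℕ) (W : ℝ → ℝ) (σ : ℝ) (u : En n → ℝ) : ℝ :=
  σ * (∫ x : En n, ‖fderiv ℝ u x‖ ^ 2) + σ⁻¹ * (∫ x : En n, W (u x))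

/-- The isoperimetric-type infimum `Ψ(σ,m)`. -/
def Psi (n : ℕ) (W : ℝ → ℝ) (σ m : ℝ) : ℝ :=
  sInf ((fun u => AC n W σ u) ''
    {u : En n → ℝ | H1Box n u ∧ (∫ x : En n, Vpot n W (u x)) = m})

/-- `u` is a minimizer of `ψ(ε) = Ψ(ε,1)`. -/
def Minimizes (n : ℕ) (W : ℝ → ℝ) (ε : ℝ) (u : En n → ℝ) : Prop :=
  H1Box n u ∧ (∫ x : En n, Vpot n W (u x)) = 1 ∧ AC n W ε u = Psi n W ε 1

/-- Radial function. -/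
def Radial (n : ℕ) (u : En n → ℝ) : Prop :=
  ∃ ζ : ℝ → ℝ, ∀ x : En n, u x = ζ ‖x‖

/-- Radial decreasing function. -/
def RadialDecreasing (n : ℕ) (u : En n → ℝ) : Prop :=
  ∃ ζ : ℝ → ℝ, AntitoneOn ζ (Ici 0) ∧ ∀ x : En n, u x = ζ ‖x‖

/-- The Laplacian as the trace of the second derivative. -/
def lap (n : ℕ) (u : En n → ℝ) (x : En n) : ℝ :=
  ∑ i : Fin n,
    fderiv ℝ (fun y => fderiv ℝ u y (EuclideanSpace.single i 1)) x (EuclideanSpace.single i 1)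

/-- The optimal transition profile `η`. -/
structure TransitionProfile (W : ℝ → ℝ) (η : ℝ → ℝ) : Prop where
  mem : ∀ s, η s ∈ Ioo (0:ℝ) 1
  init : η 0 = 1/2
  ode : ∀ s, HasDerivAt η (-(Real.sqrt (W (η s)))) s
  anti : StrictAnti η
  tendsto_bot : Tendsto η atBot (nhds 1)
  tendsto_top : Tendsto η atTop (nhds 0)

/-- `d_Φ(u,v)`. -/
def dPhi (n : ℕ) (W : ℝ → ℝ) (u v : En n → ℝ) : ℝ :=
  ∫ x : En n, |Phi W (u x) - Phi W (v x)| ^ ((n : ℝ) / ((n : ℝ) - 1))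

/-- `R₀ = ω_n^{-1/n}`. -/
def R0 (n : ℕ) : ℝ := ballVol n ^ (-(1:ℝ) / (n : ℝ))


/-- radial measure -/
def mu (n : ℕ) : Measure ℝ :=
  (volume.restrict (Ioi 0)).withDensity (fun r => ENNReal.ofReal (r ^ (n-1)))

def cn (n : ℕ) : ℝ := n * (volume : Measure (En n)).real (Metric.ball (0 : En n) 1)

lemma mu_integral (n : ℕ) (f : ℝ → ℝ) :
    ∫ r, f r ∂mu n = ∫ r in Ioi 0, r ^ (n-1) * f r := by
  unfold mu
  rw [integral_withDensity_eq_integral_toReal_smul (by fun_prop) (by simp)]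
  apply setIntegral_congr_fun measurableSet_Ioi
  intro r hr
  have : (0:ℝ) ≤ r ^ (n-1) := pow_nonneg (le_of_lt hr) _
  simp [ENNReal.toReal_ofReal this]

lemma mu_integrable (n : ℕ) (f : ℝ → ℝ) :
    Integrable f (mu n) ↔ IntegrableOn (fun r => r ^ (n-1) * f r) (Ioi 0) := by
  unfold mu
  rw [integrable_withDensity_iff_integrable_smul' (by fun_prop) (by simp)]
  unfold IntegrableOn
  apply integrable_congr
  filter_upwards [ae_restrict_mem measurableSet_Ioi] with r hr
  have : (0:ℝ) ≤ r ^ (n-1) := pow_nonneg (le_of_lt hr) _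
  simp [ENNReal.toReal_ofReal this]

lemma mu_ac (n : ℕ) : mu n ≪ volume.restrict (Ioi 0) := withDensity_absolutelyContinuous _ _

lemma mu_ae_pos (n : ℕ) : ∀ᵐ r ∂mu n, 0 < r :=
  (mu_ac n).ae_le (ae_restrict_mem measurableSet_Ioi)

lemma mu_ae_of_vol (n : ℕ) {p : ℝ → Prop} (h : ∀ᵐ r : ℝ, 0 < r → p r) : ∀ᵐ r ∂mu n, p r := by
  refine (mu_ac n).ae_le ?_
  change ∀ᵐ r ∂(volume.restrict (Ioi 0)), p r
  rw [ae_restrict_iff' measurableSet_Ioi]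
  exact h

lemma cn_pos (n : ℕ) (hn : 2 ≤ n) : 0 < cn n := by
  unfold cn
  have h0 : (0:ℝ) < n := by positivity
  have : 0 < (volume : Measure (En n)).real (Metric.ball (0 : En n) 1) := by
    apply ENNReal.toReal_pos
    · exact (Metric.measure_ball_pos volume _ one_pos).ne'
    · exact measure_ball_lt_top.ne
  positivity

lemma polar_integral (n : ℕ) (hn : 2 ≤ n) (f : ℝ → ℝ) :
    ∫ x : En n, f ‖x‖ = cn n * ∫ r, f r ∂mu n := by
  have : Nonempty (Fin n) := ⟨⟨0, by omega⟩⟩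
  rw [integral_fun_norm_addHaar, mu_integral]
  simp [cn, mul_assoc]

lemma polar_integrable (n : ℕ) (hn : 2 ≤ n) (f : ℝ → ℝ) :
    Integrable (fun x : En n => f ‖x‖) ↔ Integrable f (mu n) := by
  have : Nonempty (Fin n) := ⟨⟨0, by omega⟩⟩
  rw [integrable_fun_norm_addHaar, mu_integrable]
  simp

/-- admissible radial profiles -/
structure Adm (n : ℕ) (Z : ℝ → ℝ) : Prop where
  diff : Differentiable ℝ Z
  d0 : deriv Z 0 = 0
  mem : ∀ r, Z r ∈ Icc (0:ℝ) 1
  sq : Integrable (fun r => Z r ^ 2) (mu n)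
  dsq : Integrable (fun r => deriv Z r ^ 2) (mu n)

lemma radial_fderiv (n : ℕ) (hn : 2 ≤ n) (Z : ℝ → ℝ) (hZ : Differentiable ℝ Z) (x : En n) (hx : x ≠ 0) :
    DifferentiableAt ℝ (fun y : En n => Z ‖y‖) x ∧ ‖fderiv ℝ (fun y : En n => Z ‖y‖) x‖ = |deriv Z ‖x‖| := by
  have : Nonempty (Fin n) := ⟨⟨0, by omega⟩⟩
  have h1 : DifferentiableAt ℝ (fun y : En n => ‖y‖) x := (differentiableAt_id).norm ℝ hx
  have h2 := (hZ ‖x‖).hasDerivAt.comp_hasFDerivAt x h1.hasFDerivAt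
  refine ⟨h2.differentiableAt, ?_⟩
  have : fderiv ℝ (fun y : En n => Z ‖y‖) x = _ := h2.fderiv
  rw [this, norm_smul, norm_fderiv_norm h1]; simp

lemma radial_diff (n : ℕ) (hn : 2 ≤ n) (Z : ℝ → ℝ) (hZ : Differentiable ℝ Z) (h0 : deriv Z 0 = 0) :
    Differentiable ℝ (fun y : En n => Z ‖y‖) := by
  intro x
  by_cases hx : x = 0
  · subst hx
    have h1 : HasDerivAt Z 0 0 := by
      have := (hZ 0).hasDerivAt
      rwa [h0] at this
    have h2 : HasFDerivAt (fun y : En n => Z ‖y‖) (0 : En n →L[ℝ] ℝ) 0 := by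
      rw [hasFDerivAt_iff_isLittleO]
      have h3 := h1.hasFDerivAt
      rw [hasFDerivAt_iff_isLittleO] at h3
      have h4 : Tendsto (fun y : En n => ‖y‖) (nhds 0) (nhds 0) := by
        have := continuous_norm (E := En n)
        simpa using this.tendsto 0
      have h5 := h3.comp_tendsto h4
      have h6 : (fun x' : En n => Z ‖x'‖ - Z ‖(0 : En n)‖ - (0 : En n →L[ℝ] ℝ) (x' - 0)) =
        ((fun x' => Z x' - Z 0 - (ContinuousLinearMap.toSpanSingleton ℝ (0:ℝ)) (x' - 0)) ∘ fun y : En n => ‖y‖) := by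
        ext y; simp
      rw [h6]
      refine h5.trans_isBigO ?_
      apply Asymptotics.IsBigO.of_bound 1
      filter_upwards with y
      simp
    exact h2.differentiableAt
  · exact (radial_fderiv n hn Z hZ x hx).1

lemma ae_ne_zero (n : ℕ) (hn : 2 ≤ n) : ∀ᵐ x : En n, x ≠ 0 := by
  have : Nonempty (Fin n) := ⟨⟨0, by omega⟩⟩
  have : (volume : Measure (En n)) {0} = 0 := by simp
  exact compl_mem_ae_iff.mpr this

lemma radial_grad_sq (n : ℕ) (hn : 2 ≤ n) (Z : ℝ → ℝ) (hZ : Differentiable ℝ Z) :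
    (fun x : En n => ‖fderiv ℝ (fun y : En n => Z ‖y‖) x‖ ^ 2) =ᵐ[volume] fun x => deriv Z ‖x‖ ^ 2 := by
  filter_upwards [ae_ne_zero n hn] with x hx
  rw [(radial_fderiv n hn Z hZ x hx).2, sq_abs]

lemma Adm.h1box {n : ℕ} (hn : 2 ≤ n) {Z : ℝ → ℝ} (hZ : Adm n Z) : H1Box n (fun x => Z ‖x‖) := by
  have hd := radial_diff n hn Z hZ.diff hZ.d0
  refine ⟨fun x => hZ.mem _, hd, ?_, ?_⟩
  · rw [memLp_two_iff_integrable_sq hd.continuous.aestronglyMeasurable]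
    exact (polar_integrable n hn (fun r => Z r ^ 2)).2 hZ.sq
  · rw [memLp_two_iff_integrable_sq_norm (measurable_fderiv ℝ _).aestronglyMeasurable]
    rw [integrable_congr (radial_grad_sq n hn Z hZ.diff)]
    exact (polar_integrable n hn (fun r => deriv Z r ^ 2)).2 hZ.dsq

def DD (n : ℕ) (Z : ℝ → ℝ) : ℝ := cn n * ∫ r, deriv Z r ^ 2 ∂mu n
def PP (n : ℕ) (W : ℝ → ℝ) (Z : ℝ → ℝ) : ℝ := cn n * ∫ r, W (Z r) ∂mu n
def MM (n : ℕ) (W : ℝ → ℝ) (Z : ℝ → ℝ) : ℝ := cn n * ∫ r, Vpot n W (Z r) ∂mu n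

lemma AC_radial {n : ℕ} (hn : 2 ≤ n) {Z : ℝ → ℝ} (hZ : Differentiable ℝ Z) (W : ℝ → ℝ) (ε : ℝ) :
    AC n W ε (fun x => Z ‖x‖) = ε * DD n Z + ε⁻¹ * PP n W Z := by
  unfold AC DD PP
  rw [integral_congr_ae (radial_grad_sq n hn Z hZ), polar_integral n hn (fun r => deriv Z r ^ 2),
    polar_integral n hn (fun r => W (Z r))]

lemma MM_radial {n : ℕ} (hn : 2 ≤ n) (Z : ℝ → ℝ) (W : ℝ → ℝ) :
    ∫ x : En n, Vpot n W (Z ‖x‖) = MM n W Z := polar_integral n hn (fun r => Vpot n W (Z r))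

lemma radial_profile {n : ℕ} (hn : 2 ≤ n) {u : En n → ℝ} (hu : H1Box n u) (ζ : ℝ → ℝ)
    (hr : ∀ x, u x = ζ ‖x‖) : ∃ Z : ℝ → ℝ, Adm n Z ∧ (∀ x, u x = Z ‖x‖) ∧ ∀ r, 0 ≤ r → Z r = ζ r := by
  have : Nonempty (Fin n) := ⟨⟨0, by omega⟩⟩
  obtain ⟨e, he⟩ := exists_norm_eq (En n) (zero_le_one)
  set Z : ℝ → ℝ := fun r => u (r • e) with hZ
  have hdiff : Differentiable ℝ Z := by
    have := hu.diff
    intro r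
    apply DifferentiableAt.comp r (this _)
    fun_prop
  have hx : ∀ x, u x = Z ‖x‖ := by
    intro x; simp only [hZ]; rw [hr x, hr]; simp [norm_smul, he]
  have heven : ∀ r, Z (-r) = Z r := by
    intro r; simp only [hZ]; rw [hr, hr]; simp
  have hfun : u = fun x => Z ‖x‖ := funext hx
  refine ⟨Z, ⟨hdiff, ?_, fun r => hu.mem_Icc _, ?_, ?_⟩, hx, ?_⟩
  · have h1 : deriv (fun r => Z (-r)) 0 = - deriv Z 0 := by
      rw [deriv_comp_neg]; simp
    have h2 : (fun r => Z (-r)) = Z := funext heven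
    rw [h2] at h1
    linarith
  · have := (memLp_two_iff_integrable_sq hu.memL2.1).1 hu.memL2
    rw [hfun] at this
    exact (polar_integrable n hn (fun r => Z r ^ 2)).1 this
  · have := (memLp_two_iff_integrable_sq_norm hu.grad_memL2.1).1 hu.grad_memL2
    rw [hfun] at this
    rw [integrable_congr (radial_grad_sq n hn Z hdiff)] at this
    exact (polar_integrable n hn (fun r => deriv Z r ^ 2)).1 this
  · intro r h0; simp only [hZ]; rw [hr]; simp [norm_smul, he, abs_of_nonneg h0]


lemma DoubleWell.nonneg {W : ℝ → ℝ} (hW : DoubleWell W) {t : ℝ} (ht : t ∈ Icc (0:ℝ) 1) : 0 ≤ W t := by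
  rcases eq_or_lt_of_le ht.1 with h | h
  · rw [← h, hW.zero_at_zero]
  rcases eq_or_lt_of_le ht.2 with h' | h'
  · rw [h', hW.zero_at_one]
  exact (hW.pos_on t ⟨h, h'⟩).le

/-- one-dimensional energy -/
def EE (n : ℕ) (W : ℝ → ℝ) (ε : ℝ) (Z : ℝ → ℝ) : ℝ := ε * DD n Z + ε⁻¹ * PP n W Z

/-- radial minimizers, one-dimensional formulation -/
structure Minz (n : ℕ) (W : ℝ → ℝ) (ε : ℝ) (ζ : ℝ → ℝ) : Prop where
  adm : Adm n ζ
  anti : AntitoneOn ζ (Ici 0)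
  mass : MM n W ζ = 1
  min : ∀ Z, Adm n Z → MM n W Z = 1 → EE n W ε ζ ≤ EE n W ε Z

lemma minz_of {n : ℕ} (hn : 2 ≤ n) {W : ℝ → ℝ} (hW : DoubleWell W) {ε : ℝ} (hε : 0 < ε)
    {uε : En n → ℝ} (hm : Minimizes n W ε uε) (hr : RadialDecreasing n uε) :
    ∃ ζ, Minz n W ε ζ ∧ (∀ x, uε x = ζ ‖x‖) ∧ EE n W ε ζ = Psi n W ε 1 := by
  obtain ⟨h1, h2, h3⟩ := hm
  obtain ⟨ζ₀, ha, hζ₀⟩ := hr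
  obtain ⟨ζ, hadm, hx, heq⟩ := radial_profile hn h1 ζ₀ hζ₀
  have hfun : uε = fun x => ζ ‖x‖ := funext hx
  have hE : EE n W ε ζ = Psi n W ε 1 := by
    rw [← h3, hfun, AC_radial hn hadm.diff]; rfl
  refine ⟨ζ, ⟨hadm, ?_, ?_, ?_⟩, hx, hE⟩
  · intro a h b h' hab
    rw [heq a h, heq b h']; exact ha h h' hab
  · rw [← h2, hfun]; exact (MM_radial hn ζ W).symm
  · intro Z hZ hZ1
    rw [hE]
    have h4 : EE n W ε Z = AC n W ε (fun x => Z ‖x‖) := by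
      rw [AC_radial hn hZ.diff]; rfl
    rw [h4]
    apply csInf_le
    · refine ⟨0, ?_⟩
      rintro _ ⟨u, ⟨hu, -⟩, rfl⟩
      unfold AC
      have a1 : 0 ≤ ∫ x : En n, ‖fderiv ℝ u x‖ ^ 2 := integral_nonneg fun x => by positivity
      have a2 : 0 ≤ ∫ x : En n, W (u x) := integral_nonneg fun x => hW.nonneg (hu.mem_Icc x)
      simp only; positivity
    · refine ⟨_, ⟨hZ.h1box hn, ?_⟩, rfl⟩
      rw [MM_radial hn]; exact hZ1

lemma mu_scale (n : ℕ) (hn : 2 ≤ n) (f : ℝ → ℝ) {b : ℝ} (hb : 0 < b) :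
    ∫ r, f (b * r) ∂mu n = (b^n)⁻¹ * ∫ r, f r ∂mu n := by
  rw [mu_integral, mu_integral]
  have h1 := integral_comp_mul_left_Ioi (fun r => r^(n-1) * f r) 0 hb
  rw [mul_zero, smul_eq_mul] at h1
  have h2 : ∀ r, r^(n-1) * f (b*r) = (b^(n-1))⁻¹ * ((b*r)^(n-1) * f (b*r)) := by
    intro r; rw [mul_pow]; field_simp
  simp_rw [h2]
  rw [integral_const_mul, h1, ← mul_assoc]
  congr 1
  rw [← mul_inv, ← pow_succ]; congr 2; omega

lemma mu_scale_integrable (n : ℕ) (f : ℝ → ℝ) {b : ℝ} (hb : 0 < b) (hf : Integrable f (mu n)) :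
    Integrable (fun r => f (b * r)) (mu n) := by
  rw [mu_integrable] at hf ⊢
  have h1 := (integrableOn_Ioi_comp_mul_left_iff (fun r => r^(n-1) * f r) 0 hb).2 (by simpa using hf)
  have h2 : (fun r => r^(n-1) * f (b*r)) = fun r => (b^(n-1))⁻¹ * ((b*r)^(n-1) * f (b*r)) := by
    ext r; rw [mul_pow]; field_simp
  rw [h2]
  exact h1.const_mul _

/-- dilation inequality -/
lemma Minz.dil {n : ℕ} (hn : 2 ≤ n) {W : ℝ → ℝ} {ε : ℝ} {ζ : ℝ → ℝ}
    (hm : Minz n W ε ζ) {Z : ℝ → ℝ} (hZ : Adm n Z) (hpos : 0 < MM n W Z) :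
    EE n W ε ζ * MM n W Z ≤ ε * (MM n W Z)^((2:ℝ)/n) * DD n Z + ε⁻¹ * PP n W Z := by
  set m := MM n W Z with hmdef
  set b : ℝ := m ^ ((1:ℝ)/n) with hb
  have hn0 : (n:ℝ) ≠ 0 := by positivity
  have hbpos : 0 < b := Real.rpow_pos_of_pos hpos _
  have hbn : b ^ n = m := by
    rw [hb, ← Real.rpow_natCast, ← Real.rpow_mul hpos.le]; field_simp; simp
  have hb2 : m ^ ((2:ℝ)/n) = b^2 := by
    rw [hb, ← Real.rpow_natCast, ← Real.rpow_mul hpos.le]; congr 1; push_cast; ring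
  have hder : ∀ r, deriv (fun r => Z (b*r)) r = b * deriv Z (b*r) := by
    intro r; rw [deriv_comp_mul_left]; simp
  have hA : Adm n (fun r => Z (b*r)) := by
    refine ⟨?_, ?_, fun r => hZ.mem _, mu_scale_integrable n (fun r => Z r ^2) hbpos hZ.sq, ?_⟩
    · have := hZ.diff; fun_prop
    · rw [hder]; simp [hZ.d0]
    · simp_rw [hder, mul_pow]
      exact (mu_scale_integrable n (fun r => deriv Z r ^2) hbpos hZ.dsq).const_mul _
  have hM : MM n W (fun r => Z (b*r)) = 1 := by
    have := mu_scale n hn (fun r => Vpot n W (Z r)) hbpos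
    unfold MM at hmdef ⊢
    rw [this, hbn, mul_left_comm, ← hmdef]; field_simp
  have hP : PP n W (fun r => Z (b*r)) = m⁻¹ * PP n W Z := by
    have := mu_scale n hn (fun r => W (Z r)) hbpos
    unfold PP
    rw [this, hbn, mul_left_comm]
  have hD : DD n (fun r => Z (b*r)) = m⁻¹ * (b^2 * DD n Z) := by
    have := mu_scale n hn (fun r => deriv Z r^2) hbpos
    unfold DD
    simp_rw [hder, mul_pow]
    rw [integral_const_mul, this, hbn]; ring
  have h := hm.min _ hA hM
  have h' : EE n W ε (fun r => Z (b*r)) = (ε * m^((2:ℝ)/n) * DD n Z + ε⁻¹ * PP n W Z) * m⁻¹ := by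
    unfold EE; rw [hP, hD, hb2]; ring
  rw [h', ← div_eq_mul_inv, le_div_iff₀ hpos] at h
  exact h


structure Well2 (W W1 W2 : ℝ → ℝ) (L : ℝ) : Prop where
  Lnn : 0 ≤ L
  d1 : ∀ t ∈ Icc (0:ℝ) 1, HasDerivWithinAt W (W1 t) (Icc 0 1) t
  d2 : ∀ t ∈ Icc (0:ℝ) 1, HasDerivWithinAt W1 (W2 t) (Icc 0 1) t
  lip : ∀ s ∈ Icc (0:ℝ) 1, ∀ t ∈ Icc (0:ℝ) 1, |W2 s - W2 t| ≤ L * |s - t|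
  z0 : W 0 = 0
  z1 : W 1 = 0
  pos : ∀ t ∈ Ioo (0:ℝ) 1, 0 < W t
  s0 : 0 < W2 0
  s1 : 0 < W2 1

lemma DoubleWell.well2 {W : ℝ → ℝ} (hW : DoubleWell W) :
    ∃ L, Well2 W (derivWithin W (Icc 0 1)) (iteratedDerivWithin 2 W (Icc 0 1)) L := by
  obtain ⟨L, hL⟩ := hW.lipschitzSecond
  have hu : UniqueDiffOn ℝ (Icc (0:ℝ) 1) := uniqueDiffOn_Icc one_pos
  have hc := hW.contDiffOn
  have hc1 : ContDiffOn ℝ 1 (derivWithin W (Icc 0 1)) (Icc 0 1) :=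
    hc.derivWithin hu (by norm_num)
  refine ⟨L, L.2, ?_, ?_, ?_, hW.zero_at_zero, hW.zero_at_one, hW.pos_on, hW.second_pos_zero, hW.second_pos_one⟩
  · intro t ht
    exact (hc.differentiableOn (by norm_num) t ht).hasDerivWithinAt
  · intro t ht
    have h1 := (hc1.differentiableOn (by norm_num) t ht).hasDerivWithinAt
    have h2 : iteratedDerivWithin 2 W (Icc 0 1) t = derivWithin (derivWithin W (Icc 0 1)) (Icc 0 1) t := by
      rw [iteratedDerivWithin_succ]
      rw [iteratedDerivWithin_one]
    rw [h2]; exact h1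
  · intro s hs t ht
    have := hL.dist_le_mul s hs t ht
    simpa [Real.dist_eq] using this

lemma Well2.refl {W W1 W2 : ℝ → ℝ} {L : ℝ} (h : Well2 W W1 W2 L) :
    Well2 (fun t => W (1-t)) (fun t => - W1 (1-t)) (fun t => W2 (1-t)) L := by
  have hm : MapsTo (fun t : ℝ => 1 - t) (Icc (0:ℝ) 1) (Icc 0 1) := by
    intro t ht; constructor <;> simp [ht.1, ht.2]
  have hd : ∀ t : ℝ, HasDerivWithinAt (fun t : ℝ => 1 - t) (-1) (Icc (0:ℝ) 1) t := by
    intro t; simpa using ((hasDerivAt_id t).const_sub 1).hasDerivWithinAt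
  refine ⟨h.Lnn, ?_, ?_, ?_, by simp [h.z1], by simp [h.z0], ?_, by simpa using h.s1, by simpa using h.s0⟩
  · intro t ht
    have := (h.d1 (1-t) (hm ht)).comp t (hd t) hm
    simpa [Function.comp_def] using this
  · intro t ht
    have := ((h.d2 (1-t) (hm ht)).comp t (hd t) hm).neg
    rw [mul_neg_one, neg_neg] at this
    exact this
  · intro s hs t ht
    have := h.lip _ (hm hs) _ (hm ht)
    rw [show (1 - s) - (1-t) = -(s - t) by ring, abs_neg] at this
    exact this
  · intro t ht; exact h.pos _ ⟨by linarith [ht.2], by linarith [ht.1]⟩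

/-- mean value between two points in any order -/
lemma mvt_any {f f' : ℝ → ℝ} {z u : ℝ} (hzu : z ≠ u) (hc : ContinuousOn f (uIcc z u))
    (hd : ∀ s ∈ Ioo (min z u) (max z u), HasDerivAt f (f' s) s) :
    ∃ s ∈ Ioo (min z u) (max z u), f u - f z = f' s * (u - z) := by
  rcases lt_or_gt_of_ne hzu with h | h
  · rw [uIcc_of_le h.le] at hc
    rw [min_eq_left h.le, max_eq_right h.le] at hd ⊢
    obtain ⟨s, hs, he⟩ := exists_hasDerivAt_eq_slope f f' h hc hd
    refine ⟨s, hs, ?_⟩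
    rw [he]; field_simp [sub_ne_zero.2 h.ne']
  · rw [uIcc_of_ge h.le] at hc
    rw [min_eq_right h.le, max_eq_left h.le] at hd ⊢
    obtain ⟨s, hs, he⟩ := exists_hasDerivAt_eq_slope f f' h hc hd
    refine ⟨s, hs, ?_⟩
    rw [he]; have := sub_ne_zero.2 h.ne'; field_simp; ring

lemma mvt_taylor_le {f f' : ℝ → ℝ} {z u C : ℝ} (hc : ContinuousOn f (uIcc z u)) (hC : 0 ≤ C)
    (hd : ∀ s ∈ Ioo (min z u) (max z u), HasDerivAt f (f' s) s)
    (hb : ∀ s ∈ Ioo (min z u) (max z u), (f' s - f' z) * (s - z) ≤ C * (s - z)^2) :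
    f u - f z - f' z * (u - z) ≤ C * (u - z)^2 := by
  rcases eq_or_ne z u with rfl | hzu
  · simp
  obtain ⟨s, hs, he⟩ := mvt_any hzu hc hd
  have hb' := hb s hs
  rw [he]
  have : f' s * (u - z) - f' z * (u-z) = (f' s - f' z) * (u - z) := by ring
  rw [this]
  rcases lt_or_gt_of_ne hzu with h | h
  · rw [min_eq_left h.le, max_eq_right h.le] at hs
    have h1 : 0 < s - z := by linarith [hs.1]
    have h2 : f' s - f' z ≤ C * (s-z) := by
      by_contra hcon; push Not at hcon
      nlinarith
    have h3 : 0 < u - z := by linarith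
    have h4 : s - z ≤ u - z := by linarith [hs.2]
    calc (f' s - f' z) * (u-z) ≤ (C * (s-z)) * (u-z) := by gcongr
      _ ≤ (C * (u-z)) * (u-z) := by gcongr
      _ = _ := by ring
  · rw [min_eq_right h.le, max_eq_left h.le] at hs
    have h1 : 0 < z - s := by linarith [hs.2]
    have h2 : f' z - f' s ≤ C * (z-s) := by
      by_contra hcon; push Not at hcon
      nlinarith
    have h3 : 0 < z - u := by linarith
    have h4 : z - s ≤ z - u := by linarith [hs.1]
    calc (f' s - f' z) * (u-z) = (f' z - f' s) * (z-u) := by ring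
      _ ≤ (C * (z-s)) * (z-u) := by gcongr
      _ ≤ (C * (z-u)) * (z-u) := by gcongr
      _ = _ := by ring

lemma mvt_bound {f f' : ℝ → ℝ} {z u C : ℝ} (hc : ContinuousOn f (uIcc z u))
    (hd : ∀ s ∈ Ioo (min z u) (max z u), HasDerivAt f (f' s) s)
    (hb : ∀ s ∈ Ioo (min z u) (max z u), f' s ≤ C) :
    (f u - f z) * (u - z) ≤ C * (u - z)^2 := by
  rcases eq_or_ne z u with rfl | hzu
  · simp
  obtain ⟨s, hs, he⟩ := mvt_any hzu hc hd
  rw [he]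
  nlinarith [hb s hs, sq_nonneg (u-z)]

lemma mvt_bound_ge {f f' : ℝ → ℝ} {z u C : ℝ} (hc : ContinuousOn f (uIcc z u))
    (hd : ∀ s ∈ Ioo (min z u) (max z u), HasDerivAt f (f' s) s)
    (hb : ∀ s ∈ Ioo (min z u) (max z u), C ≤ f' s) :
    C * (u - z)^2 ≤ (f u - f z) * (u - z) := by
  rcases eq_or_ne z u with rfl | hzu
  · simp
  obtain ⟨s, hs, he⟩ := mvt_any hzu hc hd
  rw [he]
  nlinarith [hb s hs, sq_nonneg (u-z)]

lemma mvt_bound_abs {f f' : ℝ → ℝ} {z u C : ℝ} (hc : ContinuousOn f (uIcc z u))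
    (hd : ∀ s ∈ Ioo (min z u) (max z u), HasDerivAt f (f' s) s)
    (hb : ∀ s ∈ Ioo (min z u) (max z u), |f' s| ≤ C) :
    |f u - f z| ≤ C * |u - z| := by
  rcases eq_or_ne z u with rfl | hzu
  · simp
  obtain ⟨s, hs, he⟩ := mvt_any hzu hc hd
  rw [he, abs_mul]
  gcongr
  exact hb s hs

lemma uIoo_sub {a b z u : ℝ} (hz : z ∈ Icc a b) (hu : u ∈ Icc a b) :
    Ioo (min z u) (max z u) ⊆ Ioo a b :=
  Ioo_subset_Ioo (le_min hz.1 hu.1) (max_le hz.2 hu.2)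

lemma hasDerivAt_of_Icc {f : ℝ → ℝ} {d t : ℝ} (h : HasDerivWithinAt f d (Icc 0 1) t) (ht : t ∈ Ioo (0:ℝ) 1) :
    HasDerivAt f d t := h.hasDerivAt (Icc_mem_nhds ht.1 ht.2)

namespace Well2
variable {W W1 W2 : ℝ → ℝ} {L : ℝ}

lemma contW (h : Well2 W W1 W2 L) : ContinuousOn W (Icc 0 1) := fun t ht => (h.d1 t ht).continuousWithinAt
lemma contW1 (h : Well2 W W1 W2 L) : ContinuousOn W1 (Icc 0 1) := fun t ht => (h.d2 t ht).continuousWithinAt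

lemma W2_bd (h : Well2 W W1 W2 L) : ∃ B, 0 < B ∧ ∀ t ∈ Icc (0:ℝ) 1, |W2 t| ≤ B := by
  refine ⟨|W2 0| + L + 1, by have := h.Lnn; positivity, ?_⟩
  intro t ht
  have h1 := h.lip t ht 0 (by simp)
  have h2 : |t - 0| ≤ 1 := by rw [sub_zero, abs_of_nonneg ht.1]; exact ht.2
  have h3 : L * |t - 0| ≤ L := by nlinarith [h.Lnn]
  have h4 := abs_sub_abs_le_abs_sub (W2 t) (W2 0)
  linarith

lemma W1_lip (h : Well2 W W1 W2 L) {B : ℝ} (hB : ∀ t ∈ Icc (0:ℝ) 1, |W2 t| ≤ B) {s t : ℝ}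
    (hs : s ∈ Icc (0:ℝ) 1) (ht : t ∈ Icc (0:ℝ) 1) : |W1 s - W1 t| ≤ B * |s - t| := by
  apply mvt_bound_abs (f' := W2) (h.contW1.mono (uIcc_subset_Icc ht hs))
  · intro x hx
    have hx' := uIoo_sub ht hs hx
    exact hasDerivAt_of_Icc (h.d2 x (Ioo_subset_Icc_self hx')) hx'
  · intro x hx
    exact hB x (Ioo_subset_Icc_self (uIoo_sub ht hs hx))

lemma W_taylor (h : Well2 W W1 W2 L) {B : ℝ} (hB0 : 0 ≤ B) (hB : ∀ t ∈ Icc (0:ℝ) 1, |W2 t| ≤ B) {u z : ℝ}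
    (hu : u ∈ Icc (0:ℝ) 1) (hz : z ∈ Icc (0:ℝ) 1) : |W u - W z - W1 z * (u - z)| ≤ B * (u-z)^2 := by
  have hd : ∀ s ∈ Ioo (min z u) (max z u), HasDerivAt W (W1 s) s := by
    intro x hx
    have hx' := uIoo_sub hz hu hx
    exact hasDerivAt_of_Icc (h.d1 x (Ioo_subset_Icc_self hx')) hx'
  have hl : ∀ s ∈ Ioo (min z u) (max z u), |(W1 s - W1 z) * (s - z)| ≤ B * (s - z)^2 := by
    intro s hs
    have := h.W1_lip hB (Ioo_subset_Icc_self (uIoo_sub hz hu hs)) hz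
    rw [abs_mul, ← sq_abs (s-z), pow_two, ← mul_assoc]
    gcongr
  have hcc := h.contW.mono (uIcc_subset_Icc hz hu)
  rw [abs_le]
  constructor
  · have := mvt_taylor_le (f := fun t => - W t) (f' := fun t => - W1 t) (z := z) (u := u) hcc.neg hB0 (fun s hs => (hd s hs).neg)
      (fun s hs => by have := (abs_le.1 (hl s hs)).1; nlinarith)
    linarith
  · exact mvt_taylor_le hcc hB0 hd (fun s hs => (abs_le.1 (hl s hs)).2)

end Well2


namespace Well2
variable {W W1 W2 : ℝ → ℝ} {L : ℝ}

lemma w_nonneg (h : Well2 W W1 W2 L) : 0 ≤ W1 0 := by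
  obtain ⟨B, hB0, hB⟩ := h.W2_bd
  by_contra hc
  push Not at hc
  set t := min (1/2) (-W1 0 / (2*B)) with ht
  have ht0 : 0 < t := by
    apply lt_min (by norm_num)
    apply div_pos <;> linarith
  have ht1 : t ≤ 1/2 := min_le_left _ _
  have ht2 : t ≤ -W1 0/(2*B) := min_le_right _ _
  have h1 := h.W_taylor hB0.le hB (u := t) (z := 0) ⟨ht0.le, by linarith⟩ (by simp)
  rw [h.z0] at h1
  have h2 := (abs_le.1 h1).2
  have h3 := h.pos t ⟨ht0, by linarith⟩
  rw [le_div_iff₀ (by linarith)] at ht2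
  nlinarith

set_option maxHeartbeats 2000000 in
lemma endL (h : Well2 W W1 W2 L) : ∃ d c C, 0 < d ∧ d ≤ 1/8 ∧ 0 < c ∧ 0 < C ∧
    (∀ t ∈ Icc 0 d, c ≤ W2 t) ∧
    (∀ t ∈ Ioc 0 d, c ≤ W1 t / (2 * √(W t))) ∧
    (∀ t ∈ Icc 0 d, c * t ≤ √(W t)) ∧
    (∀ t ∈ Ioc 0 d, (2 * W2 t * W t - W1 t^2)/(4 * W t * √(W t)) ≤ C) ∧
    (W1 0 = 0 → ∀ t ∈ Ioc 0 d, |(2 * W2 t * W t - W1 t^2)/(4 * W t * √(W t))| ≤ C) ∧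
    (W1 0 = 0 → ∀ t ∈ Ioc 0 d, W1 t / (2 * √(W t)) ≤ C) ∧
    (0 < W1 0 → ∀ t ∈ Icc 0 d, c ≤ W1 t ∧ c * t ≤ W t) := by
  obtain ⟨B, hB0, hB⟩ := h.W2_bd
  have hw := h.w_nonneg
  set w := W1 0 with hwdef
  set a := W2 0 with hadef
  have ha : 0 < a := h.s0
  have haB : a ≤ B := (le_abs_self _).trans (hB 0 (by simp))
  set m := a/2 with hm
  have hm0 : 0 < m := by positivity
  have hL := h.Lnn
  set d0 : ℝ := if 0 < w then w^2/(2*B*(w+B)) else 1 with hd0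
  have hd0p : 0 < d0 := by
    rw [hd0]; split_ifs with hh
    · positivity
    · norm_num
  set d := min (min (1/8) (m/(L+1))) d0 with hd
  have hdp : 0 < d := by
    apply lt_min (lt_min (by norm_num) (by positivity)) hd0p
  have hd8 : d ≤ 1/8 := (min_le_left _ _).trans (min_le_left _ _)
  have hdm : d ≤ m/(L+1) := (min_le_left _ _).trans (min_le_right _ _)
  have hdd0 : d ≤ d0 := min_le_right _ _
  have hI : ∀ t ∈ Icc 0 d, t ∈ Icc (0:ℝ) 1 := fun t ht => ⟨ht.1, by linarith [ht.2]⟩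
  have hW2 : ∀ t ∈ Icc 0 d, m ≤ W2 t := by
    intro t ht
    have h1 := h.lip t (hI t ht) 0 (by simp)
    rw [sub_zero, abs_of_nonneg ht.1] at h1
    have h2 := (abs_le.1 h1).1
    have h3 : d * (L+1) ≤ m := by rwa [le_div_iff₀ (by positivity)] at hdm
    have h4 : L * t ≤ d * (L+1) := by nlinarith [ht.2, ht.1]
    linarith [hadef]
  have hdW : ∀ t ∈ Icc 0 d, ∀ s ∈ Ioo (min 0 t) (max 0 t), HasDerivAt W (W1 s) s ∧ HasDerivAt W1 (W2 s) s ∧ s ∈ Ioo 0 t := by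
    intro t ht s hs
    rw [min_eq_left ht.1, max_eq_right ht.1] at hs
    have hs' : s ∈ Ioo (0:ℝ) 1 := ⟨hs.1, by linarith [hs.2, ht.2]⟩
    exact ⟨hasDerivAt_of_Icc (h.d1 s (Ioo_subset_Icc_self hs')) hs', hasDerivAt_of_Icc (h.d2 s (Ioo_subset_Icc_self hs')) hs', hs⟩
  have hsub : ∀ t ∈ Icc 0 d, uIcc 0 t ⊆ Icc (0:ℝ) 1 := fun t ht => uIcc_subset_Icc (by simp) (hI t ht)
  have hW1 : ∀ t ∈ Icc 0 d, w + m * t ≤ W1 t := by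
    intro t ht
    rcases eq_or_lt_of_le ht.1 with h0 | h0
    · rw [← h0]; simp [hwdef]
    have := mvt_bound_ge (f := W1) (f' := W2) (z := 0) (u := t) (C := m) (h.contW1.mono (hsub t ht)) (fun s hs => (hdW t ht s hs).2.1)
      (fun s hs => hW2 s ⟨(hdW t ht s hs).2.2.1.le, (hdW t ht s hs).2.2.2.le.trans ht.2⟩)
    simp only [sub_zero] at this
    by_contra hcon; push Not at hcon
    nlinarith
  have hWl : ∀ t ∈ Icc 0 d, w * t + m/2 * t^2 ≤ W t := by
    intro t ht
    rcases eq_or_lt_of_le ht.1 with h0 | h0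
    · rw [← h0]; simp [h.z0]
    have := mvt_bound_ge (f := fun t => W t - (w * t + m/2 * t^2)) (f' := fun t => W1 t - (w + m * t)) (z := 0) (u := t) (C := 0)
      ((h.contW.mono (hsub t ht)).sub (by fun_prop)) (fun s hs => by
        refine (hdW t ht s hs).1.fun_sub ?_
        have h1 : HasDerivAt (fun t : ℝ => w * t + m/2 * t^2) (w * 1 + m/2 * (2 * s)) s := by
          have := ((hasDerivAt_id s).const_mul w).fun_add (((hasDerivAt_id s).pow 2).const_mul (m/2))
          simpa using this
        exact h1.congr_deriv (by ring))
      (fun s hs => by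
        have := hW1 s ⟨(hdW t ht s hs).2.2.1.le, (hdW t ht s hs).2.2.2.le.trans ht.2⟩
        linarith)
    simp only [sub_zero, h.z0] at this
    by_contra hcon; push Not at hcon
    nlinarith
  have hWu : ∀ t ∈ Icc 0 d, W t ≤ w * t + B * t^2 := by
    intro t ht
    have := (abs_le.1 (h.W_taylor hB0.le hB (hI t ht) (z := 0) (by simp))).2
    simp only [sub_zero, h.z0] at this
    linarith
  have hWpos : ∀ t ∈ Ioc 0 d, 0 < W t := fun t ht => h.pos t ⟨ht.1, by linarith [ht.2]⟩
  have hsq : ∀ t ∈ Icc 0 d, √(m/2) * t ≤ √(W t) := by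
    intro t ht
    apply Real.le_sqrt_of_sq_le
    rw [mul_pow, Real.sq_sqrt (by positivity)]
    have := hWl t ht
    nlinarith [mul_nonneg hw ht.1]
  set q := min m (m^2/B) with hq
  have hq0 : 0 < q := by apply lt_min hm0; positivity
  have hqB : q * B ≤ m^2 := by
    have : q ≤ m^2/B := min_le_right _ _
    rwa [le_div_iff₀ hB0] at this
  have hqm : q ≤ m := min_le_left _ _
  have hpd : ∀ t ∈ Ioc 0 d, √q/2 ≤ W1 t / (2 * √(W t)) := by
    intro t ht
    have ht' : t ∈ Icc 0 d := ⟨ht.1.le, ht.2⟩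
    rw [le_div_iff₀ (by have := Real.sqrt_pos.2 (hWpos t ht); positivity)]
    have h1 : √q/2 * (2 * √(W t)) = √(q * W t) := by rw [Real.sqrt_mul hq0.le]; ring
    rw [h1]
    have h2 := hW1 t ht'
    have h3 : 0 ≤ w + m * t := by have := ht.1; positivity
    apply Real.sqrt_le_iff.2 ⟨h3.trans h2, ?_⟩
    have h4 := hWu t ht'
    have h5 : (w + m*t)^2 ≤ W1 t^2 := by gcongr
    have h6 : q * W t ≤ q * (w * t + B*t^2) := by gcongr
    have h7 : q * (w*t) ≤ m * (w*t) := by have := ht.1; gcongr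
    have h8 : q * B * t^2 ≤ m^2 * t^2 := by gcongr
    have h9 : 0 ≤ m * (w*t) := by have := ht.1; positivity
    nlinarith
  set C := 6*L*B/(2*m*√(m/2)) + B/√(m/2) + 1 with hC
  have hCp : 0 < C := by positivity
  have hpdd0 : w = 0 → ∀ t ∈ Ioc 0 d, |(2 * W2 t * W t - W1 t^2)/(4 * W t * √(W t))| ≤ C := by
    intro hw0 t ht
    have ht0 := ht.1
    have ht' : t ∈ Icc 0 d := ⟨ht.1.le, ht.2⟩
    have e1 : |W1 t - a * t| ≤ L * t^2 := by
      have := mvt_bound_abs (f := fun t => W1 t - a * t) (f' := fun t => W2 t - a) (z := 0) (u := t) (C := L * t)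
        ((h.contW1.mono (hsub t ht')).sub (by fun_prop)) (fun s hs => by
          refine (hdW t ht' s hs).2.1.fun_sub ?_
          simpa using (hasDerivAt_id s).const_mul a)
        (fun s hs => by
          have hs' := (hdW t ht' s hs).2.2
          have := h.lip s (hI s ⟨hs'.1.le, hs'.2.le.trans ht.2⟩) 0 (by simp)
          rw [sub_zero, abs_of_pos hs'.1] at this
          refine this.trans ?_
          have := hs'.2.le
          gcongr)
      simp only [← hwdef, hw0, sub_zero, mul_zero, abs_of_pos ht0] at this
      linarith
    have e1' : ∀ s ∈ Ioo 0 t, |W1 s - a * s| ≤ L * t^2 := by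
      intro s hs
      have hsd : s ∈ Icc 0 d := ⟨hs.1.le, hs.2.le.trans ht.2⟩
      have := mvt_bound_abs (f := fun t => W1 t - a * t) (f' := fun t => W2 t - a) (z := 0) (u := s) (C := L * t)
        ((h.contW1.mono (hsub s hsd)).sub (by fun_prop)) (fun x hx => by
          refine (hdW s hsd x hx).2.1.fun_sub ?_
          simpa using (hasDerivAt_id x).const_mul a)
        (fun x hx => by
          have hs' := (hdW s hsd x hx).2.2
          have := h.lip x (hI x ⟨hs'.1.le, hs'.2.le.trans hsd.2⟩) 0 (by simp)
          rw [sub_zero, abs_of_pos hs'.1] at this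
          refine this.trans ?_
          have := hs'.2.le.trans hs.2.le
          gcongr)
      simp only [← hwdef, hw0, sub_zero, mul_zero, abs_of_pos hs.1] at this
      refine this.trans ?_
      have : L * t * s ≤ L * t * t := by have := hs.2.le; gcongr
      linarith
    have e2 : |W t - a/2 * t^2| ≤ L * t^3 := by
      have := mvt_bound_abs (f := fun t => W t - a/2 * t^2) (f' := fun t => W1 t - a * t) (z := 0) (u := t) (C := L * t^2)
        ((h.contW.mono (hsub t ht')).sub (by fun_prop)) (fun s hs => by
          refine (hdW t ht' s hs).1.fun_sub ?_
          have h1 : HasDerivAt (fun t : ℝ => a/2 * t^2) (a/2 * (2 * s)) s := by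
            have := ((hasDerivAt_id s).pow 2).const_mul (a/2)
            simpa using this
          exact h1.congr_deriv (by ring))
        (fun s hs => e1' s (hdW t ht' s hs).2.2)
      simp only [h.z0, sub_zero, mul_zero, abs_of_pos ht0, ne_eq, OfNat.ofNat_ne_zero, not_false_eq_true, zero_pow] at this
      linarith
    have e3 : |W2 t - a| ≤ L * t := by
      have := h.lip t (hI t ht') 0 (by simp)
      rwa [sub_zero, abs_of_pos ht0] at this
    have e4 : |W t| ≤ B * t^2 := by
      rw [abs_of_pos (hWpos t ht)]; have := hWu t ht'; rw [hw0] at this; linarith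
    have e5 : |W1 t + a * t| ≤ 2*B*t := by
      have := h.W1_lip hB (hI t ht') (t := 0) (by simp)
      rw [← hwdef, hw0, sub_zero, sub_zero, abs_of_pos ht0] at this
      calc |W1 t + a*t| ≤ |W1 t| + |a*t| := abs_add_le _ _
        _ ≤ B * t + B * t := by rw [abs_of_pos (by positivity : 0 < a*t)]; gcongr
        _ = _ := by ring
    have e6 : |2 * W2 t * W t - W1 t^2| ≤ 6*L*B*t^3 := by
      have : 2 * W2 t * W t - W1 t^2 = 2*((W2 t - a)*W t) + 2*a*(W t - a/2*t^2) - (W1 t - a*t)*(W1 t + a*t) := by ring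
      rw [this]
      have f1 : |(W2 t - a)*W t| ≤ L * t * (B*t^2) := by rw [abs_mul]; gcongr
      have f2 : |a*(W t - a/2*t^2)| ≤ B*(L*t^3) := by rw [abs_mul, abs_of_pos ha]; gcongr
      have f3 : |(W1 t - a*t)*(W1 t + a*t)| ≤ L*t^2*(2*B*t) := by rw [abs_mul]; gcongr
      obtain ⟨f1a, f1b⟩ := abs_le.1 f1
      obtain ⟨f2a, f2b⟩ := abs_le.1 f2
      obtain ⟨f3a, f3b⟩ := abs_le.1 f3
      rw [abs_le]
      constructor <;> linarith
    have e7 : 2*m*√(m/2) * t^3 ≤ 4 * W t * √(W t) := by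
      have f1 := hsq t ht'
      have f2 := hWl t ht'
      rw [hw0] at f2
      calc 2*m*√(m/2) * t^3 = 4 * (m/2*t^2) * (√(m/2) * t) := by ring
        _ ≤ 4 * W t * √(W t) := by have := (hWpos t ht).le; gcongr; linarith
    rw [abs_div, abs_of_pos (a := 4 * W t * √(W t)) (lt_of_lt_of_le (by positivity) e7)]
    have : |2 * W2 t * W t - W1 t^2| / (4 * W t * √(W t)) ≤ (6*L*B*t^3)/(2*m*√(m/2) * t^3) := by
      gcongr
    refine this.trans ?_
    rw [mul_div_mul_right _ _ (by positivity)]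
    have : 0 ≤ B/√(m/2) := by positivity
    linarith
  refine ⟨d, min (min m (√q/2)) (min (√(m/2)) (if 0 < w then w else 1)), C, hdp, hd8, ?_, hCp, ?_, ?_, ?_, ?_, hpdd0, ?_, ?_⟩
  · apply lt_min (lt_min hm0 (by positivity)) (lt_min (by positivity) _)
    split_ifs with hh
    · exact hh
    · norm_num
  · intro t ht
    exact ((min_le_left _ _).trans (min_le_left _ _)).trans (hW2 t ht)
  · intro t ht
    exact ((min_le_left _ _).trans (min_le_right _ _)).trans (hpd t ht)
  · intro t ht
    refine le_trans ?_ (hsq t ht)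
    have := ht.1
    gcongr
    exact ((min_le_right _ _).trans (min_le_left _ _))
  · intro t ht
    rcases eq_or_lt_of_le hw with hw0 | hw0
    · exact (le_abs_self _).trans (hpdd0 hw0.symm t ht)
    · refine le_trans ?_ hCp.le
      apply div_nonpos_of_nonpos_of_nonneg
      · have ht' : t ∈ Icc 0 d := ⟨ht.1.le, ht.2⟩
        have f1 : t ≤ w^2/(2*B*(w+B)) := by
          have := ht.2.trans hdd0; rwa [hd0, if_pos hw0] at this
        rw [le_div_iff₀ (by positivity)] at f1
        have f2 := hWu t ht'
        have f3 := hW1 t ht'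
        have f4 : w ≤ W1 t := by nlinarith [ht.1]
        have f5 : w^2 ≤ W1 t^2 := by gcongr
        have f6 : W2 t * W t ≤ B * W t := by
          have := (le_abs_self _).trans (hB t (hI t ht')); have := (hWpos t ht).le; gcongr
        have f7 : t^2 ≤ t := by nlinarith [ht.1, ht.2]
        have f8 : B * W t ≤ B * (w*t + B*t) := by gcongr; nlinarith
        nlinarith
      · have := (hWpos t ht).le; positivity
  · intro hw0 t ht
    have ht' : t ∈ Icc 0 d := ⟨ht.1.le, ht.2⟩
    have ht0 := ht.1
    have f1 := hsq t ht'
    have f0 : 0 < √(m/2) * t := by positivity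
    rw [div_le_iff₀ (by linarith)]
    have := h.W1_lip hB (hI t ht') (t := 0) (by simp)
    rw [← hwdef, hw0, sub_zero, sub_zero, abs_of_pos ht0] at this
    have f2 := (le_abs_self _).trans this
    have f3 : B/√(m/2) ≤ C := by have : 0 ≤ 6*L*B/(2*m*√(m/2)) := by positivity
                                 linarith
    have f4 : B/√(m/2) * (√(m/2) * t) = B * t := by field_simp
    have f5 : B/√(m/2) * (√(m/2) * t) ≤ C * √(W t) := by gcongr
    linarith [Real.sqrt_nonneg (W t), mul_nonneg hCp.le (Real.sqrt_nonneg (W t))]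
  · intro hw0 t ht
    have hle : min (min m (√q/2)) (min (√(m/2)) (if 0 < w then w else 1)) ≤ w := by
      refine ((min_le_right _ _).trans (min_le_right _ _)).trans ?_
      rw [if_pos hw0]
    constructor
    · refine hle.trans ?_
      have := hW1 t ht; nlinarith [ht.1]
    · have := hWl t ht
      have h1 := ht.1
      have : min (min m (√q/2)) (min (√(m/2)) (if 0 < w then w else 1)) * t ≤ w * t := by gcongr
      nlinarith [sq_nonneg t]

end Well2


/-- remainder of sqrt W -/
def pdv (W W1 : ℝ → ℝ) (t : ℝ) : ℝ := W1 t / (2 * √(W t))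
def RR (W W1 : ℝ → ℝ) (z u : ℝ) : ℝ := √(W u) - √(W z) - pdv W W1 z * (u - z)

structure PF (W W1 : ℝ → ℝ) (δ C : ℝ) : Prop where
  dpos : 0 < δ
  dle : δ ≤ 1/16
  Cge : 1 ≤ C
  contW : ContinuousOn W (Icc 0 1)
  d1 : ∀ t ∈ Icc (0:ℝ) 1, HasDerivWithinAt W (W1 t) (Icc 0 1) t
  d2 : ∀ s ∈ Icc (0:ℝ) 1, ∀ t ∈ Icc (0:ℝ) 1, |W1 s - W1 t| ≤ C * |s - t|
  dp : ∀ t ∈ Ioo (0:ℝ) 1, HasDerivAt (fun t => √(W t)) (pdv W W1 t) t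
  z0 : W 0 = 0
  z1 : W 1 = 0
  z10 : W1 0 = 0
  pos : ∀ t ∈ Ioo (0:ℝ) 1, 0 < W t
  f1a : ∀ t ∈ Icc (0:ℝ) 1, |W1 t| ≤ C * t
  f1b : ∀ t ∈ Icc (0:ℝ) 1, W t ≤ C * t^2
  f1c : ∀ t ∈ Icc (0:ℝ) 1, √(W t) ≤ C * t
  f2 : ∀ u ∈ Icc (0:ℝ) 1, ∀ z ∈ Icc (0:ℝ) 1, |W u - W z - W1 z * (u - z)| ≤ C * (u-z)^2
  f3 : ∀ u ∈ Icc (1-2*δ) 1, ∀ z ∈ Icc (1-2*δ) 1, (u-z)^2 ≤ C * (W u - W z - W1 z * (u - z))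
  f4 : ∀ u ∈ Icc (1-2*δ) 1, ∀ z ∈ Icc (1-2*δ) 1, (u-z)^2 ≤ C * (-((√(W u) - √(W z)) * (u - z)))
  f5 : ∀ u ∈ Icc 0 (2*δ), ∀ z ∈ Icc 0 (2*δ), (u-z)^2 ≤ C * ((√(W u) - √(W z)) * (u - z))
  f6a : ∀ u ∈ Icc 0 (1-δ/2), ∀ z ∈ Icc 0 (1-δ/2), |√(W u) - √(W z)| ≤ C * |u - z|
  f6b : ∀ u ∈ Icc 0 (1-δ/2), ∀ z ∈ Ioc 0 (1-δ/2), |RR W W1 z u| ≤ C * (u - z)^2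
  f6c : ∀ z ∈ Ioc 0 (1-δ/2), |pdv W W1 z| ≤ C
  f7 : ∀ u ∈ Icc (1-2*δ) 1, ∀ z ∈ Ico (1-2*δ) 1, RR W W1 z u ≤ C * (u - z)^2
  f7a : W1 1 = 0 → ∀ u ∈ Icc (0:ℝ) 1, ∀ z ∈ Icc (0:ℝ) 1, |√(W u) - √(W z)| ≤ C * |u - z|
  f7b : W1 1 = 0 → ∀ u ∈ Icc (0:ℝ) 1, ∀ z ∈ Ioo (0:ℝ) 1, |RR W W1 z u| ≤ C * (u - z)^2
  f7c : W1 1 = 0 → ∀ z ∈ Ioo (0:ℝ) 1, |pdv W W1 z| ≤ C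
  nonpos : W1 1 ≤ 0
  f7d : W1 1 < 0 → ∀ u ∈ Icc (1-2*δ) 1, 1 - u ≤ C * W u ∧ 1 ≤ C * (-W1 u)
  f8 : ∀ t ∈ Icc 0 (1-δ/2), t ≤ C * √(W t)
  f9 : ∀ t ∈ Icc (δ/2) (1-δ/2), 1 ≤ C * W t

namespace Well2
variable {W W1 W2 : ℝ → ℝ} {L : ℝ}

lemma dsqrt (h : Well2 W W1 W2 L) {t : ℝ} (ht : t ∈ Ioo (0:ℝ) 1) :
    HasDerivAt (fun t => √(W t)) (pdv W W1 t) t := by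
  have h1 := hasDerivAt_of_Icc (h.d1 t (Ioo_subset_Icc_self ht)) ht
  exact h1.sqrt (h.pos t ht).ne'

lemma dpdv (h : Well2 W W1 W2 L) {t : ℝ} (ht : t ∈ Ioo (0:ℝ) 1) :
    HasDerivAt (pdv W W1) ((2 * W2 t * W t - W1 t^2)/(4 * W t * √(W t))) t := by
  have h1 := hasDerivAt_of_Icc (h.d2 t (Ioo_subset_Icc_self ht)) ht
  have h2 := (h.dsqrt ht).const_mul 2
  have hp := h.pos t ht
  have hq : 0 < √(W t) := Real.sqrt_pos.2 hp
  have h3 := h1.fun_div h2 (by positivity)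
  refine h3.congr_deriv ?_
  have hW : W t = √(W t)^2 := (Real.sq_sqrt hp.le).symm
  unfold pdv
  generalize √(W t) = q at *
  rw [hW]
  field_simp
  ring

set_option maxHeartbeats 2000000 in
lemma pf (h : Well2 W W1 W2 L) (hw : W1 0 = 0) : ∃ δ C, PF W W1 δ C := by
  obtain ⟨B, hB0, hB⟩ := h.W2_bd
  obtain ⟨d0, c0, C0, hd0, hd0', hc0, hC0, a1, a2, a3, a4, a5, a6, -⟩ := h.endL
  obtain ⟨d1, c1, C1, hd1, hd1', hc1, hC1, b1, b2, b3, b4, b5, b6, b7⟩ := h.refl.endL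
  simp only [hw, forall_const] at a5 a6
  simp only [sub_zero, Left.neg_pos_iff, neg_eq_zero] at b5 b6 b7
  have hnp : W1 1 ≤ 0 := by have := h.refl.w_nonneg; simpa using this
  set δ := min d0 d1 / 2 with hδ
  have hδ0 : 2*δ ≤ d0 := by rw [hδ]; have := min_le_left d0 d1; linarith
  have hδ1 : 2*δ ≤ d1 := by rw [hδ]; have := min_le_right d0 d1; linarith
  have hδp : 0 < δ := by have := lt_min hd0 hd1; rw [hδ]; linarith
  clear_value δ
  -- compactness
  obtain ⟨κ, hκ, hκ'⟩ : ∃ κ, 0 < κ ∧ ∀ t ∈ Icc (δ/2) (1-δ/2), κ ≤ W t := by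
    have hne : (Icc (δ/2) (1-δ/2)).Nonempty := ⟨δ/2, le_refl _, by linarith⟩
    obtain ⟨x, hx, hmin⟩ := isCompact_Icc.exists_isMinOn hne
      (h.contW.mono (Icc_subset_Icc (by linarith) (by linarith)))
    exact ⟨W x, h.pos x ⟨by linarith [hx.1], by linarith [hx.2]⟩, fun t ht => hmin ht⟩
  have hW1b : ∀ t ∈ Icc (0:ℝ) 1, |W1 t| ≤ B * t := by
    intro t ht
    have := h.W1_lip hB ht (t := 0) (by simp)
    rwa [hw, sub_zero, sub_zero, abs_of_nonneg ht.1] at this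
  have hWb : ∀ t ∈ Icc (0:ℝ) 1, W t ≤ B * t^2 := by
    intro t ht
    have := (abs_le.1 (h.W_taylor hB0.le hB ht (z := 0) (by simp))).2
    simp only [sub_zero, h.z0, hw] at this
    linarith
  have hWn : ∀ t ∈ Icc (0:ℝ) 1, 0 ≤ W t := by
    intro t ht
    rcases eq_or_lt_of_le ht.1 with h' | h'
    · rw [← h', h.z0]
    rcases eq_or_lt_of_le ht.2 with h'' | h''
    · rw [h'', h.z1]
    exact (h.pos t ⟨h', h''⟩).le
  have hsb : ∀ t ∈ Icc (0:ℝ) 1, √(W t) ≤ (B+1) * t := by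
    intro t ht
    have := ht.1
    apply Real.sqrt_le_iff.2 ⟨by positivity, ?_⟩
    have := hWb t ht
    nlinarith [sq_nonneg t]
  have hsκ : 0 < √κ := Real.sqrt_pos.2 hκ
  set Cm := (2*B*B + B^2)/(4*κ*√κ) with hCm
  have hCm0 : 0 ≤ Cm := by positivity
  -- middle bounds
  have mid1 : ∀ t ∈ Icc (δ/2) (1-δ/2), |(2 * W2 t * W t - W1 t^2)/(4 * W t * √(W t))| ≤ Cm := by
    intro t ht
    have ht' : t ∈ Icc (0:ℝ) 1 := ⟨by linarith [ht.1], by linarith [ht.2]⟩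
    have k1 := hκ' t ht
    have k2 : √κ ≤ √(W t) := Real.sqrt_le_sqrt k1
    have k0 : 0 < W t := by linarith
    rw [abs_div, abs_of_pos (a := 4 * W t * √(W t)) (by positivity), hCm]
    have k3 : |W1 t| ≤ B := (hW1b t ht').trans (by nlinarith [ht'.2])
    have k4 : |W t| ≤ B := by rw [abs_of_pos k0]; refine (hWb t ht').trans ?_; have : t^2 ≤ 1 := pow_le_one₀ ht'.1 ht'.2; nlinarith
    have k5 : |2 * W2 t * W t - W1 t^2| ≤ 2*B*B + B^2 := by
      refine (abs_sub _ _).trans ?_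
      rw [abs_mul, abs_mul, abs_pow, abs_two]
      have := hB t ht'
      gcongr
    gcongr
  set Cp := B/(2*√κ) with hCp
  have hCp0 : 0 ≤ Cp := by positivity
  have mid2 : ∀ t ∈ Icc (δ/2) (1-δ/2), |pdv W W1 t| ≤ Cp := by
    intro t ht
    have ht' : t ∈ Icc (0:ℝ) 1 := ⟨by linarith [ht.1], by linarith [ht.2]⟩
    have k1 := hκ' t ht
    have k2 : √κ ≤ √(W t) := Real.sqrt_le_sqrt k1
    unfold pdv
    rw [abs_div, abs_of_pos (a := 2 * √(W t)) (by linarith), hCp]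
    have k3 : |W1 t| ≤ B := (hW1b t ht').trans (by nlinarith [ht'.2])
    gcongr
  -- pointwise bounds, left
  have left1 : ∀ t ∈ Ioc 0 (1-δ/2), |(2 * W2 t * W t - W1 t^2)/(4 * W t * √(W t))| ≤ Cm + C0 := by
    intro t ht
    by_cases hh : t ≤ d0
    · have := a5 t ⟨ht.1, hh⟩; linarith
    · have := mid1 t ⟨by linarith, ht.2⟩; linarith
  have left2 : ∀ t ∈ Ioc 0 (1-δ/2), |pdv W W1 t| ≤ Cp + C0 := by
    intro t ht
    by_cases hh : t ≤ d0
    · have := a6 t ⟨ht.1, hh⟩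
      have k := a2 t ⟨ht.1, hh⟩
      unfold pdv; rw [abs_of_nonneg (by linarith)]; linarith
    · have := mid2 t ⟨by linarith, ht.2⟩; linarith
  have right1 : ∀ t ∈ Ico (1-2*δ) 1, (2 * W2 t * W t - W1 t^2)/(4 * W t * √(W t)) ≤ C1 := by
    intro t ht
    have := b4 (1-t) ⟨by linarith [ht.2], by linarith [ht.1]⟩
    simpa using this
  have right2 : ∀ t ∈ Ico (1-2*δ) 1, pdv W W1 t ≤ -c1 := by
    intro t ht
    have := b2 (1-t) ⟨by linarith [ht.2], by linarith [ht.1]⟩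
    simp only [sub_sub_cancel, neg_div] at this
    unfold pdv; linarith
  have glob1 : W1 1 = 0 → ∀ t ∈ Ioo (0:ℝ) 1, |(2 * W2 t * W t - W1 t^2)/(4 * W t * √(W t))| ≤ Cm + C0 + C1 := by
    intro hw1 t ht
    by_cases hh : t ≤ 1 - δ/2
    · have := left1 t ⟨ht.1, hh⟩; linarith
    · have := b5 hw1 (1-t) ⟨by linarith [ht.2], by linarith⟩
      simp only [sub_sub_cancel, neg_sq] at this
      linarith
  have glob2 : W1 1 = 0 → ∀ t ∈ Ioo (0:ℝ) 1, |pdv W W1 t| ≤ Cp + C0 + C1 := by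
    intro hw1 t ht
    by_cases hh : t ≤ 1 - δ/2
    · have := left2 t ⟨ht.1, hh⟩; linarith
    · have := b6 hw1 (1-t) ⟨by linarith [ht.2], by linarith⟩
      have k := right2 t ⟨by linarith, ht.2⟩
      simp only [sub_sub_cancel, neg_div] at this
      rw [abs_of_nonpos (by linarith)]
      unfold pdv; linarith
  have hcs : ContinuousOn (fun t => √(W t)) (Icc 0 1) := h.contW.sqrt
  have hdq : ∀ u ∈ Icc (0:ℝ) 1, ∀ z ∈ Icc (0:ℝ) 1, ∀ s ∈ Ioo (min z u) (max z u), HasDerivAt (fun t => √(W t)) (pdv W W1 s) s :=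
    fun u hu z hz s hs => h.dsqrt (uIoo_sub hz hu hs)
  -- Taylor for sqrt
  have tay : ∀ D : ℝ, 0 ≤ D → ∀ u ∈ Icc (0:ℝ) 1, ∀ z ∈ Ioo (0:ℝ) 1,
      (∀ s ∈ Ioo (0:ℝ) 1, s ∈ uIcc z u → (2 * W2 s * W s - W1 s^2)/(4 * W s * √(W s)) ≤ D) → RR W W1 z u ≤ D * (u-z)^2 := by
    intro D hD u hu z hz hb
    have hz' := Ioo_subset_Icc_self hz
    refine mvt_taylor_le (f := fun t => √(W t)) (hcs.mono (uIcc_subset_Icc hz' hu)) hD (hdq u hu z hz') ?_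
    intro s hs
    have hs' := uIoo_sub hz' hu hs
    have hss : s ∈ uIcc z u := Ioo_subset_Icc_self hs
    have hsub : uIcc z s ⊆ Ioo (0:ℝ) 1 := by
      rw [uIcc]
      intro x hx
      exact ⟨lt_of_lt_of_le (lt_min hz.1 hs'.1) hx.1, lt_of_le_of_lt hx.2 (max_lt hz.2 hs'.2)⟩
    have hsub2 : uIcc z s ⊆ uIcc z u := uIcc_subset_uIcc_left hss
    apply mvt_bound (f := pdv W W1) (f' := fun s => (2 * W2 s * W s - W1 s^2)/(4 * W s * √(W s)))
    · intro x hx; exact (h.dpdv (hsub hx)).continuousAt.continuousWithinAt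
    · intro x hx; exact h.dpdv (hsub (Ioo_subset_Icc_self hx))
    · intro x hx; exact hb x (hsub (Ioo_subset_Icc_self hx)) (hsub2 (Ioo_subset_Icc_self hx))
  have tay' : ∀ D : ℝ, 0 ≤ D → ∀ u ∈ Icc (0:ℝ) 1, ∀ z ∈ Ioo (0:ℝ) 1,
      (∀ s ∈ Ioo (0:ℝ) 1, s ∈ uIcc z u → -D ≤ (2 * W2 s * W s - W1 s^2)/(4 * W s * √(W s))) → -(D * (u-z)^2) ≤ RR W W1 z u := by
    intro D hD u hu z hz hb
    have hz' := Ioo_subset_Icc_self hz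
    have key := mvt_taylor_le (f := fun t => -√(W t)) (f' := fun t => -pdv W W1 t) (z := z) (u := u)
      (hcs.mono (uIcc_subset_Icc hz' hu)).neg hD (fun s hs => (hdq u hu z hz' s hs).neg) ?_
    · unfold RR; linarith
    intro s hs
    have hs' := uIoo_sub hz' hu hs
    have hss : s ∈ uIcc z u := Ioo_subset_Icc_self hs
    have hsub : uIcc z s ⊆ Ioo (0:ℝ) 1 := by
      rw [uIcc]
      intro x hx
      exact ⟨lt_of_lt_of_le (lt_min hz.1 hs'.1) hx.1, lt_of_le_of_lt hx.2 (max_lt hz.2 hs'.2)⟩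
    have hsub2 : uIcc z s ⊆ uIcc z u := uIcc_subset_uIcc_left hss
    have := mvt_bound_ge (f := pdv W W1) (z := z) (u := s) (C := -D) (f' := fun s => (2 * W2 s * W s - W1 s^2)/(4 * W s * √(W s)))
      (fun x hx => (h.dpdv (hsub hx)).continuousAt.continuousWithinAt)
      (fun x hx => h.dpdv (hsub (Ioo_subset_Icc_self hx)))
      (fun x hx => hb x (hsub (Ioo_subset_Icc_self hx)) (hsub2 (Ioo_subset_Icc_self hx)))
    linarith
  set C := 1 + (B+1) + 2/c1 + 1/c1 + 1/c0 + (Cm + C0 + C1) + (Cp + C0 + C1) + 1/κ + (B+1)/√κ with hC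
  have q1 : 0 < 1/c1 := by positivity
  have q2 : 0 < 1/c0 := by positivity
  have q3 : 0 < 1/κ := by positivity
  have q4 : 0 < 2/c1 := by positivity
  have q5 : 0 < (B+1)/√κ := by positivity
  have hC1 : 1 ≤ C := by linarith
  have hCB : B + 1 ≤ C := by linarith
  have e1 : 2/c1 ≤ C := by linarith
  have e2 : 1/c1 ≤ C := by linarith
  have e3 : 1/c0 ≤ C := by linarith
  have e4 : Cm + C0 + C1 ≤ C := by linarith
  have e5 : Cp + C0 + C1 ≤ C := by linarith
  have e6 : 1/κ ≤ C := by linarith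
  have e7 : 1/√κ ≤ C := by
    have : 1/√κ ≤ (B+1)/√κ := by gcongr; linarith
    linarith
  clear_value C Cm Cp
  have inv_le : ∀ {c x y : ℝ}, 0 < c → 1/c ≤ C → 0 ≤ y → c * x ≤ y → x ≤ C * y := by
    intro c x y hc hcC hy hxy
    have : x ≤ (1/c) * y := by rw [one_div, ← div_eq_inv_mul, le_div_iff₀ hc]; linarith
    exact this.trans (by gcongr)
  refine ⟨δ, C, ⟨hδp, by linarith, hC1, h.contW, h.d1, ?_, fun t ht => h.dsqrt ht, h.z0, h.z1, hw, h.pos, ?_, ?_, ?_, ?_, ?_, ?_, ?_, ?_, ?_, ?_, ?_, ?_, ?_, ?_, hnp, ?_, ?_, ?_⟩⟩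
  · intro s hs t ht
    exact (h.W1_lip hB hs ht).trans (by gcongr; linarith)
  · intro t ht
    have := ht.1
    exact (hW1b t ht).trans (by gcongr; linarith)
  · intro t ht
    exact (hWb t ht).trans (by gcongr; linarith)
  · intro t ht
    have := ht.1
    exact (hsb t ht).trans (by gcongr)
  · intro u hu z hz
    exact (h.W_taylor hB0.le hB hu hz).trans (by gcongr; linarith)
  · -- f3
    intro u hu z hz
    have hu' : u ∈ Icc (0:ℝ) 1 := ⟨by linarith [hu.1], hu.2⟩
    have hz' : z ∈ Icc (0:ℝ) 1 := ⟨by linarith [hz.1], hz.2⟩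
    have key := mvt_taylor_le (f := fun t => -(W t - c1/2*t^2)) (f' := fun t => -(W1 t - c1 * t)) (z := z) (u := u) (C := 0)
      ((h.contW.mono (uIcc_subset_Icc hz' hu')).sub (by fun_prop)).neg le_rfl
      (fun s hs => by
        have hs' := uIoo_sub hz' hu' hs
        have h1 : HasDerivAt (fun t : ℝ => c1/2 * t^2) (c1/2 * (2 * s)) s := by
          have := ((hasDerivAt_id s).pow 2).const_mul (c1/2)
          simpa using this
        exact ((hasDerivAt_of_Icc (h.d1 s (Ioo_subset_Icc_self hs')) hs').fun_sub (h1.congr_deriv (by ring))).neg)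
      (fun s hs => by
        have hs' := uIoo_sub hz hu hs
        have hsI : s ∈ Icc (0:ℝ) 1 := ⟨by linarith [hs'.1], hs'.2.le⟩
        have := mvt_bound_ge (f := W1) (f' := W2) (z := z) (u := s) (C := c1) (h.contW1.mono (uIcc_subset_Icc hz' hsI))
          (fun x hx => by
            have hx' := uIoo_sub hz' hsI hx
            exact hasDerivAt_of_Icc (h.d2 x (Ioo_subset_Icc_self hx')) hx')
          (fun x hx => by
            have hx' := uIoo_sub hz (Ioo_subset_Icc_self hs') hx
            have := b1 (1-x) ⟨by linarith [hx'.2], by linarith [hx'.1]⟩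
            simpa using this)
        nlinarith)
    have k : c1/2 * (u-z)^2 ≤ W u - W z - W1 z * (u-z) := by nlinarith
    apply inv_le (c := c1/2) (by positivity) (by rw [one_div_div]; exact e1) _ k
    exact le_trans (by positivity) k
  · -- f4
    intro u hu z hz
    have hu' : u ∈ Icc (0:ℝ) 1 := ⟨by linarith [hu.1], hu.2⟩
    have hz' : z ∈ Icc (0:ℝ) 1 := ⟨by linarith [hz.1], hz.2⟩
    have := mvt_bound (f := fun t => √(W t)) (C := -c1) (hcs.mono (uIcc_subset_Icc hz' hu')) (hdq u hu' z hz')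
      (fun s hs => right2 s ⟨(uIoo_sub hz hu hs).1.le, (uIoo_sub hz hu hs).2⟩)
    have k : c1 * (u-z)^2 ≤ -((√(W u) - √(W z)) * (u - z)) := by linarith
    exact inv_le hc1 e2 (le_trans (by positivity) k) k
  · -- f5
    intro u hu z hz
    have hu' : u ∈ Icc (0:ℝ) 1 := ⟨hu.1, by linarith [hu.2]⟩
    have hz' : z ∈ Icc (0:ℝ) 1 := ⟨hz.1, by linarith [hz.2]⟩
    have k := mvt_bound_ge (f := fun t => √(W t)) (C := c0) (hcs.mono (uIcc_subset_Icc hz' hu')) (hdq u hu' z hz')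
      (fun s hs => a2 s ⟨(uIoo_sub hz hu hs).1, (uIoo_sub hz hu hs).2.le.trans hδ0⟩)
    exact inv_le hc0 e3 (le_trans (by positivity) k) k
  · intro u hu z hz
    have hu' : u ∈ Icc (0:ℝ) 1 := ⟨hu.1, by linarith [hu.2]⟩
    have hz' : z ∈ Icc (0:ℝ) 1 := ⟨hz.1, by linarith [hz.2]⟩
    exact mvt_bound_abs (f := fun t => √(W t)) (hcs.mono (uIcc_subset_Icc hz' hu')) (hdq u hu' z hz')
      (fun s hs => (left2 s ⟨(uIoo_sub hz hu hs).1, (uIoo_sub hz hu hs).2.le⟩).trans (by linarith))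
  · intro u hu z hz
    have hu' : u ∈ Icc (0:ℝ) 1 := ⟨hu.1, by linarith [hu.2]⟩
    have hz' : z ∈ Ioo (0:ℝ) 1 := ⟨hz.1, by linarith [hz.2]⟩
    have hb : ∀ s ∈ Ioo (0:ℝ) 1, s ∈ uIcc z u → |(2 * W2 s * W s - W1 s^2)/(4 * W s * √(W s))| ≤ C := by
      intro s hs hs'
      exact (left1 s ⟨hs.1, hs'.2.trans (max_le hz.2 hu.2)⟩).trans (by linarith)
    rw [abs_le]
    exact ⟨tay' C (by linarith) u hu' z hz' (fun s hs hs' => (abs_le.1 (hb s hs hs')).1),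
      tay C (by linarith) u hu' z hz' (fun s hs hs' => (abs_le.1 (hb s hs hs')).2)⟩
  · intro z hz; exact (left2 z hz).trans (by linarith)
  · intro u hu z hz
    have hu' : u ∈ Icc (0:ℝ) 1 := ⟨by linarith [hu.1], hu.2⟩
    have hz' : z ∈ Ioo (0:ℝ) 1 := ⟨by linarith [hz.1], hz.2⟩
    apply tay C (by linarith) u hu' z hz'
    intro s hs hs'
    exact (right1 s ⟨(le_min hz.1 hu.1).trans hs'.1, hs.2⟩).trans (by linarith)
  · intro hw1 u hu' z hz'
    exact mvt_bound_abs (f := fun t => √(W t)) (hcs.mono (uIcc_subset_Icc hz' hu')) (hdq u hu' z hz')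
      (fun s hs => (glob2 hw1 s (uIoo_sub hz' hu' hs)).trans e5)
  · intro hw1 u hu' z hz'
    have hb : ∀ s ∈ Ioo (0:ℝ) 1, s ∈ uIcc z u → |(2 * W2 s * W s - W1 s^2)/(4 * W s * √(W s))| ≤ C := by
      intro s hs hs'
      exact (glob1 hw1 s hs).trans e4
    rw [abs_le]
    exact ⟨tay' C (by linarith) u hu' z hz' (fun s hs hs' => (abs_le.1 (hb s hs hs')).1),
      tay C (by linarith) u hu' z hz' (fun s hs hs' => (abs_le.1 (hb s hs hs')).2)⟩
  · intro hw1 z hz; exact (glob2 hw1 z hz).trans e5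
  · intro hw1 u hu
    have hu' : u ∈ Icc (0:ℝ) 1 := ⟨by linarith [hu.1], hu.2⟩
    obtain ⟨k1, k2⟩ := b7 hw1 (1-u) ⟨by linarith [hu.2], by linarith [hu.1]⟩
    simp only [sub_sub_cancel] at k1 k2
    exact ⟨inv_le hc1 e2 (hWn u hu') k2, inv_le hc1 e2 (by linarith) (by linarith)⟩
  · intro t ht
    by_cases hh : t ≤ d0
    · exact inv_le hc0 e3 (Real.sqrt_nonneg _) (a3 t ⟨ht.1, hh⟩)
    · have k1 := hκ' t ⟨by linarith, ht.2⟩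
      have k2 : √κ ≤ √(W t) := Real.sqrt_le_sqrt k1
      apply inv_le hsκ e7 (Real.sqrt_nonneg _)
      refine le_trans ?_ k2
      nlinarith [ht.2]
  · intro t ht
    have k1 := hκ' t ht
    exact inv_le hκ e6 (by linarith) (by linarith)

end Well2


def V1 (n : ℕ) (W : ℝ → ℝ) (t : ℝ) : ℝ := √(W t) * ((n:ℝ)/((n:ℝ)-1)) * Phi W t ^ ((n:ℝ)/((n:ℝ)-1) - 1)

structure VF (n : ℕ) (W W1 : ℝ → ℝ) (δ C : ℝ) : Prop where
  Cge : 1 ≤ C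
  dV : ∀ t ∈ Icc (0:ℝ) 1, HasDerivWithinAt (Vpot n W) (V1 n W t) (Icc 0 1) t
  dPhi : ∀ t ∈ Icc (0:ℝ) 1, HasDerivWithinAt (Phi W) (√(W t)) (Icc 0 1) t
  mono : MonotoneOn (Vpot n W) (Icc 0 1)
  V0 : Vpot n W 0 = 0
  V1e : Vpot n W 1 = 1
  v1 : ∀ t ∈ Icc (0:ℝ) 1, 0 ≤ V1 n W t ∧ V1 n W t ≤ C * √(W t)
  v2 : ∀ u ∈ Icc (0:ℝ) 1, ∀ z ∈ Icc (0:ℝ) 1, Vpot n W u - Vpot n W z - V1 n W z * (u - z) ≤ C * (u-z)^2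
  v3 : ∀ t ∈ Icc 0 (1-δ/2), Vpot n W t ≤ C * W t
  v4 : ∀ t ∈ Icc (δ/2) (1-δ/2), 1 ≤ C * V1 n W t
  v5 : ∀ t ∈ Icc (0:ℝ) 1, Vpot n W t ≤ C * t^2

lemma phi_deriv {W : ℝ → ℝ} (hc : ContinuousOn W (Icc 0 1)) {t : ℝ} (ht : t ∈ Icc (0:ℝ) 1) :
    HasDerivWithinAt (Phi W) (√(W t)) (Icc 0 1) t := by
  have hc' : ContinuousOn (fun t => √(W t)) (Icc 0 1) := hc.sqrt
  have hintg : IntervalIntegrable (fun t => √(W t)) volume 0 t := by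
    apply ContinuousOn.intervalIntegrable
    exact hc'.mono (uIcc_subset_Icc (by simp) ht)
  have : Fact (t ∈ Icc (0:ℝ) 1) := ⟨ht⟩
  exact intervalIntegral.integral_hasDerivWithinAt_right hintg
    (hc'.stronglyMeasurableAtFilter_nhdsWithin measurableSet_Icc t) (hc' t ht)

lemma rpow_sub_le {x y γ : ℝ} (hy : 0 < y) (hy1 : y ≤ 1) (hxy : y ≤ x) (hg : 0 ≤ γ) (hg1 : γ ≤ 1) :
    x^γ - y^γ ≤ (x - y)/y := by
  have h1 : x^γ = y^γ * (x/y)^γ := by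
    rw [← Real.mul_rpow hy.le (div_nonneg (hy.le.trans hxy) hy.le)]; congr 1; field_simp
  have h2 : 1 ≤ x/y := by rwa [le_div_iff₀ hy, one_mul]
  have h3 : (x/y)^γ ≤ x/y := by
    calc (x/y)^γ ≤ (x/y)^(1:ℝ) := Real.rpow_le_rpow_of_exponent_le h2 hg1
      _ = x/y := Real.rpow_one _
  have h4 : y^γ ≤ 1 := Real.rpow_le_one hy.le hy1 hg
  have h5 : 0 ≤ y^γ := by positivity
  have h6 : (x-y)/y = x/y - 1 := by field_simp
  rw [h1, h6]
  nlinarith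

set_option maxHeartbeats 1000000 in
lemma PF.vf {n : ℕ} (hn : 2 ≤ n) {W W1 : ℝ → ℝ} {δ C : ℝ} (h : PF W W1 δ C)
    (hnorm : ∫ t in (0:ℝ)..1, Real.sqrt (W t) = 1) : ∃ C', VF n W W1 δ C' := by
  have hn1 : (1:ℝ) ≤ (n:ℝ) - 1 := by
    have : (2:ℝ) ≤ n := by exact_mod_cast hn
    linarith
  obtain ⟨γ, hγ, hγ0, hγ1⟩ : ∃ γ : ℝ, (n:ℝ)/((n:ℝ)-1) = 1 + γ ∧ 0 ≤ γ ∧ γ ≤ 1 := by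
    refine ⟨1/((n:ℝ)-1), ?_, by positivity, ?_⟩
    · field_simp; ring
    · rw [div_le_one (by linarith)]; exact hn1
  have hd := h.dpos
  have hdl := h.dle
  have hC := h.Cge
  have hC0 : 0 < C := by linarith
  have hdP : ∀ t ∈ Icc (0:ℝ) 1, HasDerivWithinAt (Phi W) (√(W t)) (Icc 0 1) t := fun t ht => phi_deriv h.contW ht
  have hcP : ContinuousOn (Phi W) (Icc 0 1) := fun t ht => (hdP t ht).continuousWithinAt
  have P0 : Phi W 0 = 0 := by simp [Phi]
  have P1 : Phi W 1 = 1 := hnorm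
  have hPm : MonotoneOn (Phi W) (Icc 0 1) := by
    apply monotoneOn_of_deriv_nonneg (convex_Icc 0 1) hcP
    · intro t ht
      rw [interior_Icc] at ht
      exact (hasDerivAt_of_Icc (hdP t (Ioo_subset_Icc_self ht)) ht).differentiableAt.differentiableWithinAt
    · intro t ht
      rw [interior_Icc] at ht
      rw [(hasDerivAt_of_Icc (hdP t (Ioo_subset_Icc_self ht)) ht).deriv]
      positivity
  have Pn : ∀ t ∈ Icc (0:ℝ) 1, 0 ≤ Phi W t := fun t ht => by
    rw [← P0]; exact hPm (by simp) ht ht.1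
  have Pl : ∀ t ∈ Icc (0:ℝ) 1, Phi W t ≤ 1 := fun t ht => by
    rw [← P1]; exact hPm ht (by simp) ht.2
  have hdP' : ∀ t ∈ Ioo (0:ℝ) 1, HasDerivAt (Phi W) (√(W t)) t := fun t ht => hasDerivAt_of_Icc (hdP t (Ioo_subset_Icc_self ht)) ht
  have Pu : ∀ t ∈ Icc (0:ℝ) 1, Phi W t ≤ C * t^2 := by
    intro t ht
    have := mvt_bound_abs (f := Phi W) (f' := fun t => √(W t)) (z := 0) (u := t) (C := C * t) (hcP.mono (uIcc_subset_Icc (by simp) ht))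
      (fun s hs => hdP' s (uIoo_sub (by simp) ht hs))
      (fun s hs => by
        rw [min_eq_left ht.1, max_eq_right ht.1] at hs
        rw [abs_of_nonneg (by positivity)]
        refine (h.f1c s ⟨hs.1.le, hs.2.le.trans ht.2⟩).trans ?_
        have := hs.2.le
        gcongr)
    rw [P0, sub_zero, sub_zero, abs_of_nonneg (Pn t ht), abs_of_nonneg ht.1] at this
    linarith
  have Pg0 : ∀ t ∈ Icc 0 (1-δ/2), t^2 ≤ 2*C*Phi W t := by
    intro t ht
    have htI : t ∈ Icc (0:ℝ) 1 := ⟨ht.1, by linarith [ht.2]⟩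
    rcases eq_or_lt_of_le ht.1 with h0 | h0
    · rw [← h0, P0]; simp
    have := mvt_bound_ge (f := fun t => 2*C*Phi W t - t^2) (f' := fun t => 2*C*√(W t) - 2*t) (z := 0) (u := t) (C := 0)
      (((continuousOn_const.mul hcP).mono (uIcc_subset_Icc (by simp) htI)).sub (by fun_prop))
      (fun s hs => by
        refine ((hdP' s (uIoo_sub (by simp) htI hs)).const_mul _).fun_sub ?_
        simpa using hasDerivAt_pow 2 s)
      (fun s hs => by
        rw [min_eq_left ht.1, max_eq_right ht.1] at hs
        have := h.f8 s ⟨hs.1.le, hs.2.le.trans ht.2⟩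
        linarith)
    simp only [P0, mul_zero, zero_mul, ne_eq, OfNat.ofNat_ne_zero, not_false_eq_true, zero_pow, sub_zero] at this
    by_contra hcon; push Not at hcon
    nlinarith
  have Pg : ∀ t ∈ Icc (0:ℝ) 1, t^2 ≤ 8*C*Phi W t := by
    intro t ht
    by_cases hh : t ≤ 1 - δ/2
    · have := Pg0 t ⟨ht.1, hh⟩
      have := Pn t ht
      nlinarith
    · have k1 := Pg0 (1-δ/2) ⟨by linarith, le_rfl⟩
      push Not at hh
      have k2 := hPm (a := 1-δ/2) ⟨by linarith, by linarith⟩ ht hh.le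
      have k3 : t^2 ≤ 1 := pow_le_one₀ ht.1 ht.2
      have k4 : (1/4:ℝ) ≤ (1-δ/2)^2 := by nlinarith
      have k5 : 2*C*Phi W (1-δ/2) ≤ 2*C*Phi W t := by gcongr
      linarith
  have pm : ∀ s ∈ Icc (0:ℝ) 1, ∀ t ∈ Icc (0:ℝ) 1, t < s → √(W s) - √(W t) ≤ C * (s-t) := by
    intro s hs t ht hts
    by_cases h1 : s ≤ 1 - δ/2
    · have := h.f6a s ⟨hs.1, h1⟩ t ⟨ht.1, by linarith⟩
      rw [abs_of_pos (by linarith : 0 < s - t)] at this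
      exact (le_abs_self _).trans this
    have mon : ∀ a ∈ Icc (1-2*δ) 1, a < s → √(W s) ≤ √(W a) := by
      intro a ha has
      have := h.f4 s ⟨by linarith, hs.2⟩ a ha
      by_contra hcon; push Not at hcon
      have q : 0 < (√(W s) - √(W a)) * (s-a) := mul_pos (by linarith) (by linarith)
      nlinarith [sq_nonneg (s-a)]
    by_cases h2 : 1 - 2*δ ≤ t
    · have := mon t ⟨h2, ht.2⟩ hts
      nlinarith
    · have k1 := mon (1-δ) ⟨by linarith, by linarith⟩ (by linarith)
      have k2 := h.f6a (1-δ) ⟨by linarith, by linarith⟩ t ⟨ht.1, by linarith⟩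
      rw [abs_of_pos (by linarith : 0 < 1 - δ - t)] at k2
      have k3 := (le_abs_self _).trans k2
      have : C * (1-δ-t) ≤ C * (s-t) := by gcongr; linarith
      linarith
  have Vx : ∀ t, Vpot n W t = Phi W t ^ (1+γ) := fun t => by unfold Vpot; rw [hγ]
  have V1x : ∀ t, V1 n W t = √(W t) * (1+γ) * Phi W t ^ γ := fun t => by unfold V1; rw [hγ]; congr 2; ring
  have hdV : ∀ t ∈ Icc (0:ℝ) 1, HasDerivWithinAt (Vpot n W) (V1 n W t) (Icc 0 1) t := by
    intro t ht
    have := (hdP t ht).rpow_const (p := (n:ℝ)/((n:ℝ)-1)) (Or.inr (by rw [hγ]; linarith))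
    exact this
  have hPg1 : ∀ t ∈ Icc (0:ℝ) 1, Phi W t ^ γ ≤ 1 := fun t ht => Real.rpow_le_one (Pn t ht) (Pl t ht) hγ0
  have hPg0 : ∀ t ∈ Icc (0:ℝ) 1, 0 ≤ Phi W t ^ γ := fun t ht => Real.rpow_nonneg (Pn t ht) _
  have hVP : ∀ t ∈ Icc (0:ℝ) 1, Vpot n W t ≤ Phi W t := by
    intro t ht
    rw [Vx]
    rcases eq_or_lt_of_le (Pn t ht) with h0 | h0
    · rw [← h0, Real.zero_rpow (by linarith)]
    · rw [Real.rpow_add h0, Real.rpow_one]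
      nlinarith [hPg1 t ht]
  have V1d : ∀ s ∈ Icc (0:ℝ) 1, ∀ t ∈ Icc (0:ℝ) 1, t < s → V1 n W s - V1 n W t ≤ (2*C+32*C^3+2*C) * (s-t) := by
    intro s hs t ht hts
    have hst : 0 < s - t := by linarith
    have e : V1 n W s - V1 n W t = (1+γ) * (Phi W s^γ * (√(W s) - √(W t)) + √(W t) * (Phi W s^γ - Phi W t^γ)) := by
      rw [V1x, V1x]; ring
    have k1 : Phi W s^γ * (√(W s) - √(W t)) ≤ C * (s-t) := by
      calc _ ≤ Phi W s^γ * (C * (s-t)) := mul_le_mul_of_nonneg_left (pm s hs t ht hts) (hPg0 s hs)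
        _ ≤ 1 * (C * (s-t)) := by gcongr; exact hPg1 s hs
        _ = _ := by ring
    have k2 : √(W t) * (Phi W s^γ - Phi W t^γ) ≤ (16*C^3 + C) * (s-t) := by
      have pt := h.f1c t ht
      have pt0 : 0 ≤ √(W t) := by positivity
      by_cases h2 : s ≤ 2*t
      · have ht0 : 0 < t := by linarith
        have P_pos : 0 < Phi W t := by
          have := Pg t ht
          by_contra hcon; push Not at hcon
          nlinarith [pow_pos ht0 2]
        have r1 := rpow_sub_le P_pos (Pl t ht) (hPm ht hs hts.le) hγ0 hγ1
        have r2 : Phi W s - Phi W t ≤ C * s * (s-t) := by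
          have := mvt_bound_abs (f := Phi W) (f' := fun t => √(W t)) (z := t) (u := s) (C := C * s) (hcP.mono (uIcc_subset_Icc ht hs))
            (fun x hx => hdP' x (uIoo_sub ht hs hx))
            (fun x hx => by
              have hx' := uIoo_sub ht hs hx
              rw [min_eq_left hts.le, max_eq_right hts.le] at hx
              rw [abs_of_nonneg (by positivity)]
              refine (h.f1c x (Ioo_subset_Icc_self hx')).trans ?_
              have := hx.2.le
              gcongr)
          rw [abs_of_pos hst] at this
          exact (le_abs_self _).trans this
        have r3 : Phi W s^γ - Phi W t^γ ≤ (C * (2*t) * (s-t)) * (8*C/t^2) := by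
          refine r1.trans ?_
          rw [div_eq_mul_inv]
          have i1 : (Phi W t)⁻¹ ≤ 8*C/t^2 := by
            rw [inv_le_comm₀ P_pos (by positivity), inv_div, div_le_iff₀ (by positivity)]
            have := Pg t ht
            linarith
          have i2 : Phi W s - Phi W t ≤ C * (2*t) * (s-t) := r2.trans (by gcongr)
          have i3 : 0 ≤ Phi W s - Phi W t := by linarith [hPm ht hs hts.le]
          gcongr
        calc √(W t) * (Phi W s^γ - Phi W t^γ) ≤ √(W t) * ((C * (2*t) * (s-t)) * (8*C/t^2)) := by gcongr
          _ ≤ (C * t) * ((C * (2*t) * (s-t)) * (8*C/t^2)) := by gcongr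
          _ = 16*C^3*(s-t) := by field_simp; ring
          _ ≤ _ := by gcongr; linarith
      · have j1 : Phi W s^γ - Phi W t^γ ≤ 1 := by linarith [hPg1 s hs, hPg0 t ht]
        calc √(W t) * (Phi W s^γ - Phi W t^γ) ≤ √(W t) * 1 := by gcongr
          _ ≤ C * t := by linarith
          _ ≤ C * (s-t) := by gcongr; linarith
          _ ≤ _ := by gcongr; have := pow_pos hC0 3; linarith
    rw [e]
    have : 0 ≤ C * (s-t) + (16*C^3+C)*(s-t) := by positivity
    calc _ ≤ (1+γ) * (C*(s-t) + (16*C^3+C)*(s-t)) := by gcongr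
      _ ≤ 2 * (C*(s-t) + (16*C^3+C)*(s-t)) := by gcongr; linarith
      _ = _ := by ring
  set A := 2*C+32*C^3+2*C with hA
  have hA0 : 0 ≤ A := by positivity
  set C' := 1 + 2 + A + C^3 + C + (32*C/δ^2)*(2*C/δ) with hC'
  have C3 : 0 ≤ C^3 := by positivity
  have C4 : 0 ≤ (32*C/δ^2)*(2*C/δ) := by positivity
  clear_value C' A
  have hC'0 : 0 ≤ C' := by linarith
  refine ⟨C', ⟨by linarith, hdV, hdP, ?_, ?_, ?_, ?_, ?_, ?_, ?_, ?_⟩⟩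
  · intro s hs t ht hst
    rw [Vx, Vx]
    exact Real.rpow_le_rpow (Pn s hs) (hPm hs ht hst) (by linarith)
  · rw [Vx, P0, Real.zero_rpow (by linarith)]
  · rw [Vx, P1, Real.one_rpow]
  · intro t ht
    rw [V1x]
    have := hPg0 t ht
    refine ⟨by positivity, ?_⟩
    calc √(W t) * (1+γ) * Phi W t^γ ≤ √(W t) * (1+γ) * 1 := by gcongr; exact hPg1 t ht
      _ = (1+γ) * √(W t) := by ring
      _ ≤ C' * √(W t) := by gcongr; linarith
  · intro u hu z hz
    refine (mvt_taylor_le (f := Vpot n W) (f' := V1 n W) (C := A) (fun t ht => ?_) hA0 (fun s hs => ?_) (fun s hs => ?_)).trans (by gcongr; linarith)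
    · exact ((hdV t (uIcc_subset_Icc hz hu ht)).continuousWithinAt).mono (uIcc_subset_Icc hz hu)
    · have hs' := uIoo_sub hz hu hs
      exact hasDerivAt_of_Icc (hdV s (Ioo_subset_Icc_self hs')) hs'
    · have hs' := Ioo_subset_Icc_self (uIoo_sub hz hu hs)
      rcases lt_trichotomy s z with hlt | heq | hgt
      · have := V1d z hz s hs' hlt
        nlinarith
      · rw [heq]; simp
      · have := V1d s hs' z hz hgt
        nlinarith
  · intro t ht
    have htI : t ∈ Icc (0:ℝ) 1 := ⟨ht.1, by linarith [ht.2]⟩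
    have k1 := (hVP t htI).trans (Pu t htI)
    have k2 := h.f8 t ht
    have hWn : 0 ≤ W t := by
      rcases eq_or_lt_of_le ht.1 with h0 | h0
      · rw [← h0, h.z0]
      · exact (h.pos t ⟨h0, by linarith [ht.2]⟩).le
    have k3 : t^2 ≤ (C*√(W t))^2 := by have := ht.1; gcongr
    rw [mul_pow, Real.sq_sqrt hWn] at k3
    calc Vpot n W t ≤ C * t^2 := k1
      _ ≤ C * (C^2 * W t) := by gcongr
      _ = C^3 * W t := by ring
      _ ≤ C' * W t := by gcongr; linarith
  · intro t ht
    have htI : t ∈ Icc (0:ℝ) 1 := ⟨by linarith [ht.1], by linarith [ht.2]⟩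
    have k2 := h.f8 t ⟨htI.1, ht.2⟩
    have k3 := Pg t htI
    have k4 : δ^2 ≤ 32*C*Phi W t := by
      have : (δ/2)^2 ≤ t^2 := by have := ht.1; gcongr
      linarith
    have k5 : 1 ≤ (32*C/δ^2) * Phi W t := by
      rw [div_mul_eq_mul_div, le_div_iff₀ (by positivity)]; linarith
    have k6 : 1 ≤ (2*C/δ) * √(W t) := by
      rw [div_mul_eq_mul_div, le_div_iff₀ (by positivity)]; linarith [ht.1]
    have Pt0 : 0 < Phi W t := by
      by_contra hcon; push Not at hcon
      nlinarith [pow_pos hd 2]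
    have k7 : Phi W t ≤ Phi W t^γ := by
      calc Phi W t = Phi W t^(1:ℝ) := (Real.rpow_one _).symm
        _ ≤ _ := Real.rpow_le_rpow_of_exponent_ge Pt0 (Pl t htI) hγ1
    rw [V1x]
    calc (1:ℝ) = 1 * 1 := by ring
      _ ≤ ((32*C/δ^2) * Phi W t) * ((2*C/δ) * √(W t)) := by gcongr
      _ = ((32*C/δ^2)*(2*C/δ)) * (√(W t) * 1 * Phi W t) := by ring
      _ ≤ C' * (√(W t) * (1+γ) * Phi W t^γ) := by gcongr <;> linarith
  · intro t ht
    exact ((hVP t ht).trans (Pu t ht)).trans (by gcongr; linarith)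


lemma contOn_comp {f Z : ℝ → ℝ} (hf : ContinuousOn f (Icc 0 1)) (hZ : Continuous Z) (hm : ∀ r, Z r ∈ Icc (0:ℝ) 1) :
    Continuous (fun r => f (Z r)) :=
  hf.comp_continuous hZ hm

lemma vpot_contOn {n : ℕ} (hn : 2 ≤ n) {W : ℝ → ℝ} (hc : ContinuousOn W (Icc 0 1)) : ContinuousOn (Vpot n W) (Icc 0 1) := by
  have hn1 : (1:ℝ) ≤ (n:ℝ) - 1 := by
    have : (2:ℝ) ≤ n := by exact_mod_cast hn
    linarith
  have : ContinuousOn (Phi W) (Icc 0 1) := fun t ht => (phi_deriv hc ht).continuousWithinAt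
  exact this.rpow_const (fun t ht => Or.inr (by positivity))

lemma mu_const_zero (n : ℕ) (hn : 2 ≤ n) (c : ℝ) : ∫ _r, c ∂mu n = 0 := by
  have h := mu_scale n hn (fun _ => c) (b := 2) (by norm_num)
  have h2 : (1:ℝ) < 2^n := one_lt_pow₀ (by norm_num) (by omega)
  have h3 : ((2:ℝ)^n)⁻¹ < 1 := inv_lt_one_of_one_lt₀ h2
  have : (1 - ((2:ℝ)^n)⁻¹) * ∫ _r, c ∂mu n = 0 := by linarith
  rcases mul_eq_zero.1 this with h | h
  · linarith
  · exact h

lemma energy_nonpos_false {n : ℕ} (hn : 2 ≤ n) {W : ℝ → ℝ} (hW : DoubleWell W) {ε : ℝ} (hε : 0 < ε) {ζ : ℝ → ℝ}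
    (hm : Minz n W ε ζ) (he : EE n W ε ζ ≤ 0) : False := by
  have hc := cn_pos n hn
  have hP : 0 ≤ PP n W ζ := mul_nonneg hc.le (integral_nonneg fun r => hW.nonneg (hm.adm.mem r))
  have hD : DD n ζ ≤ 0 := by
    unfold EE at he
    have : 0 ≤ ε⁻¹ * PP n W ζ := by positivity
    by_contra hcon; push Not at hcon
    nlinarith [mul_pos hε hcon]
  unfold DD at hD
  have hI : ∫ r, deriv ζ r ^ 2 ∂mu n = 0 := by
    apply le_antisymm
    · by_contra hcon; push Not at hcon
      nlinarith [mul_pos hc hcon]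
    · exact integral_nonneg fun r => sq_nonneg _
  rw [integral_eq_zero_iff_of_nonneg (fun r => sq_nonneg _) hm.adm.dsq] at hI
  have hI2 : ∀ᵐ r : ℝ, 0 < r → deriv ζ r = 0 := by
    have h1 : Integrable (fun r => deriv ζ r ^ 2) (mu n) := hm.adm.dsq
    have h2 : ∫ r, deriv ζ r^2 ∂mu n = 0 := by rw [integral_congr_ae hI]; simp
    rw [mu_integrable] at h1
    rw [mu_integral, setIntegral_eq_zero_iff_of_nonneg_ae] at h2
    · rw [Filter.EventuallyEq, ae_restrict_iff' measurableSet_Ioi] at h2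
      filter_upwards [h2] with r hr h0
      have := hr h0
      simp only [Pi.zero_apply, mul_eq_zero] at this
      rcases this with h | h
      · exact absurd h (pow_pos h0 _).ne'
      · exact pow_eq_zero_iff (two_ne_zero) |>.1 h
    · filter_upwards [ae_restrict_mem measurableSet_Ioi] with r hr
      have : (0:ℝ) < r := hr
      simp only [Pi.zero_apply]; positivity
    · exact h1
  have hconst : ∀ r, 0 < r → ζ r = ζ 1 := by
    intro r hr
    have hz : ∀ᵐ x : ℝ, x ∈ uIoc 1 r → deriv ζ x = 0 := by
      filter_upwards [hI2] with x hx hxm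
      apply hx
      exact lt_of_le_of_lt (le_min zero_le_one hr.le) hxm.1
    have hz' : ∀ᵐ x ∂volume.restrict (uIoc 1 r), deriv ζ x = 0 := by
      rwa [ae_restrict_iff' measurableSet_uIoc]
    have hi : IntervalIntegrable (deriv ζ) volume 1 r := by
      have : IntervalIntegrable (fun _ : ℝ => (0:ℝ)) volume 1 r := by simp
      refine this.congr_ae ?_
      filter_upwards [hz'] with x hx using hx.symm
    have h1 := intervalIntegral.integral_eq_sub_of_hasDerivAt (fun x _ => (hm.adm.diff x).hasDerivAt) hi
    rw [intervalIntegral.integral_congr_ae (g := fun _ => 0) hz] at h1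
    simp at h1; linarith
  have hM := hm.mass
  unfold MM at hM
  have : ∫ r, Vpot n W (ζ r) ∂mu n = ∫ _r, Vpot n W (ζ 1) ∂mu n := by
    apply integral_congr_ae
    filter_upwards [mu_ae_pos n] with r hr
    rw [hconst r hr]
  rw [this, mu_const_zero n hn] at hM
  simp at hM

/-- slowly decaying profile -/
def qq (r : ℝ) : ℝ := √(1 + r^2)

lemma qq_sq (r : ℝ) : qq r ^2 = 1 + r^2 := Real.sq_sqrt (by positivity)
lemma qq_ge (r : ℝ) : 1 ≤ qq r := by
  unfold qq; rw [Real.one_le_sqrt]; nlinarith [sq_nonneg r]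
lemma qq_ge' (r : ℝ) : |r| ≤ qq r := by
  unfold qq; apply Real.abs_le_sqrt; linarith
lemma qq_deriv (r : ℝ) : HasDerivAt qq (r / qq r) r := by
  have h : HasDerivAt (fun r : ℝ => 1 + r^2) (2*r) r := by simpa using (hasDerivAt_pow 2 r).const_add 1
  have := h.sqrt (by positivity)
  refine this.congr_deriv ?_
  unfold qq; field_simp

def Zs (n : ℕ) (τ r : ℝ) : ℝ := τ * (qq r ^ n)⁻¹

lemma Zs_deriv (n : ℕ) (τ r : ℝ) : HasDerivAt (Zs n τ) (τ * (-(n * qq r^(n-1) * (r/qq r)) / (qq r^n)^2)) r := by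
  have := (((qq_deriv r).fun_pow n).fun_inv (pow_pos (by linarith [qq_ge r]) n).ne').const_mul τ
  exact this

lemma Zs_deriv_bd (n : ℕ) {τ : ℝ} (hτ : 0 ≤ τ) (r : ℝ) : |deriv (Zs n τ) r| ≤ n * Zs n τ r := by
  rw [(Zs_deriv n τ r).deriv]
  have hq := qq_ge r
  have hq0 : 0 < qq r := by linarith
  have h1 : |r / qq r| ≤ 1 := by
    rw [abs_div, abs_of_pos hq0, div_le_one hq0]; exact qq_ge' r
  rw [abs_mul, abs_of_nonneg hτ, abs_div, abs_neg, abs_mul, abs_mul, abs_of_nonneg (Nat.cast_nonneg n), abs_of_pos (pow_pos hq0 _),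
    abs_of_pos (pow_pos (pow_pos hq0 n) 2)]
  unfold Zs
  have h2 : qq r^(n-1) ≤ qq r^n := pow_le_pow_right₀ hq (by omega)
  calc τ * (n * qq r^(n-1) * |r/qq r| / (qq r^n)^2) ≤ τ * (n * qq r^n * 1 / (qq r^n)^2) := by gcongr
    _ = _ := by have := pow_pos hq0 n; field_simp

lemma Zs_sq_int (n : ℕ) (hn : 2 ≤ n) (τ : ℝ) : Integrable (fun r => Zs n τ r^2) (mu n) := by
  rw [mu_integrable]
  have h0 : Integrable (fun r : ℝ => τ^2 * (1+r^2)⁻¹) := (integrable_inv_one_add_sq).const_mul _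
  refine (h0.integrableOn (s := Ioi 0)).mono' ?_ ?_
  · have : Continuous (Zs n τ) := continuous_iff_continuousAt.2 fun r => (Zs_deriv n τ r).continuousAt
    exact Continuous.aestronglyMeasurable (by fun_prop)
  · filter_upwards [ae_restrict_mem measurableSet_Ioi] with r hr
    have hr0 : (0:ℝ) < r := hr
    have hq := qq_ge r
    have hq0 : 0 < qq r := by linarith
    have hrq : r ≤ qq r := (le_abs_self r).trans (qq_ge' r)
    rw [Real.norm_of_nonneg (by positivity), ← qq_sq]
    unfold Zs
    have h1 : r^(n-1) ≤ qq r^(n-1) := by gcongr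
    have h2 : qq r^(n-1) * qq r^2 ≤ (qq r^n)^2 := by
      rw [← pow_add, ← pow_mul]; exact pow_le_pow_right₀ hq (by omega)
    have h3 : qq r^(n-1) * ((qq r^n)^2)⁻¹ ≤ (qq r^2)⁻¹ := by
      rw [← div_eq_mul_inv, div_le_iff₀ (by positivity), inv_mul_eq_div, le_div_iff₀ (by positivity)]; exact h2
    calc r^(n-1) * (τ * (qq r^n)⁻¹)^2 ≤ qq r^(n-1) * (τ * (qq r^n)⁻¹)^2 := by gcongr
      _ = τ^2 * (qq r^(n-1) * ((qq r^n)^2)⁻¹) := by rw [mul_pow, inv_pow]; ring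
      _ ≤ _ := by gcongr

lemma Zs_adm (n : ℕ) (hn : 2 ≤ n) {τ : ℝ} (hτ : 0 ≤ τ) (hτ1 : τ ≤ 1) : Adm n (Zs n τ) := by
  refine ⟨fun r => (Zs_deriv n τ r).differentiableAt, ?_, ?_, Zs_sq_int n hn τ, ?_⟩
  · rw [(Zs_deriv n τ 0).deriv]; simp
  · intro r
    have hq := one_le_pow₀ (qq_ge r) (n := n)
    unfold Zs
    refine ⟨by positivity, ?_⟩
    have : (qq r^n)⁻¹ ≤ 1 := inv_le_one_of_one_le₀ hq
    have h0 : 0 ≤ (qq r^n)⁻¹ := by positivity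
    nlinarith
  · refine ((Zs_sq_int n hn τ).const_mul (n^2:ℝ)).mono' (Measurable.aestronglyMeasurable ((measurable_deriv _).pow_const 2)) ?_
    filter_upwards with r
    rw [Real.norm_of_nonneg (sq_nonneg _), ← sq_abs, ← mul_pow]
    have := Zs_deriv_bd n hτ r
    gcongr

lemma Zs_DD (n : ℕ) (τ : ℝ) : DD n (Zs n τ) = τ^2 * DD n (Zs n 1) := by
  unfold DD
  have : ∀ r, deriv (Zs n τ) r^2 = τ^2 * deriv (Zs n 1) r^2 := by
    intro r; rw [(Zs_deriv n τ r).deriv, (Zs_deriv n 1 r).deriv]; ring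
  simp_rw [this]
  rw [integral_const_mul]; ring

lemma Zs_W_zero {n : ℕ} (hn : 2 ≤ n) {W : ℝ → ℝ} (hc : ContinuousOn W (Icc 0 1)) {c d : ℝ} (hc0 : 0 < c) (hd1 : d ≤ 1)
    (hb : ∀ t ∈ Icc 0 d, c * t ≤ W t) {τ : ℝ} (hτ : 0 < τ) (hτd : τ ≤ d) : PP n W (Zs n τ) = 0 := by
  unfold PP
  rw [integral_undef, mul_zero]
  intro hintg
  rw [mu_integrable] at hintg
  have h1 := hintg.mono_set (Ioi_subset_Ioi (zero_le_one (α := ℝ)))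
  have hZ := Zs_adm n hn hτ.le (hτd.trans hd1)
  apply not_integrableOn_Ioi_inv (a := (1:ℝ))
  have h2 : IntegrableOn (fun r : ℝ => (2^n/(c*τ)) * (r^(n-1) * W (Zs n τ r))) (Ioi 1) := h1.const_mul _
  refine h2.mono' (by fun_prop) ?_
  filter_upwards [ae_restrict_mem measurableSet_Ioi] with r hr
  have hr1 : (1:ℝ) < r := hr
  have hr0 : 0 < r := by linarith
  rw [Real.norm_of_nonneg (by positivity)]
  have hq := qq_ge r
  have hq0 : 0 < qq r := by linarith
  have hq2 : qq r ≤ 2*r := by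
    unfold qq; apply Real.sqrt_le_iff.2 ⟨by linarith, ?_⟩; nlinarith
  have hZd : Zs n τ r ∈ Icc 0 d := by
    refine ⟨(hZ.mem r).1, le_trans ?_ hτd⟩
    unfold Zs
    have : (qq r^n)⁻¹ ≤ 1 := inv_le_one_of_one_le₀ (one_le_pow₀ hq)
    nlinarith
  have h3 := hb _ hZd
  have h4 : τ * ((2*r)^n)⁻¹ ≤ Zs n τ r := by unfold Zs; gcongr
  calc r⁻¹ = (2^n/(c*τ)) * (r^(n-1) * (c * (τ * ((2*r)^n)⁻¹))) := by
        rw [mul_pow]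
        obtain ⟨k, rfl⟩ : ∃ k, n = k+1 := ⟨n-1, by omega⟩
        simp only [Nat.add_sub_cancel]
        field_simp
        ring
    _ ≤ _ := by gcongr; exact le_trans (by gcongr) h3


lemma phi_nonneg {W : ℝ → ℝ} {t : ℝ} (ht : 0 ≤ t) : 0 ≤ Phi W t :=
  intervalIntegral.integral_nonneg ht fun _ _ => Real.sqrt_nonneg _

lemma phi_le_one {W : ℝ → ℝ} (hc : ContinuousOn W (Icc 0 1)) (hno : ∫ t in (0:ℝ)..1, Real.sqrt (W t) = 1) {t : ℝ}
    (ht : t ∈ Icc (0:ℝ) 1) : Phi W t ≤ 1 := by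
  have h := mvt_bound_ge (f := Phi W) (f' := fun s => √(W s)) (z := t) (u := 1) (C := 0)
    (fun s hs => ((phi_deriv hc (uIcc_subset_Icc ht (by simp) hs)).continuousWithinAt).mono (uIcc_subset_Icc ht (by simp)))
    (fun s hs => by
      have hs' := uIoo_sub ht (by simp : (1:ℝ) ∈ Icc (0:ℝ) 1) hs
      exact hasDerivAt_of_Icc (phi_deriv hc (Ioo_subset_Icc_self hs')) hs')
    (fun s _ => Real.sqrt_nonneg _)
  have h1 : Phi W 1 = 1 := hno
  rcases eq_or_lt_of_le ht.2 with h' | h'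
  · rw [h', h1]
  · rw [h1] at h; by_contra hcon; push Not at hcon
    nlinarith

lemma vpot_le_phi {n : ℕ} (hn : 2 ≤ n) {W : ℝ → ℝ} {t : ℝ} (h0 : 0 ≤ Phi W t) (h1 : Phi W t ≤ 1) :
    Vpot n W t ≤ Phi W t := by
  have hn2 : (2:ℝ) ≤ n := by exact_mod_cast hn
  unfold Vpot
  have h3 : (1:ℝ) ≤ (n:ℝ)/((n:ℝ)-1) := by rw [le_div_iff₀ (by linarith)]; linarith
  rcases eq_or_lt_of_le h0 with h | h
  · rw [← h, Real.zero_rpow (by linarith)]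
  · calc _ ≤ Phi W t ^ (1:ℝ) := Real.rpow_le_rpow_of_exponent_ge h h1 h3
      _ = _ := Real.rpow_one _

lemma Zs_V_int {n : ℕ} (hn : 2 ≤ n) {W : ℝ → ℝ} (hc : ContinuousOn W (Icc 0 1)) {B : ℝ} (hB : 0 ≤ B)
    (hWB : ∀ t ∈ Icc (0:ℝ) 1, W t ≤ B * t) (hno : ∫ t in (0:ℝ)..1, Real.sqrt (W t) = 1) {τ : ℝ} (hτ : 0 ≤ τ) (hτ1 : τ ≤ 1) :
    Integrable (fun r => Vpot n W (Zs n τ r)) (mu n) := by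
  have hphi : ∀ t ∈ Icc (0:ℝ) 1, Phi W t ≤ √B * (t * √t) := by
    intro t ht
    have h := mvt_bound (f := Phi W) (f' := fun s => √(W s)) (z := 0) (u := t) (C := √B * √t)
      (fun s hs => ((phi_deriv hc (uIcc_subset_Icc (by simp) ht hs)).continuousWithinAt).mono (uIcc_subset_Icc (by simp) ht))
      (fun s hs => by
        have hs' := uIoo_sub (by simp : (0:ℝ) ∈ Icc (0:ℝ) 1) ht hs
        exact hasDerivAt_of_Icc (phi_deriv hc (Ioo_subset_Icc_self hs')) hs')
      (fun s hs => by
        have hs' := uIoo_sub (by simp : (0:ℝ) ∈ Icc (0:ℝ) 1) ht hs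
        rw [← Real.sqrt_mul hB]
        apply Real.sqrt_le_sqrt
        have : s ≤ t := by rw [max_eq_right ht.1] at hs; exact hs.2.le
        calc W s ≤ B * s := hWB s (Ioo_subset_Icc_self hs')
          _ ≤ _ := by gcongr)
    have h0 : Phi W 0 = 0 := by simp [Phi]
    rw [h0, sub_zero, sub_zero] at h
    rcases eq_or_lt_of_le ht.1 with h' | h'
    · rw [← h', h0]; simp
    · by_contra hcon; push Not at hcon
      nlinarith
  have hZ := Zs_adm n hn hτ hτ1
  rw [mu_integrable]
  have h0 : Integrable (fun r : ℝ => √B * (1+r^2)⁻¹) := (integrable_inv_one_add_sq).const_mul _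
  have hcont : Continuous fun r => Vpot n W (Zs n τ r) := contOn_comp (vpot_contOn hn hc) hZ.diff.continuous hZ.mem
  refine (h0.integrableOn (s := Ioi 0)).mono' (Continuous.aestronglyMeasurable (by fun_prop)) ?_
  filter_upwards [ae_restrict_mem measurableSet_Ioi] with r hr
  have hr0 : (0:ℝ) < r := hr
  have hq := qq_ge r
  have hq0 : 0 < qq r := by linarith
  have hrq : r ≤ qq r := (le_abs_self r).trans (qq_ge' r)
  set z := Zs n τ r with hz
  have hzm := hZ.mem r
  have hP0 := phi_nonneg (W := W) hzm.1
  have hV0 : 0 ≤ Vpot n W z := Real.rpow_nonneg hP0 _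
  rw [Real.norm_of_nonneg (by positivity), ← qq_sq]
  have hzq : z ≤ (qq r^n)⁻¹ := by
    rw [hz]; unfold Zs
    have : 0 ≤ (qq r^n)⁻¹ := by positivity
    nlinarith
  have hsq : √z ≤ (qq r)⁻¹ := by
    apply Real.sqrt_le_iff.2 ⟨by positivity, ?_⟩
    refine hzq.trans ?_
    rw [← inv_pow]
    exact pow_le_pow_of_le_one (by positivity) (inv_le_one_of_one_le₀ hq) hn
  calc r^(n-1) * Vpot n W z ≤ qq r^(n-1) * (√B * ((qq r^n)⁻¹ * (qq r)⁻¹)) := by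
        gcongr
        calc Vpot n W z ≤ Phi W z := vpot_le_phi hn hP0 (phi_le_one hc hno hzm)
          _ ≤ _ := hphi z hzm
          _ ≤ _ := by gcongr
    _ = √B * (qq r^2)⁻¹ := by
      obtain ⟨k, rfl⟩ : ∃ k, n = k+1 := ⟨n-1, by omega⟩
      simp only [Nat.add_sub_cancel]; field_simp; ring

lemma mu_Ioo (n : ℕ) (hn : 2 ≤ n) (f : ℝ → ℝ) (hf : Integrable f (mu n)) (h0 : ∀ r, 0 ≤ f r) {v : ℝ}
    (hv : ∀ r ∈ Ioo (0:ℝ) 1, v ≤ f r) : v / n ≤ ∫ r, f r ∂mu n := by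
  rw [mu_integral]
  rw [mu_integrable] at hf
  have h1 : ∫ r in Ioc (0:ℝ) 1, r^(n-1) * v = v / n := by
    rw [← intervalIntegral.integral_of_le zero_le_one]
    simp only [intervalIntegral.integral_mul_const, integral_pow]
    rw [Nat.sub_add_cancel (by omega), one_pow, zero_pow (by omega)]
    rw [Nat.cast_sub (by omega)]; push_cast
    ring
  rw [← h1]
  have hs : Ioc (0:ℝ) 1 ⊆ Ioi 0 := fun x hx => hx.1
  calc ∫ r in Ioc (0:ℝ) 1, r^(n-1) * v ≤ ∫ r in Ioc (0:ℝ) 1, r^(n-1) * f r := by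
        rw [integral_Ioc_eq_integral_Ioo, integral_Ioc_eq_integral_Ioo]
        apply setIntegral_mono_on
        · apply IntegrableOn.mono_set _ Ioo_subset_Icc_self
          exact ContinuousOn.integrableOn_Icc (by fun_prop)
        · exact hf.mono_set (fun x hx => hx.1)
        · exact measurableSet_Ioo
        · intro r hr
          have := hv r hr
          have := hr.1
          gcongr
    _ ≤ _ := by
      apply setIntegral_mono_set hf
      · filter_upwards [ae_restrict_mem measurableSet_Ioi] with r hr
        have : (0:ℝ) < r := hr
        have := h0 r
        simp only [Pi.zero_apply]; positivity
      · exact Eventually.of_forall hs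

set_option maxHeartbeats 1000000 in
lemma vacuous {n : ℕ} (hn : 2 ≤ n) {W W1 W2 : ℝ → ℝ} {L : ℝ} (hW : DoubleWell W) (h : Well2 W W1 W2 L) (hw : 0 < W1 0)
    {ε : ℝ} (hε : 0 < ε) {ζ : ℝ → ℝ} (hm : Minz n W ε ζ) : False := by
  apply energy_nonpos_false hn hW hε hm
  obtain ⟨d, c, _, hd0, hd8, hc0, -, -, -, hsq, -, -, -, hlin⟩ := h.endL
  have hn2 : (2:ℝ) ≤ n := by exact_mod_cast hn
  have hcn := cn_pos n hn
  obtain ⟨B, hB0, hB⟩ := h.W2_bd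
  have hWB : ∀ t ∈ Icc (0:ℝ) 1, W t ≤ (W1 0 + B) * t := by
    intro t ht
    have := (abs_le.1 (h.W_taylor hB0.le hB ht (by simp : (0:ℝ) ∈ Icc (0:ℝ) 1))).2
    rw [h.z0] at this
    nlinarith [ht.1, ht.2, mul_nonneg ht.1 (sub_nonneg.2 ht.2)]
  have hphi : ∀ t ∈ Icc (0:ℝ) d, c/4 * t^2 ≤ Phi W t := by
    intro t ht
    have ht1 : t ∈ Icc (0:ℝ) 1 := ⟨ht.1, by linarith [ht.2]⟩
    have ht2 : t/2 ∈ Icc (0:ℝ) 1 := ⟨by linarith [ht.1], by linarith [ht1.2]⟩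
    have h := mvt_bound_ge (f := Phi W) (f' := fun s => √(W s)) (z := t/2) (u := t) (C := c * (t/2))
      (fun s hs => ((phi_deriv h.contW (uIcc_subset_Icc ht2 ht1 hs)).continuousWithinAt).mono (uIcc_subset_Icc ht2 ht1))
      (fun s hs => by
        have hs' := uIoo_sub ht2 ht1 hs
        exact hasDerivAt_of_Icc (phi_deriv h.contW (Ioo_subset_Icc_self hs')) hs')
      (fun s hs => by
        rw [min_eq_left (by linarith [ht.1]), max_eq_right (by linarith [ht.1])] at hs
        have := hsq s ⟨by linarith [hs.1, ht.1], by linarith [hs.2, ht.2]⟩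
        refine le_trans ?_ this
        have := hs.1
        gcongr)
    have h0 := phi_nonneg (W := W) ht2.1
    rcases eq_or_lt_of_le ht.1 with h' | h'
    · rw [← h']; simpa using phi_nonneg (W := W) le_rfl
    · have : c*(t/2) * (t - t/2) ≤ Phi W t - Phi W (t/2) := by
        have h5 : 0 < t - t/2 := by linarith
        by_contra hcon; push Not at hcon
        nlinarith
      nlinarith
  set α : ℝ := (n:ℝ)/((n:ℝ)-1) with hα
  have hα0 : 0 < α := by rw [hα]; apply div_pos <;> linarith
  set κ : ℝ := ((2:ℝ)^n)⁻¹ with hκ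
  have hκ0 : 0 < κ := by positivity
  set b := c/4*κ^2 with hb
  have hb0 : 0 < b := by positivity
  set a := cn n / n with ha
  have ha0 : 0 < a := by positivity
  have key : ∀ τ ∈ Ioc (0:ℝ) d, EE n W ε ζ ≤ ε * DD n (Zs n 1) * (a * b^α)^((2:ℝ)/n - 1) * (τ^2)^((1:ℝ)/(n-1)) := by
    intro τ hτ
    have hτ1 : τ ≤ 1 := by linarith [hτ.2]
    have hZ := Zs_adm n hn hτ.1.le hτ1
    have hP := Zs_W_zero hn h.contW hc0 (by linarith) (fun t ht => (hlin hw t ht).2) hτ.1 hτ.2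
    have hVi := Zs_V_int hn h.contW (by positivity) hWB hW.normalized hτ.1.le hτ1
    have hM : a * (b * τ^2)^α ≤ MM n W (Zs n τ) := by
      unfold MM
      have := mu_Ioo n hn _ hVi (fun r => Real.rpow_nonneg (phi_nonneg (hZ.mem r).1) _) (v := (b*τ^2)^α) (by
        intro r hr
        unfold Vpot
        apply Real.rpow_le_rpow (by positivity) _ hα0.le
        have hq2 : qq r ≤ 2 := by
          unfold qq; apply Real.sqrt_le_iff.2 ⟨by norm_num, ?_⟩; nlinarith [hr.1, hr.2]
        have hq := qq_ge r
        have hz1 : τ * κ ≤ Zs n τ r := by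
          unfold Zs; rw [hκ]; have := hτ.1; gcongr
        have hz2 : Zs n τ r ≤ τ := by
          unfold Zs
          have : (qq r^n)⁻¹ ≤ 1 := inv_le_one_of_one_le₀ (one_le_pow₀ hq)
          nlinarith [hτ.1]
        calc b * τ^2 = c/4 * (τ*κ)^2 := by rw [hb]; ring
          _ ≤ c/4 * (Zs n τ r)^2 := by have := hτ.1; gcongr
          _ ≤ _ := hphi _ ⟨(hZ.mem r).1, hz2.trans hτ.2⟩)
      calc a * (b*τ^2)^α = cn n * ((b*τ^2)^α / n) := by rw [ha]; ring
        _ ≤ _ := by gcongr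
    have hτ0 := hτ.1
    have hlow : 0 < a * (b * τ^2)^α := by positivity
    have hMpos := hlow.trans_le hM
    have hdil := hm.dil hn hZ hMpos
    rw [hP, mul_zero, add_zero, Zs_DD] at hdil
    set m := MM n W (Zs n τ) with hmdef
    have hD1 : 0 ≤ DD n (Zs n 1) := mul_nonneg hcn.le (integral_nonneg fun r => sq_nonneg _)
    have e1 : EE n W ε ζ ≤ ε * m^((2:ℝ)/n-1) * (τ^2 * DD n (Zs n 1)) := by
      rw [Real.rpow_sub_one hMpos.ne']
      rw [← le_div_iff₀ hMpos] at hdil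
      refine hdil.trans (le_of_eq ?_)
      ring
    have hexp : (2:ℝ)/n - 1 ≤ 0 := by
      rw [sub_nonpos, div_le_one (by linarith)]; exact hn2
    have e2 : m^((2:ℝ)/n-1) ≤ (a * (b * τ^2)^α)^((2:ℝ)/n-1) := Real.rpow_le_rpow_of_nonpos hlow hM hexp
    have e3 : (a * (b * τ^2)^α)^((2:ℝ)/n-1) * τ^2 = (a * b^α)^((2:ℝ)/n - 1) * (τ^2)^((1:ℝ)/(n-1)) := by
      rw [Real.mul_rpow hb0.le (by positivity), ← mul_assoc, Real.mul_rpow (by positivity) (by positivity), mul_assoc,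
        ← Real.rpow_mul (by positivity)]
      congr 1
      rw [← Real.rpow_add_one (by positivity)]
      congr 1
      rw [hα]
      have : (n:ℝ) - 1 ≠ 0 := by linarith
      have : (n:ℝ) ≠ 0 := by linarith
      field_simp
      ring
    calc EE n W ε ζ ≤ ε * m^((2:ℝ)/n-1) * (τ^2 * DD n (Zs n 1)) := e1
      _ ≤ ε * (a * (b * τ^2)^α)^((2:ℝ)/n-1) * (τ^2 * DD n (Zs n 1)) := by gcongr
      _ = ε * DD n (Zs n 1) * ((a * (b * τ^2)^α)^((2:ℝ)/n-1) * τ^2) := by ring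
      _ = _ := by rw [e3]; ring
  have hg : 0 < (1:ℝ)/(n-1) := by apply div_pos <;> linarith
  have hlim : Tendsto (fun τ : ℝ => ε * DD n (Zs n 1) * (a * b^α)^((2:ℝ)/n - 1) * (τ^2)^((1:ℝ)/(n-1))) (nhdsWithin 0 (Ioi 0)) (nhds 0) := by
    have hc : Continuous (fun τ : ℝ => ε * DD n (Zs n 1) * (a * b^α)^((2:ℝ)/n - 1) * (τ^2)^((1:ℝ)/(n-1))) := by
      apply Continuous.mul continuous_const
      exact (continuous_id.pow 2).rpow_const (fun x => Or.inr hg.le)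
    have := hc.tendsto 0
    simp only [ne_eq, OfNat.ofNat_ne_zero, not_false_eq_true, zero_pow, Real.zero_rpow hg.ne', mul_zero] at this
    exact this.mono_left nhdsWithin_le_nhds
  refine ge_of_tendsto hlim ?_
  filter_upwards [Ioc_mem_nhdsGT hd0] with τ hτ
  exact key τ hτ


lemma mu_supp (n : ℕ) {f : ℝ → ℝ} (hf : AEStronglyMeasurable f (volume : Measure ℝ)) {a b v : ℝ} (ha : 0 ≤ a) (hab : a ≤ b) (hv : 0 ≤ v)
    (h1 : ∀ r ∈ Icc a b, |f r| ≤ v) (h2 : ∀ r, 0 < r → r ∉ Icc a b → f r = 0) :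
    Integrable f (mu n) ∧ ∫ r, f r ∂mu n ≤ v * b^(n-1) * (b - a) := by
  have hb : 0 ≤ b := ha.trans hab
  set g : ℝ → ℝ := (Icc a b).indicator (fun _ => b^(n-1) * v) with hg
  have hgi : Integrable g := by
    rw [hg, integrable_indicator_iff measurableSet_Icc]
    exact integrableOn_const (by simp)
  have hle : ∀ r ∈ Ioi (0:ℝ), ‖r^(n-1) * f r‖ ≤ g r := by
    intro r hr
    have hr0 : (0:ℝ) < r := hr
    by_cases h : r ∈ Icc a b
    · rw [hg, indicator_of_mem h, norm_mul, Real.norm_of_nonneg (by positivity), Real.norm_eq_abs]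
      have := h1 r h
      have := h.2
      gcongr
    · rw [h2 r hr h, hg, indicator_of_notMem h]; simp
  have hi : Integrable f (mu n) := by
    rw [mu_integrable]
    refine (hgi.integrableOn (s := Ioi 0)).mono' ?_ ?_
    · exact ((Continuous.aestronglyMeasurable (by fun_prop)).mul hf).restrict
    · filter_upwards [ae_restrict_mem measurableSet_Ioi] with r hr using hle r hr
  refine ⟨hi, ?_⟩
  rw [mu_integral]
  calc ∫ r in Ioi (0:ℝ), r^(n-1) * f r ≤ ∫ r in Ioi (0:ℝ), g r := by
        apply setIntegral_mono_on ((mu_integrable n f).1 hi) hgi.integrableOn measurableSet_Ioi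
        intro r hr
        exact (le_abs_self _).trans (hle r hr)
    _ ≤ ∫ r, g r := by
        apply setIntegral_le_integral hgi
        filter_upwards with r
        rw [hg]; apply indicator_nonneg; intro _ _; positivity
    _ = _ := by
        rw [hg, integral_indicator measurableSet_Icc]; simp [Measure.real, hab]; ring

/-- smooth step, 1 for `s ≤ 0`, 0 for `s ≥ 1` -/
def SS (s : ℝ) : ℝ := 1 - Real.smoothTransition s

lemma SS_contDiff : ContDiff ℝ 2 SS := contDiff_const.sub Real.smoothTransition.contDiff
lemma SS_diff : Differentiable ℝ SS := SS_contDiff.differentiable (by norm_num)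
lemma SS_left {s : ℝ} (h : s ≤ 0) : SS s = 1 := by simp [SS, Real.smoothTransition.zero_of_nonpos h]
lemma SS_right {s : ℝ} (h : 1 ≤ s) : SS s = 0 := by simp [SS, Real.smoothTransition.one_of_one_le h]
lemma SS_mem (s : ℝ) : SS s ∈ Icc (0:ℝ) 1 := by
  have := Real.smoothTransition.nonneg s
  have := Real.smoothTransition.le_one s
  constructor <;> unfold SS <;> linarith
lemma SS_dleft {s : ℝ} (h : s < 0) : deriv SS s = 0 := by
  have : SS =ᶠ[nhds s] fun _ => 1 := by
    filter_upwards [Iio_mem_nhds h] with x hx using SS_left (le_of_lt hx)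
  rw [this.deriv_eq]; simp
lemma SS_dright {s : ℝ} (h : 1 < s) : deriv SS s = 0 := by
  have : SS =ᶠ[nhds s] fun _ => 0 := by
    filter_upwards [Ioi_mem_nhds h] with x hx using SS_right (le_of_lt hx)
  rw [this.deriv_eq]; simp
lemma SS_dcont : Continuous (deriv SS) := SS_contDiff.continuous_deriv (by norm_num)
lemma SS_dbd : ∃ B, 0 < B ∧ ∀ s, |deriv SS s| ≤ B := by
  obtain ⟨B, hB⟩ := isCompact_Icc.exists_bound_of_continuousOn (SS_dcont.continuousOn (s := Icc (0:ℝ) 1))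
  refine ⟨max B 1, by positivity, fun s => ?_⟩
  by_cases h : s < 0
  · rw [SS_dleft h]; simp
  by_cases h' : 1 < s
  · rw [SS_dright h']; simp
  · exact (hB s ⟨not_lt.1 h, not_lt.1 h'⟩).trans (le_max_left _ _)

lemma Minz.Vint {n : ℕ} {W : ℝ → ℝ} {ε : ℝ} {ζ : ℝ → ℝ} (hm : Minz n W ε ζ) : Integrable (fun r => Vpot n W (ζ r)) (mu n) := by
  by_contra h
  have := hm.mass
  unfold MM at this
  rw [integral_undef h] at this
  simp at this

set_option maxHeartbeats 1000000 in
lemma crude {n : ℕ} (hn : 2 ≤ n) {W W1 : ℝ → ℝ} {δ Cp Cv : ℝ} (hp : PF W W1 δ Cp) (hv : VF n W W1 δ Cv) :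
    ∃ E0, 1 ≤ E0 ∧ ∀ ε, 0 < ε → ε ≤ 1 → ∀ ζ, Minz n W ε ζ → EE n W ε ζ ≤ E0 := by
  obtain ⟨B, hB0, hB⟩ := SS_dbd
  have hcn := cn_pos n hn
  have hn2 : (2:ℝ) ≤ n := by exact_mod_cast hn
  have hCp := hp.Cge
  set a := cn n / n with ha
  have ha0 : 0 < a := by positivity
  set E := a^((2:ℝ)/n-1) * (cn n * (B^2 * 2^(n-1))) + a⁻¹ * (cn n * (Cp * 2^(n-1))) with hE
  refine ⟨max E 1, le_max_right _ _, ?_⟩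
  intro ε hε hε1 ζ hm
  refine le_trans ?_ (le_max_left _ _)
  set Z : ℝ → ℝ := fun r => SS ((r-1)/ε) with hZd
  have hd : ∀ r, HasDerivAt Z (deriv SS ((r-1)/ε) * (1/ε)) r := by
    intro r
    have h1 : HasDerivAt (fun r : ℝ => (r-1)/ε) (1/ε) r := ((hasDerivAt_id r).sub_const 1).div_const ε
    exact (SS_diff _).hasDerivAt.comp r h1
  have hZc : Continuous Z := by
    exact continuous_iff_continuousAt.2 fun r => (hd r).continuousAt
  have hzero : ∀ r, r ∉ Icc (0:ℝ) 2 → 0 < r → Z r = 0 := by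
    intro r hr h0
    have : 2 < r := by by_contra hh; exact hr ⟨h0.le, not_lt.1 hh⟩
    apply SS_right
    rw [le_div_iff₀ hε]; linarith
  have hone : ∀ r, r ≤ 1 → Z r = 1 := by
    intro r hr
    apply SS_left
    apply div_nonpos_of_nonpos_of_nonneg <;> linarith
  have hz1 : ∀ r, 0 < r → r ∉ Icc 1 (1+ε) → Z r = 0 ∨ Z r = 1 := by
    intro r h0 hr
    by_cases h : r ≤ 1
    · exact Or.inr (hone r h)
    · left
      have : 1 + ε < r := by by_contra hh; exact hr ⟨(not_le.1 h).le, not_lt.1 hh⟩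
      apply SS_right; rw [le_div_iff₀ hε]; linarith
  have hdz : ∀ r, 0 < r → r ∉ Icc 1 (1+ε) → deriv Z r = 0 := by
    intro r h0 hr
    rw [(hd r).deriv]
    by_cases h : r < 1
    · rw [SS_dleft (div_neg_of_neg_of_pos (by linarith) hε)]; simp
    · have : 1 + ε < r := by by_contra hh; exact hr ⟨(not_lt.1 h), not_lt.1 hh⟩
      rw [SS_dright (by rw [lt_div_iff₀ hε]; linarith)]; simp
  have hdsq := mu_supp n (f := fun r => deriv Z r^2) ((measurable_deriv Z).pow_const 2).aestronglyMeasurable (a := 1) (b := 1+ε) (v := B^2/ε^2)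
    (by norm_num) (by linarith) (by positivity) (by
      intro r _
      rw [abs_of_nonneg (sq_nonneg _), (hd r).deriv, mul_pow, ← sq_abs (deriv SS _)]
      have := hB ((r-1)/ε)
      calc |deriv SS ((r-1)/ε)|^2 * (1/ε)^2 ≤ B^2 * (1/ε)^2 := by gcongr
        _ = _ := by rw [div_pow]; ring) (fun r h0 hr => by rw [hdz r h0 hr]; simp)
  have hsq := mu_supp n (f := fun r => Z r^2) (Continuous.aestronglyMeasurable (by fun_prop)) (a := 0) (b := 2) (v := 1)
    le_rfl (by norm_num) zero_le_one (by
      intro r _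
      have := SS_mem ((r-1)/ε)
      rw [abs_of_nonneg (sq_nonneg _)]
      exact pow_le_one₀ this.1 this.2) (fun r h0 hr => by rw [hzero r hr h0]; simp)
  have hZ : Adm n Z := by
    refine ⟨fun r => (hd r).differentiableAt, ?_, fun r => SS_mem _, hsq.1, hdsq.1⟩
    rw [(hd 0).deriv, SS_dleft (div_neg_of_neg_of_pos (by linarith) hε)]; simp
  have hWm : ∀ r, 0 ≤ W (Z r) := by
    intro r
    have := hZ.mem r
    rcases eq_or_lt_of_le this.1 with h | h
    · rw [← h, hp.z0]
    rcases eq_or_lt_of_le this.2 with h' | h'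
    · rw [h', hp.z1]
    exact (hp.pos _ ⟨h, h'⟩).le
  have hWi := mu_supp n (f := fun r => W (Z r)) (contOn_comp hp.contW hZc hZ.mem).aestronglyMeasurable (a := 1) (b := 1+ε) (v := Cp)
    (by norm_num) (by linarith) (by linarith) (by
      intro r _
      rw [abs_of_nonneg (hWm r)]
      refine (hp.f1b _ (hZ.mem r)).trans ?_
      have : Z r^2 ≤ 1 := pow_le_one₀ (hZ.mem r).1 (hZ.mem r).2
      nlinarith) (fun r h0 hr => by
        rcases hz1 r h0 hr with h | h <;> simp only [h]
        · exact hp.z0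
        · exact hp.z1)
  have hVc := contOn_comp (vpot_contOn hn hp.contW) hZc hZ.mem
  have hV0 : ∀ r, 0 ≤ Vpot n W (Z r) := by
    intro r; have := hv.mono (by simp) (hZ.mem r) (hZ.mem r).1
    rwa [hv.V0] at this
  have hVi : Integrable (fun r => Vpot n W (Z r)) (mu n) := by
    refine (hsq.1.const_mul Cv).mono' ?_ ?_
    · exact hVc.aestronglyMeasurable
    · filter_upwards with r
      rw [Real.norm_of_nonneg (hV0 r)]; exact hv.v5 _ (hZ.mem r)
  have hM : a ≤ MM n W Z := by
    have := mu_Ioo n hn _ hVi hV0 (v := 1) (by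
      intro r hr; rw [hone r hr.2.le, hv.V1e])
    unfold MM
    calc a = cn n * (1/n) := by rw [ha]; ring
      _ ≤ _ := by gcongr
  have hMpos := ha0.trans_le hM
  have hdil := hm.dil hn hZ hMpos
  set m := MM n W Z with hmd
  have hexp : (2:ℝ)/n - 1 ≤ 0 := by
    rw [sub_nonpos, div_le_one (by linarith)]; exact hn2
  have e2 : m^((2:ℝ)/n-1) ≤ a^((2:ℝ)/n-1) := Real.rpow_le_rpow_of_nonpos ha0 hM hexp
  have e1 : EE n W ε ζ ≤ m^((2:ℝ)/n-1) * (ε * DD n Z) + m⁻¹ * (ε⁻¹ * PP n W Z) := by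
    rw [Real.rpow_sub_one hMpos.ne']
    rw [← le_div_iff₀ hMpos] at hdil
    refine hdil.trans (le_of_eq ?_)
    ring
  have hpow : (1+ε)^(n-1) ≤ 2^(n-1) := by gcongr; linarith
  have eD : ε * DD n Z ≤ cn n * (B^2 * 2^(n-1)) := by
    unfold DD
    calc ε * (cn n * ∫ r, deriv Z r^2 ∂mu n) ≤ ε * (cn n * (B^2/ε^2 * (1+ε)^(n-1) * (1+ε-1))) := by
          gcongr; exact hdsq.2
      _ = cn n * (B^2 * (1+ε)^(n-1)) := by field_simp; ring
      _ ≤ _ := by gcongr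
  have eP : ε⁻¹ * PP n W Z ≤ cn n * (Cp * 2^(n-1)) := by
    unfold PP
    calc ε⁻¹ * (cn n * ∫ r, W (Z r) ∂mu n) ≤ ε⁻¹ * (cn n * (Cp * (1+ε)^(n-1) * (1+ε-1))) := by
          gcongr; exact hWi.2
      _ = cn n * (Cp * (1+ε)^(n-1)) := by field_simp; ring
      _ ≤ _ := by gcongr
  have hD0 : 0 ≤ ε * DD n Z := mul_nonneg hε.le (mul_nonneg hcn.le (integral_nonneg fun r => sq_nonneg _))
  have hP0 : 0 ≤ ε⁻¹ * PP n W Z := mul_nonneg (by positivity) (mul_nonneg hcn.le (integral_nonneg fun r => hWm r))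
  refine e1.trans ?_
  rw [hE]
  gcongr


lemma mu_local {n : ℕ} {f : ℝ → ℝ} (hf : Integrable f (mu n)) {a : ℝ} (ha : 0 < a) : IntegrableOn f (Ioi a) volume := by
  rw [mu_integrable] at hf
  have h1 := hf.mono_set (Ioi_subset_Ioi ha.le)
  have h2 : IntegrableOn (fun r => (a^(n-1))⁻¹ * |r^(n-1) * f r|) (Ioi a) := h1.abs.const_mul _
  refine h2.mono' ?_ ?_
  · have h3 : AEStronglyMeasurable (fun r : ℝ => (r^(n-1))⁻¹ * (r^(n-1) * f r)) (volume.restrict (Ioi a)) := by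
      apply AEStronglyMeasurable.mul _ h1.aestronglyMeasurable
      exact (Measurable.aestronglyMeasurable (by fun_prop))
    refine h3.congr ?_
    filter_upwards [ae_restrict_mem measurableSet_Ioi] with r hr
    have : (0:ℝ) < r := ha.trans hr
    field_simp
  · filter_upwards [ae_restrict_mem measurableSet_Ioi] with r hr
    have hr' : a < r := hr
    have : (0:ℝ) < r := ha.trans hr
    rw [abs_mul, abs_of_pos (pow_pos this _), Real.norm_eq_abs, inv_mul_eq_div, le_div_iff₀ (by positivity), mul_comm]
    gcongr

lemma mu_local_le {n : ℕ} {f : ℝ → ℝ} (hf : Integrable f (mu n)) (h0 : ∀ r, 0 ≤ f r) {a b : ℝ} (ha : 0 < a) :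
    a^(n-1) * ∫ r in Ioc a b, f r ≤ ∫ r, f r ∂mu n := by
  have hl := (mu_local hf ha).mono_set (Ioc_subset_Ioi_self (a := b) (b := a))
  rw [mu_integral]
  rw [mu_integrable] at hf
  rw [← integral_const_mul]
  calc ∫ r in Ioc a b, a^(n-1) * f r ≤ ∫ r in Ioc a b, r^(n-1) * f r := by
        apply setIntegral_mono_on (hl.const_mul _) _ measurableSet_Ioc
        · intro r hr
          have := h0 r
          have := hr.1.le
          gcongr
        · exact hf.mono_set (fun r hr => ha.trans hr.1)
    _ ≤ _ := by
        apply setIntegral_mono_set hf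
        · filter_upwards [ae_restrict_mem measurableSet_Ioi] with r hr
          have : (0:ℝ) < r := hr
          have := h0 r
          simp only [Pi.zero_apply]; positivity
        · exact Eventually.of_forall fun r hr => ha.trans hr.1

lemma Adm.derInt {n : ℕ} {Z : ℝ → ℝ} (hZ : Adm n Z) {a b : ℝ} (ha : 0 < a) (hab : a ≤ b) : IntervalIntegrable (deriv Z) volume a b := by
  rw [intervalIntegrable_iff_integrableOn_Ioc_of_le hab]
  have h1 := (mu_local hZ.dsq ha).mono_set (Ioc_subset_Ioi_self (a := b) (b := a))
  have h2 : IntegrableOn (fun _ : ℝ => (1:ℝ)) (Ioc a b) := integrableOn_const (by simp)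
  refine (h2.add h1).mono' (measurable_deriv Z).aestronglyMeasurable ?_
  filter_upwards with r
  simp only [Pi.add_apply, Real.norm_eq_abs]
  rw [← sq_abs]
  nlinarith [sq_nonneg (|deriv Z r| - 1)]

lemma Adm.ftc {n : ℕ} {Z : ℝ → ℝ} (hZ : Adm n Z) {a b : ℝ} (ha : 0 < a) (hab : a ≤ b) : ∫ r in a..b, deriv Z r = Z b - Z a :=
  intervalIntegral.integral_eq_sub_of_hasDerivAt (fun r _ => (hZ.diff r).hasDerivAt) (hZ.derInt ha hab)

lemma PF.Wnn {W W1 : ℝ → ℝ} {δ C : ℝ} (hp : PF W W1 δ C) {t : ℝ} (ht : t ∈ Icc (0:ℝ) 1) : 0 ≤ W t := by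
  rcases eq_or_lt_of_le ht.1 with h | h
  · rw [← h, hp.z0]
  rcases eq_or_lt_of_le ht.2 with h' | h'
  · rw [h', hp.z1]
  exact (hp.pos _ ⟨h, h'⟩).le

lemma VF.Vnn {n : ℕ} {W W1 : ℝ → ℝ} {δ C : ℝ} (hv : VF n W W1 δ C) {t : ℝ} (ht : t ∈ Icc (0:ℝ) 1) : 0 ≤ Vpot n W t := by
  have := hv.mono (by simp) ht ht.1
  rwa [hv.V0] at this

lemma VF.Vle {n : ℕ} {W W1 : ℝ → ℝ} {δ C : ℝ} (hv : VF n W W1 δ C) {t : ℝ} (ht : t ∈ Icc (0:ℝ) 1) : Vpot n W t ≤ 1 := by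
  have := hv.mono ht (by simp) ht.2
  rwa [hv.V1e] at this

lemma Adm.Wint {n : ℕ} {W W1 : ℝ → ℝ} {δ C : ℝ} (hp : PF W W1 δ C) {Z : ℝ → ℝ} (hZ : Adm n Z) :
    Integrable (fun r => W (Z r)) (mu n) := by
  refine (hZ.sq.const_mul C).mono' (contOn_comp hp.contW hZ.diff.continuous hZ.mem).aestronglyMeasurable ?_
  filter_upwards with r
  rw [Real.norm_of_nonneg (hp.Wnn (hZ.mem r))]
  exact hp.f1b _ (hZ.mem r)

lemma Adm.Vint {n : ℕ} {W W1 : ℝ → ℝ} {δ C : ℝ} (hv : VF n W W1 δ C) {Z : ℝ → ℝ} (hZ : Adm n Z) :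
    Integrable (fun r => Vpot n W (Z r)) (mu n) := by
  have hVc : ContinuousOn (Vpot n W) (Icc 0 1) := fun t ht => (hv.dV t ht).continuousWithinAt
  refine (hZ.sq.const_mul C).mono' (contOn_comp hVc hZ.diff.continuous hZ.mem).aestronglyMeasurable ?_
  filter_upwards with r
  rw [Real.norm_of_nonneg (hv.Vnn (hZ.mem r))]
  exact hv.v5 _ (hZ.mem r)

lemma VF.Vpos {n : ℕ} {W W1 : ℝ → ℝ} {δ C Cp : ℝ} (hp : PF W W1 δ Cp) (hv : VF n W W1 δ C) : 0 < Vpot n W δ := by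
  have hd := hp.dpos
  have hd' := hp.dle
  have hC := hv.Cge
  have m1 : δ/2 ∈ Icc (0:ℝ) 1 := ⟨by linarith, by linarith⟩
  have m2 : δ ∈ Icc (0:ℝ) 1 := ⟨by linarith, by linarith⟩
  have hVc : ContinuousOn (Vpot n W) (Icc 0 1) := fun t ht => (hv.dV t ht).continuousWithinAt
  have h := mvt_bound_ge (f := Vpot n W) (f' := V1 n W) (z := δ/2) (u := δ) (C := 1/C)
    (hVc.mono (uIcc_subset_Icc m1 m2))
    (fun s hs => by
        have hs' := uIoo_sub m1 m2 hs
        exact hasDerivAt_of_Icc (hv.dV s (Ioo_subset_Icc_self hs')) hs')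
    (fun s hs => by
        rw [min_eq_left (by linarith), max_eq_right (by linarith)] at hs
        rw [div_le_iff₀ (by linarith), mul_comm]
        exact hv.v4 s ⟨hs.1.le, by linarith [hs.2]⟩)
  have h1 := hv.Vnn m1
  have h2 : 0 < 1/C * (δ - δ/2)^2 := by
    have : 0 < δ - δ/2 := by linarith
    positivity
  by_contra hcon; push Not at hcon
  nlinarith

/-- location of the transition layer -/
structure Lay (δ ε : ℝ) (ζ : ℝ → ℝ) (r1 r2 M rm rp : ℝ) : Prop where
  h1 : r1 ≤ rm
  h2 : rm < rp
  h3 : rp ≤ r2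
  zm : ζ rm = 1 - δ
  zp : ζ rp = δ
  w1 : rp - rm ≤ M * ε
  w2 : ε ≤ M * (rp - rm)

set_option maxHeartbeats 1000000 in
lemma layer_exists {n : ℕ} (hn : 2 ≤ n) {W W1 : ℝ → ℝ} {δ Cp Cv : ℝ} (hp : PF W W1 δ Cp) (hv : VF n W W1 δ Cv) {E0 : ℝ} (hE0 : 1 ≤ E0) :
    ∃ r1 r2 M ε1, 0 < r1 ∧ r1 < r2 ∧ r1 ≤ 1 ∧ 1 ≤ r2 ∧ 1 ≤ M ∧ 0 < ε1 ∧ ∀ ε, 0 < ε → ε ≤ ε1 → ∀ ζ, Minz n W ε ζ → EE n W ε ζ ≤ E0 →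
      ∃ rm rp, Lay δ ε ζ r1 r2 M rm rp := by
  have hcn := cn_pos n hn
  have hn2 : (2:ℝ) ≤ n := by exact_mod_cast hn
  have hCp := hp.Cge
  have hCv := hv.Cge
  have hd := hp.dpos
  have hd' := hp.dle
  have hVp := VF.Vpos hp hv
  set r1 := min 1 (1/(2*cn n)) with hr1
  have hr10 : 0 < r1 := by rw [hr1]; positivity
  have hr1n : cn n * r1^n ≤ 1/2 := by
    have e1 : r1 ≤ 1 := min_le_left _ _
    have e2 : r1 ≤ 1/(2*cn n) := min_le_right _ _
    have e3 : r1^n ≤ r1 := pow_le_of_le_one hr10.le e1 (by omega)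
    calc cn n * r1^n ≤ cn n * (1/(2*cn n)) := by gcongr; exact e3.trans e2
      _ = 1/2 := by field_simp
  set r2 := max 2 (2 * n /(cn n * Vpot n W δ)) with hr2
  have hr22 : 2 ≤ r2 := le_max_left _ _
  have hr2n : 1 < cn n * (Vpot n W δ / n) * r2 := by
    have e2 : 2 * n /(cn n * Vpot n W δ) ≤ r2 := le_max_right _ _
    calc (1:ℝ) < cn n * (Vpot n W δ / n) * (2 * n /(cn n * Vpot n W δ)) := by
          have : cn n * (Vpot n W δ / n) * (2 * n /(cn n * Vpot n W δ)) = 2 := by field_simp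
          rw [this]; norm_num
      _ ≤ _ := by gcongr
  set M := max 1 (max (E0 * Cp /(cn n * r1^(n-1))) (2 * E0/(cn n * r1^(n-1)))) with hM
  have hM1 : 1 ≤ M := le_max_left _ _
  refine ⟨r1, r2, M, 1/(4 * Cv * E0), hr10, by linarith [min_le_left 1 (1/(2*cn n))], min_le_left _ _, by linarith, hM1, by positivity, ?_⟩
  intro ε hε hε1 ζ hm hE
  have hWi := hm.adm.Wint hp
  have hW0 : ∀ r, 0 ≤ W (ζ r) := fun r => hp.Wnn (hm.adm.mem r)
  have hD0 : 0 ≤ DD n ζ := mul_nonneg hcn.le (integral_nonneg fun r => sq_nonneg _)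
  have hP0 : 0 ≤ PP n W ζ := mul_nonneg hcn.le (integral_nonneg fun r => hW0 r)
  have hDE : ε * DD n ζ ≤ E0 := by
    unfold EE at hE
    have : 0 ≤ ε⁻¹ * PP n W ζ := by positivity
    linarith
  have hPE : PP n W ζ ≤ E0 * ε := by
    unfold EE at hE
    have : 0 ≤ ε * DD n ζ := by positivity
    have h2 : ε⁻¹ * PP n W ζ ≤ E0 := by linarith
    rwa [inv_mul_le_iff₀ hε, mul_comm] at h2
  have hVi := hm.Vint
  have hV0 : ∀ r, 0 ≤ Vpot n W (ζ r) := fun r => hv.Vnn (hm.adm.mem r)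
  have hmass := hm.mass
  unfold MM at hmass
  -- lower bound at r1
  have hz1 : 1 - δ ≤ ζ r1 := by
    by_contra hcon; push Not at hcon
    have hs := mu_supp n (f := (Icc 0 r1).indicator (fun _ => (1:ℝ))) (measurable_const.indicator measurableSet_Icc).aestronglyMeasurable (a := 0) (b := r1) (v := 1) le_rfl hr10.le zero_le_one
      (fun r hr => by rw [indicator_of_mem hr]; simp) (fun r _ hr => indicator_of_notMem hr _)
    have hle : ∫ r, Vpot n W (ζ r) ∂mu n ≤ ∫ r, ((Icc 0 r1).indicator (fun _ => (1:ℝ)) r + Cv * W (ζ r)) ∂mu n := by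
      apply integral_mono_ae hVi (hs.1.add (hWi.const_mul _))
      filter_upwards [mu_ae_pos n] with r hr
      simp only [Pi.add_apply]
      by_cases h : r ≤ r1
      · rw [indicator_of_mem (show r ∈ Icc 0 r1 from ⟨hr.le, h⟩)]
        have := hv.Vle (hm.adm.mem r)
        have := hW0 r
        nlinarith
      · rw [indicator_of_notMem (show r ∉ Icc 0 r1 from fun h' => h h'.2), zero_add]
        apply hv.v3
        have := hm.anti (mem_Ici.2 hr10.le) (mem_Ici.2 hr.le) (not_le.1 h).le
        exact ⟨(hm.adm.mem r).1, by linarith⟩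
    rw [integral_add hs.1 (hWi.const_mul _), integral_const_mul] at hle
    have h3 : cn n * ∫ r, W (ζ r) ∂mu n ≤ E0 * ε := hPE
    have h4 : cn n * ∫ r, (Icc 0 r1).indicator (fun _ => (1:ℝ)) r ∂mu n ≤ 1/2 := by
      refine le_trans ?_ hr1n
      refine mul_le_mul_of_nonneg_left (hs.2.trans (le_of_eq ?_)) hcn.le
      rw [one_mul, sub_zero, ← pow_succ, Nat.sub_add_cancel (by omega)]
    have h5 : Cv * (E0 * ε) ≤ 1/4 := by
      calc Cv * (E0 * ε) ≤ Cv * (E0 * (1/(4*Cv*E0))) := by gcongr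
        _ = 1/4 := by field_simp
    have h6 := mul_le_mul_of_nonneg_left hle hcn.le
    have h7 := mul_le_mul_of_nonneg_left h3 (by linarith : 0 ≤ Cv)
    nlinarith
  have hz2 : ζ r2 ≤ δ := by
    by_contra hcon; push Not at hcon
    have h1 := mu_scale n hn (fun r => Vpot n W (ζ r)) (b := r2) (by linarith)
    have h2 := mu_Ioo n hn (fun r => Vpot n W (ζ (r2 * r))) (mu_scale_integrable n (fun r => Vpot n W (ζ r)) (b := r2) (by linarith) hVi) (fun r => hV0 _) (v := Vpot n W δ) (by
      intro r hr
      apply hv.mono ⟨by linarith, by linarith⟩ (hm.adm.mem _)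
      have := hm.anti (a := r2 * r) (b := r2) (mem_Ici.2 (by have := hr.1; positivity)) (mem_Ici.2 (by linarith)) (by nlinarith [hr.2])
      linarith)
    rw [h1] at h2
    have h3 := mul_le_mul_of_nonneg_left h2 hcn.le
    rw [mul_left_comm, hmass, mul_one] at h3
    have h4 : (r2^n)⁻¹ ≤ r2⁻¹ := by
      apply inv_anti₀ (by linarith)
      exact le_self_pow₀ (by linarith) (by omega)
    have h5 : cn n * (Vpot n W δ / n) ≤ r2⁻¹ := h3.trans h4
    rw [← one_div, le_div_iff₀ (by linarith)] at h5
    linarith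
  have hr12 : r1 ≤ r2 := by linarith [min_le_left 1 (1/(2*cn n))]
  have hcont := hm.adm.diff.continuous
  obtain ⟨rm, hrm, hzm⟩ := intermediate_value_Icc' hr12 hcont.continuousOn (show 1 - δ ∈ Icc (ζ r2) (ζ r1) from ⟨by linarith, hz1⟩)
  obtain ⟨rp, hrp, hzp⟩ := intermediate_value_Icc' hr12 hcont.continuousOn (show δ ∈ Icc (ζ r2) (ζ r1) from ⟨hz2, by linarith⟩)
  have hlt : rm < rp := by
    by_contra hcon; push Not at hcon
    have := hm.anti (mem_Ici.2 (hr10.le.trans hrp.1)) (mem_Ici.2 (hr10.le.trans hrm.1)) hcon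
    rw [hzm, hzp] at this; linarith
  have hrm0 : 0 < rm := hr10.trans_le hrm.1
  refine ⟨rm, rp, hrm.1, hlt, hrp.2, hzm, hzp, ?_, ?_⟩
  · have h1 := mu_local_le hWi hW0 hrm0 (b := rp)
    have h2 : (1/Cp) * (rp - rm) ≤ ∫ r in Ioc rm rp, W (ζ r) := by
      have : ∫ r in Ioc rm rp, (1/Cp) = (1/Cp) * (rp - rm) := by simp [Measure.real, hlt.le]; ring
      rw [← this]
      apply setIntegral_mono_on (integrableOn_const (by simp)) ((mu_local hWi hrm0).mono_set Ioc_subset_Ioi_self) measurableSet_Ioc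
      intro r hr
      rw [div_le_iff₀ (by linarith), mul_comm]
      apply hp.f9
      have hr0 : 0 ≤ r := hrm0.le.trans hr.1.le
      have e1 := hm.anti (mem_Ici.2 hrm0.le) (mem_Ici.2 hr0) hr.1.le
      have e2 := hm.anti (mem_Ici.2 hr0) (mem_Ici.2 (hr0.trans hr.2)) hr.2
      constructor <;> linarith
    have h3 : cn n * ∫ r, W (ζ r) ∂mu n ≤ E0 * ε := hPE
    have h4 : r1^(n-1) ≤ rm^(n-1) := by gcongr; exact hrm.1
    have h5 : cn n * (r1^(n-1) * ((1/Cp) * (rp-rm))) ≤ E0 * ε := by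
      refine le_trans ?_ h3
      gcongr
      refine le_trans ?_ h1
      have : 0 ≤ 1/Cp * (rp - rm) := mul_nonneg (by positivity) (by linarith)
      gcongr
    have h6 : rp - rm ≤ E0 * Cp/(cn n * r1^(n-1)) * ε := by
      rw [div_mul_eq_mul_div, le_div_iff₀ (by positivity)]
      have : (rp - rm) * (cn n * r1^(n-1)) = Cp * (cn n * (r1^(n-1) * ((1/Cp) * (rp-rm)))) := by field_simp
      rw [this]
      calc _ ≤ Cp * (E0 * ε) := by gcongr
        _ = _ := by ring
    refine h6.trans ?_
    gcongr
    exact (le_max_left _ _).trans (le_max_right _ _)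
  · have h1 := mu_local_le hm.adm.dsq (fun r => sq_nonneg _) hrm0 (b := rp)
    have hw : 0 < rp - rm := by linarith
    have hIi := (mu_local hm.adm.dsq hrm0).mono_set (Ioc_subset_Ioi_self (a := rp))
    have hftc := hm.adm.ftc hrm0 hlt.le
    have hdi := hm.adm.derInt hrm0 hlt.le
    rw [intervalIntegral.integral_of_le hlt.le, hzm, hzp] at hftc
    rw [intervalIntegrable_iff_integrableOn_Ioc_of_le hlt.le] at hdi
    have hci : IntegrableOn (fun _ : ℝ => 1/(4*(rp - rm))) (Ioc rm rp) := integrableOn_const (by simp)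
    have h2 : ∫ r in Ioc rm rp, - deriv ζ r ≤ ∫ r in Ioc rm rp, (1/(4*(rp - rm)) + (rp-rm) * deriv ζ r^2) := by
      apply setIntegral_mono_on hdi.neg ((integrableOn_const (by simp)).add (hIi.const_mul _)) measurableSet_Ioc
      intro r hr
      have : 1/(4*(rp - rm)) + (rp-rm) * deriv ζ r^2 + deriv ζ r = (1/(rp-rm)) * (1/2 + (rp-rm)*deriv ζ r)^2 := by field_simp; ring
      have h' : 0 ≤ (1/(rp-rm)) * (1/2 + (rp-rm)*deriv ζ r)^2 := by positivity
      simp only [Pi.neg_apply, Pi.add_apply]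
      linarith
    rw [integral_neg, hftc, integral_add hci (hIi.const_mul _), integral_const_mul] at h2
    have h3 : ∫ r in Ioc rm rp, 1/(4*(rp-rm)) = 1/4 := by
      simp [Measure.real, hlt.le]; field_simp
    rw [h3] at h2
    have h4 : 1/2 ≤ (rp-rm) * ∫ r in Ioc rm rp, deriv ζ r^2 := by linarith
    have h5 : r1^(n-1) ≤ rm^(n-1) := by gcongr; exact hrm.1
    have hI0 : 0 ≤ ∫ r in Ioc rm rp, deriv ζ r^2 := integral_nonneg fun r => sq_nonneg _
    have h6 : ε * (cn n * (r1^(n-1) * ∫ r in Ioc rm rp, deriv ζ r^2)) ≤ E0 := by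
      refine le_trans ?_ hDE
      unfold DD
      gcongr
      refine le_trans ?_ h1
      gcongr
    set I := ∫ r in Ioc rm rp, deriv ζ r^2
    have h7 : ε ≤ 2*E0/(cn n * r1^(n-1)) * (rp - rm) := by
      rw [div_mul_eq_mul_div, le_div_iff₀ (by positivity)]
      calc ε * (cn n * r1^(n-1)) ≤ ε * (cn n * r1^(n-1)) * (2 * ((rp-rm)*I)) := by
            apply le_mul_of_one_le_right (by positivity); linarith
        _ = 2 * (rp-rm) * (ε * (cn n * (r1^(n-1) * I))) := by ring
        _ ≤ 2 * (rp-rm) * E0 := by gcongr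
        _ = _ := by ring
    refine h7.trans ?_
    gcongr
    exact (le_max_right _ _).trans (le_max_right _ _)


lemma int_mul_sq {μ : Measure ℝ} {f g : ℝ → ℝ} (hf : AEStronglyMeasurable f μ) (hg : AEStronglyMeasurable g μ)
    (hf2 : Integrable (fun r => f r^2) μ) (hg2 : Integrable (fun r => g r^2) μ) : Integrable (fun r => f r * g r) μ := by
  refine (hf2.fun_add hg2).mono' (hf.mul hg) ?_
  filter_upwards with r
  rw [Real.norm_eq_abs, abs_mul, ← sq_abs (f r), ← sq_abs (g r)]
  nlinarith [sq_nonneg (|f r| - |g r|), abs_nonneg (f r), abs_nonneg (g r)]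

lemma int_sub_sq {μ : Measure ℝ} {f g : ℝ → ℝ} (hf : AEStronglyMeasurable f μ) (hg : AEStronglyMeasurable g μ)
    (hf2 : Integrable (fun r => f r^2) μ) (hg2 : Integrable (fun r => g r^2) μ) : Integrable (fun r => (f r - g r)^2) μ := by
  have h := (hf2.fun_add ((int_mul_sq hf hg hf2 hg2).const_mul (-2))).fun_add hg2
  refine h.congr ?_
  filter_upwards with r; ring

lemma int_add_sq {μ : Measure ℝ} {f g : ℝ → ℝ} (hf : AEStronglyMeasurable f μ) (hg : AEStronglyMeasurable g μ)
    (hf2 : Integrable (fun r => f r^2) μ) (hg2 : Integrable (fun r => g r^2) μ) : Integrable (fun r => (f r + g r)^2) μ := by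
  have h := (hf2.fun_add ((int_mul_sq hf hg hf2 hg2).const_mul 2)).fun_add hg2
  refine h.congr ?_
  filter_upwards with r; ring

lemma Adm.ms {n : ℕ} {Z : ℝ → ℝ} (hZ : Adm n Z) : AEStronglyMeasurable Z (mu n) := hZ.diff.continuous.aestronglyMeasurable
lemma der_ms {n : ℕ} (Z : ℝ → ℝ) : AEStronglyMeasurable (deriv Z) (mu n) := (measurable_deriv Z).aestronglyMeasurable

lemma Adm.mix_deriv {n : ℕ} {ζ Z : ℝ → ℝ} (h1 : Adm n ζ) (h2 : Adm n Z) (t r : ℝ) :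
    HasDerivAt (fun r => ζ r + t * (Z r - ζ r)) (deriv ζ r + t * (deriv Z r - deriv ζ r)) r :=
  (h1.diff r).hasDerivAt.fun_add (((h2.diff r).hasDerivAt.fun_sub (h1.diff r).hasDerivAt).const_mul t)

lemma Adm.mix {n : ℕ} {ζ Z : ℝ → ℝ} (h1 : Adm n ζ) (h2 : Adm n Z) {t : ℝ} (ht : t ∈ Icc (0:ℝ) 1) :
    Adm n (fun r => ζ r + t * (Z r - ζ r)) := by
  refine ⟨fun r => (h1.mix_deriv h2 t r).differentiableAt, ?_, ?_, ?_, ?_⟩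
  · rw [(h1.mix_deriv h2 t 0).deriv, h1.d0, h2.d0]; simp
  · intro r
    have a := h1.mem r
    have b := h2.mem r
    constructor
    · nlinarith [a.1, b.1, ht.1, ht.2, mul_nonneg ht.1 b.1, mul_nonneg (sub_nonneg.2 ht.2) a.1]
    · nlinarith [a.2, b.2, ht.1, ht.2, mul_nonneg ht.1 (sub_nonneg.2 b.2), mul_nonneg (sub_nonneg.2 ht.2) (sub_nonneg.2 a.2)]
  · apply int_add_sq h1.ms ((h2.ms.sub h1.ms).const_mul t) h1.sq
    have := (int_sub_sq h2.ms h1.ms h2.sq h1.sq).const_mul (t^2)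
    refine this.congr ?_
    filter_upwards with r; simp only [Pi.sub_apply]; ring
  · simp_rw [fun r => (h1.mix_deriv h2 t r).deriv]
    apply int_add_sq (der_ms ζ) (((der_ms Z).sub (der_ms ζ)).const_mul t) h1.dsq
    have := (int_sub_sq (der_ms Z) (der_ms ζ) h2.dsq h1.dsq).const_mul (t^2)
    refine this.congr ?_
    filter_upwards with r; simp only [Pi.sub_apply]; ring

lemma meas_comp {Q : ℝ → ℝ} {Z : ℝ → ℝ} (hZ : Continuous Z) (hm : ∀ r, Z r ∈ Icc (0:ℝ) 1) (hQ : ContinuousOn Q (Icc 0 1)) :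
    Continuous fun r => Q (Z r) := contOn_comp hQ hZ hm

lemma slope_bound {Q Q1 : ℝ → ℝ} {C : ℝ} (hC : 0 ≤ C) (hd : ∀ t ∈ Icc (0:ℝ) 1, HasDerivWithinAt Q (Q1 t) (Icc 0 1) t)
    (hb : ∀ t ∈ Icc (0:ℝ) 1, |Q1 t| ≤ C * t) {z u : ℝ} (hz : z ∈ Icc (0:ℝ) 1) (hu : u ∈ Icc (0:ℝ) 1) :
    |Q u - Q z| ≤ C * (z + u) * |u - z| := by
  have hc : ContinuousOn Q (Icc 0 1) := fun t ht => (hd t ht).continuousWithinAt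
  apply mvt_bound_abs (f' := Q1) (hc.mono (uIcc_subset_Icc hz hu))
  · intro s hs
    have hs' := uIoo_sub hz hu hs
    exact hasDerivAt_of_Icc (hd s (Ioo_subset_Icc_self hs')) hs'
  · intro s hs
    have hs' := uIoo_sub hz hu hs
    refine (hb s (Ioo_subset_Icc_self hs')).trans ?_
    have : s ≤ z + u := hs.2.le.trans (max_le (by linarith [hu.1]) (by linarith [hz.1]))
    gcongr

lemma slope_tendsto {n : ℕ} {Q Q1 : ℝ → ℝ} {C : ℝ} (hC : 0 ≤ C) (hd : ∀ t ∈ Icc (0:ℝ) 1, HasDerivWithinAt Q (Q1 t) (Icc 0 1) t)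
    (hb : ∀ t ∈ Icc (0:ℝ) 1, |Q1 t| ≤ C * t) {ζ Z : ℝ → ℝ} (h1 : Adm n ζ) (h2 : Adm n Z)  :
    Tendsto (fun t => ∫ r, (Q (ζ r + t * (Z r - ζ r)) - Q (ζ r))/t ∂mu n) (nhdsWithin 0 (Ioi 0)) (nhds (∫ r, Q1 (ζ r) * (Z r - ζ r) ∂mu n)) := by
  have hc : ContinuousOn Q (Icc 0 1) := fun t ht => (hd t ht).continuousWithinAt
  have hev : ∀ᶠ t in nhdsWithin (0:ℝ) (Ioi 0), t ∈ Ioc (0:ℝ) 1 := Ioc_mem_nhdsGT one_pos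
  apply tendsto_integral_filter_of_dominated_convergence (fun r => C * ((2 * ζ r + Z r) * |Z r - ζ r|))
  · filter_upwards [hev] with t ht
    have hA := h1.mix h2 (Ioc_subset_Icc_self ht)
    exact (((contOn_comp hc hA.diff.continuous hA.mem).sub (contOn_comp hc h1.diff.continuous h1.mem)).div_const t).aestronglyMeasurable
  · filter_upwards [hev] with t ht
    filter_upwards with r
    have hA := h1.mix h2 (Ioc_subset_Icc_self ht)
    have h := slope_bound hC hd hb (h1.mem r) (hA.mem r)
    have e : ζ r + t * (Z r - ζ r) - ζ r = t * (Z r - ζ r) := by ring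
    rw [e, abs_mul, abs_of_pos ht.1] at h
    rw [Real.norm_eq_abs, abs_div, abs_of_pos ht.1, div_le_iff₀ ht.1]
    refine h.trans ?_
    have e2 : ζ r + (ζ r + t * (Z r - ζ r)) ≤ 2 * ζ r + Z r := by
      have := (h1.mem r).1; have := (h2.mem r).1
      nlinarith [ht.1, ht.2]
    have h0 : 0 ≤ |Z r - ζ r| := abs_nonneg _
    calc C * (ζ r + (ζ r + t * (Z r - ζ r))) * (t * |Z r - ζ r|) ≤ C * (2 * ζ r + Z r) * (t * |Z r - ζ r|) := by
          have := ht.1; gcongr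
      _ = _ := by ring
  · apply Integrable.const_mul
    apply int_mul_sq ((h1.ms.const_mul 2).add h2.ms)
    · exact ((h2.diff.continuous.sub h1.diff.continuous).abs).aestronglyMeasurable
    · apply int_add_sq (h1.ms.const_mul 2) h2.ms _ h2.sq
      refine (h1.sq.const_mul 4).congr ?_
      filter_upwards with r; ring
    · simp_rw [sq_abs]
      exact int_sub_sq h2.ms h1.ms h2.sq h1.sq
  · filter_upwards with r
    by_cases hzr : Z r = ζ r
    · simp [hzr]
    have hh := hd (ζ r) (h1.mem r)
    have hl : HasDerivWithinAt (fun t : ℝ => ζ r + t * (Z r - ζ r)) (Z r - ζ r) (Ioc 0 1) 0 := by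
      have : HasDerivAt (fun t : ℝ => ζ r + t * (Z r - ζ r)) (1 * (Z r - ζ r)) 0 := ((hasDerivAt_id (0:ℝ)).mul_const _).const_add _
      rw [one_mul] at this
      exact this.hasDerivWithinAt
    have hcomp := HasDerivWithinAt.comp (h₂ := Q) (h := fun t : ℝ => ζ r + t * (Z r - ζ r)) (h₂' := Q1 (ζ r)) (0:ℝ) (by simpa using hh) hl
      (fun t ht => (h1.mix h2 (Ioc_subset_Icc_self ht)).mem r)
    rw [hasDerivWithinAt_iff_tendsto_slope] at hcomp
    have hs : Ioc (0:ℝ) 1 \ {0} = Ioc 0 1 := by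
      ext x; simp only [mem_diff, mem_Ioc, mem_singleton_iff]
      exact ⟨fun h => h.1, fun h => ⟨h, h.1.ne'⟩⟩
    rw [hs] at hcomp
    have hn : nhdsWithin (0:ℝ) (Ioi 0) = nhdsWithin 0 (Ioc 0 1) := (nhdsWithin_Ioc_eq_nhdsGT one_pos).symm
    rw [hn]
    refine hcomp.congr ?_
    intro t
    simp [slope_def_field]

/-- Lagrange multiplier -/
def Lam (n : ℕ) (W : ℝ → ℝ) (ε : ℝ) (ζ : ℝ → ℝ) : ℝ := EE n W ε ζ - (2/n) * ε * DD n ζ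

lemma V1_lin {n : ℕ} {W W1 : ℝ → ℝ} {δ Cp Cv : ℝ} (hp : PF W W1 δ Cp) (hv : VF n W W1 δ Cv) :
    ∀ t ∈ Icc (0:ℝ) 1, |V1 n W t| ≤ (Cv * Cp) * t := by
  intro t ht
  have h1 := hv.v1 t ht
  have h2 := hp.f1c t ht
  have := hv.Cge
  rw [abs_of_nonneg h1.1]
  calc _ ≤ Cv * √(W t) := h1.2
    _ ≤ Cv * (Cp * t) := by gcongr
    _ = _ := by ring

set_option maxHeartbeats 1000000 in
lemma FV {n : ℕ} (hn : 2 ≤ n) {W W1 : ℝ → ℝ} {δ Cp Cv : ℝ} (hp : PF W W1 δ Cp) (hv : VF n W W1 δ Cv) {ε : ℝ} (hε : 0 < ε) {ζ Z : ℝ → ℝ}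
    (hm : Minz n W ε ζ) (hZ : Adm n Z) :
    0 ≤ 2 * ε * (∫ r, deriv ζ r * (deriv Z r - deriv ζ r) ∂mu n) + ε⁻¹ * (∫ r, W1 (ζ r) * (Z r - ζ r) ∂mu n)
      - Lam n W ε ζ * ∫ r, V1 n W (ζ r) * (Z r - ζ r) ∂mu n := by
  have hcn := cn_pos n hn
  have hn2 : (2:ℝ) ≤ n := by exact_mod_cast hn
  have hCp := hp.Cge
  have hCv := hv.Cge
  have h1 := hm.adm
  have sW := slope_tendsto (by linarith) hp.d1 hp.f1a h1 hZ
  have sV := slope_tendsto (by positivity) hv.dV (V1_lin hp hv) h1 hZ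
  set IW := ∫ r, W1 (ζ r) * (Z r - ζ r) ∂mu n with hIW
  set IV := ∫ r, V1 n W (ζ r) * (Z r - ζ r) ∂mu n with hIV
  set ID := ∫ r, deriv ζ r * (deriv Z r - deriv ζ r) ∂mu n with hID
  set G := ∫ r, (deriv Z r - deriv ζ r)^2 ∂mu n with hG
  set T : ℝ → ℝ → ℝ := fun t r => ζ r + t * (Z r - ζ r) with hT
  have hev : ∀ᶠ t in nhdsWithin (0:ℝ) (Ioi 0), t ∈ Ioc (0:ℝ) 1 := Ioc_mem_nhdsGT one_pos
  have eW : ∀ t ∈ Ioc (0:ℝ) 1, (PP n W (T t) - PP n W ζ)/t = cn n * ∫ r, (W (T t r) - W (ζ r))/t ∂mu n := by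
    intro t ht
    have hA := h1.mix hZ (Ioc_subset_Icc_self ht)
    unfold PP
    rw [integral_div, integral_sub (hA.Wint hp) (h1.Wint hp)]; ring
  have eV : ∀ t ∈ Ioc (0:ℝ) 1, (MM n W (T t) - 1)/t = cn n * ∫ r, (Vpot n W (T t r) - Vpot n W (ζ r))/t ∂mu n := by
    intro t ht
    have hA := h1.mix hZ (Ioc_subset_Icc_self ht)
    rw [← hm.mass]
    unfold MM
    rw [integral_div, integral_sub (hA.Vint hv) (h1.Vint hv)]; ring
  have i1 := int_mul_sq (der_ms ζ) ((der_ms Z).sub (der_ms ζ)) h1.dsq (int_sub_sq (der_ms Z) (der_ms ζ) hZ.dsq h1.dsq)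
  have i2 := int_sub_sq (der_ms (n := n) Z) (der_ms ζ) hZ.dsq h1.dsq
  have eD : ∀ t, DD n (T t) = DD n ζ + t * (2 * cn n * ID) + t^2 * (cn n * G) := by
    intro t
    unfold DD
    simp_rw [hT, fun r => (h1.mix_deriv hZ t r).deriv]
    have : ∀ r, (deriv ζ r + t * (deriv Z r - deriv ζ r))^2 = deriv ζ r^2 + (2*t) * (deriv ζ r * (deriv Z r - deriv ζ r)) + t^2 * (deriv Z r - deriv ζ r)^2 := by
      intro r; ring
    simp_rw [this]
    have j1 : Integrable (fun r => (2*t) * (deriv ζ r * (deriv Z r - deriv ζ r))) (mu n) := i1.const_mul (2*t)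
    rw [integral_add (h1.dsq.fun_add j1) (i2.const_mul (t^2)), integral_add h1.dsq j1, integral_const_mul, integral_const_mul]
    ring
  have lV : Tendsto (fun t => (MM n W (T t) - 1)/t) (nhdsWithin 0 (Ioi 0)) (nhds (cn n * IV)) := by
    refine (sV.const_mul (cn n)).congr' ?_
    filter_upwards [hev] with t ht using (eV t ht).symm
  have lW : Tendsto (fun t => (PP n W (T t) - PP n W ζ)/t) (nhdsWithin 0 (Ioi 0)) (nhds (cn n * IW)) := by
    refine (sW.const_mul (cn n)).congr' ?_
    filter_upwards [hev] with t ht using (eW t ht).symm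
  have lid : Tendsto (fun t : ℝ => t) (nhdsWithin 0 (Ioi 0)) (nhds 0) := tendsto_id.mono_left nhdsWithin_le_nhds
  have lM : Tendsto (fun t => MM n W (T t)) (nhdsWithin 0 (Ioi 0)) (nhds 1) := by
    have := (lid.mul lV).const_add 1
    rw [zero_mul, add_zero] at this
    refine this.congr' ?_
    filter_upwards [hev] with t ht
    have := ht.1.ne'
    field_simp; ring
  have lD : Tendsto (fun t => DD n (T t)) (nhdsWithin 0 (Ioi 0)) (nhds (DD n ζ)) := by
    simp_rw [eD]
    have hc : Continuous (fun t : ℝ => DD n ζ + t * (2 * cn n * ID) + t^2 * (cn n * G)) := by fun_prop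
    have := hc.tendsto 0
    simp only [zero_mul, add_zero, ne_eq, OfNat.ofNat_ne_zero, not_false_eq_true, zero_pow] at this
    exact this.mono_left nhdsWithin_le_nhds
  have lD' : Tendsto (fun t => (2 * cn n * ID) + t * (cn n * G)) (nhdsWithin 0 (Ioi 0)) (nhds (2 * cn n * ID)) := by
    have := (lid.mul_const (cn n * G)).const_add (2 * cn n * ID)
    simpa using this
  have lim := ((((lV.mul lD).const_mul (ε * (2/n))).add (lD'.const_mul ε)).add (lW.const_mul ε⁻¹)).sub (lV.const_mul (EE n W ε ζ))
  have hpos : 0 ≤ ε * (2/n) * (cn n * IV * DD n ζ) + ε * (2 * cn n * ID) + ε⁻¹ * (cn n * IW) - EE n W ε ζ * (cn n * IV) := by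
    refine ge_of_tendsto lim ?_
    filter_upwards [hev, lM.eventually_const_lt (show (0:ℝ) < 1 by norm_num)] with t ht hmp
    have hA := h1.mix hZ (Ioc_subset_Icc_self ht)
    have hd := hm.dil hn hA hmp
    set m := MM n W (T t) with hmd
    have hb : m^((2:ℝ)/n) ≤ 1 + (2/n) * (m - 1) := by
      have := rpow_one_add_le_one_add_mul_self (s := m - 1) (by linarith) (p := (2:ℝ)/n) (by positivity) (by rw [div_le_one (by linarith)]; exact hn2)
      rwa [add_sub_cancel] at this
    have hD0 : 0 ≤ DD n (T t) := mul_nonneg hcn.le (integral_nonneg fun r => sq_nonneg _)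
    have h3 : EE n W ε ζ * m ≤ ε * (1 + (2/n) * (m-1)) * DD n (T t) + ε⁻¹ * PP n W (T t) := by
      refine hd.trans ?_
      gcongr
    have h4 : EE n W ε ζ = ε * DD n ζ + ε⁻¹ * PP n W ζ := rfl
    have h5 : 0 ≤ (ε * (1 + (2/n) * (m-1)) * DD n (T t) + ε⁻¹ * PP n W (T t) - EE n W ε ζ * m)/t :=
      div_nonneg (by linarith) ht.1.le
    have h6 : (2 * cn n * ID) + t * (cn n * G) = (DD n (T t) - DD n ζ)/t := by
      rw [eD t]; have := ht.1.ne'; field_simp; ring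
    refine h5.trans (le_of_eq ?_)
    rw [h6]
    have e : EE n W ε ζ * m = EE n W ε ζ * (m-1) + (ε * DD n ζ + ε⁻¹ * PP n W ζ) := by rw [← h4]; ring
    rw [e]
    ring
  have hfin : ε * (2/n) * (cn n * IV * DD n ζ) + ε * (2 * cn n * ID) + ε⁻¹ * (cn n * IW) - EE n W ε ζ * (cn n * IV)
      = cn n * (2 * ε * ID + ε⁻¹ * IW - Lam n W ε ζ * IV) := by unfold Lam; ring
  rw [hfin] at hpos
  exact nonneg_of_mul_nonneg_right hpos hcn


lemma DD_nonneg {n : ℕ} (hn : 2 ≤ n) (ζ : ℝ → ℝ) : 0 ≤ DD n ζ :=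
  mul_nonneg (cn_pos n hn).le (integral_nonneg fun r => sq_nonneg _)

lemma PP_nonneg {n : ℕ} (hn : 2 ≤ n) {W W1 : ℝ → ℝ} {δ Cp : ℝ} (hp : PF W W1 δ Cp) {ζ : ℝ → ℝ} (hm : Adm n ζ) : 0 ≤ PP n W ζ :=
  mul_nonneg (cn_pos n hn).le (integral_nonneg fun r => hp.Wnn (hm.mem r))

lemma Lam_nonneg {n : ℕ} (hn : 2 ≤ n) {W W1 : ℝ → ℝ} {δ Cp : ℝ} (hp : PF W W1 δ Cp) {ζ : ℝ → ℝ} (hm : Adm n ζ) {ε : ℝ} (hε : 0 < ε) :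
    0 ≤ Lam n W ε ζ := by
  have h1 := DD_nonneg hn ζ
  have h2 := PP_nonneg hn hp hm
  have hn2 : (2:ℝ) ≤ n := by exact_mod_cast hn
  have : Lam n W ε ζ = (1 - 2/n) * (ε * DD n ζ) + ε⁻¹ * PP n W ζ := by unfold Lam EE; ring
  rw [this]
  have : 0 ≤ 1 - 2/(n:ℝ) := by rw [sub_nonneg, div_le_one (by linarith)]; exact hn2
  positivity

lemma Lam_le {n : ℕ} (hn : 2 ≤ n) {W : ℝ → ℝ} {ζ : ℝ → ℝ} {ε : ℝ} (hε : 0 < ε) :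
    Lam n W ε ζ ≤ EE n W ε ζ := by
  have h1 := DD_nonneg hn ζ
  have : 0 ≤ (2/(n:ℝ)) * ε * DD n ζ := by positivity
  unfold Lam; linarith

lemma EE_D {n : ℕ} (hn : 2 ≤ n) {W W1 : ℝ → ℝ} {δ Cp : ℝ} (hp : PF W W1 δ Cp) {ζ : ℝ → ℝ} (hm : Adm n ζ) {ε E0 : ℝ} (hε : 0 < ε)
    (hE : EE n W ε ζ ≤ E0) : ε * (∫ r, deriv ζ r^2 ∂mu n) ≤ E0 / cn n := by
  have h2 := PP_nonneg hn hp hm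
  have hcn := cn_pos n hn
  rw [le_div_iff₀ hcn]
  have : ε * DD n ζ ≤ E0 := by
    have : 0 ≤ ε⁻¹ * PP n W ζ := by positivity
    unfold EE at hE; linarith
  unfold DD at this
  linarith

lemma EE_P {n : ℕ} (hn : 2 ≤ n) {W : ℝ → ℝ} {ζ : ℝ → ℝ} {ε E0 : ℝ} (hε : 0 < ε)
    (hE : EE n W ε ζ ≤ E0) : (∫ r, W (ζ r) ∂mu n) ≤ ε * (E0 / cn n) := by
  have h2 := DD_nonneg hn ζ
  have hcn := cn_pos n hn
  rw [mul_div_assoc', le_div_iff₀ hcn]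
  have : ε⁻¹ * PP n W ζ ≤ E0 := by
    have : 0 ≤ ε * DD n ζ := by positivity
    unfold EE at hE; linarith
  rw [inv_mul_le_iff₀ hε] at this
  unfold PP at this
  linarith

lemma PF.contW1 {W W1 : ℝ → ℝ} {δ Cp : ℝ} (hp : PF W W1 δ Cp) : ContinuousOn W1 (Icc 0 1) := by
  have hCp := hp.Cge
  have : LipschitzOnWith (Real.toNNReal Cp) W1 (Icc 0 1) := by
    apply LipschitzOnWith.of_dist_le_mul
    intro x hx y hy
    rw [Real.dist_eq, Real.dist_eq, Real.coe_toNNReal _ (by linarith)]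
    exact hp.d2 x hx y hy
  exact this.continuousOn

lemma supp_deriv {g : ℝ → ℝ} {a b : ℝ} (hz : ∀ r, r ∉ Icc a b → g r = 0) : ∀ r, r ∉ Icc a b → deriv g r = 0 := by
  intro r hr
  have : g =ᶠ[nhds r] fun _ => 0 := by
    filter_upwards [isClosed_Icc.isOpen_compl.mem_nhds hr] with x hx using hz x hx
  rw [this.deriv_eq]; simp

lemma Adm.test {n : ℕ} {ζ g : ℝ → ℝ} (h : Adm n ζ) {a b v : ℝ} (ha : 0 < a) (hab : a ≤ b) (gd : Differentiable ℝ g)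
    (hz : ∀ r, r ∉ Icc a b → g r = 0) (b1 : ∀ r, |g r| ≤ v) (b2 : ∀ r, |deriv g r| ≤ v)
    (hmem : ∀ r, ζ r + g r ∈ Icc (0:ℝ) 1) : Adm n (fun r => ζ r + g r) := by
  have hd : ∀ r, HasDerivAt (fun r => ζ r + g r) (deriv ζ r + deriv g r) r := fun r => (h.diff r).hasDerivAt.fun_add (gd r).hasDerivAt
  have hz' := supp_deriv hz
  have sqb : ∀ {x : ℝ}, |x| ≤ v → |x^2| ≤ v^2 := by
    intro x hx; rw [abs_pow]; exact pow_le_pow_left₀ (abs_nonneg _) hx 2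
  refine ⟨fun r => (hd r).differentiableAt, ?_, hmem, ?_, ?_⟩
  · rw [(hd 0).deriv, h.d0, hz' 0 (by simp [ha])]; simp
  · apply int_add_sq h.ms gd.continuous.aestronglyMeasurable h.sq
    exact (mu_supp n (f := fun r => g r^2) (gd.continuous.pow 2).aestronglyMeasurable ha.le hab (sq_nonneg v) (fun r _ => sqb (b1 r)) (fun r _ hr => by rw [hz r hr]; simp)).1
  · simp_rw [fun r => (hd r).deriv]
    apply int_add_sq (der_ms ζ) (der_ms g) h.dsq
    exact (mu_supp n (f := fun r => deriv g r^2) ((measurable_deriv g).pow_const 2).aestronglyMeasurable ha.le hab (sq_nonneg v) (fun r _ => sqb (b2 r)) (fun r _ hr => by rw [hz' r hr]; simp)).1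

lemma FV_test {n : ℕ} (hn : 2 ≤ n) {W W1 : ℝ → ℝ} {δ Cp Cv : ℝ} (hp : PF W W1 δ Cp) (hv : VF n W W1 δ Cv) {ε : ℝ} (hε : 0 < ε) {ζ g : ℝ → ℝ}
    (hm : Minz n W ε ζ) {a b v : ℝ} (ha : 0 < a) (hab : a ≤ b) (gd : Differentiable ℝ g)
    (hz : ∀ r, r ∉ Icc a b → g r = 0) (b1 : ∀ r, |g r| ≤ v) (b2 : ∀ r, |deriv g r| ≤ v) {τ : ℝ} (hτ : 0 < τ)
    (hmem : ∀ r, ζ r + τ * g r ∈ Icc (0:ℝ) 1) :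
    0 ≤ 2 * ε * (∫ r, deriv ζ r * deriv g r ∂mu n) + ε⁻¹ * (∫ r, W1 (ζ r) * g r ∂mu n)
      - Lam n W ε ζ * ∫ r, V1 n W (ζ r) * g r ∂mu n := by
  have hd' : ∀ r, HasDerivAt (fun r => τ * g r) (τ * deriv g r) r := fun r => (gd r).hasDerivAt.const_mul τ
  have hA : Adm n (fun r => ζ r + τ * g r) := by
    apply hm.adm.test ha hab (g := fun r => τ * g r) (v := τ * v) (fun r => (hd' r).differentiableAt)
    · intro r hr; rw [hz r hr, mul_zero]
    · intro r; rw [abs_mul, abs_of_pos hτ]; exact mul_le_mul_of_nonneg_left (b1 r) hτ.le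
    · intro r; rw [(hd' r).deriv, abs_mul, abs_of_pos hτ]; exact mul_le_mul_of_nonneg_left (b2 r) hτ.le
    · exact hmem
  have h := FV hn hp hv hε hm hA
  have e1 : ∀ r, deriv (fun r => ζ r + τ * g r) r - deriv ζ r = τ * deriv g r := by
    intro r
    rw [((hm.adm.diff r).hasDerivAt.fun_add (hd' r)).deriv]; ring
  simp_rw [e1, add_sub_cancel_left, mul_left_comm _ τ] at h
  rw [integral_const_mul, integral_const_mul, integral_const_mul] at h
  refine nonneg_of_mul_nonneg_right (a := τ) ?_ hτ
  refine h.trans (le_of_eq (by ring))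

set_option maxHeartbeats 1000000 in
/-- in the degenerate case the minimizer is `1` near the origin -/
lemma core_one {n : ℕ} (hn : 2 ≤ n) {W W1 : ℝ → ℝ} {δ Cp Cv : ℝ} (hp : PF W W1 δ Cp) (hv : VF n W W1 δ Cv) (hb : W1 1 < 0) {E0 ra : ℝ} (hE0 : 1 ≤ E0) (hra : 0 < ra) :
    ∃ ε2, 0 < ε2 ∧ ε2 ≤ 1 ∧ ∀ ε, 0 < ε → ε ≤ ε2 → ∀ ζ, Minz n W ε ζ → EE n W ε ζ ≤ E0 → 1 - δ ≤ ζ (2*ra) → ζ ra = 1 := by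
  have hcn := cn_pos n hn
  have hCp := hp.Cge
  let f : ContDiffBump (3*ra/2) := ⟨ra/4, ra/2, by positivity, by linarith⟩
  have fc : ContDiff ℝ 1 f := f.contDiff
  have fd : Differentiable ℝ f := fc.differentiable (by norm_num)
  have fdc : Continuous (deriv f) := fc.continuous_deriv (by norm_num)
  have fz : ∀ r, r ∉ Icc ra (2*ra) → f r = 0 := by
    intro r hr
    apply f.zero_of_le_dist
    by_contra h
    push Not at h
    rw [Real.dist_eq, abs_lt] at h
    apply hr
    have : f.rOut = ra/2 := rfl
    rw [this] at h
    constructor <;> linarith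
  have fdz := supp_deriv fz
  obtain ⟨B, hB⟩ := isCompact_Icc.exists_bound_of_continuousOn (fdc.continuousOn (s := Icc ra (2*ra)))
  have hB' : ∀ r, |deriv f r| ≤ max B 1 := by
    intro r
    by_cases hr : r ∈ Icc ra (2*ra)
    · exact (hB r hr).trans (le_max_left _ _)
    · rw [fdz r hr]; simp
  have f1 : ∀ r, |f r| ≤ max B 1 := by
    intro r; rw [abs_of_nonneg f.nonneg]; exact f.le_one.trans (le_max_right _ _)
  have fi : Integrable (fun r => f r) (mu n) := (mu_supp n fd.continuous.aestronglyMeasurable hra.le (by linarith) (le_max_of_le_right zero_le_one) (fun r _ => f1 r) (fun r _ => fz r)).1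
  have fdi : Integrable (fun r => deriv f r^2) (mu n) := by
    refine (mu_supp n (f := fun r => deriv f r^2) (v := (max B 1)^2) (fdc.pow 2).aestronglyMeasurable hra.le (by linarith : ra ≤ 2*ra) (by positivity) (fun r _ => ?_) (fun r _ hr => by rw [fdz r hr]; simp)).1
    rw [abs_pow]; exact pow_le_pow_left₀ (abs_nonneg _) (hB' r) 2
  set G := ∫ r, deriv f r^2 ∂mu n
  have hG : 0 ≤ G := integral_nonneg fun r => sq_nonneg _
  set m := ∫ r, f r ∂mu n
  have hm0 : 0 < m := by
    have h0 : ∀ r, 0 ≤ f r := fun r => f.nonneg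
    have h2 := mu_local_le fi h0 (a := 5*ra/4) (b := 7*ra/4) (by positivity)
    have h3 : ∫ r in Ioc (5*ra/4) (7*ra/4), f r = ∫ r in Ioc (5*ra/4) (7*ra/4), (1:ℝ) := by
      apply setIntegral_congr_fun measurableSet_Ioc
      intro r hr
      apply f.one_of_mem_closedBall
      rw [Metric.mem_closedBall, Real.dist_eq, abs_le]
      have : f.rIn = ra/4 := rfl
      rw [this]
      constructor <;> linarith [hr.1, hr.2]
    rw [h3] at h2
    simp only [integral_const, MeasurableSet.univ, measureReal_restrict_apply, univ_inter, Real.volume_real_Ioc, smul_eq_mul, mul_one] at h2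
    rw [max_eq_left (by linarith)] at h2
    have : 0 < (5*ra/4)^(n-1) * (7*ra/4 - 5*ra/4) := by
      apply mul_pos (by positivity); linarith
    linarith
  refine ⟨min 1 (m/Cp / (2*(E0/cn n + G))), by positivity, min_le_left _ _, ?_⟩
  intro ε hε hεl ζ hm hE hz
  by_contra hne
  set τ := 1 - ζ ra with hτ
  have hτ0 : 0 < τ := by
    have := (hm.adm.mem ra).2
    rcases lt_or_eq_of_le this with h | h
    · linarith
    · exact absurd h hne
  have hloc : ∀ r ∈ Icc ra (2*ra), ζ r ∈ Icc (1-2*δ) 1 ∧ ζ r ≤ 1 - τ := by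
    intro r hr
    have h1 := hm.anti (show (0:ℝ) ≤ r by linarith [hr.1]) (show (0:ℝ) ≤ 2*ra by linarith) hr.2
    have h2 := hm.anti (show (0:ℝ) ≤ ra from hra.le) (show (0:ℝ) ≤ r by linarith [hr.1]) hr.1
    have := hp.dpos
    exact ⟨⟨by linarith, (hm.adm.mem r).2⟩, by linarith⟩
  have hFV := FV_test hn hp hv hε hm hra (by linarith) fd fz f1 hB' hτ0 (by
    intro r
    by_cases hr : r ∈ Icc ra (2*ra)
    · have h1 := hloc r hr
      have h2 : 0 ≤ f r := f.nonneg
      have h3 : f r ≤ 1 := f.le_one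
      have h4 := (hm.adm.mem r).1
      constructor
      · positivity
      · nlinarith
    · rw [fz r hr]; simpa using hm.adm.mem r)
  have hV : 0 ≤ Lam n W ε ζ * ∫ r, V1 n W (ζ r) * f r ∂mu n :=
    mul_nonneg (Lam_nonneg hn hp hm.adm hε) (integral_nonneg fun r => mul_nonneg (hv.v1 _ (hm.adm.mem r)).1 f.nonneg)
  have hWi : ∫ r, W1 (ζ r) * f r ∂mu n ≤ -(m/Cp) := by
    have : -(m/Cp) = ∫ r, (-(1/Cp)) * f r ∂mu n := by rw [integral_const_mul]; ring
    rw [this]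
    have hle : ∀ r, W1 (ζ r) * f r ≤ -(1/Cp) * f r := by
      intro r
      by_cases hr : r ∈ Icc ra (2*ra)
      · have h1 := (hp.f7d hb (ζ r) (hloc r hr).1).2
        apply mul_le_mul_of_nonneg_right _ f.nonneg
        rw [le_neg, div_le_iff₀ (by linarith)]; linarith
      · rw [fz r hr]; simp
    apply integral_mono _ (fi.const_mul _) hle
    have hc : Continuous fun r => W1 (ζ r) * f r := by
      apply Continuous.mul _ fd.continuous
      exact contOn_comp hp.contW1 hm.adm.diff.continuous hm.adm.mem
    refine (fi.const_mul Cp).mono' hc.aestronglyMeasurable ?_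
    filter_upwards with r
    rw [Real.norm_eq_abs, abs_mul, abs_of_nonneg (f.nonneg (x := r))]
    apply mul_le_mul_of_nonneg_right _ f.nonneg
    have := hp.f1a _ (hm.adm.mem r)
    have := (hm.adm.mem r).2
    nlinarith
  have hDi : 2 * ε * (∫ r, deriv ζ r * deriv f r ∂mu n) ≤ E0/cn n + G := by
    have h1 : ∫ r, deriv ζ r * deriv f r ∂mu n ≤ ∫ r, (1/2) * (deriv ζ r^2 + deriv f r^2) ∂mu n := by
      apply integral_mono (int_mul_sq (der_ms ζ) (der_ms f) hm.adm.dsq fdi) ((hm.adm.dsq.fun_add fdi).const_mul _)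
      intro r
      simp only
      nlinarith [sq_nonneg (deriv ζ r - deriv f r)]
    rw [integral_const_mul, integral_add hm.adm.dsq fdi] at h1
    have h2 := EE_D hn hp hm.adm hε hE
    have h3 : ε * G ≤ 1 * G := by
      apply mul_le_mul_of_nonneg_right _ hG
      exact hεl.trans (min_le_left _ _)
    have h4 := mul_le_mul_of_nonneg_left h1 (show 0 ≤ 2*ε by positivity)
    calc _ ≤ _ := h4
      _ = ε * (∫ r, deriv ζ r^2 ∂mu n) + ε * G := by ring
      _ ≤ _ := by linarith
  have hpos : 0 < E0/cn n + G := by positivity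
  have h1 : ε⁻¹ * (m/Cp) ≤ E0/cn n + G := by
    have := mul_le_mul_of_nonneg_left hWi (inv_nonneg.2 hε.le)
    linarith
  rw [inv_mul_le_iff₀ hε] at h1
  have h2 := hεl.trans (min_le_right _ _)
  rw [le_div_iff₀ (by positivity)] at h2
  have : 0 < m/Cp := by positivity
  linarith


def Ws (W W1 : ℝ → ℝ) (t : ℝ) : ℝ := 2 * √(W t) * pdv W W1 t

lemma Ws_Ioo {W W1 : ℝ → ℝ} {δ Cp : ℝ} (hp : PF W W1 δ Cp) {t : ℝ} (ht : t ∈ Ioo (0:ℝ) 1) : Ws W W1 t = W1 t := by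
  have : 0 < √(W t) := Real.sqrt_pos.2 (hp.pos t ht)
  unfold Ws pdv
  field_simp

lemma Ws_zero {W W1 : ℝ → ℝ} {δ Cp : ℝ} (hp : PF W W1 δ Cp) : Ws W W1 0 = 0 := by simp [Ws, hp.z0]
lemma Ws_one {W W1 : ℝ → ℝ} {δ Cp : ℝ} (hp : PF W W1 δ Cp) : Ws W W1 1 = 0 := by simp [Ws, hp.z1]
lemma Ws_lt {W W1 : ℝ → ℝ} {δ Cp : ℝ} (hp : PF W W1 δ Cp) {t : ℝ} (h0 : 0 ≤ t) (h1 : t < 1) : Ws W W1 t = W1 t := by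
  rcases eq_or_lt_of_le h0 with h | h
  · rw [← h, Ws_zero hp, hp.z10]
  · exact Ws_Ioo hp ⟨h, h1⟩

lemma Ws_bd {W W1 : ℝ → ℝ} {δ Cp : ℝ} (hp : PF W W1 δ Cp) {t : ℝ} (ht : t ∈ Icc (0:ℝ) 1) : |Ws W W1 t| ≤ Cp * t := by
  rcases eq_or_lt_of_le ht.2 with h | h
  · rw [h, Ws_one hp]; have := hp.Cge; simp; linarith
  · rw [Ws_lt hp ht.1 h]; exact hp.f1a t ht

lemma ae_mu_ne {n : ℕ} (a : ℝ) : ∀ᵐ r ∂mu n, r ≠ a := by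
  apply mu_ae_of_vol
  have : ∀ᵐ r : ℝ, r ≠ a := by
    rw [ae_iff]; simp
  filter_upwards [this] with r hr _ using hr

lemma Adm.cut_deriv {n : ℕ} {ζ u η : ℝ → ℝ} (h1 : Adm n ζ) (h2 : Adm n u) (hd : Differentiable ℝ η) (r : ℝ) :
    HasDerivAt (fun r => ζ r + (u r - ζ r) * η r) (deriv ζ r + ((deriv u r - deriv ζ r) * η r + (u r - ζ r) * deriv η r)) r :=
  (h1.diff r).hasDerivAt.fun_add (((h2.diff r).hasDerivAt.fun_sub (h1.diff r).hasDerivAt).fun_mul (hd r).hasDerivAt)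

lemma int_mul_bd {μ : Measure ℝ} {f g : ℝ → ℝ} {B : ℝ} (hf : Integrable (fun r => f r^2) μ) (hfm : AEStronglyMeasurable f μ) (hg : AEStronglyMeasurable g μ)
    (hb : ∀ r, |g r| ≤ B) : Integrable (fun r => (f r * g r)^2) μ := by
  refine (hf.const_mul (B^2)).mono' ((hfm.mul hg).pow 2) ?_
  filter_upwards with r
  rw [Real.norm_eq_abs, abs_pow, abs_mul, mul_pow, sq_abs]
  have := pow_le_pow_left₀ (abs_nonneg _) (hb r) 2
  nlinarith [sq_nonneg (f r)]

lemma Adm.cut {n : ℕ} {ζ u η : ℝ → ℝ} (h1 : Adm n ζ) (h2 : Adm n u) (hd : Differentiable ℝ η) (hm : ∀ r, η r ∈ Icc (0:ℝ) 1)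
    {B : ℝ} (hB : ∀ r, |deriv η r| ≤ B) (h0 : deriv η 0 = 0) : Adm n (fun r => ζ r + (u r - ζ r) * η r) := by
  have hs := int_sub_sq h2.ms h1.ms h2.sq h1.sq
  have hs' := int_sub_sq (der_ms u) (der_ms ζ) h2.dsq h1.dsq
  have ems : AEStronglyMeasurable η (mu n) := hd.continuous.aestronglyMeasurable
  have eb : ∀ r, |η r| ≤ 1 := fun r => by rw [abs_of_nonneg (hm r).1]; exact (hm r).2
  have uz : AEStronglyMeasurable (fun r => u r - ζ r) (mu n) := h2.ms.sub h1.ms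
  have uz' : AEStronglyMeasurable (fun r => deriv u r - deriv ζ r) (mu n) := (der_ms u).sub (der_ms ζ)
  refine ⟨fun r => (h1.cut_deriv h2 hd r).differentiableAt, ?_, ?_, ?_, ?_⟩
  · rw [(h1.cut_deriv h2 hd 0).deriv, h1.d0, h2.d0, h0]; simp
  · intro r
    have a := h1.mem r
    have b := h2.mem r
    have ht := hm r
    constructor
    · nlinarith [a.1, b.1, ht.1, ht.2, mul_nonneg ht.1 b.1, mul_nonneg (sub_nonneg.2 ht.2) a.1]
    · nlinarith [a.2, b.2, ht.1, ht.2, mul_nonneg ht.1 (sub_nonneg.2 b.2), mul_nonneg (sub_nonneg.2 ht.2) (sub_nonneg.2 a.2)]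
  · exact int_add_sq h1.ms (uz.mul ems) h1.sq (int_mul_bd hs uz ems eb)
  · simp_rw [fun r => (h1.cut_deriv h2 hd r).deriv]
    apply int_add_sq (der_ms ζ) ((uz'.mul ems).add (uz.mul (der_ms η))) h1.dsq
    exact int_add_sq (uz'.mul ems) (uz.mul (der_ms η)) (int_mul_bd hs' uz' ems eb) (int_mul_bd hs uz (der_ms η) hB)

lemma deriv_zero_of_one {n : ℕ} {ζ : ℝ → ℝ} (h : Adm n ζ) {r : ℝ} (hr : ζ r = 1) : deriv ζ r = 0 := by
  apply IsLocalMax.deriv_eq_zero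
  filter_upwards with x
  rw [hr]; exact (h.mem x).2

lemma deriv_zero_of_zero {n : ℕ} {ζ : ℝ → ℝ} (h : Adm n ζ) {r : ℝ} (hr : ζ r = 0) : deriv ζ r = 0 := by
  apply IsLocalMin.deriv_eq_zero
  filter_upwards with x
  rw [hr]; exact (h.mem x).1

set_option maxHeartbeats 1000000 in
lemma FVs {n : ℕ} (hn : 2 ≤ n) {W W1 : ℝ → ℝ} {δ Cp Cv : ℝ} (hp : PF W W1 δ Cp) (hv : VF n W W1 δ Cv) {ε : ℝ} (hε : 0 < ε) {ζ u : ℝ → ℝ}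
    (hm : Minz n W ε ζ) (hu : Adm n u)
    (hs : W1 1 = 0 ∨ ∃ rs, 0 < rs ∧ (∀ r ∈ Icc 0 rs, ζ r = 1) ∧ ∀ r, rs < r → ζ r < 1) :
    0 ≤ 2 * ε * (∫ r, deriv ζ r * (deriv u r - deriv ζ r) ∂mu n) + ε⁻¹ * (∫ r, Ws W W1 (ζ r) * (u r - ζ r) ∂mu n)
      - Lam n W ε ζ * ∫ r, V1 n W (ζ r) * (u r - ζ r) ∂mu n := by
  have hζ := hm.adm
  have hCp := hp.Cge
  rcases hs with hs | ⟨rs, hrs, hone, hlt⟩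
  · have h := FV hn hp hv hε hm hu
    have : ∀ r, Ws W W1 (ζ r) = W1 (ζ r) := by
      intro r
      rcases eq_or_lt_of_le (hζ.mem r).2 with h | h
      · rw [h, Ws_one hp, hs]
      · exact Ws_lt hp (hζ.mem r).1 h
    simp_rw [this]; exact h
  obtain ⟨B, hB0, hB⟩ := SS_dbd
  set η : ℝ → ℝ → ℝ := fun j r => 1 - SS (j * (r - rs) + 1) with hη
  have ηd : ∀ j r, HasDerivAt (η j) (-(deriv SS (j * (r - rs) + 1) * j)) r := by
    intro j r
    have h1 : HasDerivAt (fun r => j * (r - rs) + 1) j r := by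
      have := (((hasDerivAt_id r).sub_const rs).const_mul j).add_const 1
      simpa using this
    exact ((SS_diff _).hasDerivAt.comp r h1).const_sub 1
  have ev : ∀ᶠ j in (atTop : Filter ℝ), 1 / rs < j := eventually_gt_atTop _
  have ηone : ∀ j r, 0 < j → rs ≤ r → η j r = 1 := by
    intro j r hj hr
    have : 1 ≤ j * (r - rs) + 1 := by have := mul_nonneg hj.le (sub_nonneg.2 hr); linarith
    simp [hη, SS_right this]
  have key : ∀ j, 1/rs < j → 0 ≤ 2 * ε * (∫ r, deriv ζ r * (deriv u r - deriv ζ r) ∂mu n) + ε⁻¹ * (∫ r, W1 (ζ r) * ((u r - ζ r) * η j r) ∂mu n)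
      - Lam n W ε ζ * ∫ r, V1 n W (ζ r) * (u r - ζ r) ∂mu n := by
    intro j hj
    have hj0 : 0 < j := lt_trans (by positivity) hj
    have hd : Differentiable ℝ (η j) := fun r => (ηd j r).differentiableAt
    have hA := hζ.cut hu hd (fun r => ⟨by have := (SS_mem (j * (r - rs) + 1)).2; simp only [hη]; linarith, by have := (SS_mem (j * (r - rs) + 1)).1; simp only [hη]; linarith⟩)
      (B := B * j) (by intro r; rw [(ηd j r).deriv, abs_neg, abs_mul, abs_of_pos hj0]; exact mul_le_mul_of_nonneg_right (hB _) hj0.le)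
      (by
        rw [(ηd j 0).deriv, SS_dleft]; simp
        rw [div_lt_iff₀ hrs] at hj; linarith)
    have h := FV hn hp hv hε hm hA
    simp_rw [add_sub_cancel_left] at h
    have e1 : ∫ r, deriv ζ r * (deriv (fun r => ζ r + (u r - ζ r) * η j r) r - deriv ζ r) ∂mu n = ∫ r, deriv ζ r * (deriv u r - deriv ζ r) ∂mu n := by
      apply integral_congr_ae
      filter_upwards [mu_ae_pos n] with r hr
      rw [(hζ.cut_deriv hu hd r).deriv]
      rcases le_or_gt r rs with h | h
      · rw [deriv_zero_of_one hζ (hone r ⟨le_of_lt hr, h⟩)]; simp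
      · rw [ηone j r hj0 h.le, (ηd j r).deriv, SS_dright]
        · ring
        · have := mul_pos hj0 (sub_pos.2 h); linarith
    have e2 : ∫ r, V1 n W (ζ r) * ((u r - ζ r) * η j r) ∂mu n = ∫ r, V1 n W (ζ r) * (u r - ζ r) ∂mu n := by
      apply integral_congr_ae
      filter_upwards [mu_ae_pos n] with r hr
      rcases le_or_gt r rs with h | h
      · have : V1 n W 1 = 0 := by simp [V1, hp.z1]
        rw [hone r ⟨le_of_lt hr, h⟩, this]; simp
      · rw [ηone j r hj0 h.le, mul_one]
    rw [e1, e2] at h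
    exact h
  have lim : Tendsto (fun j => ∫ r, W1 (ζ r) * ((u r - ζ r) * η j r) ∂mu n) atTop (nhds (∫ r, Ws W W1 (ζ r) * (u r - ζ r) ∂mu n)) := by
    apply tendsto_integral_filter_of_dominated_convergence (fun r => Cp * (ζ r * |u r - ζ r|))
    · filter_upwards with j
      have hd : Differentiable ℝ (η j) := fun r => (ηd j r).differentiableAt
      exact ((contOn_comp hp.contW1 hζ.diff.continuous hζ.mem).mul ((hu.diff.continuous.sub hζ.diff.continuous).mul hd.continuous)).aestronglyMeasurable
    · filter_upwards with j
      filter_upwards with r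
      have h1 := hp.f1a _ (hζ.mem r)
      have h2 : |η j r| ≤ 1 := by
        have := SS_mem (j * (r - rs) + 1)
        rw [abs_le]; simp only [hη]; constructor <;> linarith [this.1, this.2]
      rw [Real.norm_eq_abs, abs_mul, abs_mul]
      calc |W1 (ζ r)| * (|u r - ζ r| * |η j r|) ≤ (Cp * ζ r) * (|u r - ζ r| * 1) := by
            have := (abs_nonneg _).trans h1
            gcongr
        _ = _ := by ring
    · apply Integrable.const_mul
      apply int_mul_sq hζ.ms (hu.diff.continuous.sub hζ.diff.continuous).abs.aestronglyMeasurable hζ.sq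
      simp only [Pi.abs_apply, Pi.sub_apply, sq_abs]
      exact int_sub_sq hu.ms hζ.ms hu.sq hζ.sq
    · filter_upwards [mu_ae_pos n, ae_mu_ne rs] with r hr hne
      rcases lt_or_gt_of_ne hne with h | h
      · rw [hone r ⟨le_of_lt hr, h.le⟩, Ws_one hp, zero_mul]
        apply tendsto_const_nhds.congr'
        filter_upwards [eventually_gt_atTop (1/(rs - r))] with j hj
        rw [div_lt_iff₀ (by linarith)] at hj
        have : η j r = 0 := by simp only [hη]; rw [SS_left (by linarith)]; simp
        rw [this]; simp
      · apply tendsto_const_nhds.congr'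
        filter_upwards [eventually_gt_atTop 0] with j hj
        rw [ηone j r hj h.le, mul_one, Ws_lt hp (hζ.mem r).1 (hlt r h)]
  refine ge_of_tendsto (((lim.const_mul ε⁻¹).const_add _).sub_const _) ?_
  filter_upwards [ev] with j hj using key j hj


lemma VF.contV1 {n : ℕ} (hn : 2 ≤ n) {W W1 : ℝ → ℝ} {δ Cp Cv : ℝ} (hp : PF W W1 δ Cp) (hv : VF n W W1 δ Cv) : ContinuousOn (V1 n W) (Icc 0 1) := by
  have hn2 : (2:ℝ) ≤ n := by exact_mod_cast hn
  have h1 : ContinuousOn (Phi W) (Icc 0 1) := fun t ht => (hv.dPhi t ht).continuousWithinAt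
  unfold V1
  apply ContinuousOn.mul (hp.contW.sqrt.mul continuousOn_const)
  apply h1.rpow_const
  intro t _
  right
  rw [sub_nonneg, le_div_iff₀ (by linarith)]; linarith

lemma EL_weak {n : ℕ} (hn : 2 ≤ n) {W W1 : ℝ → ℝ} {δ Cp Cv : ℝ} (hp : PF W W1 δ Cp) (hv : VF n W W1 δ Cv) {ε : ℝ} (hε : 0 < ε) {ζ g : ℝ → ℝ}
    (hm : Minz n W ε ζ) {a b v : ℝ} (ha : 0 < a) (hab : a ≤ b) (h1 : ζ a < 1) (h2 : 0 < ζ b) (gd : Differentiable ℝ g)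
    (hz : ∀ r, r ∉ Icc a b → g r = 0) (b1 : ∀ r, |g r| ≤ v) (b2 : ∀ r, |deriv g r| ≤ v) :
    2 * ε * (∫ r, deriv ζ r * deriv g r ∂mu n) + ε⁻¹ * (∫ r, W1 (ζ r) * g r ∂mu n)
      - Lam n W ε ζ * ∫ r, V1 n W (ζ r) * g r ∂mu n = 0 := by
  have hv0 : 0 ≤ v := (abs_nonneg _).trans (b1 0)
  set τ := min (ζ b) (1 - ζ a) / (v + 1) with hτ
  have hm0 : 0 < min (ζ b) (1 - ζ a) := lt_min h2 (by linarith)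
  have hτ0 : 0 < τ := by positivity
  have hb : ∀ r, |τ * g r| ≤ min (ζ b) (1 - ζ a) := by
    intro r
    rw [abs_mul, abs_of_pos hτ0, hτ, div_mul_eq_mul_div, div_le_iff₀ (by linarith)]
    apply mul_le_mul_of_nonneg_left _ hm0.le
    linarith [b1 r]
  have hmem : ∀ σ : ℝ, |σ| = 1 → ∀ r, ζ r + τ * (σ * g r) ∈ Icc (0:ℝ) 1 := by
    intro σ hσ r
    by_cases hr : r ∈ Icc a b
    · have k1 := hm.anti (show (0:ℝ) ≤ r by linarith [hr.1]) (show (0:ℝ) ≤ b by linarith) hr.2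
      have k2 := hm.anti (show (0:ℝ) ≤ a from ha.le) (show (0:ℝ) ≤ r by linarith [hr.1]) hr.1
      have k3 : |τ * (σ * g r)| ≤ min (ζ b) (1 - ζ a) := by
        have := hb r
        rw [abs_mul] at this ⊢
        rwa [abs_mul, hσ, one_mul]
      have k4 := abs_le.1 (k3.trans (min_le_left _ _))
      have k5 := abs_le.1 (k3.trans (min_le_right _ _))
      constructor <;> linarith [k4.1, k5.2]
    · rw [hz r hr]; simpa using hm.adm.mem r
  have A := FV_test hn hp hv hε hm ha hab gd hz b1 b2 hτ0 (by simpa using hmem 1 (by simp))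
  have gd' : ∀ r, HasDerivAt (fun r => -g r) (-deriv g r) r := fun r => (gd r).hasDerivAt.fun_neg
  have B := FV_test hn hp hv hε hm (g := fun r => -g r) (v := v) ha hab (fun r => (gd' r).differentiableAt) (fun r hr => by simp [hz r hr]) (by simpa using b1)
    (fun r => by rw [(gd' r).deriv, abs_neg]; exact b2 r) hτ0 (by simpa using hmem (-1) (by simp))
  simp_rw [fun r => (gd' r).deriv, mul_neg, integral_neg] at B
  linarith

set_option maxHeartbeats 1000000 in
lemma EL_class {n : ℕ} (hn : 2 ≤ n) {W W1 : ℝ → ℝ} {δ Cp Cv : ℝ} (hp : PF W W1 δ Cp) (hv : VF n W W1 δ Cv) {ε : ℝ} (hε : 0 < ε) {ζ : ℝ → ℝ}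
    (hm : Minz n W ε ζ) {c d : ℝ} (hc : 0 < c) (hcd : c < d) (h1 : ζ c < 1) (h2 : 0 < ζ d) :
    ∃ K : ℝ, ∀ r ∈ Ioo c d, 2 * ε * (r^(n-1) * deriv ζ r) = K + ∫ s in c..r, s^(n-1) * (ε⁻¹ * W1 (ζ s) - Lam n W ε ζ * V1 n W (ζ s)) := by
  have hζ := hm.adm
  set Λ := Lam n W ε ζ
  set q : ℝ → ℝ := fun s => s^(n-1) * (ε⁻¹ * W1 (ζ s) - Λ * V1 n W (ζ s)) with hq
  have cW1 : Continuous fun s => W1 (ζ s) := contOn_comp hp.contW1 hζ.diff.continuous hζ.mem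
  have cV1 : Continuous fun s => V1 n W (ζ s) := contOn_comp (hv.contV1 hn hp) hζ.diff.continuous hζ.mem
  have cq : Continuous q := (continuous_pow (n-1)).mul ((cW1.const_mul ε⁻¹).sub (cV1.const_mul Λ))
  set Q : ℝ → ℝ := fun r => ∫ s in c..r, q s with hQ
  have dQ : ∀ r, HasDerivAt Q (q r) r := fun r => (cq.integral_hasStrictDerivAt c r).hasDerivAt
  have cQ : Continuous Q := by
    rw [continuous_iff_continuousAt]; exact fun r => (dQ r).continuousAt
  set f : ℝ → ℝ := fun r => 2 * ε * (r^(n-1) * deriv ζ r) - Q r with hf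
  have hd0 : 0 ≤ d := by linarith
  have fint : IntegrableOn f (Icc c d) := by
    have i1 := hζ.derInt hc hcd.le
    rw [intervalIntegrable_iff_integrableOn_Icc_of_le hcd.le] at i1
    have i2 : IntegrableOn (fun r => r^(n-1) * deriv ζ r) (Icc c d) :=
      i1.continuousOn_mul (by fun_prop) isCompact_Icc
    exact (i2.const_mul (2*ε)).sub (cQ.continuousOn.integrableOn_compact isCompact_Icc)
  -- weak identity
  have key : ∀ ψ : ℝ → ℝ, Continuous ψ → (∀ r, r ∉ Icc c d → ψ r = 0) → ∫ r in c..d, ψ r = 0 → ∫ r in c..d, f r * ψ r = 0 := by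
    intro ψ cψ zψ mψ
    set φ : ℝ → ℝ := fun r => ∫ s in c..r, ψ s with hφ
    have dφ : ∀ r, HasDerivAt φ (ψ r) r := fun r => (cψ.integral_hasStrictDerivAt c r).hasDerivAt
    have φd : φ d = 0 := mψ
    have φc : φ c = 0 := by simp [hφ]
    have zφ : ∀ r, r ∉ Icc c d → φ r = 0 := by
      intro r hr
      rw [mem_Icc, not_and_or, not_le, not_le] at hr
      rcases hr with hr | hr
      · simp only [hφ]
        rw [intervalIntegral.integral_symm, intervalIntegral.integral_zero_ae, neg_zero]
        have : ∀ᵐ x : ℝ, x ≠ c := by rw [ae_iff]; simp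
        filter_upwards [this] with x hx hx'
        rw [uIoc_of_le hr.le] at hx'
        exact zψ x (fun h => hx (le_antisymm hx'.2 h.1))
      · have : φ r = φ d + ∫ s in d..r, ψ s := by
          simp only [hφ]
          rw [intervalIntegral.integral_add_adjacent_intervals (cψ.intervalIntegrable _ _) (cψ.intervalIntegrable _ _)]
        rw [this, φd, zero_add]
        apply intervalIntegral.integral_zero_ae
        filter_upwards with x hx'
        rw [uIoc_of_le hr.le] at hx'
        exact zψ x (fun h => not_lt.2 h.2 hx'.1)
    have fφ : Differentiable ℝ φ := fun r => (dφ r).differentiableAt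
    obtain ⟨B1, hB1⟩ := isCompact_Icc.exists_bound_of_continuousOn (fφ.continuous.continuousOn (s := Icc c d))
    obtain ⟨B2, hB2⟩ := isCompact_Icc.exists_bound_of_continuousOn (cψ.continuousOn (s := Icc c d))
    set v := max (max B1 B2) 0
    have e := EL_weak hn hp hv hε hm (v := v) hc hcd.le h1 h2 fφ zφ (by
        intro r
        by_cases hr : r ∈ Icc c d
        · exact (hB1 r hr).trans ((le_max_left _ _).trans (le_max_left _ _))
        · rw [zφ r hr]; simp [v])
      (by
        intro r
        rw [(dφ r).deriv]
        by_cases hr : r ∈ Icc c d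
        · exact (hB2 r hr).trans ((le_max_right _ _).trans (le_max_left _ _))
        · rw [zψ r hr]; simp [v])
    have conv : ∀ F : ℝ → ℝ, (∀ r, r ∉ Icc c d → F r = 0) → ∫ r, F r ∂mu n = ∫ r in c..d, r^(n-1) * F r := by
      intro F hF
      rw [mu_integral, intervalIntegral.integral_of_le hcd.le, ← integral_Icc_eq_integral_Ioc]
      apply setIntegral_eq_of_subset_of_forall_sdiff_eq_zero measurableSet_Ioi
      · intro x hx; exact lt_of_lt_of_le hc hx.1
      · intro x hx; rw [hF x hx.2, mul_zero]
    rw [conv (fun r => deriv ζ r * deriv φ r) (fun r hr => by rw [(dφ r).deriv, zψ r hr, mul_zero]), conv (fun r => W1 (ζ r) * φ r) (fun r hr => by rw [zφ r hr, mul_zero]), conv (fun r => V1 n W (ζ r) * φ r) (fun r hr => by rw [zφ r hr, mul_zero])] at e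
    simp_rw [fun r => (dφ r).deriv] at e
    have ibp : ∫ r in c..d, Q r * ψ r = Q d * φ d - Q c * φ c - ∫ r in c..d, q r * φ r :=
      intervalIntegral.integral_mul_deriv_eq_deriv_mul (fun r _ => dQ r) (fun r _ => dφ r) (cq.intervalIntegrable _ _) (cψ.intervalIntegrable _ _)
    rw [φd, φc, mul_zero, mul_zero, sub_zero, zero_sub] at ibp
    have i1 : IntervalIntegrable (fun r => r^(n-1) * (deriv ζ r * ψ r)) volume c d := by
      rw [intervalIntegrable_iff_integrableOn_Icc_of_le hcd.le]
      have i1 := hζ.derInt hc hcd.le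
      rw [intervalIntegrable_iff_integrableOn_Icc_of_le hcd.le] at i1
      have i2 : IntegrableOn (fun r => r^(n-1) * (deriv ζ r * ψ r)) (Icc c d) :=
        (i1.mul_continuousOn cψ.continuousOn isCompact_Icc).continuousOn_mul (by fun_prop) isCompact_Icc
      exact i2
    have e1 : ∫ r in c..d, f r * ψ r = 2 * ε * (∫ r in c..d, r^(n-1) * (deriv ζ r * ψ r)) - ∫ r in c..d, Q r * ψ r := by
      have i2 : IntervalIntegrable (fun r => Q r * ψ r) volume c d := (cQ.mul cψ).intervalIntegrable _ _
      rw [← intervalIntegral.integral_const_mul, ← intervalIntegral.integral_sub (i1.const_mul _) i2]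
      congr 1; ext r; simp only [hf]; ring
    have e2 : ∫ r in c..d, q r * φ r = ε⁻¹ * (∫ r in c..d, r^(n-1) * (W1 (ζ r) * φ r)) - Λ * ∫ r in c..d, r^(n-1) * (V1 n W (ζ r) * φ r) := by
      have cφ := fφ.continuous
      rw [← intervalIntegral.integral_const_mul, ← intervalIntegral.integral_const_mul, ← intervalIntegral.integral_sub]
      · congr 1; ext r; simp only [hq]; ring
      · exact (((continuous_pow (n-1)).mul (cW1.mul cφ)).const_mul ε⁻¹).intervalIntegrable _ _
      · exact (((continuous_pow (n-1)).mul (cV1.mul cφ)).const_mul Λ).intervalIntegrable _ _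
    rw [e1, ibp, e2]
    linarith
  -- normalised bump
  let b0 : ContDiffBump ((c+d)/2) := ⟨(d-c)/8, (d-c)/4, by linarith, by linarith⟩
  have cb0 : Continuous b0 := b0.continuous
  have zb0 : ∀ r, r ∉ Icc c d → b0 r = 0 := by
    intro r hr
    apply b0.zero_of_le_dist
    by_contra h
    push Not at h
    rw [Real.dist_eq, abs_lt] at h
    apply hr
    have : b0.rOut = (d-c)/4 := rfl
    rw [this] at h
    constructor <;> linarith [h.1, h.2]
  set m0 := ∫ r in c..d, b0 r with hm0
  have m0p : 0 < m0 := by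
    rw [hm0]
    apply intervalIntegral.integral_pos hcd cb0.continuousOn (fun r _ => b0.nonneg)
    refine ⟨(c+d)/2, ⟨by linarith, by linarith⟩, ?_⟩
    exact b0.pos_of_mem_ball (by simp [b0.rOut_pos])
  set K := (∫ r in c..d, f r * b0 r)/m0 with hK
  have ifi : IntervalIntegrable f volume c d := by
    rw [intervalIntegrable_iff_integrableOn_Icc_of_le hcd.le]; exact fint
  have fae : ∀ᵐ r : ℝ, r ∈ Ioo c d → f r - K = 0 := by
    apply isOpen_Ioo.ae_eq_zero_of_integral_contDiff_smul_eq_zero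
    · apply LocallyIntegrableOn.sub
      · exact (fint.mono_set Ioo_subset_Icc_self).locallyIntegrableOn
      · exact (continuous_const).locallyIntegrable.locallyIntegrableOn _
    · intro g hg hgc hgs
      have cg : Continuous g := hg.continuous
      have zg : ∀ r, r ∉ Ioo c d → g r = 0 := by
        intro r hr
        by_contra hne
        exact hr (hgs (subset_tsupport _ hne))
      have zg' : ∀ r, r ∉ Icc c d → g r = 0 := fun r hr => zg r (fun h => hr (Ioo_subset_Icc_self h))
      set mg := ∫ r in c..d, g r with hmg
      have k := key (fun r => g r - (mg/m0) * b0 r) (by fun_prop) (fun r hr => by rw [zg' r hr, zb0 r hr]; simp) (by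
        have i5 : IntervalIntegrable (fun r => (mg/m0) * b0 r) volume c d := (cb0.const_mul _).intervalIntegrable _ _
        rw [intervalIntegral.integral_sub (cg.intervalIntegrable _ _) i5, intervalIntegral.integral_const_mul, ← hm0, ← hmg]
        field_simp; ring)
      have i1 : IntervalIntegrable (fun r => f r * g r) volume c d := ifi.mul_continuousOn cg.continuousOn
      have i2 : IntervalIntegrable (fun r => f r * b0 r) volume c d := ifi.mul_continuousOn cb0.continuousOn
      have e1 : ∫ r in c..d, f r * (g r - (mg/m0) * b0 r) = (∫ r in c..d, f r * g r) - (mg/m0) * ∫ r in c..d, f r * b0 r := by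
        rw [← intervalIntegral.integral_const_mul, ← intervalIntegral.integral_sub i1 (i2.const_mul _)]
        congr 1; ext r; ring
      have e2 : ∫ r, g r • (f r - K) = ∫ r in c..d, g r * (f r - K) := by
        rw [intervalIntegral.integral_of_le hcd.le, ← integral_Icc_eq_integral_Ioc]
        symm
        apply setIntegral_eq_integral_of_forall_compl_eq_zero
        intro r hr; rw [zg' r hr, zero_mul]
      have e3 : ∫ r in c..d, g r * (f r - K) = (∫ r in c..d, f r * g r) - K * mg := by
        rw [hmg, ← intervalIntegral.integral_const_mul, ← intervalIntegral.integral_sub i1 ((cg.intervalIntegrable _ _).const_mul _)]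
        congr 1; ext r; ring
      rw [e2, e3]
      rw [e1] at k
      rw [hK]
      linear_combination k
  -- pointwise
  refine ⟨K, fun r hr => ?_⟩
  set G : ℝ → ℝ := fun s => (K + Q s) / (2 * ε * s^(n-1)) with hG
  have cG : ContinuousOn G (Ioo c d) := by
    apply ContinuousOn.div (by fun_prop) (by fun_prop)
    intro s hs
    have : 0 < s := hc.trans hs.1
    positivity
  have zG : ∀ᵐ s : ℝ, s ∈ Ioo c d → deriv ζ s = G s := by
    filter_upwards [fae] with s hs hs'
    have h := hs hs'
    have : 0 < s := hc.trans hs'.1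
    simp only [hf] at h
    simp only [hG]
    rw [eq_div_iff (by positivity)]
    linear_combination h
  obtain ⟨a', ha'⟩ := exists_between hr.1
  obtain ⟨b', hb'⟩ := exists_between hr.2
  have sub : Icc a' b' ⊆ Ioo c d := fun x hx => ⟨ha'.1.trans_le hx.1, hx.2.trans_lt hb'.2⟩
  have eqz : ∀ s ∈ Icc a' b', ζ s = ζ a' + ∫ x in a'..s, G x := by
    intro s hs
    have e := hζ.ftc (a := a') (b := s) (by linarith [ha'.1]) hs.1
    have : ∫ x in a'..s, deriv ζ x = ∫ x in a'..s, G x := by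
      apply intervalIntegral.integral_congr_ae
      filter_upwards [zG] with x hx hx'
      rw [uIoc_of_le hs.1] at hx'
      exact hx (sub ⟨hx'.1.le, hx'.2.trans hs.2⟩)
    rw [← this, e]; ring
  have dG : HasDerivAt (fun s => ζ a' + ∫ x in a'..s, G x) (G r) r := by
    apply HasDerivAt.const_add
    apply intervalIntegral.integral_hasDerivAt_right
    · apply ContinuousOn.intervalIntegrable
      apply cG.mono
      rw [uIcc_of_le ha'.2.le]
      exact fun x hx => sub ⟨hx.1, hx.2.trans hb'.1.le⟩
    · exact cG.stronglyMeasurableAtFilter isOpen_Ioo r hr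
    · exact cG.continuousAt (isOpen_Ioo.mem_nhds hr)
  have dz : HasDerivAt ζ (G r) r := by
    apply dG.congr_of_eventuallyEq
    filter_upwards [Icc_mem_nhds ha'.2 hb'.1] with s hs using eqz s hs
  rw [dz.deriv]
  have : 0 < r := hc.trans hr.1
  simp only [hG]
  field_simp
  rfl


def JJ (n : ℕ) (W : ℝ → ℝ) (ε : ℝ) (ζ : ℝ → ℝ) (r : ℝ) : ℝ :=
  ε^2 * deriv ζ r^2 - W (ζ r) + ε * Lam n W ε ζ * Vpot n W (ζ r)

section
variable {n : ℕ} {W W1 : ℝ → ℝ} {δ Cp Cv ε : ℝ} {ζ : ℝ → ℝ}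

lemma dd_zeta (hn : 2 ≤ n) (hp : PF W W1 δ Cp) (hv : VF n W W1 δ Cv) (hε : 0 < ε)
    (hm : Minz n W ε ζ) {r : ℝ} (hr : 0 < r) (h1 : ζ r < 1) (h2 : 0 < ζ r) :
    HasDerivAt (deriv ζ) ((ε⁻¹ * W1 (ζ r) - Lam n W ε ζ * V1 n W (ζ r)) / (2*ε) - (n-1:ℝ)/r * deriv ζ r) r := by
  have hζ := hm.adm
  have cz := hζ.diff.continuous
  obtain ⟨c, hc0, hcr, hc⟩ : ∃ c, 0 < c ∧ c < r ∧ ζ c < 1 := by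
    have h := (cz.continuousAt (x := r)).eventually (Iio_mem_nhds h1)
    have h' : ∀ᶠ s in nhdsWithin r (Iio r), s ∈ Iio r ∧ ζ s < 1 ∧ 0 < s :=
      (eventually_mem_nhdsWithin).and (((h.filter_mono nhdsWithin_le_nhds)).and (Filter.Eventually.filter_mono nhdsWithin_le_nhds (Ioi_mem_nhds hr)))
    obtain ⟨s, a, b, c⟩ := h'.exists
    exact ⟨s, c, a, b⟩
  obtain ⟨d, hrd, hd⟩ : ∃ d, r < d ∧ 0 < ζ d := by
    have h := (cz.continuousAt (x := r)).eventually (Ioi_mem_nhds h2)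
    have h' : ∀ᶠ s in nhdsWithin r (Ioi r), s ∈ Ioi r ∧ 0 < ζ s :=
      (eventually_mem_nhdsWithin).and (h.filter_mono nhdsWithin_le_nhds)
    obtain ⟨s, a, b⟩ := h'.exists
    exact ⟨s, a, b⟩
  obtain ⟨K, hK⟩ := EL_class hn hp hv hε hm hc0 (hcr.trans hrd) hc hd
  set Λ := Lam n W ε ζ
  set q : ℝ → ℝ := fun s => s^(n-1) * (ε⁻¹ * W1 (ζ s) - Λ * V1 n W (ζ s)) with hq
  have cW1 : Continuous fun s => W1 (ζ s) := contOn_comp hp.contW1 hζ.diff.continuous hζ.mem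
  have cV1 : Continuous fun s => V1 n W (ζ s) := contOn_comp (hv.contV1 hn hp) hζ.diff.continuous hζ.mem
  have cq : Continuous q := (continuous_pow (n-1)).mul ((cW1.const_mul ε⁻¹).sub (cV1.const_mul Λ))
  have dQ : HasDerivAt (fun r => K + ∫ s in c..r, q s) (q r) r := by
    exact ((cq.integral_hasStrictDerivAt c r).hasDerivAt).const_add K
  have dG : HasDerivAt (fun r : ℝ => 2 * ε * r^(n-1)) (2 * ε * (((n-1:ℕ):ℝ) * r^(n-1-1))) r :=
    (hasDerivAt_pow (n-1) r).const_mul (2*ε)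
  have hrn : 0 < r^(n-1) := pow_pos hr _
  have dF := dQ.fun_div dG (by positivity)
  have he : deriv ζ =ᶠ[nhds r] fun r => (K + ∫ s in c..r, q s) / (2 * ε * r^(n-1)) := by
    filter_upwards [Ioo_mem_nhds hcr hrd] with s hs
    have hs0 : 0 < s := hc0.trans hs.1
    have : 0 < s^(n-1) := pow_pos hs0 _
    rw [eq_div_iff (by positivity), ← hK s hs]; ring
  have dF' := dF.congr_of_eventuallyEq he
  refine dF'.congr_deriv ?_
  rw [← hK r ⟨hcr, hrd⟩]
  have hcast : ((n-1:ℕ):ℝ) = (n:ℝ) - 1 := by rw [Nat.cast_sub (by omega)]; simp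
  have hpw : r^(n-1) = r^(n-1-1) * r := by rw [← pow_succ]; congr 1; omega
  rw [hcast, hq]
  simp only
  rw [hpw]
  have : 0 < r^(n-1-1) := pow_pos hr _
  field_simp

lemma d_JJ (hn : 2 ≤ n) (hp : PF W W1 δ Cp) (hv : VF n W W1 δ Cv) (hε : 0 < ε)
    (hm : Minz n W ε ζ) {r : ℝ} (hr : 0 < r) (h1 : ζ r < 1) (h2 : 0 < ζ r) :
    HasDerivAt (JJ n W ε ζ) (-(2 * (n-1:ℝ) * ε^2 * deriv ζ r^2 / r)) r := by
  have a1 := dd_zeta hn hp hv hε hm hr h1 h2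
  have hz := (hm.adm.diff r).hasDerivAt
  have a2 : HasDerivAt W (W1 (ζ r)) (ζ r) := hasDerivAt_of_Icc (hp.d1 _ ⟨h2.le, h1.le⟩) ⟨h2, h1⟩
  have a3 : HasDerivAt (Vpot n W) (V1 n W (ζ r)) (ζ r) := hasDerivAt_of_Icc (hv.dV _ ⟨h2.le, h1.le⟩) ⟨h2, h1⟩
  have b2 := HasDerivAt.comp r a2 hz
  have b3 := HasDerivAt.comp r a3 hz
  have := (((a1.fun_pow 2).const_mul (ε^2)).fun_sub b2).fun_add (b3.const_mul (ε * Lam n W ε ζ))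
  refine this.congr_deriv ?_
  field_simp
  ring

lemma JJ_anti (hn : 2 ≤ n) (hp : PF W W1 δ Cp) (hv : VF n W W1 δ Cv) (hε : 0 < ε)
    (hm : Minz n W ε ζ) {r s : ℝ} (hr : 0 < r) (hrs : r ≤ s) (h1 : ζ r < 1) (h2 : 0 < ζ s) :
    JJ n W ε ζ s ≤ JJ n W ε ζ r := by
  have hn2 : (2:ℝ) ≤ n := by exact_mod_cast hn
  have key : ∀ t ∈ Icc r s, HasDerivAt (JJ n W ε ζ) (-(2 * (n-1:ℝ) * ε^2 * deriv ζ t^2 / t)) t := by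
    intro t ht
    refine d_JJ hn hp hv hε hm (hr.trans_le ht.1) ?_ ?_
    · exact (hm.anti (mem_Ici.2 hr.le) (mem_Ici.2 (hr.le.trans ht.1)) ht.1).trans_lt h1
    · exact h2.trans_le (hm.anti (mem_Ici.2 (hr.le.trans ht.1)) (mem_Ici.2 (hr.le.trans hrs)) ht.2)
  have h := antitoneOn_of_deriv_nonpos (convex_Icc r s) (f := JJ n W ε ζ)
    (fun t ht => (key t ht).continuousAt.continuousWithinAt)
    (fun t ht => (key t (interior_subset ht)).differentiableAt.differentiableWithinAt)
    (fun t ht => by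
      have ht' := interior_subset ht
      rw [(key t ht').deriv]
      have : 0 < t := hr.trans_le ht'.1
      have h3 : (0:ℝ) ≤ (n:ℝ) - 1 := by linarith
      have : 0 ≤ 2 * (n-1:ℝ) * ε^2 * deriv ζ t^2 / t := by positivity
      linarith)
  exact h ⟨le_rfl, hrs⟩ ⟨hrs, le_rfl⟩ hrs

lemma zeta_small (hζ : Adm n ζ) {θ r : ℝ} (hθ : 0 < θ) : ∃ s, r < s ∧ 1 ≤ s ∧ ζ s < θ := by
  by_contra hcon
  push Not at hcon
  set a := max r 1 with ha
  set S := ∫ r, ζ r^2 ∂mu n with hS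
  have hS0 : 0 ≤ S := integral_nonneg fun _ => sq_nonneg _
  set b := a + (S+1)/θ^2 with hb
  have hab : a < b := by rw [hb]; have : 0 < (S+1)/θ^2 := by positivity
                         linarith
  have ha1 : 1 ≤ a := le_max_right _ _
  have h1 := mu_local_le (b := b) hζ.sq (fun r => sq_nonneg _) (by linarith : 0 < a)
  have h2 : ∫ r in Ioc a b, θ^2 ≤ ∫ r in Ioc a b, ζ r^2 := by
    apply setIntegral_mono_on
    · simp
    · exact ((hζ.diff.continuous.pow 2).integrableOn_Icc).mono_set Ioc_subset_Icc_self
    · exact measurableSet_Ioc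
    · intro s hs
      have := hcon s ((le_max_left _ _).trans_lt hs.1) (ha1.trans hs.1.le)
      gcongr
  have h3 : ∫ r in Ioc a b, θ^2 = S + 1 := by
    rw [setIntegral_const, Measure.real, Real.volume_Ioc, ENNReal.toReal_ofReal (by linarith), smul_eq_mul, hb]
    field_simp; ring
  have h4 : 1 ≤ a^(n-1) := one_le_pow₀ ha1
  have h5 : 0 ≤ ∫ r in Ioc a b, ζ r^2 := integral_nonneg fun _ => sq_nonneg _
  nlinarith

lemma JJ_nonneg (hn : 2 ≤ n) (hp : PF W W1 δ Cp) (hv : VF n W W1 δ Cv) (hε : 0 < ε)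
    (hm : Minz n W ε ζ) {r : ℝ} (hr : 0 < r) (h1 : ζ r < 1) (h2 : 0 < ζ r) : 0 ≤ JJ n W ε ζ r := by
  by_contra hcon
  push Not at hcon
  have hCp := hp.Cge
  set η := - JJ n W ε ζ r with hη
  set θ := min (ζ r) (η/(2*Cp)) with hθ
  have hθ0 : 0 < θ := lt_min h2 (by apply div_pos <;> linarith)
  obtain ⟨s, hs, -, hsθ⟩ := zeta_small (r := r) hm.adm hθ0
  obtain ⟨t, ht, htθ⟩ : ∃ t ∈ Icc r s, ζ t = θ := by
    apply intermediate_value_Icc' hs.le hm.adm.diff.continuous.continuousOn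
    exact ⟨hsθ.le, min_le_left _ _⟩
  have h3 := JJ_anti hn hp hv hε hm hr ht.1 h1 (by rw [htθ]; exact hθ0)
  have hθ1 : θ ≤ 1 := (min_le_left _ _).trans h1.le
  have h4 := hp.f1b θ ⟨hθ0.le, hθ1⟩
  have h5 : 0 ≤ Vpot n W θ := VF.Vnn hv ⟨hθ0.le, hθ1⟩
  have h6 := Lam_nonneg hn hp hm.adm hε
  have h7 : -W θ ≤ JJ n W ε ζ t := by
    unfold JJ; rw [htθ]
    have : 0 ≤ ε^2 * deriv ζ t^2 := by positivity
    have : 0 ≤ ε * Lam n W ε ζ * Vpot n W θ := by positivity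
    linarith
  have h8 : θ * (2*Cp) ≤ η := by
    have : θ ≤ η/(2*Cp) := min_le_right _ _
    rwa [le_div_iff₀ (by linarith)] at this
  nlinarith

lemma last_one (hm : Minz n W ε ζ) {c r : ℝ} (hc : 0 ≤ c) (hcr : c ≤ r) (h1 : ζ c = 1) (h2 : ζ r < 1) :
    ∃ q, c ≤ q ∧ q < r ∧ ζ q = 1 ∧ ∀ s, q < s → ζ s < 1 := by
  have cz := hm.adm.diff.continuous
  have hcomp : IsCompact (Icc c r ∩ ζ ⁻¹' {1}) := isCompact_Icc.inter_right (isClosed_singleton.preimage cz)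
  obtain ⟨q, hq, hq2⟩ := hcomp.exists_isGreatest ⟨c, ⟨le_rfl, hcr⟩, h1⟩
  have hqr : q < r := lt_of_le_of_ne hq.1.2 (fun h => by have : ζ q = 1 := hq.2
                                                         rw [h] at this; linarith)
  refine ⟨q, hq.1.1, hqr, hq.2, fun s hs => ?_⟩
  by_contra hcon
  have h3 : ζ s = 1 := le_antisymm (hm.adm.mem s).2 (not_lt.1 hcon)
  rcases le_total s r with h | h
  · exact absurd (hq2 ⟨⟨hq.1.1.trans hs.le, h⟩, h3⟩) (not_le.2 hs)
  · have := hm.anti (mem_Ici.2 (hc.trans hcr)) (mem_Ici.2 (hc.trans (hcr.trans h))) h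
    linarith

lemma JJ_le_of_one (hn : 2 ≤ n) (hp : PF W W1 δ Cp) (hv : VF n W W1 δ Cv) (hε : 0 < ε)
    (hm : Minz n W ε ζ) {c r : ℝ} (hc : 0 < c) (hcr : c ≤ r) (hc1 : ζ c = 1) (h1 : ζ r < 1) (h2 : 0 < ζ r) :
    JJ n W ε ζ r ≤ ε * Lam n W ε ζ := by
  obtain ⟨q, hq1, hq2, hq3, hq4⟩ := last_one hm hc.le hcr hc1 h1
  have hd : deriv ζ q = 0 := deriv_zero_of_one hm.adm hq3
  have hdq := (hm.adm.diff q).hasDerivAt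
  rw [hd] at hdq
  have hL := Lam_nonneg hn hp hm.adm hε
  apply le_of_forall_pos_le_add
  intro τ hτ
  have hsl := hdq.tendsto_slope
  have hτ' : 0 < √τ / ε := by positivity
  have hev : ∀ᶠ s in nhdsWithin q (Ioi q), |slope ζ q s| < √τ/ε := by
    have h3 : ∀ᶠ s in nhdsWithin q {q}ᶜ, |slope ζ q s| < √τ/ε := by
      have := hsl.abs
      rw [abs_zero] at this
      exact this.eventually (Iio_mem_nhds hτ')
    exact h3.filter_mono (nhdsWithin_mono _ (fun x hx => (ne_of_gt hx)))
  have hev2 : ∀ᶠ s in nhdsWithin q (Ioi q), s ∈ Ioo q r := Ioo_mem_nhdsGT hq2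
  obtain ⟨s, hs1, hs2⟩ := (hev.and hev2).exists
  obtain ⟨t, ht, hte⟩ := exists_hasDerivAt_eq_slope ζ (deriv ζ) hs2.1 hm.adm.diff.continuous.continuousOn
    (fun x _ => (hm.adm.diff x).hasDerivAt)
  have hqt : 0 < t := hc.trans_le (hq1.trans ht.1.le)
  have h3 := JJ_anti hn hp hv hε hm hqt (ht.2.le.trans hs2.2.le) (hq4 t ht.1) h2
  have h4 : |deriv ζ t| < √τ/ε := by rw [hte]; rwa [slope_def_field] at hs1
  have h5 : ε^2 * deriv ζ t^2 ≤ τ := by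
    have h6 : |ε * deriv ζ t| ≤ √τ := by
      rw [abs_mul, abs_of_pos hε]; rw [lt_div_iff₀ hε] at h4; linarith
    have h7 := sq_le_sq' (by linarith [abs_nonneg (ε * deriv ζ t), Real.sqrt_nonneg τ]) h6
    rw [sq_abs, Real.sq_sqrt hτ.le] at h7
    linarith [mul_pow ε (deriv ζ t) 2]
  have h6 := hp.Wnn (hm.adm.mem t)
  have h7 := VF.Vle hv (hm.adm.mem t)
  unfold JJ at h3 ⊢
  have h8 : ε * Lam n W ε ζ * Vpot n W (ζ t) ≤ ε * Lam n W ε ζ * 1 := by gcongr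
  linarith

lemma JJ_le (hn : 2 ≤ n) (hp : PF W W1 δ Cp) (hv : VF n W W1 δ Cv) (hε : 0 < ε)
    (hm : Minz n W ε ζ) {a r : ℝ} (ha : 0 < a) (har : a ≤ r) (h1 : ζ r < 1) (h2 : 0 < ζ r) :
    JJ n W ε ζ r ≤ ε^2 * (2/a)^2 + ε * Lam n W ε ζ := by
  have hL := Lam_nonneg hn hp hm.adm hε
  rcases lt_or_ge (ζ (a/2)) 1 with h | h
  · obtain ⟨t, ht, hte⟩ := exists_hasDerivAt_eq_slope ζ (deriv ζ) (by linarith : a/2 < a) hm.adm.diff.continuous.continuousOn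
      (fun x _ => (hm.adm.diff x).hasDerivAt)
    have ht0 : 0 < t := by linarith [ht.1]
    have hz : ζ t < 1 := (hm.anti (mem_Ici.2 (by linarith : (0:ℝ) ≤ a/2)) (mem_Ici.2 ht0.le) ht.1.le).trans_lt h
    have h3 := JJ_anti hn hp hv hε hm ht0 (ht.2.le.trans har) hz h2
    have h5 : deriv ζ t ^2 ≤ (2/a)^2 := by
      rw [hte]
      have e1 := hm.adm.mem a
      have e2 := hm.adm.mem (a/2)
      have e3 : (ζ a - ζ (a/2)) / (a - a/2) = (ζ a - ζ (a/2)) * (2/a) := by field_simp; ring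
      rw [e3, mul_pow]
      have : (ζ a - ζ (a/2))^2 ≤ 1 := by nlinarith [e1.1, e1.2, e2.1, e2.2]
      nlinarith [sq_nonneg (2/a)]
    have h6 := hp.Wnn (hm.adm.mem t)
    have h7 := VF.Vle hv (hm.adm.mem t)
    unfold JJ at h3 ⊢
    have h8 : ε * Lam n W ε ζ * Vpot n W (ζ t) ≤ ε * Lam n W ε ζ * 1 := by gcongr
    have h9 : ε^2 * deriv ζ t^2 ≤ ε^2 * (2/a)^2 := by gcongr
    linarith
  · have h3 : ζ (a/2) = 1 := le_antisymm (hm.adm.mem _).2 h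
    have := JJ_le_of_one hn hp hv hε hm (by linarith : 0 < a/2) (by linarith) h3 h1 h2
    have : 0 ≤ ε^2 * (2/a)^2 := by positivity
    linarith

lemma JJ_ge_b (hn : 2 ≤ n) (hp : PF W W1 δ Cp) (hv : VF n W W1 δ Cv) (hε : 0 < ε)
    (hm : Minz n W ε ζ) {c r D : ℝ} (hc : 0 < c) (hcr : c ≤ r) (hc1 : ζ c = 1) (h1 : ζ r < 1) (h2 : 0 < ζ r)
    (hd : ∀ t, deriv ζ t ≤ 0 ∨ t ≤ 0) (hD : ∀ t, c ≤ t → 2 * (n-1:ℝ) * (ε * |deriv ζ t|) ≤ D * t) :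
    ε * Lam n W ε ζ - D * ε * (1 - ζ r) ≤ JJ n W ε ζ r := by
  obtain ⟨q, hq1, hq2, hq3, hq4⟩ := last_one hm hc.le hcr hc1 h1
  have hL := Lam_nonneg hn hp hm.adm hε
  have cz := hm.adm.diff.continuous
  set G : ℝ → ℝ := fun s => - W (ζ s) + ε * Lam n W ε ζ * Vpot n W (ζ s) - D * ε * ζ s with hG
  have cG : Continuous G := by
    have c1 : Continuous fun s => W (ζ s) := contOn_comp hp.contW cz hm.adm.mem
    have c2 : Continuous fun s => Vpot n W (ζ s) := contOn_comp (vpot_contOn hn hp.contW) cz hm.adm.mem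
    exact (c1.neg.add (c2.const_mul _)).sub (cz.const_mul _)
  have hGq : G q = ε * Lam n W ε ζ - D * ε := by
    simp only [hG, hq3, hp.z1, hv.V1e]; ring
  have key : ∀ s ∈ Ioo q r, G s ≤ JJ n W ε ζ r - D * ε * ζ r := by
    intro s hs
    have hs0 : 0 < s := hc.trans_le (hq1.trans hs.1.le)
    have kd : ∀ t ∈ Icc s r, HasDerivAt (fun t => JJ n W ε ζ t - D * ε * ζ t)
        (-(2 * (n-1:ℝ) * ε^2 * deriv ζ t^2 / t) - D * ε * deriv ζ t) t := by
      intro t ht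
      have ht0 : 0 < t := hs0.trans_le ht.1
      refine (d_JJ hn hp hv hε hm ht0 (hq4 t (hs.1.trans_le ht.1)) ?_).fun_sub (((hm.adm.diff t).hasDerivAt).const_mul (D*ε))
      exact h2.trans_le (hm.anti (mem_Ici.2 ht0.le) (mem_Ici.2 (ht0.le.trans ht.2)) ht.2)
    have hmono := monotoneOn_of_deriv_nonneg (convex_Icc s r) (f := fun t => JJ n W ε ζ t - D * ε * ζ t)
      (fun t ht => (kd t ht).continuousAt.continuousWithinAt)
      (fun t ht => (kd t (interior_subset ht)).differentiableAt.differentiableWithinAt)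
      (fun t ht => by
        have ht' := interior_subset ht
        rw [(kd t ht').deriv]
        have ht0 : 0 < t := hs0.trans_le ht'.1
        have hdt : deriv ζ t ≤ 0 := by
          rcases hd t with h | h
          · exact h
          · linarith
        have hDt := hD t (hq1.trans (hs.1.le.trans ht'.1))
        rw [abs_of_nonpos hdt] at hDt
        have : 2 * (n-1:ℝ) * ε^2 * deriv ζ t^2 / t ≤ - (D * ε * deriv ζ t) := by
          rw [div_le_iff₀ ht0]
          have : 0 ≤ ε * (-deriv ζ t) := by nlinarith
          nlinarith [mul_le_mul_of_nonneg_left hDt this]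
        linarith)
    have h3 := hmono ⟨le_rfl, hs.2.le⟩ ⟨hs.2.le, le_rfl⟩ hs.2.le
    simp only at h3
    refine le_trans ?_ h3
    simp only [hG, JJ]
    have : 0 ≤ ε^2 * deriv ζ s^2 := by positivity
    linarith
  have hlim : Tendsto G (nhdsWithin q (Ioi q)) (nhds (G q)) := (cG.tendsto q).mono_left nhdsWithin_le_nhds
  have := le_of_tendsto hlim (by
    have : ∀ᶠ s in nhdsWithin q (Ioi q), s ∈ Ioo q r := Ioo_mem_nhdsGT hq2
    filter_upwards [this] with s hs using key s hs)
  rw [hGq] at this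
  linarith

lemma der_nonpos (hm : Minz n W ε ζ) {r : ℝ} (hr : 0 < r) : deriv ζ r ≤ 0 := by
  have h1 : derivWithin ζ (Ici 0) r = deriv ζ r := derivWithin_of_mem_nhds (Ici_mem_nhds hr)
  rw [← h1]
  exact hm.anti.derivWithin_nonpos

lemma sq_diff_bound {x p B : ℝ} (hx : 0 ≤ x) (hp : 0 ≤ p) (h1 : x^2 ≤ p^2 + B) (h2 : p^2 ≤ x^2 + B) : |p - x| ≤ √B := by
  apply Real.abs_le_sqrt
  rcases le_total x p with h | h <;> nlinarith

/-- the equipartition estimates -/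
structure EqP (W W1 : ℝ → ℝ) (δ C ε : ℝ) (ζ : ℝ → ℝ) (a : ℝ) : Prop where
  Cge : 1 ≤ C
  e1 : ∀ r, a ≤ r → |ε * deriv ζ r + √(W (ζ r))| ≤ C * √ε
  e2 : ∀ r, a ≤ r → ε * |deriv ζ r| ≤ C
  e3 : W1 1 < 0 → ζ a = 1 → ∀ r, a ≤ r → 1 - 2*δ ≤ ζ r → ζ r < 1 → ε * deriv ζ r + √(W (ζ r)) ≤ C * ε * √(W (ζ r))
  e4 : W1 1 < 0 → ζ a = 1 → ∀ r, a ≤ r → 1 - 2*δ ≤ ζ r → ζ r < 1 → ε * |deriv ζ r| ≤ C * √(W (ζ r))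

set_option maxHeartbeats 2000000 in
lemma eqp_exists (hn : 2 ≤ n) (hp : PF W W1 δ Cp) (hv : VF n W W1 δ Cv) {E0 a : ℝ} (hE0 : 1 ≤ E0) (ha : 0 < a) :
    ∃ C, ∀ ε, 0 < ε → ε ≤ 1 → ∀ ζ, Minz n W ε ζ → EE n W ε ζ ≤ E0 → EqP W W1 δ C ε ζ a := by
  have hn2 : (2:ℝ) ≤ n := by exact_mod_cast hn
  have hCp := hp.Cge
  have hCv := hv.Cge
  have hδ := hp.dpos
  have hδ2 := hp.dle
  set B := (2/a)^2 + E0 with hB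
  have hB0 : 1 ≤ B := by have : 0 ≤ (2/a)^2 := sq_nonneg _
                         linarith
  set C2 := √B + Cp with hC2
  set D := 2 * (n-1:ℝ) * C2 / a with hDd
  have hsB := Real.sqrt_nonneg B
  have hC20 : 0 < C2 := by linarith
  have hD0 : 0 < D := by
    have : (0:ℝ) < n - 1 := by linarith
    positivity
  set C4 := 1 + E0 * (Cv * Cp + Cv) * Cp with hC4
  have hC40 : 1 ≤ C4 := by have : 0 ≤ E0 * (Cv * Cp + Cv) * Cp := by positivity
                           linarith
  refine ⟨C2 + D * Cp + C4, fun ε hε hε1 ζ hm hE => ?_⟩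
  have hDC : 0 ≤ D * Cp := by positivity
  have hL := Lam_nonneg hn hp hm.adm hε
  have hLE : Lam n W ε ζ ≤ E0 := (Lam_le hn hε).trans hE
  have hse : 0 ≤ √ε := Real.sqrt_nonneg _
  have E1 : ∀ r, a ≤ r → |ε * deriv ζ r + √(W (ζ r))| ≤ √B * √ε := by
    intro r hr
    have hr0 : 0 < r := ha.trans_le hr
    rcases eq_or_lt_of_le (hm.adm.mem r).1 with h0 | h0
    · rw [deriv_zero_of_zero hm.adm h0.symm, ← h0, hp.z0]; simp; positivity
    rcases eq_or_lt_of_le (hm.adm.mem r).2 with h1 | h1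
    · rw [deriv_zero_of_one hm.adm h1, h1, hp.z1]; simp; positivity
    have j1 := JJ_nonneg hn hp hv hε hm hr0 h1 h0
    have j2 := JJ_le hn hp hv hε hm ha hr h1 h0
    have hd := der_nonpos hm hr0
    have hW := hp.Wnn (hm.adm.mem r)
    have hV0 := VF.Vnn hv (hm.adm.mem r)
    have hV1 := VF.Vle hv (hm.adm.mem r)
    have k1 : 0 ≤ ε * Lam n W ε ζ * Vpot n W (ζ r) := by positivity
    have k2 : ε * Lam n W ε ζ * Vpot n W (ζ r) ≤ ε * E0 * 1 := by gcongr
    have k3 : ε * Lam n W ε ζ ≤ ε * E0 := by gcongr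
    have k4 : ε^2 * (2/a)^2 ≤ ε * (2/a)^2 := by
      apply mul_le_mul_of_nonneg_right _ (sq_nonneg _); rw [pow_two]; exact mul_le_of_le_one_left hε.le hε1
    unfold JJ at j1 j2
    have k5 : 0 ≤ ε * (2/a)^2 := by positivity
    have hBe : B * ε = ε * (2/a)^2 + ε * E0 := by rw [hB]; ring
    have := sq_diff_bound (x := -(ε * deriv ζ r)) (p := √(W (ζ r))) (B := B * ε) (by linarith [mul_nonneg hε.le (neg_nonneg.2 hd)]) (Real.sqrt_nonneg _)
      (by rw [Real.sq_sqrt hW, hBe, neg_sq, mul_pow]; linarith) (by rw [Real.sq_sqrt hW, hBe, neg_sq, mul_pow]; linarith)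
    rw [Real.sqrt_mul (by linarith)] at this
    rwa [sub_neg_eq_add, add_comm] at this
  have E2 : ∀ r, a ≤ r → ε * |deriv ζ r| ≤ C2 := by
    intro r hr
    have h1 := E1 r hr
    have hp1 := hp.f1c _ (hm.adm.mem r)
    have hz1 := (hm.adm.mem r).2
    have hp0 := Real.sqrt_nonneg (W (ζ r))
    have hs1 : √ε ≤ 1 := Real.sqrt_le_one.2 hε1
    have h3 : √B * √ε ≤ √B := mul_le_of_le_one_right hsB hs1
    rw [show ε * |deriv ζ r| = |ε * deriv ζ r| by rw [abs_mul, abs_of_pos hε]]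
    rw [abs_le] at h1 ⊢
    have h4 : Cp * ζ r ≤ Cp := mul_le_of_le_one_right (by linarith) hz1
    constructor <;> linarith [h1.1, h1.2]
  have D2 : ∀ t, a ≤ t → 2 * (n-1:ℝ) * (ε * |deriv ζ t|) ≤ D * t := by
    intro t ht
    have : D * a ≤ D * t := by gcongr
    have h2 : D * a = 2 * (n-1:ℝ) * C2 := by rw [hDd]; field_simp
    have h3 : 2 * (n-1:ℝ) * (ε * |deriv ζ t|) ≤ 2 * (n-1:ℝ) * C2 := by
      have : (0:ℝ) ≤ n - 1 := by linarith
      have := E2 t ht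
      gcongr
    linarith
  refine ⟨by linarith, ?_, ?_, ?_, ?_⟩
  · intro r hr
    refine (E1 r hr).trans ?_
    gcongr; linarith
  · intro r hr
    linarith [E2 r hr]
  · intro hb haz r hr hz hz1
    have hr0 : 0 < r := ha.trans_le hr
    have hz0 : 0 < ζ r := by linarith
    have j := JJ_ge_b hn hp hv hε hm ha hr haz hz1 hz0 (fun t => by
      rcases le_or_gt t 0 with h | h
      · right; exact h
      · left; exact der_nonpos hm h) D2
    have hd := der_nonpos hm hr0
    have hW := hp.Wnn (hm.adm.mem r)
    have hV1 := VF.Vle hv (hm.adm.mem r)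
    have f := (hp.f7d hb (ζ r) ⟨hz, hz1.le⟩).1
    have hs := Real.sq_sqrt hW
    have hs0 := Real.sqrt_nonneg (W (ζ r))
    set p := √(W (ζ r))
    unfold JJ at j
    have k1 : ε * Lam n W ε ζ * Vpot n W (ζ r) ≤ ε * Lam n W ε ζ * 1 := by gcongr
    have k2 : D * ε * (1 - ζ r) ≤ D * ε * (Cp * W (ζ r)) := by gcongr
    set x := -(ε * deriv ζ r) with hx
    have hx0 : 0 ≤ x := by linarith [mul_nonneg hε.le (neg_nonneg.2 hd)]
    have k3 : p^2 * (1 - D * Cp * ε) ≤ x^2 := by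
      rw [hs, hx, neg_sq, mul_pow]
      have : W (ζ r) * (1 - D * Cp * ε) = W (ζ r) - D * ε * (Cp * W (ζ r)) := by ring
      linarith
    have k4 : p - x ≤ D * Cp * ε * p := by
      have hτ : 0 ≤ D * Cp * ε := by positivity
      set τ := D * Cp * ε
      by_contra hcon
      push Not at hcon
      have h5 : x < (1-τ) * p := by linarith
      have h6 : 0 < 1 - τ := by
        by_contra h; push Not at h; linarith [mul_nonneg (by linarith : 0 ≤ τ - 1) hs0]
      have h7 : x^2 < ((1-τ)*p)^2 := by apply pow_lt_pow_left₀ h5 hx0; norm_num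
      have h8 : ((1-τ)*p)^2 ≤ p^2 * (1-τ) := by
        have : 0 ≤ p^2 * (1-τ) * τ := by positivity
        linarith [(by ring : ((1-τ)*p)^2 = p^2 * (1-τ) - p^2 * (1-τ) * τ)]
      linarith
    have k5 : 0 ≤ C2 * ε * p := by positivity
    have k6 : 0 ≤ C4 * ε * p := by positivity
    have k7 : (C2 + D * Cp + C4) * ε * p = C2 * ε * p + D * Cp * ε * p + C4 * ε * p := by ring
    linarith
  · intro hb haz r hr hz hz1
    have hr0 : 0 < r := ha.trans_le hr
    have hz0 : 0 < ζ r := by linarith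
    have j := JJ_le_of_one hn hp hv hε hm ha hr haz hz1 hz0
    have hW := hp.Wnn (hm.adm.mem r)
    have f := (hp.f7d hb (ζ r) ⟨hz, hz1.le⟩).1
    have hs := Real.sq_sqrt hW
    have hs0 := Real.sqrt_nonneg (W (ζ r))
    have v2 := hv.v2 1 (by simp) (ζ r) (hm.adm.mem r)
    have v1 := (hv.v1 _ (hm.adm.mem r)).2
    have f1 := hp.f1c _ (hm.adm.mem r)
    set p := √(W (ζ r))
    unfold JJ at j
    rw [hv.V1e] at v2
    have k0 : V1 n W (ζ r) ≤ Cv * Cp := by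
      refine v1.trans ?_
      gcongr; exact f1.trans (mul_le_of_le_one_right (by linarith) hz1.le)
    have k1 : 1 - Vpot n W (ζ r) ≤ (Cv * Cp + Cv) * (1 - ζ r) := by
      have : V1 n W (ζ r) * (1 - ζ r) ≤ Cv * Cp * (1 - ζ r) := by
        apply mul_le_mul_of_nonneg_right k0; linarith
      have : Cv * (1-ζ r)^2 ≤ Cv * (1 - ζ r) := by
        gcongr; rw [pow_two]; exact mul_le_of_le_one_right (by linarith) (by linarith)
      linarith
    have k2 : ε^2 * deriv ζ r^2 ≤ C4 * p^2 := by
      rw [hs]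
      have k3 : ε * Lam n W ε ζ * (1 - Vpot n W (ζ r)) ≤ 1 * E0 * ((Cv * Cp + Cv) * (Cp * W (ζ r))) := by
        have := VF.Vle hv (hm.adm.mem r)
        have h0 : 0 ≤ 1 - Vpot n W (ζ r) := by linarith
        gcongr
        refine k1.trans ?_
        gcongr
      have k4 : C4 * W (ζ r) = W (ζ r) + 1 * E0 * ((Cv * Cp + Cv) * (Cp * W (ζ r))) := by rw [hC4]; ring
      rw [k4]
      have k5 : ε * Lam n W ε ζ * (1 - Vpot n W (ζ r)) = ε * Lam n W ε ζ - ε * Lam n W ε ζ * Vpot n W (ζ r) := by ring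
      linarith
    have k3 : (ε * |deriv ζ r|)^2 ≤ (C4 * p)^2 := by
      rw [mul_pow, sq_abs]
      refine k2.trans ?_
      rw [mul_pow]
      apply mul_le_mul_of_nonneg_right _ (sq_nonneg _)
      rw [pow_two]; exact le_mul_of_one_le_left (by linarith) hC40
    have k4 := abs_le_of_sq_le_sq' k3 (by positivity)
    refine k4.2.trans ?_
    gcongr; linarith
end


lemma ftc_Ioi {Y Y' : ℝ → ℝ} {a : ℝ} {s : Set ℝ} (hs : s.Countable) (hc : ContinuousOn Y (Ici a))
    (hd : ∀ r, a < r → r ∉ s → HasDerivAt Y (Y' r) r) (hY : IntegrableOn Y (Ioi a)) (hY' : IntegrableOn Y' (Ioi a)) :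
    ∫ r in Ioi a, Y' r = - Y a := by
  have h1 : ∀ b, a ≤ b → ∫ r in a..b, Y' r = Y b - Y a := by
    intro b hb
    apply integral_eq_of_hasDerivAt_off_countable_of_le Y Y' hb hs (hc.mono Icc_subset_Ici_self)
    · intro x hx; exact hd x hx.1.1 hx.2
    · rw [intervalIntegrable_iff_integrableOn_Ioc_of_le hb]
      exact hY'.mono_set Ioc_subset_Ioi_self
  have h2 := intervalIntegral_tendsto_integral_Ioi a hY' tendsto_id
  have h3 : Tendsto Y atTop (nhds (Y a + ∫ r in Ioi a, Y' r)) := by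
    have h4 : Tendsto (fun b => Y a + ∫ r in a..id b, Y' r) atTop (nhds (Y a + ∫ r in Ioi a, Y' r)) := h2.const_add _
    refine h4.congr' ?_
    filter_upwards [eventually_ge_atTop a] with b hb
    simp only [id]
    rw [h1 b hb]; ring
  have h5 : Y a + ∫ r in Ioi a, Y' r = 0 := by
    have h6 : IntegrableAtFilter Y atTop := ⟨Ioi a, Ioi_mem_atTop a, hY⟩
    refine h6.eq_zero_of_tendsto ?_ h3
    intro s hs
    rcases mem_atTop_sets.1 hs with ⟨b, hb⟩
    rw [← top_le_iff, ← volume_Ici (a := b)]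
    exact measure_mono hb
  linarith

lemma gron_fwd {y y' κ : ℝ → ℝ} {a b B : ℝ} (hab : a ≤ b) (hB : 0 ≤ B) (hy : ∀ r, HasDerivAt y (y' r) r)
    (hκ : ∀ r, 0 ≤ κ r) (hκi : IntegrableOn κ (Icc a b)) (hle : ∀ r ∈ Icc a b, y' r ≤ B * y r + κ r) (h0 : 0 ≤ y a) :
    y b ≤ exp (B * (b-a)) * (y a + ∫ r in a..b, κ r) := by
  have hz : ∀ r, HasDerivAt (fun r => y r * exp (-(B * (r - a)))) (y' r * exp (-(B * (r - a))) + y r * (exp (-(B * (r - a))) * (-(B * 1)))) r := by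
    intro r
    exact (hy r).fun_mul (((((hasDerivAt_id r).sub_const a).const_mul B).fun_neg).exp)
  have h1 := intervalIntegral.sub_le_integral_of_hasDeriv_right_of_le hab
    (g := fun r => y r * exp (-(B * (r - a)))) (φ := κ)
    (fun r _ => (hz r).continuousAt.continuousWithinAt)
    (fun r _ => (hz r).hasDerivWithinAt) hκi (by
      intro r hr
      have h2 : exp (-(B * (r - a))) ≤ 1 := by
        rw [Real.exp_le_one_iff]
        have := mul_nonneg hB (by linarith [hr.1] : 0 ≤ r - a)
        linarith
      have h3 := Real.exp_pos (-(B * (r - a)))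
      have h4 := hle r (Ioo_subset_Icc_self hr)
      have h5 := hκ r
      nlinarith [mul_le_mul_of_nonneg_right h4 h3.le])
  simp only [sub_self, mul_zero, neg_zero, Real.exp_zero, mul_one] at h1
  have h2 : y b * exp (-(B * (b - a))) ≤ y a + ∫ r in a..b, κ r := by linarith
  rw [Real.exp_neg, ← div_eq_mul_inv, div_le_iff₀ (Real.exp_pos _)] at h2
  linarith

lemma gron {y y' κ : ℝ → ℝ} {a b B : ℝ} (hab : a ≤ b) (hB : 0 ≤ B) (hy : ∀ r, HasDerivAt y (y' r) r)
    (hκ : ∀ r, 0 ≤ κ r) (hκi : IntegrableOn κ (Icc a b)) (hle : ∀ r ∈ Icc a b, |y' r| ≤ B * y r + κ r) (h0 : ∀ r, 0 ≤ y r) :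
    ∀ r ∈ Icc a b, y r ≤ exp (B * (b-a)) * (y a + ∫ r in a..b, κ r) ∧ y a ≤ exp (B * (b-a)) * (y r + ∫ r in a..b, κ r) := by
  intro r hr
  have hintg : ∫ s in a..r, κ s ≤ ∫ s in a..b, κ s := by
    apply intervalIntegral.integral_mono_interval le_rfl hr.1 hr.2
    · exact ae_of_all _ hκ
    · rw [intervalIntegrable_iff_integrableOn_Icc_of_le hab]; exact hκi
  have hint0 : 0 ≤ ∫ s in a..r, κ s := intervalIntegral.integral_nonneg hr.1 fun s _ => hκ s
  have hexp : exp (B * (r-a)) ≤ exp (B * (b-a)) := by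
    apply Real.exp_le_exp.2
    apply mul_le_mul_of_nonneg_left _ hB
    linarith [hr.2]
  have hκr : IntegrableOn κ (Icc a r) := hκi.mono_set (Icc_subset_Icc_right hr.2)
  constructor
  · have := gron_fwd hr.1 hB hy hκ hκr (fun s hs => (le_abs_self _).trans (hle s ⟨hs.1, hs.2.trans hr.2⟩)) (h0 a)
    refine this.trans ?_
    have := h0 a
    gcongr
  · have hy2 : ∀ s, HasDerivAt (fun s => y (a + r - s)) (- y' (a + r - s)) s := by
      intro s
      have h1 : HasDerivAt (fun s : ℝ => a + r - s) (-1) s := by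
        simpa using (hasDerivAt_id s).const_sub (a + r)
      have := HasDerivAt.comp s (hy (a + r - s)) h1
      exact this.congr_deriv (by ring)
    have e1 : ∫ s in a..r, κ (a + r - s) = ∫ s in a..r, κ s := by
      rw [intervalIntegral.integral_comp_sub_left κ (a+r)]
      congr 1 <;> ring
    have := gron_fwd (y := fun s => y (a + r - s)) (κ := fun s => κ (a + r - s)) hr.1 hB hy2 (fun s => hκ _) (by
        have h3 : IntervalIntegrable κ volume a r := by rw [intervalIntegrable_iff_integrableOn_Icc_of_le hr.1]; exact hκr
        have h4 := h3.comp_sub_left (a + r)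
        rw [show a + r - a = r by ring, show a + r - r = a by ring] at h4
        rw [← intervalIntegrable_iff_integrableOn_Icc_of_le hr.1]
        exact h4.symm) (by
        intro s hs
        refine (neg_le_abs _).trans (hle _ ⟨by linarith [hs.2], by linarith [hs.1, hr.2]⟩)) (h0 _)
    simp only [add_sub_cancel_right, add_sub_cancel_left, e1] at this
    refine this.trans ?_
    have := h0 r
    gcongr

lemma mu_Ioi_le {n : ℕ} {F : ℝ → ℝ} (hF : Integrable F (mu n)) (h0 : ∀ r, 0 < r → 0 ≤ F r) {b : ℝ} (hb : 0 ≤ b) :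
    IntegrableOn (fun r => r^(n-1) * F r) (Ioi b) ∧ 0 ≤ ∫ r in Ioi b, r^(n-1) * F r ∧ ∫ r in Ioi b, r^(n-1) * F r ≤ ∫ r, F r ∂mu n := by
  rw [mu_integral]
  rw [mu_integrable] at hF
  refine ⟨hF.mono_set (Ioi_subset_Ioi hb), ?_, ?_⟩
  · apply setIntegral_nonneg measurableSet_Ioi
    intro r hr
    have hr0 : 0 < r := hb.trans_lt hr
    exact mul_nonneg (by positivity) (h0 r hr0)
  · apply setIntegral_mono_set hF
    · rw [EventuallyLE, ae_restrict_iff' measurableSet_Ioi]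
      filter_upwards with r hr
      have hr0 : 0 < r := hr
      exact mul_nonneg (by positivity) (h0 r hr0)
    · exact (Ioi_subset_Ioi hb).eventuallyLE

lemma mu_Ioc_le {n : ℕ} {F : ℝ → ℝ} (hF : Integrable F (mu n)) (h0 : ∀ r, 0 < r → 0 ≤ F r) {a b : ℝ} (ha : 0 ≤ a) (hab : a ≤ b) :
    IntervalIntegrable (fun r => r^(n-1) * F r) volume a b ∧ 0 ≤ ∫ r in a..b, r^(n-1) * F r ∧ ∫ r in a..b, r^(n-1) * F r ≤ ∫ r, F r ∂mu n := by
  rw [mu_integral]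
  rw [mu_integrable] at hF
  have hsub : Ioc a b ⊆ Ioi (0:ℝ) := fun x hx => ha.trans_lt hx.1
  rw [intervalIntegrable_iff_integrableOn_Ioc_of_le hab, intervalIntegral.integral_of_le hab]
  refine ⟨hF.mono_set hsub, ?_, ?_⟩
  · apply setIntegral_nonneg measurableSet_Ioc
    intro r hr
    have hr0 : 0 < r := hsub hr
    exact mul_nonneg (by positivity) (h0 r hr0)
  · apply setIntegral_mono_set hF
    · rw [EventuallyLE, ae_restrict_iff' measurableSet_Ioi]
      filter_upwards with r hr
      have hr0 : 0 < r := hr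
      exact mul_nonneg (by positivity) (h0 r hr0)
    · exact hsub.eventuallyLE

lemma mu_split {n : ℕ} {F : ℝ → ℝ} (hF : Integrable F (mu n)) {a b : ℝ} (ha : 0 ≤ a) (hab : a ≤ b) :
    ∫ r, F r ∂mu n = (∫ r in (0:ℝ)..a, r^(n-1) * F r) + (∫ r in a..b, r^(n-1) * F r) + ∫ r in Ioi b, r^(n-1) * F r := by
  rw [mu_integral]
  rw [mu_integrable] at hF
  have i1 : IntervalIntegrable (fun r => r^(n-1) * F r) volume 0 a := by
    rw [intervalIntegrable_iff_integrableOn_Ioc_of_le ha]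
    exact hF.mono_set Ioc_subset_Ioi_self
  have i2 : IntervalIntegrable (fun r => r^(n-1) * F r) volume a b := by
    rw [intervalIntegrable_iff_integrableOn_Ioc_of_le hab]
    exact hF.mono_set (fun x hx => ha.trans_lt hx.1)
  rw [intervalIntegral.integral_add_adjacent_intervals i1 i2, intervalIntegral.integral_of_le (ha.trans hab),
    ← setIntegral_union (by
      rw [Set.disjoint_left]; intro x hx hx2; exact absurd hx.2 (not_le.2 hx2)) measurableSet_Ioi
      (hF.mono_set Ioc_subset_Ioi_self) (hF.mono_set (Ioi_subset_Ioi (ha.trans hab))), Ioc_union_Ioi_eq_Ioi (ha.trans hab)]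


/-- hypotheses of the abstract coercivity lemma -/
structure HC (n : ℕ) (r1 r2 M C ε rm rp : ℝ) (h q χ G vd pz : ℝ → ℝ) : Prop where
  hn : 2 ≤ n
  ε0 : 0 < ε
  r10 : 0 < r1
  l1 : r1 ≤ rm
  l2 : rm < rp
  l3 : rp ≤ r2
  w1 : rp - rm ≤ M * ε
  w2 : ε ≤ M * (rp - rm)
  Cge : 1 ≤ C
  Mge : 1 ≤ M
  εs : ε * (2 * (n-1:ℝ) * C) ≤ r1
  hd : Differentiable ℝ h
  hs : Integrable (fun r => h r^2) (mu n)
  hds : Integrable (fun r => deriv h r^2) (mu n)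
  h1 : ∀ r, |h r| ≤ 1
  qc : Continuous q
  qs : Integrable (fun r => q r^2) (mu n)
  χc : Continuous χ
  χm : ∀ r, χ r ∈ Icc (0:ℝ) 1
  χ1 : ∀ r, rm ≤ r → χ r = 1
  G0 : ∀ r, 0 < r → 0 ≤ G r
  Gi : Integrable G (mu n)
  i1 : ∀ r, 0 < r → r ≤ rm → q r * h r ≤ 0
  i2 : ∀ r, 0 < r → r ≤ rm → h r^2 + |h r| * |q r| ≤ C * (χ r * (|h r| * |q r|) + G r)
  la : ∀ r ∈ Icc rm rp, |q r| ≤ C * |h r|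
  x1 : ∀ r, rp ≤ r → 0 ≤ q r * h r
  x2 : ∀ r, rp ≤ r → |h r| ≤ C * |q r|
  vi : Integrable vd (mu n)
  v0 : ∫ r, vd r ∂mu n = 0
  v1 : ∀ r, 0 ≤ vd r * h r
  v2 : ∀ r, |vd r| ≤ C * (|h r| * (pz r + |q r| + |h r|))
  v3 : ∀ r ∈ Icc rm rp, |h r| ≤ C * |vd r|
  pc : Continuous pz
  p0 : ∀ r, 0 ≤ pz r
  pi : Integrable (fun r => pz r^2) (mu n)
  p2 : ∫ r, pz r^2 ∂mu n ≤ C * ε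

section
variable {n : ℕ} {r1 r2 M C ε rm rp : ℝ} {h q χ G vd pz : ℝ → ℝ}

lemma HC.neg (H : HC n r1 r2 M C ε rm rp h q χ G vd pz) :
    HC n r1 r2 M C ε rm rp (fun r => - h r) (fun r => - q r) χ G (fun r => - vd r) pz where
  hn := H.hn
  ε0 := H.ε0
  r10 := H.r10
  l1 := H.l1
  l2 := H.l2
  l3 := H.l3
  w1 := H.w1
  w2 := H.w2
  Cge := H.Cge
  Mge := H.Mge
  εs := H.εs
  hd := H.hd.neg
  hs := by simpa using H.hs
  hds := by simpa [deriv.fun_neg] using H.hds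
  h1 := by simpa using H.h1
  qc := H.qc.neg
  qs := by simpa using H.qs
  χc := H.χc
  χm := H.χm
  χ1 := H.χ1
  G0 := H.G0
  Gi := H.Gi
  i1 := by simpa using H.i1
  i2 := by simpa using H.i2
  la := by simpa using H.la
  x1 := by simpa using H.x1
  x2 := by simpa using H.x2
  vi := H.vi.neg
  v0 := by rw [integral_neg, H.v0, neg_zero]
  v1 := by simpa using H.v1
  v2 := by simpa using H.v2
  v3 := by simpa using H.v3
  pc := H.pc
  p0 := H.p0
  pi := H.pi
  p2 := H.p2

def kk (ε : ℝ) (h q χ : ℝ → ℝ) (r : ℝ) : ℝ := ε * deriv h r + χ r * q r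

lemma HC.ki (H : HC n r1 r2 M C ε rm rp h q χ G vd pz) : Integrable (fun r => kk ε h q χ r^2) (mu n) := by
  have m1 : AEStronglyMeasurable (fun r => ε * deriv h r) (mu n) := ((measurable_deriv h).const_mul ε).aestronglyMeasurable
  have m2 : AEStronglyMeasurable (fun r => χ r * q r) (mu n) := (H.χc.mul H.qc).aestronglyMeasurable
  refine int_add_sq m1 m2 ?_ ?_
  · have := H.hds.const_mul (ε^2)
    refine this.congr (ae_of_all _ fun r => ?_)
    simp only; ring
  · refine H.qs.mono' (m2.pow 2) (ae_of_all _ fun r => ?_)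
    rw [Real.norm_of_nonneg (sq_nonneg _), mul_pow]
    have := H.χm r
    exact mul_le_of_le_one_left (sq_nonneg _) (by nlinarith [this.1, this.2])

/-- a truncation of h -/
structure Tr (h g : ℝ → ℝ) : Prop where
  c : Continuous g
  d : ∀ r, HasDerivAt (fun r => g r^2) (2 * g r * deriv h r) r
  e : ∀ r, g r = h r ∨ g r = 0

lemma Tr.self (hd : Differentiable ℝ h) : Tr h h := by
  refine ⟨hd.continuous, fun r => ?_, fun r => Or.inl rfl⟩
  have := (hd r).hasDerivAt.fun_pow 2
  exact this.congr_deriv (by simp)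

lemma Tr.neg (hd : Differentiable ℝ h) : Tr h (fun r => min (h r) 0) := by
  refine ⟨hd.continuous.min continuous_const, fun r => ?_, fun r => ?_⟩
  · have key : HasDerivAt (fun t : ℝ => (min t 0)^2) (2 * min (h r) 0) (h r) := by
      rcases lt_trichotomy (h r) 0 with h0 | h0 | h0
      · rw [min_eq_left h0.le]
        have h1 : HasDerivAt (fun t : ℝ => t^2) (2 * h r) (h r) := by simpa using hasDerivAt_pow 2 (h r)
        refine h1.congr_of_eventuallyEq ?_
        filter_upwards [Iio_mem_nhds h0] with t ht
        rw [min_eq_left (le_of_lt ht)]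
      · rw [h0]
        simp only [min_self, mul_zero]
        rw [hasDerivAt_iff_isLittleO_nhds_zero]
        simp only [zero_add, min_self, smul_eq_mul, mul_zero, sub_zero]
        have h2 : (fun t : ℝ => (min t 0)^2) =O[nhds 0] fun t => t^2 := by
          apply Asymptotics.IsBigO.of_bound 1
          filter_upwards with t
          rw [one_mul, norm_pow, norm_pow]
          apply pow_le_pow_left₀ (norm_nonneg _)
          rcases le_total t 0 with h | h
          · rw [min_eq_left h]
          · rw [min_eq_right h]; simp
        have h3 := h2.trans_isLittleO (Asymptotics.isLittleO_pow_id (n := 2) (by norm_num))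
        simpa using h3
      · rw [min_eq_right h0.le, mul_zero]
        refine (hasDerivAt_const (h r) (0:ℝ)).congr_of_eventuallyEq ?_
        filter_upwards [Ioi_mem_nhds h0] with t ht
        rw [min_eq_right (le_of_lt ht)]; simp
    have := HasDerivAt.comp r key (hd r).hasDerivAt
    exact this
  · rcases le_total (h r) 0 with h0 | h0
    · left; exact min_eq_left h0
    · right; exact min_eq_right h0

lemma Tr.abs_le {g : ℝ → ℝ} (T : Tr h g) (r : ℝ) : |g r| ≤ |h r| := by
  rcases T.e r with e | e <;> rw [e]
  simp

lemma Tr.dY {g : ℝ → ℝ} (T : Tr h g) (r : ℝ) : HasDerivAt (fun r => r^(n-1) * g r^2)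
    (((n-1:ℕ):ℝ) * r^(n-1-1) * g r^2 + r^(n-1) * (2 * g r * deriv h r)) r :=
  (hasDerivAt_pow (n-1) r).fun_mul (T.d r)

lemma int_prod {f g : ℝ → ℝ} (mf : AEStronglyMeasurable f (mu n)) (mg : AEStronglyMeasurable g (mu n))
    (hf : Integrable (fun r => f r^2) (mu n)) (hg : Integrable (fun r => g r^2) (mu n)) :
    Integrable (fun r => f r * g r) (mu n) := by
  refine (hf.fun_add hg).mono' (mf.mul mg) (ae_of_all _ fun r => ?_)
  rw [Real.norm_eq_abs, abs_le]
  constructor <;> nlinarith [sq_nonneg (f r + g r), sq_nonneg (f r - g r), sq_nonneg (f r), sq_nonneg (g r)]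

lemma HC.gs (H : HC n r1 r2 M C ε rm rp h q χ G vd pz) {g : ℝ → ℝ} (T : Tr h g) : Integrable (fun r => g r^2) (mu n) := by
  refine H.hs.mono' (T.c.pow 2).aestronglyMeasurable (ae_of_all _ fun r => ?_)
  rw [Real.norm_of_nonneg (sq_nonneg _)]
  exact sq_le_sq.2 (T.abs_le r)

lemma HC.gq (H : HC n r1 r2 M C ε rm rp h q χ G vd pz) {g : ℝ → ℝ} (T : Tr h g) : Integrable (fun r => |g r| * |q r|) (mu n) := by
  have := (int_prod T.c.aestronglyMeasurable H.qc.aestronglyMeasurable (H.gs T) H.qs).abs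
  refine this.congr (ae_of_all _ fun r => ?_)
  simp only [abs_mul]

set_option maxHeartbeats 1000000 in
lemma HC.ext (H : HC n r1 r2 M C ε rm rp h q χ G vd pz) {g : ℝ → ℝ} (T : Tr h g) :
    ∫ r in Ioi rp, r^(n-1) * (g r^2 + |g r| * |q r|) ≤
      (1 + C) * (2 * C * (∫ r, kk ε h q χ r^2 ∂mu n) + ε * (r2^(n-1) * g rp^2)) := by
  have hC := H.Cge
  have hn2 : (2:ℝ) ≤ n := by exact_mod_cast H.hn
  have hrp : 0 < rp := H.r10.trans_le (H.l1.trans H.l2.le)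
  set Y' : ℝ → ℝ := fun r => ((n-1:ℕ):ℝ) * r^(n-1-1) * g r^2 + r^(n-1) * (2 * g r * deriv h r) with hY'
  have hcast : ((n-1:ℕ):ℝ) = (n:ℝ) - 1 := by rw [Nat.cast_sub (by have := H.hn; omega)]; simp
  have gsI := mu_Ioi_le (H.gs T) (fun r _ => sq_nonneg _) hrp.le
  have gqI := mu_Ioi_le (H.gq T) (fun r _ => by positivity) hrp.le
  have kI := mu_Ioi_le H.ki (fun r _ => sq_nonneg _) hrp.le
  have ghI : IntegrableOn (fun r => r^(n-1) * (g r * deriv h r)) (Ioi rp) := by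
    have := int_prod T.c.aestronglyMeasurable (measurable_deriv h).aestronglyMeasurable (H.gs T) H.hds
    rw [mu_integrable] at this
    exact this.mono_set (Ioi_subset_Ioi hrp.le)
  have hpw : ∀ r : ℝ, r^(n-1) = r^(n-1-1) * r := by
    intro r; rw [← pow_succ]; congr 1; have := H.hn; omega
  have Y'I : IntegrableOn Y' (Ioi rp) := by
    refine Integrable.add ?_ ?_
    · refine (gsI.1.const_mul ((n-1:ℕ)/rp:ℝ)).mono' ?_ ?_
      · exact (((continuous_const.mul (continuous_pow _)).mul (T.c.pow 2))).aestronglyMeasurable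
      · rw [ae_restrict_iff' measurableSet_Ioi]
        filter_upwards with r hr
        have hr' : rp < r := hr
        have hr0 : 0 < r := hrp.trans hr
        rw [Real.norm_of_nonneg (by positivity), div_mul_eq_mul_div, le_div_iff₀ hrp, hpw r]
        have : 0 ≤ ((n-1:ℕ):ℝ) * r^(n-1-1) * g r^2 := by positivity
        nlinarith
    · refine (ghI.const_mul 2).congr (ae_of_all _ fun r => ?_)
      simp only; ring
  have hF : ∫ r in Ioi rp, Y' r = -(rp^(n-1) * g rp^2) :=
    ftc_Ioi (s := ∅) (Y := fun r => r^(n-1) * g r^2) countable_empty (((continuous_pow _).mul (T.c.pow 2)).continuousOn) (fun r _ _ => T.dY r) gsI.1 Y'I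
  have pw : ∀ r ∈ Ioi rp, r^(n-1) * (|g r| * |q r|) ≤ 2 * C * (r^(n-1) * kk ε h q χ r^2) + (-ε) * Y' r := by
    intro r hr
    have hr' : rp < r := hr
    have hr0 : 0 < r := hrp.trans hr'
    have hχ := H.χ1 r (H.l2.le.trans hr'.le)
    have hk : kk ε h q χ r = ε * deriv h r + q r := by unfold kk; rw [hχ, one_mul]
    set k := kk ε h q χ r
    have hgq : g r * q r = |g r| * |q r| := by
      rw [← abs_mul, abs_of_nonneg]
      rcases T.e r with e | e <;> rw [e]
      · rw [mul_comm]; exact H.x1 r hr'.le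
      · simp
    have hg2 : g r^2 ≤ C * (|g r| * |q r|) := by
      rw [← sq_abs]
      rcases T.e r with e | e <;> rw [e]
      · have := mul_le_mul_of_nonneg_left (H.x2 r hr'.le) (abs_nonneg (h r)); nlinarith
      · simp
    set s := |g r| * |q r| with hs
    have hw : 0 < r^(n-1-1) := by positivity
    set w := r^(n-1-1) with hwd
    have e1 : ε * Y' r = r * w * (2 * (g r * (k - q r))) + ε * (((n:ℝ)-1) * w * g r^2) := by
      simp only [hY']; rw [hcast, hpw r, hk]; ring
    have e2 : 2 * (g r * k) ≤ s / 2 + 2 * C * k^2 := by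
      have : 0 ≤ (g r - 2 * C * k)^2 := sq_nonneg _
      have h3 : 4 * C * (g r * k) ≤ g r^2 + 4 * C^2*k^2 := by nlinarith
      have h4 : 4 * C * (g r * k) ≤ C * s + 4 * C^2 * k^2 := by linarith
      have h5 : C * (2 * (2 * (g r * k))) ≤ C * (s + 4 * C * k^2) := by nlinarith
      have := le_of_mul_le_mul_left h5 (by linarith); linarith
    have e3 : ε * (((n:ℝ)-1) * w * g r^2) ≤ r * w * (s/2) := by
      have h3 : ε * (2 * ((n:ℝ)-1) * C) ≤ r := H.εs.trans (H.l1.trans (H.l2.le.trans hr'.le))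
      have hs0 : 0 ≤ s := by positivity
      have h4 : ε * (((n:ℝ)-1) * w * g r^2) ≤ ε * (((n:ℝ)-1) * w * (C * s)) := by
        have : (0:ℝ) ≤ n - 1 := by linarith
        have := H.ε0
        gcongr
      have h5 := mul_le_mul_of_nonneg_right h3 (by positivity : 0 ≤ w * s)
      nlinarith
    rw [hpw r]
    have hrw : 0 < r * w := by positivity
    have e4 := mul_le_mul_of_nonneg_left e2 hrw.le
    have e5 : ε * Y' r ≤ r * w * (s/2 + 2 * C * k^2) - 2 * (r * w) * s + r * w * (s/2) := by
      rw [e1]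
      have : r * w * (2 * (g r * (k - q r))) = r * w * (2 * (g r * k)) - 2 * (r * w) * s := by rw [← hgq]; ring
      linarith
    nlinarith
  have hmono : ∫ r in Ioi rp, r^(n-1) * (|g r| * |q r|) ≤ ∫ r in Ioi rp, (2 * C * (r^(n-1) * kk ε h q χ r^2) + (-ε) * Y' r) :=
    setIntegral_mono_on gqI.1 ((kI.1.const_mul _).fun_add (Y'I.const_mul _)) measurableSet_Ioi pw
  rw [integral_add (kI.1.const_mul _) (Y'I.const_mul _), integral_const_mul, integral_const_mul, hF] at hmono
  have hS : ∫ r in Ioi rp, r^(n-1) * (g r^2 + |g r| * |q r|) ≤ ∫ r in Ioi rp, (1 + C) * (r^(n-1) * (|g r| * |q r|)) := by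
    apply setIntegral_mono_on
    · refine (gsI.1.add gqI.1).congr (ae_of_all _ fun r => ?_)
      simp only [Pi.add_apply]; ring
    · exact gqI.1.const_mul _
    · exact measurableSet_Ioi
    · intro r hr
      have hr' : rp < r := hr
      have hg2 : g r^2 ≤ C * (|g r| * |q r|) := by
        rw [← sq_abs]
        rcases T.e r with e | e <;> rw [e]
        · have := mul_le_mul_of_nonneg_left (H.x2 r hr'.le) (abs_nonneg (h r)); nlinarith
        · simp
      have hw : 0 < r^(n-1) := pow_pos (hrp.trans hr') _
      have := mul_le_mul_of_nonneg_left hg2 hw.le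
      linarith
  rw [integral_const_mul] at hS
  refine hS.trans ?_
  apply mul_le_mul_of_nonneg_left _ (by linarith)
  have h6 : 2 * C * ∫ r in Ioi rp, r^(n-1) * kk ε h q χ r^2 ≤ 2 * C * (∫ r, kk ε h q χ r^2 ∂mu n) :=
    mul_le_mul_of_nonneg_left kI.2.2 (by linarith)
  have h7 : ε * (rp^(n-1) * g rp^2) ≤ ε * (r2^(n-1) * g rp^2) := by
    have := H.ε0
    have := H.l3
    gcongr
  linarith

set_option maxHeartbeats 1000000 in
lemma HC.int (H : HC n r1 r2 M C ε rm rp h q χ G vd pz) {g : ℝ → ℝ} (T : Tr h g) :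
    ∫ r in (0:ℝ)..rm, r^(n-1) * (g r^2 + |g r| * |q r|) ≤
      C * (2 * (∫ r, G r ∂mu n) + C * (∫ r, kk ε h q χ r^2 ∂mu n) + ε * (r2^(n-1) * g rm^2)) := by
  have hC := H.Cge
  have hn2 : (2:ℝ) ≤ n := by exact_mod_cast H.hn
  have hrm : 0 < rm := H.r10.trans_le H.l1
  set Y' : ℝ → ℝ := fun r => ((n-1:ℕ):ℝ) * r^(n-1-1) * g r^2 + r^(n-1) * (2 * g r * deriv h r) with hY'
  have gsI := mu_Ioc_le (H.gs T) (fun r _ => sq_nonneg _) le_rfl hrm.le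
  have gqI := mu_Ioc_le (H.gq T) (fun r _ => by positivity) le_rfl hrm.le
  have GI := mu_Ioc_le H.Gi H.G0 le_rfl hrm.le
  have kI := mu_Ioc_le H.ki (fun r _ => sq_nonneg _) le_rfl hrm.le
  have ghI : IntervalIntegrable (fun r => r^(n-1) * (g r * deriv h r)) volume 0 rm := by
    have := int_prod T.c.aestronglyMeasurable (measurable_deriv h).aestronglyMeasurable (H.gs T) H.hds
    rw [mu_integrable] at this
    rw [intervalIntegrable_iff_integrableOn_Ioc_of_le hrm.le]
    exact this.mono_set Ioc_subset_Ioi_self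
  have Y'I : IntervalIntegrable Y' volume 0 rm := by
    refine IntervalIntegrable.add ?_ ?_
    · exact ((((continuous_const.mul (continuous_pow _)).mul (T.c.pow 2)))).intervalIntegrable _ _
    · refine IntervalIntegrable.congr (fun r _ => ?_) (ghI.const_mul 2)
      show 2 * (r^(n-1) * (g r * deriv h r)) = r^(n-1) * (2 * g r * deriv h r); ring
  have hF : ∫ r in (0:ℝ)..rm, Y' r = rm^(n-1) * g rm^2 := by
    rw [intervalIntegral.integral_eq_sub_of_hasDerivAt (f := fun r => r^(n-1) * g r^2) (fun r _ => T.dY r) Y'I]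
    rw [zero_pow (by have := H.hn; omega)]; ring
  have pw : ∀ r ∈ Ioo 0 rm, r^(n-1) * (g r^2 + |g r| * |q r|) ≤
      C * (2 * (r^(n-1) * G r) + C * (r^(n-1) * kk ε h q χ r^2) + ε * Y' r) := by
    intro r hr
    have hr0 : 0 < r := hr.1
    have hk : kk ε h q χ r = ε * deriv h r + χ r * q r := rfl
    set k := kk ε h q χ r
    have hG := H.G0 r hr0
    have hgq : g r * q r = -(|g r| * |q r|) := by
      have : g r * q r ≤ 0 := by
        rcases T.e r with e | e <;> rw [e]
        · rw [mul_comm]; exact H.i1 r hr0 hr.2.le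
        · simp
      rw [← abs_mul, abs_of_nonpos this]; ring
    have hg2 : g r^2 + |g r| * |q r| ≤ C * (χ r * (|g r| * |q r|) + G r) := by
      rcases T.e r with e | e <;> rw [e]
      · exact H.i2 r hr0 hr.2.le
      · simp; positivity
    set s := |g r| * |q r| with hs
    have hs0 : 0 ≤ s := by positivity
    have hw : 0 < r^(n-1) := by positivity
    have e1 : r^(n-1) * (2 * (g r * k) + 2 * (χ r * s)) ≤ ε * Y' r := by
      have : ε * Y' r = r^(n-1) * (2 * (g r * k) - 2 * χ r * (g r * q r)) + ε * (((n-1:ℕ):ℝ) * r^(n-1-1) * g r^2) := by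
        simp only [hY']; rw [hk]; ring
      rw [this, hgq]
      have h3 : 0 ≤ ε * (((n-1:ℕ):ℝ) * r^(n-1-1) * g r^2) := by have := H.ε0; positivity
      nlinarith
    set w := r^(n-1)
    have e2 : -(χ r * s + G r + C * k^2) ≤ 2 * (g r * k) := by
      have : 0 ≤ (g r + C * k)^2 := sq_nonneg _
      have h3 : g r^2 ≤ C * (χ r * s + G r) := by linarith
      have h5 : C * (-(χ r * s + G r + C * k^2)) ≤ C * (2 * (g r * k)) := by nlinarith
      exact le_of_mul_le_mul_left h5 (by linarith)
    have e3 : w * (χ r * s - G r - C * k^2) ≤ ε * Y' r := by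
      refine le_trans ?_ e1
      apply mul_le_mul_of_nonneg_left _ hw.le
      linarith
    have e4 := mul_le_mul_of_nonneg_left hg2 hw.le
    refine e4.trans ?_
    rw [show w * (C * (χ r * s + G r)) = C * (w * (χ r * s + G r)) by ring]
    apply mul_le_mul_of_nonneg_left _ (by linarith : (0:ℝ) ≤ C)
    linarith
  have i1 : IntervalIntegrable (fun r => r^(n-1) * (g r^2 + |g r| * |q r|)) volume 0 rm := by
    refine IntervalIntegrable.congr (fun r _ => ?_) (gsI.1.add gqI.1)
    show r^(n-1) * g r^2 + r^(n-1) * (|g r| * |q r|) = r^(n-1) * (g r^2 + |g r| * |q r|); ring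
  have j1 : IntervalIntegrable (fun r => 2 * (r^(n-1) * G r)) volume 0 rm := GI.1.const_mul 2
  have j2 : IntervalIntegrable (fun r => C * (r^(n-1) * kk ε h q χ r^2)) volume 0 rm := kI.1.const_mul C
  have j3 : IntervalIntegrable (fun r => ε * Y' r) volume 0 rm := Y'I.const_mul ε
  have j4 : IntervalIntegrable (fun r => 2 * (r^(n-1) * G r) + C * (r^(n-1) * kk ε h q χ r^2)) volume 0 rm := j1.add j2
  have j5 : IntervalIntegrable (fun r => 2 * (r^(n-1) * G r) + C * (r^(n-1) * kk ε h q χ r^2) + ε * Y' r) volume 0 rm := j4.add j3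
  have hmono := intervalIntegral.integral_mono_on_of_le_Ioo hrm.le i1 (j5.const_mul C) pw
  rw [intervalIntegral.integral_const_mul, intervalIntegral.integral_add j4 j3, intervalIntegral.integral_add j1 j2,
    intervalIntegral.integral_const_mul, intervalIntegral.integral_const_mul, intervalIntegral.integral_const_mul, hF] at hmono
  refine hmono.trans ?_
  apply mul_le_mul_of_nonneg_left _ (by linarith)
  have h6 := mul_le_mul_of_nonneg_left kI.2.2 (by linarith : 0 ≤ C)
  have h7 : ε * (rm^(n-1) * g rm^2) ≤ ε * (r2^(n-1) * g rm^2) := by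
    have := H.ε0
    have := H.l2.le.trans H.l3
    gcongr
  linarith [GI.2.2]
end


section
variable {n : ℕ} {r1 r2 M C ε rm rp : ℝ} {h q χ G vd pz : ℝ → ℝ}

lemma HC.lay (H : HC n r1 r2 M C ε rm rp h q χ G vd pz) : ∀ r ∈ Icc rm rp,
    h r^2 ≤ exp ((2*C+1)*M) * (h rm^2 + ε⁻¹ * ((r1^(n-1))⁻¹ * ∫ r, kk ε h q χ r^2 ∂mu n)) ∧
    h rm^2 ≤ exp ((2*C+1)*M) * (h r^2 + ε⁻¹ * ((r1^(n-1))⁻¹ * ∫ r, kk ε h q χ r^2 ∂mu n)) := by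
  intro r hr
  have hC := H.Cge
  have hε := H.ε0
  have hr1 := H.r10
  have hrm : 0 < rm := hr1.trans_le H.l1
  have hki : IntegrableOn (fun r => kk ε h q χ r^2) (Icc rm rp) :=
    (mu_local H.ki (by linarith : 0 < rm/2)).mono_set (fun x hx => by
      have : rm ≤ x := hx.1
      show rm/2 < x
      linarith)
  have h1 := gron (y := fun r => h r^2) (κ := fun r => ε⁻¹ * kk ε h q χ r^2) (B := (2*C+1)/ε) H.l2.le (by positivity)
    (Tr.self H.hd).d (fun r => by positivity) (hki.const_mul _) (by
      intro r hr
      have hχ := H.χ1 r hr.1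
      have hk : kk ε h q χ r = ε * deriv h r + q r := by unfold kk; rw [hχ, one_mul]
      set k := kk ε h q χ r
      have hd : deriv h r = (k - q r)/ε := by rw [hk]; field_simp; ring
      rw [hd, show 2 * h r * ((k - q r)/ε) = (2 * (h r * k) - 2 * (h r * q r))/ε by ring, abs_div, abs_of_pos hε]
      rw [show (2*C+1)/ε * h r^2 + ε⁻¹ * k^2 = ((2*C+1) * h r^2 + k^2)/ε by field_simp]
      apply div_le_div_of_nonneg_right _ hε.le
      have a1 : |h r * q r| ≤ C * h r^2 := by
        rw [abs_mul, ← sq_abs]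
        have := mul_le_mul_of_nonneg_left (H.la r hr) (abs_nonneg (h r)); nlinarith
      rw [abs_le] at a1 ⊢
      constructor <;> nlinarith [sq_nonneg (h r - k), sq_nonneg (h r + k)]) (fun r => sq_nonneg _) r hr
  rw [intervalIntegral.integral_const_mul] at h1
  have h2 : ∫ r in rm..rp, kk ε h q χ r^2 ≤ (r1^(n-1))⁻¹ * ∫ r, kk ε h q χ r^2 ∂mu n := by
    have h3 := mu_local_le (b := rp) H.ki (fun r => sq_nonneg _) hrm
    rw [← intervalIntegral.integral_of_le H.l2.le] at h3
    rw [inv_mul_eq_div, le_div_iff₀ (by positivity), mul_comm]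
    refine le_trans ?_ h3
    apply mul_le_mul_of_nonneg_right
    · exact pow_le_pow_left₀ hr1.le H.l1 _
    · exact intervalIntegral.integral_nonneg H.l2.le fun _ _ => sq_nonneg _
  have h3 : exp ((2*C+1)/ε * (rp - rm)) ≤ exp ((2*C+1)*M) := by
    apply Real.exp_le_exp.2
    rw [div_mul_eq_mul_div, div_le_iff₀ hε]
    have := mul_le_mul_of_nonneg_left H.w1 (by linarith : 0 ≤ 2*C+1)
    linarith
  have h4 : 0 ≤ ∫ r in rm..rp, kk ε h q χ r^2 := intervalIntegral.integral_nonneg H.l2.le fun _ _ => sq_nonneg _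
  constructor
  · refine h1.1.trans ?_
    gcongr
  · refine h1.2.trans ?_
    gcongr

def X3 (n : ℕ) (ε : ℝ) (h q χ G : ℝ → ℝ) : ℝ := (∫ r, kk ε h q χ r^2 ∂mu n) + ∫ r, G r ∂mu n

lemma HC.K0 (_H : HC n r1 r2 M C ε rm rp h q χ G vd pz) : 0 ≤ ∫ r, kk ε h q χ r^2 ∂mu n := integral_nonneg fun _ => sq_nonneg _

lemma HC.GG0 (H : HC n r1 r2 M C ε rm rp h q χ G vd pz) : 0 ≤ ∫ r, G r ∂mu n := by
  apply integral_nonneg_of_ae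
  filter_upwards [mu_ae_pos n] with r hr using H.G0 r hr

set_option maxHeartbeats 1000000 in
lemma HC.f0pos (H : HC n r1 r2 M C ε rm rp h q χ G vd pz) (hpos : 0 < h rm) {B c a Cs : ℝ} (hB : B = exp ((2*C+1)*M))
    (hc : c = 1 / (2*B)) (ha : a = r1^(n-1) * c / (M * C^2)) (hCs : Cs = 2 * C + C^2 + 2*C*(1+C)) :
    ε * h rm^2 ≤ (2 * B * (r1^(n-1))⁻¹ + (2/a)*(Cs*C/(2*a)+Cs)) * X3 n ε h q χ G := by
  have hC := H.Cge
  have hM := H.Mge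
  have hε := H.ε0
  have hr1 := H.r10
  have hrm : 0 < rm := hr1.trans_le H.l1
  have hB1 : 1 ≤ B := by rw [hB]; apply Real.one_le_exp; positivity
  have hc0 : 0 < c := by rw [hc]; positivity
  have ha0 : 0 < a := by rw [ha]; positivity
  have hCs0 : 0 < Cs := by rw [hCs]; positivity
  have hK := H.K0
  have hG := H.GG0
  have hlay := H.lay
  rw [← hB] at hlay
  set f0 := h rm with hf0
  have hf1 : f0 ≤ 1 := (le_abs_self _).trans (H.h1 rm)
  unfold X3
  set K := ∫ r, kk ε h q χ r^2 ∂mu n with hKd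
  set Gi := ∫ r, G r ∂mu n with hGd
  have hZ : 0 < (r1^(n-1))⁻¹ := by positivity
  set Z := (r1^(n-1))⁻¹ with hZd
  have hq0 : 0 ≤ (2/a)*(Cs*C/(2*a)+Cs) := by positivity
  rcases le_or_gt (f0^2) (2 * B * (ε⁻¹ * (Z * K))) with hA | hA
  · have h1 := mul_le_mul_of_nonneg_left hA hε.le
    have h2 : ε * (2 * B * (ε⁻¹ * (Z * K))) = 2 * B * Z * K := by field_simp
    rw [h2] at h1
    have h3 : 0 ≤ 2 * B * Z * Gi := by positivity
    have h4 : 0 ≤ ((2/a)*(Cs*C/(2*a)+Cs)) * (K + Gi) := by positivity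
    linarith
  have hsq : ∀ r ∈ Icc rm rp, (c * f0)^2 ≤ h r^2 := by
    intro r hr
    have h1 := (hlay r hr).2
    have h2 : f0^2/2 ≤ B * h r^2 := by nlinarith
    have h3 : (c*f0)^2 = f0^2/(4*B^2) := by rw [hc]; field_simp; norm_num
    rw [h3, div_le_iff₀ (by positivity)]
    have h4 : B * (f0^2/2) ≤ B * (B * h r^2) := by gcongr
    have h5 : f0^2/2 ≤ B * (f0^2/2) := le_mul_of_one_le_left (by positivity) hB1
    nlinarith
  have hcf : 0 < c * f0 := by positivity
  have hposl : ∀ r ∈ Icc rm rp, c * f0 ≤ h r := by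
    intro r hr
    by_contra hcon
    push Not at hcon
    have hneg : h r < 0 := by
      by_contra h5; push Not at h5
      have := hsq r hr
      nlinarith
    obtain ⟨t, ht, ht0⟩ := intermediate_value_Icc' hr.1 H.hd.continuous.continuousOn ⟨hneg.le, hpos.le⟩
    have := hsq t ⟨ht.1, ht.2.trans hr.2⟩
    rw [ht0] at this
    nlinarith
  have T := Tr.neg H.hd
  set g : ℝ → ℝ := fun r => min (h r) 0 with hg
  have gz : ∀ r ∈ Icc rm rp, g r = 0 := fun r hr => min_eq_right (hcf.le.trans (hposl r hr))
  -- the estimate of the truncated part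
  have iS : Integrable (fun r => g r^2 + |g r| * |q r|) (mu n) := (H.gs T).fun_add (H.gq T)
  have hS : ∫ r, (g r^2 + |g r| * |q r|) ∂mu n ≤ Cs * (K + Gi) := by
    rw [mu_split iS hrm.le H.l2.le]
    have h1 := H.int T
    have h2 := H.ext T
    have h3 : ∫ r in rm..rp, r^(n-1) * (g r^2 + |g r| * |q r|) = 0 := by
      rw [intervalIntegral.integral_congr (g := fun _ => (0:ℝ)), intervalIntegral.integral_zero]
      intro r hr
      rw [uIcc_of_le H.l2.le] at hr
      simp only
      rw [gz r hr]; simp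
    rw [gz rm ⟨le_rfl, H.l2.le⟩] at h1
    rw [gz rp ⟨H.l2.le, le_rfl⟩] at h2
    rw [← hKd] at h1 h2
    rw [← hGd] at h1
    rw [h3]
    have h4 : Cs * (K + Gi) = C * (2 * Gi + C * K) + (1 + C) * (2*C*K) + 2 * C * K + (C^2 + 2*C*(1+C)) * Gi := by rw [hCs]; ring
    have h5 : 0 ≤ 2 * C * K := by positivity
    have h6 : 0 ≤ (C^2 + 2*C*(1+C)) * Gi := by positivity
    norm_num at h1 h2
    linarith
  have iP : Integrable (fun r => |g r| * pz r) (mu n) := by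
    have := int_prod T.c.abs.aestronglyMeasurable H.pc.aestronglyMeasurable (by simpa using H.gs T) H.pi
    exact this
  have iB : Integrable (fun r => |g r| * pz r + (g r^2 + |g r| * |q r|)) (mu n) := iP.fun_add iS
  have iT : Integrable (fun r => vd r + C * (|g r| * pz r + (g r^2 + |g r| * |q r|))) (mu n) := H.vi.fun_add (iB.const_mul C)
  have nn : ∀ r, 0 ≤ vd r + C * (|g r| * pz r + (g r^2 + |g r| * |q r|)) := by
    intro r
    have hp0 := H.p0 r
    rcases le_or_gt 0 (h r) with h0 | h0
    · have : 0 ≤ vd r := by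
        rcases eq_or_lt_of_le h0 with h1 | h1
        · have := H.v2 r
          rw [← h1] at this
          simp at this
          rw [this]
        · exact nonneg_of_mul_nonneg_left (H.v1 r) h1
      positivity
    · have hgr : g r = h r := min_eq_left h0.le
      have := H.v2 r
      rw [hgr, ← sq_abs (h r)]
      have h2 := neg_abs_le (vd r)
      nlinarith
  have low : a * C * (ε * f0) ≤ ∫ r, (vd r + C * (|g r| * pz r + (g r^2 + |g r| * |q r|))) ∂mu n := by
    have h1 := mu_local_le (b := rp) iT nn hrm
    have h2 : ∫ r in Ioc rm rp, c * f0 / C ≤ ∫ r in Ioc rm rp, (vd r + C * (|g r| * pz r + (g r^2 + |g r| * |q r|))) := by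
      apply setIntegral_mono_on
      · simp
      · exact (mu_local iT (by linarith : 0 < rm/2)).mono_set (fun x hx => by
          have : rm < x := hx.1
          show rm/2 < x
          linarith)
      · exact measurableSet_Ioc
      · intro r hr
        have hr' := Ioc_subset_Icc_self hr
        have h3 := hposl r hr'
        have h4 := H.v3 r hr'
        have hvd : 0 ≤ vd r := nonneg_of_mul_nonneg_left (H.v1 r) (hcf.trans_le h3)
        rw [abs_of_nonneg hvd, abs_of_nonneg (hcf.le.trans h3)] at h4
        rw [gz r hr']
        simp
        rw [div_le_iff₀ (by linarith)]
        linarith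
    rw [setIntegral_const, Measure.real, Real.volume_Ioc, ENNReal.toReal_ofReal (by linarith [H.l2]), smul_eq_mul] at h2
    refine le_trans ?_ h1
    have h3 : r1^(n-1) * ((rp-rm) * (c * f0/C)) ≤ rm^(n-1) * ∫ r in Ioc rm rp, (vd r + C * (|g r| * pz r + (g r^2 + |g r| * |q r|))) := by
      have := H.l2
      have h5 : 0 ≤ (rp-rm) * (c * f0/C) := mul_nonneg (by linarith) (by positivity)
      apply mul_le_mul (pow_le_pow_left₀ hr1.le H.l1 _) h2 h5 (by positivity)
    refine le_trans ?_ h3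
    have h4 : ε / M ≤ rp - rm := by rw [div_le_iff₀ (by linarith)]; linarith [H.w2]
    have h5 : a * C * (ε * f0) = r1^(n-1) * ((ε/M) * (c * f0/C)) := by rw [ha]; field_simp
    rw [h5]
    gcongr
  rw [integral_add H.vi (iB.const_mul C), H.v0, zero_add, integral_const_mul] at low
  have low2 : a * (ε * f0) ≤ ∫ r, (|g r| * pz r + (g r^2 + |g r| * |q r|)) ∂mu n := by
    have : C * (a * (ε * f0)) ≤ C * ∫ r, (|g r| * pz r + (g r^2 + |g r| * |q r|)) ∂mu n := by linarith
    exact le_of_mul_le_mul_left this (by linarith)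
  rw [integral_add iP iS] at low2
  have young : ∫ r, |g r| * pz r ∂mu n ≤ C / (2 * a * f0) * (Cs * (K + Gi)) + a * f0 / (2 * C) * (C * ε) := by
    have h1 : ∫ r, |g r| * pz r ∂mu n ≤ ∫ r, (C / (2 * a * f0) * (g r^2 + |g r| * |q r|) + a * f0 / (2 * C) * pz r^2) ∂mu n := by
      apply integral_mono iP ((iS.const_mul _).fun_add (H.pi.const_mul _))
      intro r
      simp only
      have h2 : |g r| * pz r ≤ C / (2 * a * f0) * |g r|^2 + a * f0 / (2*C) * pz r^2 := by
        have e : C / (2 * a * f0) * |g r|^2 + a * f0 / (2*C) * pz r^2 - |g r| * pz r = (C * |g r| - a * f0 * pz r)^2 / (2 * a * f0 * C) := by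
          field_simp; ring
        have : 0 ≤ (C * |g r| - a * f0 * pz r)^2 / (2 * a * f0 * C) := by positivity
        linarith
      rw [sq_abs] at h2
      have h3 : 0 ≤ C / (2 * a * f0) * (|g r| * |q r|) := by positivity
      linarith
    rw [integral_add (iS.const_mul _) (H.pi.const_mul _), integral_const_mul, integral_const_mul] at h1
    refine h1.trans ?_
    have := H.p2
    gcongr
  have fin : a * (ε * f0) / 2 ≤ C / (2 * a * f0) * (Cs * (K + Gi)) + Cs * (K + Gi) := by
    have e : a * f0 / (2 * C) * (C * ε) = a * (ε * f0) / 2 := by field_simp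
    rw [e] at young
    linarith
  have fin2 := mul_le_mul_of_nonneg_right fin hpos.le
  have e1 : (C / (2 * a * f0) * (Cs * (K + Gi)) + Cs * (K + Gi)) * f0 = Cs * C / (2*a) * (K+Gi) + Cs * (K+Gi) * f0 := by
    field_simp
  rw [e1] at fin2
  have hX : 0 ≤ K + Gi := by linarith
  have e2 : Cs * (K + Gi) * f0 ≤ Cs * (K + Gi) := mul_le_of_le_one_right (by positivity) hf1
  have e3 : a * (ε * f0^2) / 2 ≤ (Cs * C/(2*a) + Cs) * (K + Gi) := by nlinarith
  have e4 : ε * f0^2 ≤ (2/a) * (Cs * C/(2*a) + Cs) * (K + Gi) := by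
    have := mul_le_mul_of_nonneg_left e3 (by positivity : 0 ≤ 2/a)
    have e5 : 2 / a * (a * (ε * f0^2) / 2) = ε * f0^2 := by field_simp
    rw [e5] at this
    linarith
  have e6 : 0 ≤ 2 * B * Z * (K + Gi) := by positivity
  linarith

lemma kk_neg (r : ℝ) : kk ε (fun r => - h r) (fun r => - q r) χ r^2 = kk ε h q χ r^2 := by
  unfold kk; rw [deriv.fun_neg]; ring

set_option maxHeartbeats 1000000 in
lemma coer (n : ℕ) (r1 r2 M C : ℝ) : ∃ C', ∀ ε rm rp h q χ G vd pz, HC n r1 r2 M C ε rm rp h q χ G vd pz →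
    ∫ r, (h r^2 + |h r| * |q r|) ∂mu n ≤ C' * X3 n ε h q χ G := by
  set B := exp ((2*C+1)*M) with hB
  set c := 1 / (2*B) with hc
  set a := r1^(n-1) * c / (M * C^2) with ha
  set Cs := 2 * C + C^2 + 2*C*(1+C) with hCs
  set Z := (r1^(n-1))⁻¹ with hZd
  set C3 := 2 * B * Z + (2/a)*(Cs*C/(2*a)+Cs) with hC3
  set R := r2^(n-1) with hR
  refine ⟨C * (2 + C + R * C3) + M * R * ((1 + C) * B * (C3 + Z)) + (1+C) * (2 * C + R * B * (C3 + Z)), ?_⟩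
  intro ε rm rp h q χ G vd pz H
  have hC := H.Cge
  have hM := H.Mge
  have hε := H.ε0
  have hr1 := H.r10
  have hrm : 0 < rm := hr1.trans_le H.l1
  have hrp : 0 < rp := hrm.trans H.l2
  have hr2 : 0 < r2 := hrp.trans_le H.l3
  have hB1 : 1 ≤ B := by rw [hB]; apply Real.one_le_exp; positivity
  have hc0 : 0 < c := by rw [hc]; positivity
  have ha0 : 0 < a := by rw [ha]; positivity
  have hCs0 : 0 < Cs := by rw [hCs]; positivity
  have hZ : 0 < Z := by positivity
  have hR0 : 0 < R := by positivity
  have hC30 : 0 < C3 := by rw [hC3]; positivity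
  have hK := H.K0
  have hG := H.GG0
  have F0 : ε * h rm^2 ≤ C3 * X3 n ε h q χ G := by
    rcases lt_trichotomy (h rm) 0 with h0 | h0 | h0
    · have := H.neg.f0pos (by simpa using h0) hB hc ha hCs
      simp only [neg_sq] at this
      unfold X3 at this ⊢
      simp only [kk_neg] at this
      exact this
    · rw [h0]; unfold X3; rw [zero_pow (by norm_num), mul_zero]; positivity
    · exact H.f0pos h0 hB hc ha hCs
  have hlay := H.lay
  rw [← hB, ← hZd] at hlay
  have T := Tr.self H.hd
  have h1 := H.int T
  have h2 := H.ext T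
  unfold X3 at F0 ⊢
  set K := ∫ r, kk ε h q χ r^2 ∂mu n with hKd
  set Gi := ∫ r, G r ∂mu n with hGd
  have iS : Integrable (fun r => h r^2 + |h r| * |q r|) (mu n) := H.hs.fun_add (H.gq T)
  have sl : ∀ r ∈ Icc rm rp, ε * h r^2 ≤ B * (C3 + Z) * (K + Gi) := by
    intro r hr
    have h3 := mul_le_mul_of_nonneg_left (hlay r hr).1 hε.le
    have h4 : ε * (B * (h rm^2 + ε⁻¹ * (Z * K))) = B * (ε * h rm^2 + Z * K) := by field_simp
    rw [h4] at h3
    refine h3.trans ?_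
    rw [mul_assoc]
    apply mul_le_mul_of_nonneg_left _ (by linarith)
    have : 0 ≤ Z * Gi := by positivity
    linarith
  have h3 : ∫ r in rm..rp, r^(n-1) * (h r^2 + |h r| * |q r|) ≤ M * R * ((1 + C) * B * (C3 + Z)) * (K + Gi) := by
    have hc : ∀ r ∈ Icc rm rp, r^(n-1) * (h r^2 + |h r| * |q r|) ≤ R * ((1+C) * (ε⁻¹ * (B * (C3 + Z) * (K + Gi)))) := by
      intro r hr
      have hr0 : 0 < r := hrm.trans_le hr.1
      have h5 : h r^2 ≤ ε⁻¹ * (B * (C3 + Z) * (K + Gi)) := by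
        rw [inv_mul_eq_div, le_div_iff₀ hε]; linarith [sl r hr]
      have h6 : |h r| * |q r| ≤ C * h r^2 := by
        rw [← sq_abs]
        have := mul_le_mul_of_nonneg_left (H.la r hr) (abs_nonneg (h r)); nlinarith
      apply mul_le_mul (pow_le_pow_left₀ hr0.le (hr.2.trans H.l3) _) _ (by positivity) hR0.le
      have := mul_le_mul_of_nonneg_left h5 (by linarith : 0 ≤ 1 + C)
      linarith
    have i1 : IntervalIntegrable (fun r => r^(n-1) * (h r^2 + |h r| * |q r|)) volume rm rp :=
      (mu_Ioc_le iS (fun r _ => by positivity) hrm.le H.l2.le).1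
    have h5 := intervalIntegral.integral_mono_on H.l2.le i1 (intervalIntegrable_const) hc
    rw [intervalIntegral.integral_const, smul_eq_mul] at h5
    refine h5.trans ?_
    have h6 : 0 ≤ R * ((1+C) * (ε⁻¹ * (B * (C3 + Z) * (K + Gi)))) := by positivity
    refine (mul_le_mul_of_nonneg_right H.w1 h6).trans (le_of_eq ?_)
    field_simp
  rw [mu_split iS hrm.le H.l2.le]
  have h4 : ε * (R * h rm^2) ≤ R * C3 * (K + Gi) := by
    have := mul_le_mul_of_nonneg_left F0 hR0.le; linarith
  have h5 : ε * (R * h rp^2) ≤ R * B * (C3 + Z) * (K + Gi) := by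
    have := mul_le_mul_of_nonneg_left (sl rp ⟨H.l2.le, le_rfl⟩) hR0.le; linarith
  have h6 : C * (2 * Gi + C * K + ε * (R * h rm^2)) ≤ C * ((2 + C + R * C3) * (K + Gi)) := by
    apply mul_le_mul_of_nonneg_left _ (by linarith)
    have : 0 ≤ C * Gi := by positivity
    linarith
  have h7 : (1+C) * (2 * C * K + ε * (R * h rp^2)) ≤ (1+C) * ((2*C + R * B * (C3+Z)) * (K + Gi)) := by
    apply mul_le_mul_of_nonneg_left _ (by linarith)
    have : 0 ≤ 2 * C * Gi := by positivity
    linarith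
  linarith
end


/-- All standing data for the final coercivity argument. -/
structure SU (n : ℕ) (W W1 : ℝ → ℝ) (δ Cp Cv E0 r1 r2 M Ce Cx ra ε rm rp : ℝ) (ζ u χ : ℝ → ℝ) : Prop where
  hn : 2 ≤ n
  hp : PF W W1 δ Cp
  hv : VF n W W1 δ Cv
  ε0 : 0 < ε
  ε1 : ε ≤ 1
  E1 : 1 ≤ E0
  hm : Minz n W ε ζ
  hE : EE n W ε ζ ≤ E0
  hu : Adm n u
  mass : MM n W u = 1
  hh : ∀ r, 0 ≤ r → |u r - ζ r| ≤ δ/2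
  lay : Lay δ ε ζ r1 r2 M rm rp
  r10 : 0 < r1
  Mge : 1 ≤ M
  ra0 : 0 < ra
  ra1 : 2 * ra ≤ r1
  χd : Differentiable ℝ χ
  χdc : Continuous (deriv χ)
  χm : ∀ r, χ r ∈ Icc (0:ℝ) 1
  χ0 : ∀ r, r ≤ ra/2 → χ r = 0
  χ1 : ∀ r, ra ≤ r → χ r = 1
  χb : ∀ r, 0 < r → |deriv χ r| * r + (n-1:ℝ) * χ r ≤ Cx * r
  Cx0 : 0 ≤ Cx
  eqp : EqP W W1 δ Ce ε ζ (ra/2)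
  hs : W1 1 = 0 ∨ (W1 1 < 0 ∧ ∃ rs, ra ≤ rs ∧ (∀ r ∈ Icc 0 rs, ζ r = 1) ∧ ∀ r, rs < r → ζ r < 1)

def dq (W ζ u : ℝ → ℝ) (r : ℝ) : ℝ := √(W (u r)) - √(W (ζ r))
def AA (W W1 ζ u : ℝ → ℝ) (r : ℝ) : ℝ := W (u r) - W (ζ r) - Ws W W1 (ζ r) * (u r - ζ r)
def hhd (ζ u : ℝ → ℝ) (r : ℝ) : ℝ := u r - ζ r

def Chc (n : ℕ) (Cp Cv E0 : ℝ) : ℝ := (1 + Cp) * Cp + Cv + E0 / cn n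

section
variable {n : ℕ} {W W1 : ℝ → ℝ} {δ Cp Cv E0 r1 r2 M Ce Cx ra ε rm rp : ℝ} {ζ u χ : ℝ → ℝ}

namespace SU

lemma zin (H : SU n W W1 δ Cp Cv E0 r1 r2 M Ce Cx ra ε rm rp ζ u χ) {r : ℝ} (h0 : 0 ≤ r) (h : r ≤ rm) : ζ r ∈ Icc (1-2*δ) 1 ∧ u r ∈ Icc (1-2*δ) 1 ∧ 1 - δ ≤ ζ r := by
  have h1 := H.hm.anti h0 (show (0:ℝ) ≤ rm by linarith [H.r10, H.lay.h1]) h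
  rw [H.lay.zm] at h1
  have h2 := abs_le.1 (H.hh r h0)
  have hd := H.hp.dpos
  refine ⟨⟨by linarith, (H.hm.adm.mem r).2⟩, ⟨by linarith, (H.hu.mem r).2⟩, h1⟩

lemma zout (H : SU n W W1 δ Cp Cv E0 r1 r2 M Ce Cx ra ε rm rp ζ u χ) {r : ℝ} (h : rp ≤ r) : ζ r ∈ Icc 0 (2*δ) ∧ u r ∈ Icc 0 (2*δ) ∧ ζ r ≤ δ := by
  have hp0 : 0 ≤ rp := by linarith [H.r10, H.lay.h1, H.lay.h2]
  have h1 := H.hm.anti hp0 (show (0:ℝ) ≤ r by linarith) h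
  rw [H.lay.zp] at h1
  have h2 := abs_le.1 (H.hh r (by linarith))
  have hd := H.hp.dpos
  refine ⟨⟨(H.hm.adm.mem r).1, by linarith⟩, ⟨(H.hu.mem r).1, by linarith⟩, h1⟩

lemma zlow (H : SU n W W1 δ Cp Cv E0 r1 r2 M Ce Cx ra ε rm rp ζ u χ) {r : ℝ} (h : rm ≤ r) : ζ r ∈ Icc 0 (1-δ/2) ∧ u r ∈ Icc 0 (1-δ/2) ∧ ζ r ≤ 1 - δ := by
  have hp0 : 0 ≤ rm := by linarith [H.r10, H.lay.h1, H.lay.h2]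
  have h1 := H.hm.anti hp0 (show (0:ℝ) ≤ r by linarith) h
  rw [H.lay.zm] at h1
  have h2 := abs_le.1 (H.hh r (by linarith))
  have hd := H.hp.dpos
  refine ⟨⟨(H.hm.adm.mem r).1, by linarith⟩, ⟨(H.hu.mem r).1, by linarith⟩, h1⟩

lemma zmid (H : SU n W W1 δ Cp Cv E0 r1 r2 M Ce Cx ra ε rm rp ζ u χ) {r : ℝ} (h : r ∈ Icc rm rp) : ζ r ∈ Icc (δ/2) (1-δ/2) ∧ u r ∈ Icc (δ/2) (1-δ/2) := by
  have hp0 : 0 ≤ rm := by linarith [H.r10, H.lay.h1, H.lay.h2]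
  have h1 := H.hm.anti hp0 (show (0:ℝ) ≤ r by linarith [h.1]) h.1
  rw [H.lay.zm] at h1
  have h3 := H.hm.anti (show (0:ℝ) ≤ r by linarith [h.1]) (show (0:ℝ) ≤ rp by linarith [H.lay.h2]) h.2
  rw [H.lay.zp] at h3
  have h2 := abs_le.1 (H.hh r (by linarith [h.1]))
  have hd := H.hp.dpos
  exact ⟨⟨by linarith, by linarith⟩, ⟨by linarith, by linarith⟩⟩

lemma rarm (H : SU n W W1 δ Cp Cv E0 r1 r2 M Ce Cx ra ε rm rp ζ u χ) : ra ≤ rm := by linarith [H.lay.h1, H.ra1, H.ra0]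

lemma cWz (H : SU n W W1 δ Cp Cv E0 r1 r2 M Ce Cx ra ε rm rp ζ u χ) : Continuous fun r => W (ζ r) := contOn_comp H.hp.contW H.hm.adm.diff.continuous H.hm.adm.mem
lemma cWu (H : SU n W W1 δ Cp Cv E0 r1 r2 M Ce Cx ra ε rm rp ζ u χ) : Continuous fun r => W (u r) := contOn_comp H.hp.contW H.hu.diff.continuous H.hu.mem
lemma cq (H : SU n W W1 δ Cp Cv E0 r1 r2 M Ce Cx ra ε rm rp ζ u χ) : Continuous (dq W ζ u) := H.cWu.sqrt.sub H.cWz.sqrt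
lemma mWs (H : SU n W W1 δ Cp Cv E0 r1 r2 M Ce Cx ra ε rm rp ζ u χ) : Measurable fun r => Ws W W1 (ζ r) := by
  have h1 : Measurable fun r => √(W (ζ r)) := H.cWz.sqrt.measurable
  have h2 : Measurable fun r => W1 (ζ r) := (contOn_comp H.hp.contW1 H.hm.adm.diff.continuous H.hm.adm.mem).measurable
  unfold Ws pdv
  exact (h1.const_mul 2).mul (h2.div (h1.const_mul 2))

lemma mpdv (H : SU n W W1 δ Cp Cv E0 r1 r2 M Ce Cx ra ε rm rp ζ u χ) : Measurable fun r => pdv W W1 (ζ r) := by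
  have h1 : Measurable fun r => √(W (ζ r)) := H.cWz.sqrt.measurable
  have h2 : Measurable fun r => W1 (ζ r) := (contOn_comp H.hp.contW1 H.hm.adm.diff.continuous H.hm.adm.mem).measurable
  exact (h2.div (h1.const_mul 2))

lemma hsq (H : SU n W W1 δ Cp Cv E0 r1 r2 M Ce Cx ra ε rm rp ζ u χ) : Integrable (fun r => (hhd ζ u r)^2) (mu n) := int_sub_sq H.hu.ms H.hm.adm.ms H.hu.sq H.hm.adm.sq
lemma dh (H : SU n W W1 δ Cp Cv E0 r1 r2 M Ce Cx ra ε rm rp ζ u χ) (r : ℝ) : HasDerivAt (hhd ζ u) (deriv u r - deriv ζ r) r :=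
  (H.hu.diff r).hasDerivAt.fun_sub (H.hm.adm.diff r).hasDerivAt
lemma hdd (H : SU n W W1 δ Cp Cv E0 r1 r2 M Ce Cx ra ε rm rp ζ u χ) : Differentiable ℝ (hhd ζ u) := fun r => (H.dh r).differentiableAt
lemma hdsq (H : SU n W W1 δ Cp Cv E0 r1 r2 M Ce Cx ra ε rm rp ζ u χ) : Integrable (fun r => deriv (hhd ζ u) r^2) (mu n) := by
  have := int_sub_sq (der_ms (n := n) u) (der_ms ζ) H.hu.dsq H.hm.adm.dsq
  refine this.congr ?_
  filter_upwards with r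
  rw [(H.dh r).deriv]

lemma WsI (H : SU n W W1 δ Cp Cv E0 r1 r2 M Ce Cx ra ε rm rp ζ u χ) : Integrable (fun r => Ws W W1 (ζ r) * hhd ζ u r) (mu n) := by
  have hC := H.hp.Cge
  refine int_mul_sq H.mWs.aestronglyMeasurable H.hdd.continuous.aestronglyMeasurable ?_ H.hsq
  refine (H.hm.adm.sq.const_mul (Cp^2)).mono' (H.mWs.pow_const 2).aestronglyMeasurable ?_
  filter_upwards with r
  rw [Real.norm_eq_abs, abs_pow]
  have := pow_le_pow_left₀ (abs_nonneg _) (Ws_bd H.hp (H.hm.adm.mem r)) 2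
  linarith [mul_pow Cp (ζ r) 2]

lemma AI (H : SU n W W1 δ Cp Cv E0 r1 r2 M Ce Cx ra ε rm rp ζ u χ) : Integrable (AA W W1 ζ u) (mu n) :=
  ((H.hu.Wint H.hp).sub (H.hm.adm.Wint H.hp)).sub H.WsI

lemma qI (H : SU n W W1 δ Cp Cv E0 r1 r2 M Ce Cx ra ε rm rp ζ u χ) : Integrable (fun r => dq W ζ u r^2) (mu n) := by
  refine int_sub_sq H.cWu.sqrt.aestronglyMeasurable H.cWz.sqrt.aestronglyMeasurable ?_ ?_
  · refine (H.hu.Wint H.hp).congr ?_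
    filter_upwards with r; rw [Real.sq_sqrt (H.hp.Wnn (H.hu.mem r))]
  · refine (H.hm.adm.Wint H.hp).congr ?_
    filter_upwards with r; rw [Real.sq_sqrt (H.hp.Wnn (H.hm.adm.mem r))]

lemma A_in (H : SU n W W1 δ Cp Cv E0 r1 r2 M Ce Cx ra ε rm rp ζ u χ) {r : ℝ} (h0 : 0 ≤ r) (h : r ≤ rm) : 0 ≤ AA W W1 ζ u r ∧ ((W1 1 = 0 ∨ ζ r < 1) → (hhd ζ u r)^2 ≤ Cp * AA W W1 ζ u r) := by
  obtain ⟨hz, hu, -⟩ := H.zin h0 h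
  have hC := H.hp.Cge
  have key : (W1 1 = 0 ∨ ζ r < 1) → (hhd ζ u r)^2 ≤ Cp * AA W W1 ζ u r := by
    intro hc
    have h3 := H.hp.f3 _ hu _ hz
    have : Ws W W1 (ζ r) = W1 (ζ r) := by
      rcases eq_or_lt_of_le hz.2 with h4 | h4
      · rw [h4, Ws_one H.hp]
        rcases hc with hc | hc
        · exact hc.symm
        · linarith
      · exact Ws_lt H.hp (H.hm.adm.mem r).1 h4
    unfold AA hhd; rw [this]; exact h3
  refine ⟨?_, key⟩
  rcases eq_or_lt_of_le hz.2 with h4 | h4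
  · unfold AA; rw [h4, Ws_one H.hp, H.hp.z1]
    have := H.hp.Wnn (H.hu.mem r); linarith
  · have := key (Or.inr h4)
    by_contra hneg
    push Not at hneg
    have := mul_neg_of_pos_of_neg (show 0 < Cp by linarith) hneg
    linarith [sq_nonneg (hhd ζ u r)]

lemma q_in (H : SU n W W1 δ Cp Cv E0 r1 r2 M Ce Cx ra ε rm rp ζ u χ) {r : ℝ} (h0 : 0 ≤ r) (h : r ≤ rm) : dq W ζ u r * hhd ζ u r ≤ 0 ∧ (hhd ζ u r)^2 ≤ Cp * (|hhd ζ u r| * |dq W ζ u r|) := by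
  obtain ⟨hz, hu, -⟩ := H.zin h0 h
  have hC := H.hp.Cge
  have h4 := H.hp.f4 _ hu _ hz
  change (hhd ζ u r)^2 ≤ Cp * (-(dq W ζ u r * hhd ζ u r)) at h4
  have h5 : dq W ζ u r * hhd ζ u r ≤ 0 := by
    by_contra hneg
    push Not at hneg
    have := mul_pos (show 0 < Cp by linarith) hneg
    linarith [sq_nonneg (hhd ζ u r)]
  refine ⟨h5, ?_⟩
  rw [← abs_mul, mul_comm (hhd ζ u r), abs_of_nonpos h5]
  exact h4

lemma vd_bd (H : SU n W W1 δ Cp Cv E0 r1 r2 M Ce Cx ra ε rm rp ζ u χ) (r : ℝ) : |Vpot n W (u r) - Vpot n W (ζ r)| ≤ Cv * (|hhd ζ u r| * (√(W (ζ r)) + |dq W ζ u r| + |hhd ζ u r|)) := by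
  have hC := H.hv.Cge
  have a1 := H.hv.v2 _ (H.hu.mem r) _ (H.hm.adm.mem r)
  have a2 := H.hv.v2 _ (H.hm.adm.mem r) _ (H.hu.mem r)
  have b1 := H.hv.v1 _ (H.hu.mem r)
  have b2 := H.hv.v1 _ (H.hm.adm.mem r)
  have e : u r - ζ r = hhd ζ u r := rfl
  have e' : ζ r - u r = - hhd ζ u r := by unfold hhd; ring
  rw [e] at a1; rw [e'] at a2
  set h := hhd ζ u r
  have sq : h^2 = |h| * |h| := by rw [← sq_abs]; ring
  have c1 : V1 n W (ζ r) * h ≤ Cv * √(W (ζ r)) * |h| :=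
    (mul_le_mul_of_nonneg_left (le_abs_self h) b2.1).trans (mul_le_mul_of_nonneg_right b2.2 (abs_nonneg _))
  have c2 : V1 n W (u r) * (-h) ≤ Cv * √(W (u r)) * |h| :=
    (mul_le_mul_of_nonneg_left (neg_le_abs h) b1.1).trans (mul_le_mul_of_nonneg_right b1.2 (abs_nonneg _))
  have c3 : √(W (u r)) ≤ √(W (ζ r)) + |dq W ζ u r| := by
    have := le_abs_self (dq W ζ u r); unfold dq at this ⊢; linarith
  have c4 := mul_le_mul_of_nonneg_left c3 (show 0 ≤ Cv * |h| by positivity)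
  have c5 : 0 ≤ Cv * |h| * |dq W ζ u r| := by positivity
  have nsq : (-h)^2 = |h| * |h| := by rw [neg_sq, sq]
  rw [sq] at a1; rw [nsq] at a2
  rw [abs_le]; constructor
  · linarith
  · linarith

lemma vd_lay (H : SU n W W1 δ Cp Cv E0 r1 r2 M Ce Cx ra ε rm rp ζ u χ) {r : ℝ} (hr : r ∈ Icc rm rp) : |hhd ζ u r| ≤ Cv * |Vpot n W (u r) - Vpot n W (ζ r)| := by
  have hC := H.hv.Cge
  have hδ := H.hp.dpos
  have hδ2 := H.hp.dle
  obtain ⟨hz, hu⟩ := H.zmid hr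
  have h1 : Cv⁻¹ * (u r - ζ r)^2 ≤ (Vpot n W (u r) - Vpot n W (ζ r)) * (u r - ζ r) := by
    have hsub : Icc (min (ζ r) (u r)) (max (ζ r) (u r)) ⊆ Icc (δ/2) (1-δ/2) :=
      Icc_subset_Icc (le_min hz.1 hu.1) (max_le hz.2 hu.2)
    refine mvt_bound_ge (f' := V1 n W) ?_ ?_ ?_
    · refine (vpot_contOn H.hn H.hp.contW).mono ?_
      refine Subset.trans hsub (Icc_subset_Icc (by linarith) (by linarith))
    · intro s hs
      have := hsub (Ioo_subset_Icc_self hs)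
      exact hasDerivAt_of_Icc (H.hv.dV s ⟨by linarith [this.1], by linarith [this.2]⟩) ⟨by linarith [this.1], by linarith [this.2]⟩
    · intro s hs
      have := H.hv.v4 s (hsub (Ioo_subset_Icc_self hs))
      rw [inv_le_iff_one_le_mul₀ (by linarith)]; linarith
  change Cv⁻¹ * (hhd ζ u r)^2 ≤ (Vpot n W (u r) - Vpot n W (ζ r)) * hhd ζ u r at h1
  set h := hhd ζ u r
  rw [inv_mul_le_iff₀ (by linarith)] at h1
  rcases eq_or_ne h 0 with h0 | h0
  · rw [h0]; simp; positivity
  · have hpos : 0 < |h| := abs_pos.2 h0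
    have h2 : (Vpot n W (u r) - Vpot n W (ζ r)) * h ≤ |Vpot n W (u r) - Vpot n W (ζ r)| * |h| := by
      rw [← abs_mul]; exact le_abs_self _
    have h3 := mul_le_mul_of_nonneg_left h2 (show 0 ≤ Cv by linarith)
    rw [← sq_abs] at h1
    refine le_of_mul_le_mul_right ?_ hpos
    linarith

set_option maxHeartbeats 1000000 in
lemma hc (H : SU n W W1 δ Cp Cv E0 r1 r2 M Ce Cx ra ε rm rp ζ u χ) (hε : ε * (2 * (n-1:ℝ) * Chc n Cp Cv E0) ≤ r1) :
    HC n r1 r2 M (Chc n Cp Cv E0) ε rm rp (hhd ζ u) (dq W ζ u) χ (fun r => (1 - χ r) * AA W W1 ζ u r)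
      (fun r => Vpot n W (u r) - Vpot n W (ζ r)) (fun r => √(W (ζ r))) := by
  have hC := H.hp.Cge
  have hCv := H.hv.Cge
  have hE := H.E1
  have hcn := cn_pos n H.hn
  have hE' : 0 ≤ E0 / cn n := by positivity
  have hCC : Cp ≤ (1 + Cp) * Cp := le_mul_of_one_le_left (by linarith) (by linarith)
  have hCp : (1 + Cp) * Cp ≤ Chc n Cp Cv E0 := by unfold Chc; linarith
  have hCp' : Cp ≤ Chc n Cp Cv E0 := by linarith
  have hCv' : Cv ≤ Chc n Cp Cv E0 := by unfold Chc; linarith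
  have hCE : E0 / cn n ≤ Chc n Cp Cv E0 := by unfold Chc; linarith
  have hrm0 : 0 < rm := by linarith [H.r10, H.lay.h1]
  refine
  { hn := H.hn, ε0 := H.ε0, r10 := H.r10, l1 := H.lay.h1, l2 := H.lay.h2, l3 := H.lay.h3, w1 := H.lay.w1, w2 := H.lay.w2
    Cge := by linarith
    Mge := H.Mge, εs := hε, hd := H.hdd, hs := H.hsq, hds := H.hdsq
    h1 := ?_, qc := H.cq, qs := H.qI, χc := H.χd.continuous, χm := H.χm, χ1 := fun r hr => H.χ1 r (by linarith [H.rarm])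
    G0 := ?_, Gi := ?_, i1 := ?_, i2 := ?_, la := ?_, x1 := ?_, x2 := ?_, vi := (H.hu.Vint H.hv).sub (H.hm.adm.Vint H.hv), v0 := ?_, v1 := ?_, v2 := ?_, v3 := ?_
    pc := H.cWz.sqrt, p0 := fun r => Real.sqrt_nonneg _, pi := ?_, p2 := ?_ }
  · intro r
    have a := H.hu.mem r; have b := H.hm.adm.mem r
    unfold hhd; rw [abs_le]; constructor <;> linarith [a.1, a.2, b.1, b.2]
  · intro r hr
    rcases le_total r rm with h | h
    · exact mul_nonneg (by linarith [(H.χm r).2]) (H.A_in hr.le h).1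
    · rw [H.χ1 r (by linarith [H.rarm])]; simp
  · refine H.AI.norm.mono' ((continuous_const.sub H.χd.continuous).aestronglyMeasurable.mul H.AI.1) ?_
    filter_upwards with r
    rw [norm_mul]
    refine mul_le_of_le_one_left (norm_nonneg _) ?_
    rw [Real.norm_eq_abs, abs_le]; constructor <;> linarith [(H.χm r).1, (H.χm r).2]
  · intro r h0 h
    exact (H.q_in h0.le h).1
  · intro r h0 h
    obtain ⟨hz, hu, -⟩ := H.zin h0.le h
    have h2 := (H.q_in h0.le h).2
    have hA := H.A_in h0.le h
    have hX : 0 ≤ |hhd ζ u r| * |dq W ζ u r| := by positivity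
    have k1 : (hhd ζ u r)^2 + |hhd ζ u r| * |dq W ζ u r| ≤ (1 + Cp) * Cp * (|hhd ζ u r| * |dq W ζ u r|) := by
      have : (1 + Cp) * (|hhd ζ u r| * |dq W ζ u r|) ≤ (1 + Cp) * Cp * (|hhd ζ u r| * |dq W ζ u r|) := by
        apply mul_le_mul_of_nonneg_right _ hX
        exact le_mul_of_one_le_right (by linarith) hC
      linarith
    have k2 : χ r = 1 ∨ (hhd ζ u r)^2 + |hhd ζ u r| * |dq W ζ u r| ≤ (1 + Cp) * Cp * AA W W1 ζ u r := by
      rcases H.hs with hs | ⟨hs, rs, hrs, hone, -⟩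
      · right
        have f := H.hp.f7a hs _ (H.hu.mem r) _ (H.hm.adm.mem r)
        change |dq W ζ u r| ≤ Cp * |hhd ζ u r| at f
        have f2 := mul_le_mul_of_nonneg_left f (abs_nonneg (hhd ζ u r))
        have f3 := mul_le_mul_of_nonneg_left (hA.2 (Or.inl hs)) (show 0 ≤ 1 + Cp by linarith)
        have : |hhd ζ u r| * (Cp * |hhd ζ u r|) = Cp * (hhd ζ u r)^2 := by rw [← sq_abs (hhd ζ u r)]; ring
        linarith
      · rcases le_total ra r with hr | hr
        · left; exact H.χ1 r hr
        · right
          have z1 := hone r ⟨h0.le, by linarith⟩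
          have eA : AA W W1 ζ u r = W (u r) := by unfold AA; rw [z1, Ws_one H.hp, H.hp.z1]; ring
          have eq : dq W ζ u r = √(W (u r)) := by unfold dq; rw [z1, H.hp.z1]; simp
          have q1 : |dq W ζ u r| ≤ Cp := by
            rw [eq, abs_of_nonneg (Real.sqrt_nonneg _)]
            exact (H.hp.f1c _ (H.hu.mem r)).trans (mul_le_of_le_one_right (by linarith) hu.2)
          have h1 : |hhd ζ u r| ≤ Cp * W (u r) := by
            have : |hhd ζ u r| = 1 - u r := by
              unfold hhd; rw [z1, abs_sub_comm]; exact abs_of_nonneg (by linarith [hu.2])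
            rw [this]; exact (H.hp.f7d hs _ hu).1
          have h11 : |hhd ζ u r| ≤ 1 := (H.hh r h0.le).trans (by linarith [H.hp.dle])
          have g1 : (hhd ζ u r)^2 ≤ |hhd ζ u r| := by
            rw [← sq_abs, sq]; exact mul_le_of_le_one_left (abs_nonneg _) h11
          have g2 := mul_le_mul_of_nonneg_left q1 (abs_nonneg (hhd ζ u r))
          have g3 := mul_le_mul_of_nonneg_left h1 (show 0 ≤ 1 + Cp by linarith)
          rw [eA]; linarith
    have hx := H.χm r
    have tot : (hhd ζ u r)^2 + |hhd ζ u r| * |dq W ζ u r| ≤ (1 + Cp) * Cp * (χ r * (|hhd ζ u r| * |dq W ζ u r|) + (1 - χ r) * AA W W1 ζ u r) := by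
      rcases k2 with k2 | k2
      · rw [k2]; linarith
      · have m1 := mul_le_mul_of_nonneg_left k1 hx.1
        have m2 := mul_le_mul_of_nonneg_left k2 (show 0 ≤ 1 - χ r by linarith [hx.2])
        linarith
    refine tot.trans (mul_le_mul_of_nonneg_right hCp ?_)
    exact add_nonneg (mul_nonneg hx.1 hX) (mul_nonneg (by linarith [hx.2]) hA.1)
  · intro r hr
    obtain ⟨hz, hu, -⟩ := H.zlow hr.1
    exact (H.hp.f6a _ hu _ hz).trans (mul_le_mul_of_nonneg_right hCp' (abs_nonneg _))
  · intro r hr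
    obtain ⟨hz, hu, -⟩ := H.zout hr
    have := H.hp.f5 _ hu _ hz
    by_contra hneg
    push Not at hneg
    have := mul_neg_of_pos_of_neg (show 0 < Cp by linarith) hneg
    unfold dq hhd at this
    linarith [sq_nonneg (u r - ζ r)]
  · intro r hr
    obtain ⟨hz, hu, -⟩ := H.zout hr
    have h5 := H.hp.f5 _ hu _ hz
    change (hhd ζ u r)^2 ≤ Cp * (dq W ζ u r * hhd ζ u r) at h5
    have h6 : dq W ζ u r * hhd ζ u r ≤ |dq W ζ u r| * |hhd ζ u r| := by rw [← abs_mul]; exact le_abs_self _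
    have h7 := mul_le_mul_of_nonneg_left h6 (show 0 ≤ Cp by linarith)
    have h8 : |hhd ζ u r| ≤ Cp * |dq W ζ u r| := by
      rcases eq_or_ne (hhd ζ u r) 0 with h0 | h0
      · rw [h0]; simp; positivity
      · refine le_of_mul_le_mul_right ?_ (abs_pos.2 h0)
        rw [← sq_abs] at h5; linarith
    exact h8.trans (mul_le_mul_of_nonneg_right hCp' (abs_nonneg _))
  · rw [integral_sub (H.hu.Vint H.hv) (H.hm.adm.Vint H.hv)]
    have a := H.mass; have b := H.hm.mass
    unfold MM at a b
    have : cn n * (∫ r, Vpot n W (u r) ∂mu n) = cn n * ∫ r, Vpot n W (ζ r) ∂mu n := by rw [a, b]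
    rw [mul_left_cancel₀ hcn.ne' this, sub_self]
  · intro r
    have a := H.hu.mem r; have b := H.hm.adm.mem r
    rcases le_total (ζ r) (u r) with h | h
    · exact mul_nonneg (by linarith [H.hv.mono b a h]) (by unfold hhd; linarith)
    · exact mul_nonneg_of_nonpos_of_nonpos (by linarith [H.hv.mono a b h]) (by unfold hhd; linarith)
  · intro r
    refine (H.vd_bd r).trans (mul_le_mul_of_nonneg_right hCv' (by positivity))
  · intro r hr
    refine (H.vd_lay hr).trans (mul_le_mul_of_nonneg_right hCv' (by positivity))
  · refine (H.hm.adm.Wint H.hp).congr ?_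
    filter_upwards with r; rw [Real.sq_sqrt (H.hp.Wnn (H.hm.adm.mem r))]
  · have h1 := EE_P H.hn H.ε0 H.hE
    have : ∫ r, √(W (ζ r))^2 ∂mu n = ∫ r, W (ζ r) ∂mu n := by
      congr 1; ext r; rw [Real.sq_sqrt (H.hp.Wnn (H.hm.adm.mem r))]
    rw [this]
    refine h1.trans ?_
    rw [mul_comm]
    exact mul_le_mul_of_nonneg_right hCE H.ε0.le

end SU
end


/-- if `|g - g r| ≤ C |f - f r|` and `f' r = 0` then `g' r = 0` -/
lemma deriv_zero_of_le {f g : ℝ → ℝ} {r C : ℝ} (hf : HasDerivAt f 0 r) (h : ∀ s, |g s - g r| ≤ C * |f s - f r|) : HasDerivAt g 0 r := by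
  rw [hasDerivAt_iff_isLittleO] at hf ⊢
  simp only [smul_zero, sub_zero] at hf ⊢
  refine Asymptotics.IsBigO.trans_isLittleO ?_ hf
  refine Asymptotics.IsBigO.of_bound C ?_
  filter_upwards with s
  exact h s

def RRz (W W1 ζ u : ℝ → ℝ) (r : ℝ) : ℝ := RR W W1 (ζ r) (u r)
def TT (W ζ u : ℝ → ℝ) (r : ℝ) : ℝ := Phi W (u r) - Phi W (ζ r) - √(W (ζ r)) * hhd ζ u r
def TD (W W1 ζ u : ℝ → ℝ) (r : ℝ) : ℝ := dq W ζ u r * deriv (hhd ζ u) r + RRz W W1 ζ u r * deriv ζ r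
def ee (W ζ : ℝ → ℝ) (ε r : ℝ) : ℝ := ε * deriv ζ r + √(W (ζ r))
def Dx (n : ℕ) (χ : ℝ → ℝ) (r : ℝ) : ℝ := deriv χ r + (n-1:ℝ) * χ r / r

section
variable {n : ℕ} {W W1 : ℝ → ℝ} {δ Cp Cv E0 r1 r2 M Ce Cx ra ε rm rp : ℝ} {ζ u χ : ℝ → ℝ}

namespace SU

lemma A_eq (H : SU n W W1 δ Cp Cv E0 r1 r2 M Ce Cx ra ε rm rp ζ u χ) (r : ℝ) :
    AA W W1 ζ u r = dq W ζ u r^2 + 2 * √(W (ζ r)) * RRz W W1 ζ u r := by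
  have a := Real.sq_sqrt (H.hp.Wnn (H.hm.adm.mem r))
  have b := Real.sq_sqrt (H.hp.Wnn (H.hu.mem r))
  unfold AA dq RRz RR Ws
  linear_combination a - b

lemma R_eq (r : ℝ) : RRz W W1 ζ u r = dq W ζ u r - pdv W W1 (ζ r) * hhd ζ u r := rfl

lemma ident (H : SU n W W1 δ Cp Cv E0 r1 r2 M Ce Cx ra ε rm rp ζ u χ) (r : ℝ) :
    ε^2 * deriv (hhd ζ u) r^2 + AA W W1 ζ u r = kk ε (hhd ζ u) (dq W ζ u) χ r^2 - 2 * ε * (χ r * TD W W1 ζ u r)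
      + 2 * (χ r * (ee W ζ ε r * RRz W W1 ζ u r)) + (1 - χ r) * AA W W1 ζ u r + (χ r - χ r^2) * dq W ζ u r^2 := by
  have := H.A_eq r
  unfold kk TD ee
  linear_combination χ r * this

lemma ee_zero (H : SU n W W1 δ Cp Cv E0 r1 r2 M Ce Cx ra ε rm rp ζ u χ) {r : ℝ} (h : ζ r = 0 ∨ ζ r = 1) : ee W ζ ε r = 0 ∧ deriv ζ r = 0 := by
  rcases h with h | h
  · have := deriv_zero_of_zero H.hm.adm h
    refine ⟨?_, this⟩
    unfold ee; rw [this, h, H.hp.z0]; simp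
  · have := deriv_zero_of_one H.hm.adm h
    refine ⟨?_, this⟩
    unfold ee; rw [this, h, H.hp.z1]; simp

/-- trichotomy for `R`. -/
lemma R_cases (H : SU n W W1 δ Cp Cv E0 r1 r2 M Ce Cx ra ε rm rp ζ u χ) {r : ℝ} (h0 : 0 ≤ r) :
    (ee W ζ ε r = 0 ∧ deriv ζ r = 0) ∨ |RRz W W1 ζ u r| ≤ Cp * hhd ζ u r^2 ∨
      (W1 1 < 0 ∧ ζ (ra/2) = 1 ∧ r ≤ rm ∧ 1 - 2*δ ≤ ζ r ∧ ζ r < 1 ∧ RRz W W1 ζ u r ≤ Cp * hhd ζ u r^2) := by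
  have hδ := H.hp.dpos
  have hδ2 := H.hp.dle
  have zm := H.hm.adm.mem r
  rcases eq_or_lt_of_le zm.1 with hz | hz
  · exact Or.inl (H.ee_zero (Or.inl hz.symm))
  rcases eq_or_lt_of_le zm.2 with hz1 | hz1
  · exact Or.inl (H.ee_zero (Or.inr hz1))
  right
  rcases le_total r rm with hr | hr
  · obtain ⟨hzz, huu, -⟩ := H.zin h0 hr
    rcases H.hs with hs | ⟨hs, rs, hrs, hone, -⟩
    · left; exact H.hp.f7b hs _ (H.hu.mem r) _ ⟨hz, hz1⟩
    · right
      refine ⟨hs, hone _ ⟨by linarith [H.ra0], by linarith [H.ra0]⟩, hr, hzz.1, hz1, H.hp.f7 _ huu _ ⟨hzz.1, hz1⟩⟩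
  · left
    obtain ⟨hzz, huu, -⟩ := H.zlow hr
    exact H.hp.f6b _ huu _ ⟨hz, hzz.2⟩

lemma eR (H : SU n W W1 δ Cp Cv E0 r1 r2 M Ce Cx ra ε rm rp ζ u χ) {r : ℝ} (h0 : 0 < r) :
    -(Ce * Cp * √ε * hhd ζ u r^2 + Ce * ε * (χ r * dq W ζ u r^2)) ≤ χ r * (ee W ζ ε r * RRz W W1 ζ u r) := by
  have hx := H.χm r
  have hCe := H.eqp.Cge
  have hCp := H.hp.Cge
  have hε := H.ε0
  have hse := Real.sqrt_nonneg ε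
  have n1 : 0 ≤ Ce * Cp * √ε * hhd ζ u r^2 := by positivity
  have n2 : 0 ≤ Ce * ε * (χ r * dq W ζ u r^2) := mul_nonneg (by positivity) (mul_nonneg hx.1 (sq_nonneg _))
  rcases le_total r (ra/2) with hr | hr
  · rw [H.χ0 r hr] at n2 ⊢; linarith
  have e1 := H.eqp.e1 r hr
  change |ee W ζ ε r| ≤ _ at e1
  have fin : -(Ce * Cp * √ε * hhd ζ u r^2 + Ce * ε * dq W ζ u r^2) ≤ ee W ζ ε r * RRz W W1 ζ u r → 
     -(Ce * Cp * √ε * hhd ζ u r^2 + Ce * ε * (χ r * dq W ζ u r^2)) ≤ χ r * (ee W ζ ε r * RRz W W1 ζ u r) := by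
    intro h
    have m := mul_le_mul_of_nonneg_left h hx.1
    have m2 := mul_le_of_le_one_left n1 hx.2
    linarith
  apply fin
  have n3 : 0 ≤ Ce * ε * dq W ζ u r^2 := by positivity
  rcases H.R_cases (r := r) h0.le with h | h | ⟨h1, h2, h3, h4, h5, h6⟩
  · rw [h.1]; linarith
  · have : |ee W ζ ε r * RRz W W1 ζ u r| ≤ (Ce * √ε) * (Cp * hhd ζ u r^2) := by
      rw [abs_mul]; exact mul_le_mul e1 h (abs_nonneg _) (by positivity)
    have := (abs_le.1 this).1
    linarith
  · rcases le_total (ee W ζ ε r) 0 with he | he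
    · have m1 := mul_le_mul_of_nonpos_left h6 he
      have m2 := mul_le_mul_of_nonneg_right ((abs_le.1 e1).1) (show 0 ≤ Cp * hhd ζ u r^2 by positivity)
      linarith
    · rcases le_total 0 (RRz W W1 ζ u r) with hR | hR
      · have := mul_nonneg he hR; linarith
      · have e3 := H.eqp.e3 h1 h2 r hr h4 h5
        change ee W ζ ε r ≤ _ at e3
        have m1 := mul_le_mul_of_nonpos_right e3 hR
        have hA := (H.A_in h0.le h3).1
        rw [H.A_eq r] at hA
        have m2 := mul_nonneg (show 0 ≤ Ce * ε by positivity) hA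
        linarith

lemma TD_bd (H : SU n W W1 δ Cp Cv E0 r1 r2 M Ce Cx ra ε rm rp ζ u χ) {r : ℝ} (h0 : 0 < r) :
    |χ r * (RRz W W1 ζ u r * deriv ζ r)| ≤ ε⁻¹ * (Ce * (Cp * hhd ζ u r^2 + |AA W W1 ζ u r| + dq W ζ u r^2)) := by
  have hx := H.χm r
  have hCe := H.eqp.Cge
  have hCp := H.hp.Cge
  have hε := H.ε0
  have n1 : 0 ≤ Cp * hhd ζ u r^2 := by positivity
  have n2 := abs_nonneg (AA W W1 ζ u r)
  have n3 := sq_nonneg (dq W ζ u r)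
  have n4 : 0 ≤ ε⁻¹ * (Ce * (Cp * hhd ζ u r^2 + |AA W W1 ζ u r| + dq W ζ u r^2)) := by positivity
  rcases le_total r (ra/2) with hr | hr
  · rw [H.χ0 r hr]; simpa using n4
  rw [abs_mul, abs_of_nonneg hx.1]
  refine (mul_le_of_le_one_left (abs_nonneg _) hx.2).trans ?_
  rw [le_inv_mul_iff₀ hε]
  have e2 := H.eqp.e2 r hr
  have re : ε * |RRz W W1 ζ u r * deriv ζ r| = (ε * |deriv ζ r|) * |RRz W W1 ζ u r| := by rw [abs_mul]; ring
  rw [re]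
  rcases H.R_cases (r := r) h0.le with h | h | ⟨h1, h2, h3, h4, h5, h6⟩
  · rw [h.2]; simp; positivity
  · refine mul_le_mul e2 (h.trans (by linarith)) (abs_nonneg _) (by linarith)
  · have e4 := H.eqp.e4 h1 h2 r hr h4 h5
    refine (mul_le_mul_of_nonneg_right e4 (abs_nonneg _)).trans ?_
    rw [mul_assoc]
    refine mul_le_mul_of_nonneg_left ?_ (by linarith)
    have hA := H.A_eq r
    have : √(W (ζ r)) * |RRz W W1 ζ u r| = |√(W (ζ r)) * RRz W W1 ζ u r| := by
      rw [abs_mul, abs_of_nonneg (Real.sqrt_nonneg _)]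
    rw [this]
    have e : √(W (ζ r)) * RRz W W1 ζ u r = (AA W W1 ζ u r - dq W ζ u r^2)/2 := by rw [hA]; ring
    rw [e, abs_le]
    constructor <;> linarith [le_abs_self (AA W W1 ζ u r), neg_abs_le (AA W W1 ζ u r)]

lemma mR (H : SU n W W1 δ Cp Cv E0 r1 r2 M Ce Cx ra ε rm rp ζ u χ) : Measurable (RRz W W1 ζ u) := by
  have h : Measurable (fun r => dq W ζ u r - pdv W W1 (ζ r) * hhd ζ u r) :=
    H.cq.measurable.sub (H.mpdv.mul H.hdd.continuous.measurable)
  exact h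

lemma hq_int (H : SU n W W1 δ Cp Cv E0 r1 r2 M Ce Cx ra ε rm rp ζ u χ) :
    Integrable (fun r => hhd ζ u r^2 + |hhd ζ u r| * |dq W ζ u r|) (mu n) := by
  refine H.hsq.fun_add ?_
  refine int_mul_sq H.hdd.continuous.abs.aestronglyMeasurable H.cq.abs.aestronglyMeasurable ?_ ?_
  · simpa using H.hsq
  · simpa using H.qI

lemma RζI (H : SU n W W1 δ Cp Cv E0 r1 r2 M Ce Cx ra ε rm rp ζ u χ) :
    Integrable (fun r => χ r * (RRz W W1 ζ u r * deriv ζ r)) (mu n) := by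
  refine Integrable.mono' ((((H.hsq.const_mul Cp).fun_add H.AI.abs).fun_add H.qI).const_mul Ce |>.const_mul ε⁻¹) ?_ ?_
  · exact (H.χd.continuous.measurable.mul (H.mR.mul (measurable_deriv ζ))).aestronglyMeasurable
  · filter_upwards [mu_ae_pos n] with r hr
    exact H.TD_bd hr

lemma TDI (H : SU n W W1 δ Cp Cv E0 r1 r2 M Ce Cx ra ε rm rp ζ u χ) :
    Integrable (fun r => χ r * TD W W1 ζ u r) (mu n) := by
  have h1 : Integrable (fun r => dq W ζ u r * deriv (hhd ζ u) r) (mu n) :=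
    int_mul_sq H.cq.aestronglyMeasurable (der_ms _) H.qI H.hdsq
  have h2 : Integrable (fun r => χ r * (dq W ζ u r * deriv (hhd ζ u) r)) (mu n) := by
    refine h1.norm.mono' (H.χd.continuous.aestronglyMeasurable.mul h1.1) ?_
    filter_upwards with r
    rw [norm_mul]
    refine mul_le_of_le_one_left (norm_nonneg _) ?_
    rw [Real.norm_eq_abs, abs_of_nonneg (H.χm r).1]; exact (H.χm r).2
  refine (h2.fun_add H.RζI).congr ?_
  filter_upwards with r
  unfold TD; ring

lemma dTT (H : SU n W W1 δ Cp Cv E0 r1 r2 M Ce Cx ra ε rm rp ζ u χ) {r : ℝ} (h0 : 0 < r)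
    (hr : W1 1 < 0 → ∀ rs, (∀ r ∈ Icc 0 rs, ζ r = 1) → (∀ r, rs < r → ζ r < 1) → r ≠ rs) :
    HasDerivAt (TT W ζ u) (TD W W1 ζ u r) r := by
  have hz := (H.hm.adm.diff r).hasDerivAt
  have hu := (H.hu.diff r).hasDerivAt
  have zm := H.hm.adm.mem
  have p1 : HasDerivAt (fun s => Phi W (u s)) (√(W (u r)) * deriv u r) r :=
    (H.hv.dPhi _ (H.hu.mem r)).comp_hasDerivAt r hu (Eventually.of_forall H.hu.mem)
  have p2 : HasDerivAt (fun s => Phi W (ζ s)) (√(W (ζ r)) * deriv ζ r) r :=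
    (H.hv.dPhi _ (zm r)).comp_hasDerivAt r hz (Eventually.of_forall zm)
  have p3 : HasDerivAt (fun s => √(W (ζ s))) (pdv W W1 (ζ r) * deriv ζ r) r := by
    rcases eq_or_lt_of_le (zm r).1 with hz0 | hz0
    · have d0 := deriv_zero_of_zero H.hm.adm hz0.symm
      rw [d0] at hz ⊢
      rw [mul_zero]
      refine deriv_zero_of_le (C := Cp) hz fun s => ?_
      rw [← hz0, H.hp.z0, Real.sqrt_zero, sub_zero, sub_zero, abs_of_nonneg (Real.sqrt_nonneg _), abs_of_nonneg (zm s).1]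
      exact H.hp.f1c _ (zm s)
    rcases eq_or_lt_of_le (zm r).2 with hz1 | hz1
    · have d0 := deriv_zero_of_one H.hm.adm hz1
      rcases H.hs with hs | ⟨hs, rs, hrs, hone, hlt⟩
      · rw [d0] at hz ⊢
        rw [mul_zero]
        exact deriv_zero_of_le (C := Cp) hz fun s => H.hp.f7a hs _ (zm s) _ (zm r)
      · have hle : r < rs := by
          refine lt_of_le_of_ne ?_ (hr hs rs hone hlt)
          by_contra hc
          push Not at hc
          linarith [hlt r hc]
        rw [d0, mul_zero]
        refine (hasDerivAt_const r (√(W 1))).congr_of_eventuallyEq ?_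
        filter_upwards [Ioo_mem_nhds h0 hle] with s hs
        rw [hone s ⟨hs.1.le, hs.2.le⟩]
    · exact (H.hp.dp (ζ r) ⟨hz0, hz1⟩).comp r hz
  have p4 := H.dh r
  refine ((p1.fun_sub p2).fun_sub (p3.fun_mul p4)).congr_deriv ?_
  unfold TD
  rw [p4.deriv, R_eq]
  unfold dq
  ring

lemma TT_cont (H : SU n W W1 δ Cp Cv E0 r1 r2 M Ce Cx ra ε rm rp ζ u χ) : Continuous (TT W ζ u) := by
  have cP : ContinuousOn (Phi W) (Icc 0 1) := fun t ht => (H.hv.dPhi t ht).continuousWithinAt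
  exact ((contOn_comp cP H.hu.diff.continuous H.hu.mem).sub (contOn_comp cP H.hm.adm.diff.continuous H.hm.adm.mem)).sub
    (H.cWz.sqrt.mul H.hdd.continuous)

lemma TT_bd (H : SU n W W1 δ Cp Cv E0 r1 r2 M Ce Cx ra ε rm rp ζ u χ) {r : ℝ} (h0 : 0 ≤ r) :
    |TT W ζ u r| ≤ Cp * (hhd ζ u r^2 + |hhd ζ u r| * |dq W ζ u r|) := by
  have hCp := H.hp.Cge
  have hδ := H.hp.dpos
  have hδ2 := H.hp.dle
  have zm := H.hm.adm.mem r
  have um := H.hu.mem r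
  set z := ζ r with hz
  set v := u r with hv
  have sub01 : Icc (min z v) (max z v) ⊆ Icc (0:ℝ) 1 := Icc_subset_Icc (le_min zm.1 um.1) (max_le zm.2 um.2)
  have cP : ContinuousOn (Phi W) (Icc 0 1) := fun t ht => (H.hv.dPhi t ht).continuousWithinAt
  have gen : ∀ B, (∀ s ∈ Icc (min z v) (max z v), |√(W s) - √(W z)| ≤ B) → |TT W ζ u r| ≤ B * |hhd ζ u r| := by
    intro B hB
    have := mvt_bound_abs (f := fun s => Phi W s - √(W z) * s) (f' := fun s => √(W s) - √(W z) * 1) (z := z) (u := v) (C := B) ?_ ?_ ?_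
    · have e : TT W ζ u r = (Phi W v - √(W z) * v) - (Phi W z - √(W z) * z) := by
        unfold TT hhd; rw [← hz, ← hv]; ring
      rw [e]; exact this
    · exact (cP.mono sub01).sub (continuous_const.mul continuous_id).continuousOn
    · intro s hs
      have h1 : s ∈ Ioo (0:ℝ) 1 := ⟨lt_of_le_of_lt (le_min zm.1 um.1) hs.1, lt_of_lt_of_le hs.2 (max_le zm.2 um.2)⟩
      exact (hasDerivAt_of_Icc (H.hv.dPhi s (Ioo_subset_Icc_self h1)) h1).fun_sub ((hasDerivAt_id s).const_mul _)
    · intro s hs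
      rw [mul_one]; exact hB s (Ioo_subset_Icc_self hs)
  have hX : 0 ≤ |hhd ζ u r| * |dq W ζ u r| := by positivity
  have hh2 : |hhd ζ u r| * |hhd ζ u r| = hhd ζ u r^2 := by rw [← sq_abs]; ring
  rcases le_total r rm with hr | hr
  · obtain ⟨hzz, huu, -⟩ := H.zin h0 hr
    have anti : ∀ a ∈ Icc (1-2*δ) 1, ∀ b ∈ Icc (1-2*δ) 1, a ≤ b → √(W b) ≤ √(W a) := by
      intro a ha b hb hab
      rcases eq_or_lt_of_le hab with h | h
      · rw [h]
      have := H.hp.f4 b hb a ha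
      by_contra hc
      push Not at hc
      have m := mul_pos (show 0 < Cp by linarith) (mul_pos (sub_pos.2 hc) (sub_pos.2 h))
      linarith [sq_nonneg (b-a)]
    have := gen (|dq W ζ u r|) ?_
    · refine this.trans ?_
      have m := mul_le_mul_of_nonneg_right hCp hX
      have : 0 ≤ Cp * hhd ζ u r^2 := by positivity
      linarith
    · intro s hs
      have sub : Icc (min z v) (max z v) ⊆ Icc (1-2*δ) 1 := Icc_subset_Icc (le_min hzz.1 huu.1) (max_le zm.2 um.2)
      have hsm := sub hs
      have e : dq W ζ u r = √(W v) - √(W z) := rfl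
      rw [e]
      rcases le_total z v with h | h
      · rw [min_eq_left h, max_eq_right h] at hs
        have a1 := anti z hzz s hsm hs.1
        have a2 := anti s hsm v huu hs.2
        rw [abs_of_nonpos (by linarith), abs_of_nonpos (by linarith)]; linarith
      · rw [min_eq_right h, max_eq_left h] at hs
        have a1 := anti v huu s hsm hs.1
        have a2 := anti s hsm z hzz hs.2
        rw [abs_of_nonneg (by linarith), abs_of_nonneg (by linarith)]; linarith
  · obtain ⟨hzz, huu, -⟩ := H.zlow hr
    have := gen (Cp * |hhd ζ u r|) ?_
    · rw [mul_assoc, hh2] at this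
      have : 0 ≤ Cp * (|hhd ζ u r| * |dq W ζ u r|) := by positivity
      linarith
    · intro s hs
      have sub : Icc (min z v) (max z v) ⊆ Icc 0 (1-δ/2) := Icc_subset_Icc (le_min hzz.1 huu.1) (max_le hzz.2 huu.2)
      refine (H.hp.f6a s (sub hs) z hzz).trans (mul_le_mul_of_nonneg_left ?_ (by linarith))
      have e : hhd ζ u r = v - z := rfl
      rw [e]
      rcases le_total z v with h | h
      · rw [min_eq_left h, max_eq_right h] at hs
        rw [abs_of_nonneg (by linarith [hs.1]), abs_of_nonneg (by linarith)]; linarith [hs.2]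
      · rw [min_eq_right h, max_eq_left h] at hs
        rw [abs_of_nonpos (by linarith [hs.2]), abs_of_nonpos (by linarith)]; linarith [hs.1]

lemma TI (H : SU n W W1 δ Cp Cv E0 r1 r2 M Ce Cx ra ε rm rp ζ u χ) : Integrable (TT W ζ u) (mu n) := by
  refine (H.hq_int.const_mul Cp).mono' H.TT_cont.aestronglyMeasurable ?_
  filter_upwards [mu_ae_pos n] with r hr
  exact H.TT_bd hr.le

lemma Dx_bd (H : SU n W W1 δ Cp Cv E0 r1 r2 M Ce Cx ra ε rm rp ζ u χ) {r : ℝ} (h0 : 0 < r) : |Dx n χ r| ≤ Cx := by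
  have hn2 : (2:ℝ) ≤ n := by exact_mod_cast H.hn
  have h := H.χb r h0
  have n1 : 0 ≤ (n-1:ℝ) * χ r := mul_nonneg (by linarith) (H.χm r).1
  unfold Dx
  refine (abs_add_le _ _).trans ?_
  rw [abs_of_nonneg (show 0 ≤ (n-1:ℝ) * χ r / r by positivity)]
  rw [← sub_nonneg]
  have : Cx - (|deriv χ r| + (n-1:ℝ) * χ r / r) = (Cx * r - (|deriv χ r| * r + (n-1:ℝ) * χ r)) / r := by field_simp
  rw [this]; exact div_nonneg (by linarith) h0.le

lemma DTI (H : SU n W W1 δ Cp Cv E0 r1 r2 M Ce Cx ra ε rm rp ζ u χ) : Integrable (fun r => Dx n χ r * TT W ζ u r) (mu n) := by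
  have m : Measurable (Dx n χ) := (measurable_deriv χ).add ((H.χd.continuous.measurable.const_mul _).div measurable_id)
  refine (H.TI.norm.const_mul Cx).mono' (m.aestronglyMeasurable.mul H.TI.1) ?_
  filter_upwards [mu_ae_pos n] with r hr
  rw [norm_mul]
  exact mul_le_mul_of_nonneg_right (H.Dx_bd hr) (norm_nonneg _)

set_option maxHeartbeats 1000000 in
lemma parts (H : SU n W W1 δ Cp Cv E0 r1 r2 M Ce Cx ra ε rm rp ζ u χ) :
    ∫ r, χ r * TD W W1 ζ u r ∂mu n = - ∫ r, Dx n χ r * TT W ζ u r ∂mu n := by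
  have hi : Integrable (fun r => χ r * TD W W1 ζ u r + Dx n χ r * TT W ζ u r) (mu n) := H.TDI.fun_add H.DTI
  have hχT : Integrable (fun r => χ r * TT W ζ u r) (mu n) := by
    refine H.TI.norm.mono' (H.χd.continuous.aestronglyMeasurable.mul H.TI.1) ?_
    filter_upwards with r
    rw [norm_mul]
    refine mul_le_of_le_one_left (norm_nonneg _) ?_
    rw [Real.norm_eq_abs, abs_of_nonneg (H.χm r).1]; exact (H.χm r).2
  have key : ∫ r, (χ r * TD W W1 ζ u r + Dx n χ r * TT W ζ u r) ∂mu n = 0 := by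
    rw [mu_integral]
    obtain ⟨s, hsc, hs⟩ : ∃ s : Set ℝ, s.Countable ∧ ∀ r, 0 < r → r ∉ s → HasDerivAt (TT W ζ u) (TD W W1 ζ u r) r := by
      by_cases hex : W1 1 < 0 ∧ ∃ rs, (∀ r ∈ Icc 0 rs, ζ r = 1) ∧ ∀ r, rs < r → ζ r < 1
      · rcases H.hs with hs | ⟨hs, rs, hrs, hone, hlt⟩
        · linarith [hex.1]
        · refine ⟨{rs}, countable_singleton _, fun r h0 hr => H.dTT h0 fun _ rs' h1 h2 => ?_⟩
          have : rs' = rs := by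
            rcases lt_trichotomy rs' rs with h | h | h
            · exfalso
              have a := h2 rs h
              rw [hone rs ⟨by linarith [H.ra0], le_rfl⟩] at a; linarith
            · exact h
            · exfalso
              have a := hlt rs' h
              rw [h1 rs' ⟨by linarith [H.ra0], le_rfl⟩] at a; linarith
          rw [this]; exact hr
      · refine ⟨∅, countable_empty, fun r h0 _ => H.dTT h0 fun hb rs' h1 h2 => ?_⟩
        exact absurd ⟨hb, rs', h1, h2⟩ hex
    have := ftc_Ioi (Y := fun r => r^(n-1) * (χ r * TT W ζ u r)) (Y' := fun r => r^(n-1) * (χ r * TD W W1 ζ u r + Dx n χ r * TT W ζ u r)) (a := 0) hsc ?_ ?_ ?_ ?_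
    · rw [this, H.χ0 0 (by linarith [H.ra0])]; simp
    · exact ((continuous_pow _).mul (H.χd.continuous.mul H.TT_cont)).continuousOn
    · intro r h0 hr
      have d1 := (hasDerivAt_pow (n-1) r).fun_mul ((H.χd r).hasDerivAt.fun_mul (hs r h0 hr))
      refine d1.congr_deriv ?_
      obtain ⟨m, rfl⟩ : ∃ m, n = m + 2 := ⟨n - 2, by have := H.hn; omega⟩
      have e1 : m + 2 - 1 = m + 1 := rfl
      have e2 : m + 1 - 1 = m := rfl
      rw [e1, e2]
      unfold Dx
      push_cast
      field_simp
      ring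
    · exact (mu_integrable n _).1 hχT
    · exact (mu_integrable n _).1 hi
  rw [integral_add H.TDI H.DTI] at key
  linarith

end SU
end


section
variable {n : ℕ} {W W1 : ℝ → ℝ} {δ Cp Cv E0 r1 r2 M Ce Cx ra ε rm rp : ℝ} {ζ u χ : ℝ → ℝ}

namespace SU

lemma χI (H : SU n W W1 δ Cp Cv E0 r1 r2 M Ce Cx ra ε rm rp ζ u χ) {f : ℝ → ℝ} (hf : Integrable f (mu n)) : Integrable (fun r => χ r * f r) (mu n) := by
  refine hf.norm.mono' (H.χd.continuous.aestronglyMeasurable.mul hf.1) ?_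
  filter_upwards with r
  rw [norm_mul]
  refine mul_le_of_le_one_left (norm_nonneg _) ?_
  rw [Real.norm_eq_abs, abs_of_nonneg (H.χm r).1]; exact (H.χm r).2

lemma eRI (H : SU n W W1 δ Cp Cv E0 r1 r2 M Ce Cx ra ε rm rp ζ u χ) :
    Integrable (fun r => χ r * (ee W ζ ε r * RRz W W1 ζ u r)) (mu n) := by
  have h1 := H.RζI.const_mul ε
  have h2 := H.χI ((H.AI.sub H.qI).const_mul (1/2))
  refine (h1.fun_add h2).congr ?_
  filter_upwards with r
  have := H.A_eq r
  simp only [Pi.sub_apply]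
  unfold ee
  linear_combination (1/2) * χ r * this

lemma A_lo (H : SU n W W1 δ Cp Cv E0 r1 r2 M Ce Cx ra ε rm rp ζ u χ) (r : ℝ) : -(Cp * hhd ζ u r^2) ≤ AA W W1 ζ u r := by
  have hC := H.hp.Cge
  have zm := H.hm.adm.mem r
  rcases eq_or_lt_of_le zm.2 with h | h
  · unfold AA; rw [h, Ws_one H.hp, H.hp.z1]
    have := H.hp.Wnn (H.hu.mem r)
    have : 0 ≤ Cp * hhd ζ u r^2 := by positivity
    linarith
  · have := (abs_le.1 (H.hp.f2 _ (H.hu.mem r) _ zm)).1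
    unfold AA; rw [Ws_lt H.hp zm.1 h]; exact this

/-- lower bound for the quadratic form. -/
lemma quad (H : SU n W W1 δ Cp Cv E0 r1 r2 M Ce Cx ra ε rm rp ζ u χ) 
    (ki : Integrable (fun r => kk ε (hhd ζ u) (dq W ζ u) χ r^2) (mu n)) 
    (gi : Integrable (fun r => (1 - χ r) * AA W W1 ζ u r) (mu n)) :
    ∃ Q, 0 ≤ Q ∧
     X3 n ε (hhd ζ u) (dq W ζ u) χ (fun r => (1 - χ r) * AA W W1 ζ u r) + Q
       - 2 * ε * (Cx * (Cp * ∫ r, (hhd ζ u r^2 + |hhd ζ u r| * |dq W ζ u r|) ∂mu n))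
       - 2 * (Ce * Cp * √ε * (∫ r, hhd ζ u r^2 ∂mu n) + Ce * ε * (2 * (∫ r, kk ε (hhd ζ u) (dq W ζ u) χ r^2 ∂mu n) + 2 * (ε^2 * ∫ r, deriv (hhd ζ u) r^2 ∂mu n) + Q))
      ≤ ε^2 * (∫ r, deriv (hhd ζ u) r^2 ∂mu n) + ∫ r, AA W W1 ζ u r ∂mu n := by
  have hε := H.ε0
  have hCe := H.eqp.Cge
  have hCp := H.hp.Cge
  have q1 : Integrable (fun r => χ r * dq W ζ u r^2) (mu n) := H.χI H.qI
  have q2 : Integrable (fun r => (χ r - χ r^2) * dq W ζ u r^2) (mu n) := by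
    have q3 := H.χI q1
    refine (q1.sub q3).congr ?_
    filter_upwards with r
    simp only [Pi.sub_apply]; ring
  have i1 := H.TDI.const_mul (-(2*ε))
  have i2 := H.eRI.const_mul 2
  have d1 := H.hdsq.const_mul (ε^2)
  refine ⟨∫ r, (χ r - χ r^2) * dq W ζ u r^2 ∂mu n, ?_, ?_⟩
  · refine integral_nonneg fun r => mul_nonneg ?_ (sq_nonneg _)
    have := H.χm r
    have := mul_nonneg this.1 (sub_nonneg.2 this.2)
    linarith
  have e : ε^2 * (∫ r, deriv (hhd ζ u) r^2 ∂mu n) + ∫ r, AA W W1 ζ u r ∂mu n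
      = (∫ r, kk ε (hhd ζ u) (dq W ζ u) χ r^2 ∂mu n) + (-(2*ε)) * (∫ r, χ r * TD W W1 ζ u r ∂mu n)
        + 2 * (∫ r, χ r * (ee W ζ ε r * RRz W W1 ζ u r) ∂mu n) + (∫ r, (1 - χ r) * AA W W1 ζ u r ∂mu n)
        + ∫ r, (χ r - χ r^2) * dq W ζ u r^2 ∂mu n := by
    rw [← integral_const_mul, ← integral_const_mul, ← integral_const_mul, ← integral_add d1 H.AI, ← integral_add ki i1, ← integral_add (ki.fun_add i1) i2,
      ← integral_add ((ki.fun_add i1).fun_add i2) gi, ← integral_add (((ki.fun_add i1).fun_add i2).fun_add gi) q2]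
    congr 1; ext r
    rw [H.ident r]; ring
  have t1 : |∫ r, χ r * TD W W1 ζ u r ∂mu n| ≤ Cx * (Cp * ∫ r, (hhd ζ u r^2 + |hhd ζ u r| * |dq W ζ u r|) ∂mu n) := by
    rw [H.parts, abs_neg, ← integral_const_mul, ← integral_const_mul]
    rw [← Real.norm_eq_abs]
    refine (norm_integral_le_of_norm_le (μ := mu n) (f := fun r => Dx n χ r * TT W ζ u r)
      (g := fun r => Cx * (Cp * (hhd ζ u r^2 + |hhd ζ u r| * |dq W ζ u r|))) ((H.hq_int.const_mul Cp).const_mul Cx) ?_)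
    filter_upwards [mu_ae_pos n] with r hr
    rw [norm_mul]
    exact mul_le_mul (H.Dx_bd hr) (H.TT_bd hr.le) (norm_nonneg _) H.Cx0
  have t2 : -(Ce * Cp * √ε * (∫ r, hhd ζ u r^2 ∂mu n) + Ce * ε * ∫ r, χ r * dq W ζ u r^2 ∂mu n) ≤ ∫ r, χ r * (ee W ζ ε r * RRz W W1 ζ u r) ∂mu n := by
    rw [← integral_const_mul, ← integral_const_mul, ← integral_add (H.hsq.const_mul _) (q1.const_mul _), ← integral_neg]
    refine integral_mono_ae ((H.hsq.const_mul _).fun_add (q1.const_mul _)).neg H.eRI ?_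
    filter_upwards [mu_ae_pos n] with r hr
    exact H.eR hr
  have t3 : ∫ r, χ r * dq W ζ u r^2 ∂mu n ≤ 2 * (∫ r, kk ε (hhd ζ u) (dq W ζ u) χ r^2 ∂mu n) + 2 * (ε^2 * ∫ r, deriv (hhd ζ u) r^2 ∂mu n) + ∫ r, (χ r - χ r^2) * dq W ζ u r^2 ∂mu n := by
    rw [← integral_const_mul, ← integral_const_mul, ← integral_const_mul, ← integral_add (ki.const_mul 2) (d1.const_mul 2), ← integral_add ((ki.const_mul 2).fun_add (d1.const_mul 2)) q2]
    refine integral_mono q1 (((ki.const_mul 2).fun_add (d1.const_mul 2)).fun_add q2) ?_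
    intro r
    change χ r * dq W ζ u r^2 ≤ 2 * kk ε (hhd ζ u) (dq W ζ u) χ r^2 + 2 * (ε^2 * deriv (hhd ζ u) r^2) + (χ r - χ r^2) * dq W ζ u r^2
    unfold kk
    have := sq_nonneg (ε * deriv (hhd ζ u) r * 2 + χ r * dq W ζ u r)
    linarith
  have t4 := mul_le_mul_of_nonneg_left t3 (show 0 ≤ Ce * ε by positivity)
  have t5 := mul_le_mul_of_nonneg_left (abs_le.1 t1).2 (show 0 ≤ 2 * ε by positivity)
  rw [e]; unfold X3
  linarith

/-- energy expansion. -/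
lemma expand (H : SU n W W1 δ Cp Cv E0 r1 r2 M Ce Cx ra ε rm rp ζ u χ) :
    cn n * (ε⁻¹ * (ε^2 * (∫ r, deriv (hhd ζ u) r^2 ∂mu n) + ∫ r, AA W W1 ζ u r ∂mu n) - E0 * (Cv * ∫ r, hhd ζ u r^2 ∂mu n))
      ≤ EE n W ε u - EE n W ε ζ := by
  have hε := H.ε0
  have hcn := cn_pos n H.hn
  have hCv := H.hv.Cge
  have hu := H.hu
  have hζ := H.hm.adm
  have hd : ∀ r, deriv (hhd ζ u) r = deriv u r - deriv ζ r := fun r => (H.dh r).deriv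
  have fv := FVs H.hn H.hp H.hv hε H.hm hu (by
    rcases H.hs with hs | ⟨hs, rs, hrs, h1, h2⟩
    · exact Or.inl hs
    · exact Or.inr ⟨rs, by linarith [H.ra0], h1, h2⟩)
  have mx : Integrable (fun r => deriv ζ r * (deriv u r - deriv ζ r)) (mu n) :=
    int_mul_sq (der_ms ζ) ((der_ms u).sub (der_ms ζ)) hζ.dsq (int_sub_sq (der_ms u) (der_ms ζ) hu.dsq hζ.dsq)
  have e1 : ∫ r, deriv u r^2 ∂mu n = (∫ r, deriv ζ r^2 ∂mu n) + 2 * (∫ r, deriv ζ r * (deriv u r - deriv ζ r) ∂mu n) + ∫ r, deriv (hhd ζ u) r^2 ∂mu n := by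
    rw [← integral_const_mul, ← integral_add hζ.dsq (mx.const_mul 2), ← integral_add (hζ.dsq.fun_add (mx.const_mul 2)) H.hdsq]
    congr 1; ext r; rw [hd]; ring
  have e2 : ∫ r, AA W W1 ζ u r ∂mu n = (∫ r, W (u r) ∂mu n) - (∫ r, W (ζ r) ∂mu n) - ∫ r, Ws W W1 (ζ r) * (u r - ζ r) ∂mu n := by
    have i : Integrable (fun r => W (u r) - W (ζ r)) (mu n) := (hu.Wint H.hp).sub (hζ.Wint H.hp)
    have iw : Integrable (fun r => Ws W W1 (ζ r) * (u r - ζ r)) (mu n) := H.WsI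
    rw [← integral_sub (hu.Wint H.hp) (hζ.Wint H.hp), ← integral_sub i iw]
    rfl
  have v1i : Integrable (fun r => V1 n W (ζ r) * (u r - ζ r)) (mu n) := by
    have c : Continuous (fun r => V1 n W (ζ r)) := contOn_comp (H.hv.contV1 H.hn H.hp) hζ.diff.continuous hζ.mem
    refine int_mul_sq c.aestronglyMeasurable H.hdd.continuous.aestronglyMeasurable ?_ H.hsq
    refine (hζ.sq.const_mul ((Cv*Cp)^2)).mono' (c.pow 2).aestronglyMeasurable ?_
    filter_upwards with r
    rw [Real.norm_eq_abs, abs_pow]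
    have := pow_le_pow_left₀ (abs_nonneg _) (V1_lin H.hp H.hv _ (hζ.mem r)) 2
    linarith [mul_pow (Cv*Cp) (ζ r) 2]
  have e3 : -(Cv * ∫ r, hhd ζ u r^2 ∂mu n) ≤ ∫ r, V1 n W (ζ r) * (u r - ζ r) ∂mu n := by
    have a := H.mass; have b := H.hm.mass
    unfold MM at a b
    have : cn n * (∫ r, Vpot n W (u r) ∂mu n) = cn n * ∫ r, Vpot n W (ζ r) ∂mu n := by rw [a, b]
    have v0 := mul_left_cancel₀ hcn.ne' this
    have vi : Integrable (fun r => Vpot n W (u r) - Vpot n W (ζ r)) (mu n) := (hu.Vint H.hv).sub (hζ.Vint H.hv)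
    have m : ∫ r, (Vpot n W (u r) - Vpot n W (ζ r) - V1 n W (ζ r) * (u r - ζ r)) ∂mu n ≤ ∫ r, Cv * hhd ζ u r^2 ∂mu n := by
      refine integral_mono (vi.sub v1i) (H.hsq.const_mul Cv) ?_
      intro r
      exact H.hv.v2 _ (hu.mem r) _ (hζ.mem r)
    have m2 : ∫ r, (Vpot n W (u r) - Vpot n W (ζ r) - V1 n W (ζ r) * (u r - ζ r)) ∂mu n = (∫ r, Vpot n W (u r) ∂mu n) - (∫ r, Vpot n W (ζ r) ∂mu n) - ∫ r, V1 n W (ζ r) * (u r - ζ r) ∂mu n := by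
      rw [← integral_sub (hu.Vint H.hv) (hζ.Vint H.hv), ← integral_sub vi v1i]
    rw [m2, v0, integral_const_mul] at m
    linarith
  have l0 := Lam_nonneg H.hn H.hp hζ hε
  have l1 : Lam n W ε ζ ≤ E0 := (Lam_le H.hn hε).trans H.hE
  have hH : 0 ≤ ∫ r, hhd ζ u r^2 ∂mu n := integral_nonneg fun _ => sq_nonneg _
  have m1 := mul_le_mul_of_nonneg_left e3 l0
  have m2 := mul_le_mul_of_nonneg_right l1 (show 0 ≤ Cv * ∫ r, hhd ζ u r^2 ∂mu n by positivity)
  have main : ε⁻¹ * (ε^2 * (∫ r, deriv (hhd ζ u) r^2 ∂mu n) + ∫ r, AA W W1 ζ u r ∂mu n) - E0 * (Cv * ∫ r, hhd ζ u r^2 ∂mu n)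
      ≤ ε * (∫ r, deriv u r^2 ∂mu n) + ε⁻¹ * (∫ r, W (u r) ∂mu n) - (ε * (∫ r, deriv ζ r^2 ∂mu n) + ε⁻¹ * (∫ r, W (ζ r) ∂mu n)) := by
    have ex : ε⁻¹ * (ε^2 * (∫ r, deriv (hhd ζ u) r^2 ∂mu n) + ∫ r, AA W W1 ζ u r ∂mu n) = ε * (∫ r, deriv (hhd ζ u) r^2 ∂mu n) + ε⁻¹ * ∫ r, AA W W1 ζ u r ∂mu n := by
      have : ε⁻¹ * ε = 1 := inv_mul_cancel₀ hε.ne'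
      linear_combination (ε * ∫ r, deriv (hhd ζ u) r^2 ∂mu n) * this
    rw [ex, e1, e2]
    linarith
  refine (mul_le_mul_of_nonneg_left main hcn.le).trans (le_of_eq ?_)
  unfold EE DD PP; ring

end SU

lemma assemble_arith {X Q S H2 K D2 A P Ce Cp Cx C' ε s : ℝ} (hX : 0 ≤ X) (hQ : 0 ≤ Q) (hH : 0 ≤ H2) (hHS : H2 ≤ S)
    (hKX : K ≤ X) (hP : P = D2 + A) (hA : -(Cp * H2) ≤ A) (hS : S ≤ C' * X) (hCe : 1 ≤ Ce) (hCp : 1 ≤ Cp) (hCx : 0 ≤ Cx) (hC' : 0 ≤ C')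
    (hε : 0 < ε) (hs : 0 ≤ s) (hes : ε ≤ s) (c1 : 4 * Ce * ε ≤ 1/4) (c2 : s * (2*Cx*Cp + 6*Ce*Cp) * C' ≤ 1/4)
    (h : X + Q - 2 * ε * (Cx * (Cp * S)) - 2 * (Ce * Cp * s * H2 + Ce * ε * (2 * K + 2 * D2 + Q)) ≤ P) :
    0 ≤ P ∧ S ≤ 4 * C' * P ∧ D2 ≤ P + Cp * H2 := by
  have hD : D2 ≤ P + Cp * H2 := by linarith
  have hS0 : 0 ≤ S := hH.trans hHS
  have a1 : ε * (Cx * Cp * S) ≤ s * (Cx * Cp * S) := mul_le_mul_of_nonneg_right hes (by positivity)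
  have a2 : Ce * Cp * s * H2 ≤ Ce * Cp * s * S := mul_le_mul_of_nonneg_left hHS (by positivity)
  have a3 : 4 * Ce * ε * K ≤ 4 * Ce * ε * X := mul_le_mul_of_nonneg_left hKX (by positivity)
  have a4 : 4 * Ce * ε * X ≤ 1/4 * X := mul_le_mul_of_nonneg_right c1 hX
  have a5 : 4 * Ce * ε * D2 ≤ 4 * Ce * ε * (P + Cp * H2) := mul_le_mul_of_nonneg_left hD (by positivity)
  have a6 : 4 * Ce * ε * Q ≤ 1/4 * Q := mul_le_mul_of_nonneg_right c1 hQ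
  have a7 : ε * (4 * Ce * Cp * H2) ≤ s * (4 * Ce * Cp * H2) := mul_le_mul_of_nonneg_right hes (by positivity)
  have a8 : s * (4 * Ce * Cp) * H2 ≤ s * (4 * Ce * Cp) * S := mul_le_mul_of_nonneg_left hHS (by positivity)
  have a9 : s * (2*Cx*Cp + 6*Ce*Cp) * S ≤ s * (2*Cx*Cp + 6*Ce*Cp) * (C' * X) := mul_le_mul_of_nonneg_left hS (by positivity)
  have a10 : s * (2*Cx*Cp + 6*Ce*Cp) * C' * X ≤ 1/4 * X := mul_le_mul_of_nonneg_right c2 hX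
  have key : 1/2 * X ≤ P * (1 + 4 * Ce * ε) := by linarith
  have hP0 : 0 ≤ P := by
    by_contra hc
    push Not at hc
    have := mul_neg_of_neg_of_pos hc (show 0 < 1 + 4 * Ce * ε by positivity)
    linarith
  have b1 : P * (4 * Ce * ε) ≤ P * (1/4) := mul_le_mul_of_nonneg_left c1 hP0
  have hX4 : X ≤ 4 * P := by linarith
  refine ⟨hP0, ?_, hD⟩
  have := mul_le_mul_of_nonneg_left hX4 hC'
  linarith

lemma SU.final (H : SU n W W1 δ Cp Cv E0 r1 r2 M Ce Cx ra ε rm rp ζ u χ) {C' : ℝ} (hC' : 0 ≤ C')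
    (co : ∀ ε rm rp h q χ G vd pz, HC n r1 r2 M (Chc n Cp Cv E0) ε rm rp h q χ G vd pz →
      ∫ r, (h r^2 + |h r| * |q r|) ∂mu n ≤ C' * X3 n ε h q χ G)
    (c0 : ε * (2 * (n-1:ℝ) * Chc n Cp Cv E0) ≤ r1) (c1 : 4 * Ce * ε ≤ 1/4) (c2 : √ε * (2*Cx*Cp + 6*Ce*Cp) * C' ≤ 1/4)
    (c3 : ε * (E0 * Cv * (4 * C')) ≤ 1/2) :
    (1 / (2 * (1 + 4 * Cp * C' + 4 * C'))) * (cn n * ∫ r, (ε * deriv (hhd ζ u) r^2 + hhd ζ u r^2/ε) ∂mu n) ≤ EE n W ε u - EE n W ε ζ := by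
  have hc := H.hc c0
  have hcn := cn_pos n H.hn
  have hε := H.ε0
  have hCp := H.hp.Cge
  have hCv := H.hv.Cge
  obtain ⟨Q, hQ, hq⟩ := H.quad hc.ki hc.Gi
  have hS := co _ _ _ _ _ _ _ _ _ hc
  have hes : ε ≤ √ε := by
    have h1 : √ε ≤ 1 := Real.sqrt_le_one.2 H.ε1
    have h2 := mul_le_mul_of_nonneg_left h1 (Real.sqrt_nonneg ε)
    rw [Real.mul_self_sqrt hε.le] at h2; linarith
  have hH0 : 0 ≤ ∫ r, hhd ζ u r^2 ∂mu n := integral_nonneg fun _ => sq_nonneg _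
  have hHS : ∫ r, hhd ζ u r^2 ∂mu n ≤ ∫ r, (hhd ζ u r^2 + |hhd ζ u r| * |dq W ζ u r|) ∂mu n := by
    refine integral_mono H.hsq H.hq_int fun r => ?_
    have : 0 ≤ |hhd ζ u r| * |dq W ζ u r| := by positivity
    change hhd ζ u r^2 ≤ hhd ζ u r^2 + |hhd ζ u r| * |dq W ζ u r|
    linarith
  have hA : -(Cp * ∫ r, hhd ζ u r^2 ∂mu n) ≤ ∫ r, AA W W1 ζ u r ∂mu n := by
    rw [← integral_const_mul, ← integral_neg]
    exact integral_mono (H.hsq.const_mul Cp).neg H.AI fun r => H.A_lo r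
  obtain ⟨p0, p1, p2⟩ := assemble_arith (add_nonneg hc.K0 hc.GG0) hQ hH0 hHS (le_add_of_nonneg_right hc.GG0) rfl hA hS
    H.eqp.Cge hCp H.Cx0 hC' hε (Real.sqrt_nonneg ε) hes c1 c2 hq
  have ex := H.expand
  set P := ε^2 * (∫ r, deriv (hhd ζ u) r^2 ∂mu n) + ∫ r, AA W W1 ζ u r ∂mu n with hPd
  set H2 := ∫ r, hhd ζ u r^2 ∂mu n with hH2
  set D := ∫ r, deriv (hhd ζ u) r^2 ∂mu n with hDd
  have hE := H.E1
  have h2P : H2 ≤ 4 * C' * P := hHS.trans p1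
  have eI : ∫ r, (ε * deriv (hhd ζ u) r^2 + hhd ζ u r^2/ε) ∂mu n = ε⁻¹ * (ε^2 * D + H2) := by
    have : ∀ r, ε * deriv (hhd ζ u) r^2 + hhd ζ u r^2/ε = ε * deriv (hhd ζ u) r^2 + ε⁻¹ * hhd ζ u r^2 := fun r => by rw [div_eq_inv_mul]
    simp_rw [this]
    rw [integral_add (H.hdsq.const_mul ε) (H.hsq.const_mul ε⁻¹), integral_const_mul, integral_const_mul]
    have : ε⁻¹ * ε = 1 := inv_mul_cancel₀ hε.ne'
    linear_combination (-(ε * D)) * this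
  rw [eI]
  set B := 1 + 4 * Cp * C' + 4 * C' with hB
  have hB1 : 1 ≤ B := by
    have : 0 ≤ 4 * Cp * C' := by positivity
    linarith
  have s1 : ε^2 * D + H2 ≤ B * P := by
    have := mul_le_mul_of_nonneg_left h2P (show 0 ≤ Cp by linarith)
    rw [hB]; linarith
  have s2 : E0 * (Cv * H2) ≤ ε⁻¹ * (1/2 * P) := by
    rw [le_inv_mul_iff₀ hε]
    have t1 := mul_le_mul_of_nonneg_left h2P (show 0 ≤ ε * (E0 * Cv) by positivity)
    have t2 := mul_le_mul_of_nonneg_right c3 p0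
    linarith
  have s3 : cn n * (ε⁻¹ * (1/2 * P)) ≤ EE n W ε u - EE n W ε ζ := by
    refine le_trans (mul_le_mul_of_nonneg_left ?_ hcn.le) ex
    linarith
  refine le_trans ?_ s3
  have s4 : cn n * (ε⁻¹ * (ε^2 * D + H2)) ≤ cn n * (ε⁻¹ * (B * P)) :=
    mul_le_mul_of_nonneg_left (mul_le_mul_of_nonneg_left s1 (by positivity)) hcn.le
  refine (mul_le_mul_of_nonneg_left s4 (by positivity)).trans (le_of_eq ?_)
  field_simp

end


lemma small_ev {f : ℝ → ℝ} (hf : Continuous f) (h0 : f 0 = 0) {a : ℝ} (ha : 0 < a) : ∀ᶠ ε in nhds (0:ℝ), f ε ≤ a := by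
  have h := hf.tendsto 0
  rw [h0] at h
  filter_upwards [h.eventually_lt_const ha] with x hx using hx.le

lemma sup_to_pt {n : ℕ} (hn : 2 ≤ n) {d : ℝ → ℝ} (hd : Continuous d) {a : ℝ} (ha : 0 ≤ a)
    (h : eLpNorm (fun x : En n => d ‖x‖) ⊤ (volume : Measure (En n)) ≤ ENNReal.ofReal a) :
    ∀ r, 0 ≤ r → |d r| ≤ a := by
  intro r hr
  have : Nonempty (Fin n) := ⟨⟨0, by omega⟩⟩
  have hc : Continuous (fun x : En n => d ‖x‖) := hd.comp continuous_norm
  have hae : ∀ᵐ x : En n, |d ‖x‖| ≤ a := by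
    rw [eLpNorm_exponent_top] at h
    filter_upwards [ae_le_eLpNormEssSup (f := fun x : En n => d ‖x‖) (μ := volume)] with x hx
    have h1 := hx.trans h
    rw [Real.enorm_eq_ofReal_abs] at h1
    exact (ENNReal.ofReal_le_ofReal_iff ha).1 h1
  have hden : Dense {x : En n | |d ‖x‖| ≤ a} := Measure.dense_of_ae hae
  have hcl : IsClosed {x : En n | |d ‖x‖| ≤ a} := isClosed_le hc.abs continuous_const
  have hall := hden.closure_eq
  rw [hcl.closure_eq] at hall
  obtain ⟨x, hx⟩ := exists_norm_eq (En n) hr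
  have : x ∈ {x : En n | |d ‖x‖| ≤ a} := by rw [hall]; trivial
  rw [← hx]; exact this

lemma cutoff_exists (n : ℕ) (hn : 2 ≤ n) {ra : ℝ} (hra : 0 < ra) : ∃ (χ : ℝ → ℝ) (Cx : ℝ), Differentiable ℝ χ ∧ Continuous (deriv χ) ∧
    (∀ r, χ r ∈ Icc (0:ℝ) 1) ∧ (∀ r, r ≤ ra/2 → χ r = 0) ∧ (∀ r, ra ≤ r → χ r = 1) ∧
    (∀ r, 0 < r → |deriv χ r| * r + (n-1:ℝ) * χ r ≤ Cx * r) ∧ 0 ≤ Cx := by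
  obtain ⟨B, hB0, hB⟩ := SS_dbd
  have hn2 : (2:ℝ) ≤ n := by exact_mod_cast hn
  have hd : ∀ r, HasDerivAt (fun r => 1 - SS ((r - ra/2) * (2/ra))) (-(deriv SS ((r - ra/2) * (2/ra)) * (2/ra))) r := by
    intro r
    have h1 : HasDerivAt (fun r => (r - ra/2) * (2/ra)) (2/ra) r := by
      simpa using ((hasDerivAt_id r).sub_const (ra/2)).mul_const (2/ra)
    exact ((SS_diff _).hasDerivAt.comp r h1).const_sub 1
  have hde : deriv (fun r => 1 - SS ((r - ra/2) * (2/ra))) = fun r => -(deriv SS ((r - ra/2) * (2/ra)) * (2/ra)) :=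
    funext fun r => (hd r).deriv
  have m : ∀ r, 1 - SS ((r - ra/2) * (2/ra)) ∈ Icc (0:ℝ) 1 := fun r => by
    have := SS_mem ((r - ra/2) * (2/ra))
    exact ⟨by linarith [this.2], by linarith [this.1]⟩
  have z : ∀ r, r ≤ ra/2 → 1 - SS ((r - ra/2) * (2/ra)) = 0 := fun r hr => by
    rw [SS_left (mul_nonpos_of_nonpos_of_nonneg (by linarith) (by positivity))]; ring
  refine ⟨fun r => 1 - SS ((r - ra/2) * (2/ra)), B * (2/ra) + (n-1:ℝ) * (2/ra), fun r => (hd r).differentiableAt, ?_, m, z, ?_, ?_, ?_⟩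
  · rw [hde]
    exact ((SS_dcont.comp (by fun_prop)).mul continuous_const).neg
  · intro r hr
    have : 1 ≤ (r - ra/2) * (2/ra) := by
      rw [mul_div_assoc', le_div_iff₀ hra]; linarith
    simp only [SS_right this]; ring
  · intro r hr
    rw [hde]
    simp only [abs_neg, abs_mul]
    have a1 : |deriv SS ((r - ra/2) * (2/ra))| * |2/ra| ≤ B * (2/ra) := by
      rw [abs_of_pos (show 0 < 2/ra by positivity)]
      exact mul_le_mul_of_nonneg_right (hB _) (by positivity)
    have a2 := mul_le_mul_of_nonneg_right a1 hr.le
    have a3 : 1 - SS ((r - ra/2) * (2/ra)) ≤ (2/ra) * r := by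
      rcases le_total r (ra/2) with h | h
      · rw [z r h]; positivity
      · have : 1 ≤ (2/ra) * r := by rw [div_mul_eq_mul_div, le_div_iff₀ hra]; linarith
        linarith [(m r).2]
    have a4 := mul_le_mul_of_nonneg_left a3 (show (0:ℝ) ≤ n - 1 by linarith)
    linarith
  · have : (0:ℝ) ≤ n - 1 := by linarith
    positivity

set_option maxHeartbeats 1000000 in
lemma main_est {n : ℕ} (hn : 2 ≤ n) {W W1 : ℝ → ℝ} {δ Cp : ℝ} (hp : PF W W1 δ Cp)
    (hnorm : ∫ t in (0:ℝ)..1, Real.sqrt (W t) = 1) :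
    ∃ ε₀ > (0:ℝ), ∃ C > (0:ℝ), ∀ ε : ℝ, 0 < ε → ε < ε₀ → ∀ ζ, Minz n W ε ζ → ∀ u, Adm n u → MM n W u = 1 →
      (∀ r, 0 ≤ r → |u r - ζ r| ≤ δ/2) →
      (1 / C) * (cn n * ∫ r, (ε * deriv (hhd ζ u) r^2 + hhd ζ u r^2/ε) ∂mu n) ≤ EE n W ε u - EE n W ε ζ := by
  obtain ⟨Cv, hv⟩ := hp.vf hn hnorm
  obtain ⟨E0, hE0, hcr⟩ := crude hn hp hv
  obtain ⟨r1, r2, M, ε1, hr1, -, -, -, hM, hε1, hlay⟩ := layer_exists hn hp hv hE0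
  have hra : 0 < r1/4 := by linarith
  obtain ⟨Ce, hCe⟩ := eqp_exists hn hp hv (a := r1/4/2) hE0 (by linarith)
  obtain ⟨χ, Cx, x1, x2, x3, x4, x5, x6, x7⟩ := cutoff_exists n hn hra
  obtain ⟨C0, hC0⟩ := coer n r1 r2 M (Chc n Cp Cv E0)
  have hcore : ∃ ε2, 0 < ε2 ∧ (W1 1 < 0 → ∀ ε, 0 < ε → ε ≤ ε2 → ∀ ζ, Minz n W ε ζ → EE n W ε ζ ≤ E0 → 1 - δ ≤ ζ (2*(r1/4)) → ζ (r1/4) = 1) := by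
    by_cases hb : W1 1 < 0
    · obtain ⟨ε2, h1, -, h3⟩ := core_one hn hp hv hb hE0 hra
      exact ⟨ε2, h1, fun _ => h3⟩
    · exact ⟨1, one_pos, fun h => absurd h hb⟩
  obtain ⟨ε2, hε2, hcore⟩ := hcore
  have hCp := hp.Cge
  have hd := hp.dpos
  have hC' : 0 ≤ |C0| := abs_nonneg _
  have ev : ∀ᶠ ε in nhds (0:ℝ), ε ≤ 1 ∧ ε ≤ ε1 ∧ ε ≤ ε2 ∧ ε * (2 * (n-1:ℝ) * Chc n Cp Cv E0) ≤ r1 ∧ 4 * Ce * ε ≤ 1/4 ∧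
      √ε * (2*Cx*Cp + 6*Ce*Cp) * |C0| ≤ 1/4 ∧ ε * (E0 * Cv * (4 * |C0|)) ≤ 1/2 := by
    filter_upwards [small_ev continuous_id rfl one_pos, small_ev continuous_id rfl hε1, small_ev continuous_id rfl hε2,
      small_ev (f := fun ε => ε * (2 * (n-1:ℝ) * Chc n Cp Cv E0)) (by fun_prop) (by simp) hr1,
      small_ev (f := fun ε => 4 * Ce * ε) (by fun_prop) (by simp) (a := 1/4) (by norm_num),
      small_ev (f := fun ε => √ε * (2*Cx*Cp + 6*Ce*Cp) * |C0|) (by fun_prop) (by simp) (a := 1/4) (by norm_num),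
      small_ev (f := fun ε => ε * (E0 * Cv * (4 * |C0|))) (by fun_prop) (by simp) (a := 1/2) (by norm_num)] with ε h1 h2 h3 h4 h5 h6 h7
    exact ⟨h1, h2, h3, h4, h5, h6, h7⟩
  obtain ⟨ε₀, hε₀, hball⟩ := Metric.eventually_nhds_iff.1 ev
  refine ⟨ε₀, hε₀, 2 * (1 + 4 * Cp * |C0| + 4 * |C0|), by positivity, ?_⟩
  intro ε hε hlt ζ hm u hu hmass hh
  obtain ⟨e1, e2, e3, e4, e5, e6, e7⟩ := hball (y := ε) (by rw [Real.dist_eq, sub_zero, abs_of_pos hε]; exact hlt)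
  have hE := hcr ε hε e1 ζ hm
  obtain ⟨rm, rp, hl⟩ := hlay ε hε e2 ζ hm hE
  have hs : W1 1 = 0 ∨ (W1 1 < 0 ∧ ∃ rs, r1/4 ≤ rs ∧ (∀ r ∈ Icc 0 rs, ζ r = 1) ∧ ∀ r, rs < r → ζ r < 1) := by
    rcases hp.nonpos.eq_or_lt with h | h
    · exact Or.inl h
    · refine Or.inr ⟨h, ?_⟩
      have hl1 := hl.h1
      have z1 : 1 - δ ≤ ζ (2*(r1/4)) := by
        rw [← hl.zm]
        exact hm.anti (show (0:ℝ) ≤ 2*(r1/4) by linarith) (show (0:ℝ) ≤ rm by linarith) (by linarith)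
      have z2 := hcore h ε hε e3 ζ hm hE z1
      obtain ⟨q, q1, q2, q3, q4⟩ := last_one hm (c := r1/4) (r := rm) hra.le (by linarith) z2 (by rw [hl.zm]; linarith)
      refine ⟨q, q1, fun r hr => le_antisymm (hm.adm.mem r).2 ?_, q4⟩
      rw [← q3]
      exact hm.anti hr.1 (show (0:ℝ) ≤ q by linarith) hr.2
  have H : SU n W W1 δ Cp Cv E0 r1 r2 M Ce Cx (r1/4) ε rm rp ζ u χ :=
    { hn := hn, hp := hp, hv := hv, ε0 := hε, ε1 := e1, E1 := hE0, hm := hm, hE := hE, hu := hu, mass := hmass, hh := hh,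
      lay := hl, r10 := hr1, Mge := hM, ra0 := hra, ra1 := by linarith, χd := x1, χdc := x2, χm := x3, χ0 := x4, χ1 := x5,
      χb := x6, Cx0 := x7, eqp := hCe ε hε e1 ζ hm hE, hs := hs }
  refine H.final hC' ?_ e4 e5 e6 e7
  intro ε rm rp h q χ G vd pz hc
  refine (hC0 _ _ _ _ _ _ _ _ _ hc).trans (mul_le_mul_of_nonneg_right (le_abs_self _) ?_)
  exact add_nonneg hc.K0 hc.GG0

lemma main_thm (n : ℕ) (hn : 2 ≤ n) (W : ℝ → ℝ) (hW : DoubleWell W) :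
    ∃ δ₀ > (0:ℝ), ∃ ε₀ > (0:ℝ), ∃ C > (0:ℝ),
      ∀ ε : ℝ, 0 < ε → ε < ε₀ →
      ∀ uε : En n → ℝ, Minimizes n W ε uε → RadialDecreasing n uε →
      ∀ u : En n → ℝ, H1Box n u → Radial n u →
        (∫ x : En n, Vpot n W (u x)) = 1 →
        eLpNorm (fun x => u x - uε x) ⊤ (volume : Measure (En n)) ≤ ENNReal.ofReal δ₀ →
        (1 / C) * (∫ x : En n,
            (ε * ‖fderiv ℝ (fun y => u y - uε y) x‖ ^ 2 + (u x - uε x) ^ 2 / ε))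
          ≤ AC n W ε u - Psi n W ε 1 := by
  obtain ⟨L, h2⟩ := hW.well2
  rcases h2.w_nonneg.eq_or_lt with hw | hw
  · obtain ⟨δ, Cp, hp⟩ := h2.pf hw.symm
    have hd := hp.dpos
    obtain ⟨ε₀, hε₀, C, hC, hmain⟩ := main_est hn hp hW.normalized
    refine ⟨δ/2, by linarith, ε₀, hε₀, C, hC, ?_⟩
    intro ε hε hlt uε hm hr u hu ⟨ζ', hζ'⟩ hmass hsup
    obtain ⟨ζ, hz, hux, hEE⟩ := minz_of hn hW hε hm hr
    obtain ⟨Z, hZ, hZx, -⟩ := radial_profile hn hu ζ' hζ'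
    have eu : u = fun x => Z ‖x‖ := funext hZx
    have eue : uε = fun x => ζ ‖x‖ := funext hux
    subst eu
    subst eue
    have hdd : Differentiable ℝ (hhd ζ Z) := hZ.diff.sub hz.adm.diff
    have hpt : ∀ r, 0 ≤ r → |hhd ζ Z r| ≤ δ/2 := sup_to_pt hn hdd.continuous (by linarith) hsup
    rw [MM_radial hn] at hmass
    have h := hmain ε hε hlt ζ hz Z hZ hmass hpt
    rw [AC_radial hn hZ.diff, ← hEE]
    refine le_trans (le_of_eq ?_) h
    congr 1
    rw [← polar_integral n hn (fun r => ε * deriv (hhd ζ Z) r^2 + hhd ζ Z r^2/ε)]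
    refine integral_congr_ae ?_
    filter_upwards [radial_grad_sq n hn (hhd ζ Z) hdd] with x hx
    rw [← hx]
    rfl
  · refine ⟨1, one_pos, 1, one_pos, 1, one_pos, ?_⟩
    intro ε hε _ uε hm hr
    obtain ⟨ζ, hz, -, -⟩ := minz_of hn hW hε hm hr
    exact (vacuous hn hW h2 hw hε hz).elim


theorem statement9 (n : ℕ) (hn : 2 ≤ n) (W : ℝ → ℝ) (hW : DoubleWell W) :
    ∀ K > (0:ℝ), ∃ δ₀ > (0:ℝ), ∃ ε₀ > (0:ℝ), ∃ C > (0:ℝ),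
      ∀ ε : ℝ, 0 < ε → ε < ε₀ →
      ∀ uε : En n → ℝ, Minimizes n W ε uε → RadialDecreasing n uε →
      ∀ u : En n → ℝ, H1Box n u → Radial n u →
        (∫ x : En n, Vpot n W (u x)) = 1 →
        (∫ x : En n, (u x - uε x) ^ 2) ≤ K * ε →
        eLpNorm (fun x => u x - uε x) ⊤ (volume : Measure (En n)) ≤ ENNReal.ofReal δ₀ →
        (1 / C) * (∫ x : En n,
            (ε * ‖fderiv ℝ (fun y => u y - uε y) x‖ ^ 2 + (u x - uε x) ^ 2 / ε))
          ≤ AC n W ε u - Psi n W ε 1 := by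
  intro K _
  obtain ⟨δ₀, hδ, ε₀, hε, C, hC, h⟩ := main_thm n hn W hW
  exact ⟨δ₀, hδ, ε₀, hε, C, hC, fun ε h1 h2 uε h3 h4 u h5 h6 h7 _ h9 => h ε h1 h2 uε h3 h4 u h5 h6 h7 h9⟩
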